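/- Let F be an algebraically closed field of characteristic 0. Any two maximal finite abelian subgroups of Aut(𝔢₈), each of which contains an element θ of order 4 whose fixed subalgebra 𝔢₈^θ is semisimple of dimension 66 (an order-4 automorphism of type I), are conjugate in Aut(𝔢₈). -/

import Mathlib

open LieAlgebra

/-- The group of automorphisms of a Lie algebra, realized as the subgroup of the group
of linear automorphisms consisting of those preserving the bracket. -/
def lieAut (R L : Type*) [CommRing R] [LieRing L] [LieAlgebra R L] :
    Subgroup (L ≃ₗ[R] L) where
  carrier := {e | ∀ x y : L, e ⁅x, y⁆ = ⁅e x, e y⁆}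
  one_mem' := fun _ _ => rfl
  mul_mem' := by
    intro f g hf hg x y
    show f (g ⁅x, y⁆) = _
    rw [hg]
    exact hf _ _
  inv_mem' := by
    intro f hf x y
    apply f.injective
    show f (f.symm ⁅x, y⁆) = f ⁅f.symm x, f.symm y⁆
    rw [hf (f.symm x) (f.symm y), f.apply_symm_apply, f.apply_symm_apply, f.apply_symm_apply]

/-- The subalgebra of fixed points of an automorphism of a Lie algebra. -/
def fixedSubalgebra {R L : Type*} [CommRing R] [LieRing L] [LieAlgebra R L]
    (θ : lieAut R L) : LieSubalgebra R L where
  carrier := {x | (θ : L ≃ₗ[R] L) x = x}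
  add_mem' := by
    intro a b ha hb
    simp only [Set.mem_setOf_eq] at *
    rw [map_add, ha, hb]
  zero_mem' := map_zero _
  smul_mem' := by
    intro c a ha
    simp only [Set.mem_setOf_eq] at *
    rw [map_smul, ha]
  lie_mem' := by
    intro a b ha hb
    simp only [Set.mem_setOf_eq] at *
    rw [θ.2 a b, ha, hb]

/-- A maximal finite abelian subgroup: a finite abelian subgroup which is maximal among
all abelian subgroups. -/
def IsMaximalFiniteAbelian {G : Type*} [Group G] (Q : Subgroup G) : Prop :=
  Finite Q ∧ (∀ a b, a ∈ Q → b ∈ Q → a * b = b * a) ∧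
    ∀ Q' : Subgroup G, (∀ a b, a ∈ Q' → b ∈ Q' → a * b = b * a) → Q ≤ Q' → Q' = Q

/-- Two subgroups are conjugate. -/
def SubgroupIsConj {G : Type*} [Group G] (Q₁ Q₂ : Subgroup G) : Prop :=
  ∃ g : G, Q₂ = Q₁.map (MulAut.conj g).toMonoidHom

set_option linter.unusedSectionVars false
set_option linter.unusedVariables false
set_option linter.unusedSimpArgs false

namespace E8
open MvPolynomial

section AG
variable {F : Type} [Field F]

lemma exists_zero [IsAlgClosed F] {σ : Type} [Finite σ] {I : Ideal (MvPolynomial σ F)} (hI : I ≠ ⊤) :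
    ∃ x : σ → F, ∀ p ∈ I, eval x p = 0 := by
  obtain ⟨m, hm, hle⟩ := Ideal.exists_le_maximal I hI
  obtain ⟨x, hx⟩ := MvPolynomial.isMaximal_iff_eq_vanishingIdeal_singleton.1 hm
  refine ⟨x, fun p hp => ?_⟩
  have := hle hp
  rw [hx, mem_vanishingIdeal_singleton_iff] at this
  simpa [MvPolynomial.aeval_eq_eval] using this

lemma amalg_field {K K₁ K₂ : Type} [Field K] [Field K₁] [Field K₂] (j₁ : K →+* K₁) (j₂ : K →+* K₂) :
    ∃ (T : Type) (_ : Field T) (φ₁ : K₁ →+* T) (φ₂ : K₂ →+* T), ∀ a, φ₁ (j₁ a) = φ₂ (j₂ a) := by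
  let _ := j₁.toAlgebra
  let _ := j₂.toAlgebra
  obtain ⟨m, hm⟩ := Ideal.exists_maximal (TensorProduct K K₁ K₂)
  refine ⟨TensorProduct K K₁ K₂ ⧸ m, Ideal.Quotient.field m,
    (Ideal.Quotient.mk m).comp Algebra.TensorProduct.includeLeftRingHom,
    (Ideal.Quotient.mk m).comp (Algebra.TensorProduct.includeRight (R := K) (A := K₁) (B := K₂)).toRingHom, ?_⟩
  intro P
  show Ideal.Quotient.mk m ((j₁ P) ⊗ₜ[K] (1 : K₂)) = Ideal.Quotient.mk m ((1 : K₁) ⊗ₜ[K] (j₂ P))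
  have a1 : j₁ P = P • (1 : K₁) := (Algebra.algebraMap_eq_smul_one (A := K₁) _)
  have a2 : j₂ P = P • (1 : K₂) := (Algebra.algebraMap_eq_smul_one (A := K₂) _)
  rw [a1, a2, TensorProduct.smul_tmul]

lemma amalg {A B₁ B₂ : Type} [CommRing A] [CommRing B₁] [CommRing B₂] [IsDomain A] [IsDomain B₁] [IsDomain B₂]
    (f₁ : A →+* B₁) (f₂ : A →+* B₂) (h₁ : Function.Injective f₁) (h₂ : Function.Injective f₂) :
    ∃ (T : Type) (_ : Field T) (φ₁ : B₁ →+* T) (φ₂ : B₂ →+* T), Function.Injective φ₁ ∧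
      Function.Injective φ₂ ∧ ∀ a, φ₁ (f₁ a) = φ₂ (f₂ a) := by
  have g₁ : Function.Injective ((algebraMap B₁ (FractionRing B₁)).comp f₁) :=
    (IsFractionRing.injective B₁ (FractionRing B₁)).comp h₁
  have g₂ : Function.Injective ((algebraMap B₂ (FractionRing B₂)).comp f₂) :=
    (IsFractionRing.injective B₂ (FractionRing B₂)).comp h₂
  obtain ⟨T, i, φ₁, φ₂, h⟩ := amalg_field (IsFractionRing.lift (K := FractionRing A) g₁) (IsFractionRing.lift (K := FractionRing A) g₂)
  refine ⟨T, i, φ₁.comp (algebraMap B₁ (FractionRing B₁)), φ₂.comp (algebraMap B₂ (FractionRing B₂)),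
    φ₁.injective.comp (IsFractionRing.injective B₁ (FractionRing B₁)),
    φ₂.injective.comp (IsFractionRing.injective B₂ (FractionRing B₂)), fun a => ?_⟩
  have := h (algebraMap A _ a)
  rw [IsFractionRing.lift_algebraMap, IsFractionRing.lift_algebraMap] at this
  exact this

lemma meet [IsAlgClosed F] {σ₁ σ₂ τ : Type} [Finite σ₁] [Finite σ₂]
    (p : τ → MvPolynomial σ₁ F) (q : τ → MvPolynomial σ₂ F)
    (hp : Function.Injective (aeval (R := F) p)) (hq : Function.Injective (aeval (R := F) q))
    {u : MvPolynomial σ₁ F} {v : MvPolynomial σ₂ F} (hu : u ≠ 0) (hv : v ≠ 0) :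
    ∃ x y, (∀ j, eval x (p j) = eval y (q j)) ∧ eval x u ≠ 0 ∧ eval y v ≠ 0 := by
  obtain ⟨T, _, φ₁, φ₂, i1, i2, key'⟩ := amalg (aeval (R := F) p).toRingHom (aeval (R := F) q).toRingHom hp hq
  have key : ∀ P : MvPolynomial τ F, φ₁ (aeval p P) = φ₂ (aeval q P) := key'
  have kC : ∀ a, φ₁ (C a) = φ₂ (C a) := fun a => by
    have := key (C a); simpa [algHom_C] using this
  have hu' : φ₁ u ≠ 0 := (map_ne_zero_iff _ i1).2 hu
  have hv' : φ₂ v ≠ 0 := (map_ne_zero_iff _ i2).2 hv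
  let z : ((σ₁ ⊕ σ₂) ⊕ Bool) → T := Sum.elim (Sum.elim (fun i => φ₁ (X i)) (fun i => φ₂ (X i)))
    (fun b => if b then (φ₁ u)⁻¹ else (φ₂ v)⁻¹)
  let Φ : MvPolynomial ((σ₁ ⊕ σ₂) ⊕ Bool) F →+* T := eval₂Hom (φ₁.comp C) z
  have r1 : ∀ P : MvPolynomial σ₁ F, Φ (rename (Sum.inl ∘ Sum.inl) P) = φ₁ P := by
    intro P
    have : Φ.comp (rename (R := F) (Sum.inl ∘ Sum.inl : σ₁ → (σ₁ ⊕ σ₂) ⊕ Bool)).toRingHom = φ₁ := by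
      apply MvPolynomial.ringHom_ext
      · intro a; simp [Φ]
      · intro i; simp [Φ, z]
    exact RingHom.congr_fun this P
  have r2 : ∀ P : MvPolynomial σ₂ F, Φ (rename (Sum.inl ∘ Sum.inr) P) = φ₂ P := by
    intro P
    have : Φ.comp (rename (R := F) (Sum.inl ∘ Sum.inr : σ₂ → (σ₁ ⊕ σ₂) ⊕ Bool)).toRingHom = φ₂ := by
      apply MvPolynomial.ringHom_ext
      · intro a; simp [Φ, kC]
      · intro i; simp [Φ, z]
    exact RingHom.congr_fun this P
  have hI : RingHom.ker Φ ≠ ⊤ := RingHom.ker_ne_top Φ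
  obtain ⟨x, hx⟩ := exists_zero hI
  refine ⟨fun i => x (Sum.inl (Sum.inl i)), fun i => x (Sum.inl (Sum.inr i)), ?_, ?_, ?_⟩
  · intro j
    have := hx (rename (Sum.inl ∘ Sum.inl) (p j) - rename (Sum.inl ∘ Sum.inr) (q j)) (by
      rw [RingHom.mem_ker, map_sub, r1, r2]
      have := key (X j)
      simp only [aeval_X] at this
      rw [this, sub_self])
    rw [map_sub, eval_rename, eval_rename, sub_eq_zero] at this
    exact this
  · have := hx (rename (Sum.inl ∘ Sum.inl) u * X (Sum.inr true) - 1) (by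
      rw [RingHom.mem_ker, map_sub, map_mul, r1, map_one, sub_eq_zero]
      have : Φ (X (Sum.inr true)) = (φ₁ u)⁻¹ := by simp [Φ, z]
      rw [this, mul_inv_cancel₀ hu'])
    rw [map_sub, map_mul, eval_rename, map_one, sub_eq_zero] at this
    exact left_ne_zero_of_mul_eq_one this
  · have := hx (rename (Sum.inl ∘ Sum.inr) v * X (Sum.inr false) - 1) (by
      rw [RingHom.mem_ker, map_sub, map_mul, r2, map_one, sub_eq_zero]
      have : Φ (X (Sum.inr false)) = (φ₂ v)⁻¹ := by simp [Φ, z]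
      rw [this, mul_inv_cancel₀ hv'])
    rw [map_sub, map_mul, eval_rename, map_one, sub_eq_zero] at this
    exact left_ne_zero_of_mul_eq_one this

lemma pderiv_aeval {σ τ : Type} [Fintype τ] (f : τ → MvPolynomial σ F) (i : σ) (P : MvPolynomial τ F) :
    pderiv i (aeval f P) = ∑ j, aeval f (pderiv j P) * pderiv i (f j) := by
  classical
  induction P using MvPolynomial.induction_on with
  | C a => simp [algHom_C]
  | add p q hp hq => simp only [map_add, hp, hq, add_mul, Finset.sum_add_distrib]
  | mul_X p k hp =>
    simp only [map_mul, aeval_X, Derivation.leibniz, hp, smul_eq_mul, map_add, pderiv_X, add_mul,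
      Finset.sum_add_distrib]
    congr 1
    · rw [Finset.sum_eq_single k]
      · simp
      · intro b _ hb; simp [hb]
      · simp
    · rw [Finset.mul_sum]; exact Finset.sum_congr rfl fun j _ => by ring

lemma eq_C_of_pderiv [CharZero F] {τ : Type} {P : MvPolynomial τ F} (h : ∀ j, pderiv j P = 0) : ∃ a, P = C a := by
  classical
  refine ⟨coeff 0 P, ?_⟩
  ext m
  rw [coeff_C]
  split_ifs with h0
  · rw [h0]
  · obtain ⟨j, hj⟩ := Finsupp.ne_iff.1 (Ne.symm h0)
    have hj' : m j ≠ 0 := hj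
    have h1 := congrArg (coeff (m - Finsupp.single j 1)) (h j)
    rw [coeff_pderiv, coeff_zero, Finsupp.sub_add_single_one_cancel hj'] at h1
    rcases mul_eq_zero.1 h1 with h2 | h2
    · exact h2
    · exfalso; norm_cast at h2

lemma totalDegree_pderiv_lt {τ : Type} {P : MvPolynomial τ F} {j : τ} (h : pderiv j P ≠ 0) :
    (pderiv j P).totalDegree < P.totalDegree := by
  classical
  have key : ∀ m ∈ (pderiv j P).support, (m.sum fun _ e => e) + 1 ≤ P.totalDegree := by
    intro m hm
    have h1 : m + Finsupp.single j 1 ∈ P.support := by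
      rw [mem_support_iff] at hm ⊢
      intro h0
      rw [coeff_pderiv, h0, zero_mul] at hm
      exact hm rfl
    have h2 := le_totalDegree h1
    rw [Finsupp.sum_add_index' (fun _ => rfl) (fun _ _ _ => rfl), Finsupp.sum_single_index rfl] at h2
    exact h2
  obtain ⟨m, hm⟩ := support_nonempty.2 h
  rw [totalDegree, Finset.sup_lt_iff (by have := key m hm; simp; omega)]
  intro m hm
  exact key m hm

lemma aeval_inj [CharZero F] {σ τ : Type} [Fintype σ] [Fintype τ] [DecidableEq τ] (f : τ → MvPolynomial σ F) (b : σ → F)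
    (K : Matrix τ σ F) (hK : K * (Matrix.of fun i j => eval b (pderiv i (f j))) = 1) :
    Function.Injective (aeval (R := F) f) := by
  classical
  rw [injective_iff_map_eq_zero]
  suffices ∀ n : ℕ, ∀ P : MvPolynomial τ F, P.totalDegree ≤ n → aeval f P = 0 → P = 0 from fun P h => this _ P le_rfl h
  intro n
  induction n using Nat.strong_induction_on with
  | _ n ih =>
  intro P hn hP
  have hj : ∀ j, pderiv j P = 0 := by
    let J : Matrix σ τ (MvPolynomial σ F) := Matrix.of fun i j => pderiv i (f j)
    let v : τ → MvPolynomial σ F := fun j => aeval f (pderiv j P)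
    have h1 : J.mulVec v = 0 := by
      funext i
      have := pderiv_aeval f i P
      rw [hP, map_zero] at this
      simp only [Matrix.mulVec, dotProduct, J, v, Matrix.of_apply, Pi.zero_apply]
      rw [this]; exact Finset.sum_congr rfl fun j _ => mul_comm _ _
    let K' : Matrix τ σ (MvPolynomial σ F) := Matrix.of fun i j => C (K i j)
    let N : Matrix τ τ (MvPolynomial σ F) := K' * J
    have h2 : N.mulVec v = 0 := by
      show (K' * J).mulVec v = 0
      rw [← Matrix.mulVec_mulVec, h1, Matrix.mulVec_zero]
    have h3 : N.det ≠ 0 := by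
      intro h
      have h4 := congrArg (eval b) h
      rw [RingHom.map_det, map_zero] at h4
      have h5 : (eval b).mapMatrix N = 1 := by
        rw [← hK]
        ext i j; simp [N, J, K', Matrix.mul_apply]
      rw [h5, Matrix.det_one] at h4
      exact one_ne_zero h4
    have h6 : v = 0 := Matrix.eq_zero_of_mulVec_eq_zero h3 h2
    intro j
    by_contra hne
    have h7 := totalDegree_pderiv_lt hne
    exact hne (ih _ (lt_of_lt_of_le h7 hn) _ le_rfl (congrFun h6 j))
  obtain ⟨a, rfl⟩ := eq_C_of_pderiv hj
  rw [algHom_C] at hP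
  simpa using hP

end AG
end E8

namespace E8

/-- Root lattice of type E8 in simple-root coordinates. -/
abbrev Lam := Fin 8 → ℤ

/-- The E8 bilinear form. -/
def bil (v w : Lam) : ℤ :=
  2 * (v 0 * w 0 + v 1 * w 1 + v 2 * w 2 + v 3 * w 3 + v 4 * w 4 + v 5 * w 5 + v 6 * w 6 + v 7 * w 7)
  - (v 0 * w 2 + v 2 * w 0 + v 1 * w 3 + v 3 * w 1 + v 2 * w 3 + v 3 * w 2 + v 3 * w 4 + v 4 * w 3
    + v 4 * w 5 + v 5 * w 4 + v 5 * w 6 + v 6 * w 5 + v 6 * w 7 + v 7 * w 6)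

/-- A bilinear form whose parity is the cocycle. -/
def bb (v w : Lam) : ℤ :=
  (v 0 * w 0 + v 1 * w 1 + v 2 * w 2 + v 3 * w 3 + v 4 * w 4 + v 5 * w 5 + v 6 * w 6 + v 7 * w 7)
  + (v 0 * w 2 + v 1 * w 3 + v 2 * w 3 + v 3 * w 4 + v 4 * w 5 + v 5 * w 6 + v 6 * w 7)

lemma bil_comm (v w : Lam) : bil v w = bil w v := by unfold bil; ring
lemma bil_add_left (u v w : Lam) : bil (u + v) w = bil u w + bil v w := by
  simp only [bil, Pi.add_apply]; ring
lemma bil_add_right (u v w : Lam) : bil u (v + w) = bil u v + bil u w := by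
  simp only [bil, Pi.add_apply]; ring
lemma bil_sub_left (u v w : Lam) : bil (u - v) w = bil u w - bil v w := by
  simp only [bil, Pi.sub_apply]; ring
lemma bil_sub_right (u v w : Lam) : bil u (v - w) = bil u v - bil u w := by
  simp only [bil, Pi.sub_apply]; ring
lemma bil_neg_left (v w : Lam) : bil (-v) w = - bil v w := by
  simp only [bil, Pi.neg_apply]; ring
lemma bil_neg_right (v w : Lam) : bil v (-w) = - bil v w := by
  simp only [bil, Pi.neg_apply]; ring
lemma bil_smul_left (n : ℤ) (v w : Lam) : bil (n • v) w = n * bil v w := by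
  simp only [bil, Pi.smul_apply, smul_eq_mul]; ring
lemma bil_smul_right (n : ℤ) (v w : Lam) : bil v (n • w) = n * bil v w := by
  simp only [bil, Pi.smul_apply, smul_eq_mul]; ring
@[simp] lemma bil_zero_left (w : Lam) : bil 0 w = 0 := by simp [bil]
@[simp] lemma bil_zero_right (w : Lam) : bil w 0 = 0 := by simp [bil]
lemma bb_add_left (u v w : Lam) : bb (u + v) w = bb u w + bb v w := by
  simp only [bb, Pi.add_apply]; ring
lemma bb_add_right (u v w : Lam) : bb u (v + w) = bb u v + bb u w := by
  simp only [bb, Pi.add_apply]; ring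
lemma bb_neg_left (v w : Lam) : bb (-v) w = - bb v w := by
  simp only [bb, Pi.neg_apply]; ring
lemma bb_neg_right (v w : Lam) : bb v (-w) = - bb v w := by
  simp only [bb, Pi.neg_apply]; ring

lemma bb_add_bb (v w : Lam) : ∃ k, bb v w + bb w v = bil v w + 2 * k :=
  ⟨v 0 * w 2 + v 2 * w 0 + v 1 * w 3 + v 3 * w 1 + v 2 * w 3 + v 3 * w 2 + v 3 * w 4 + v 4 * w 3
    + v 4 * w 5 + v 5 * w 4 + v 5 * w 6 + v 6 * w 5 + v 6 * w 7 + v 7 * w 6, by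
    unfold bb bil; ring⟩

lemma two_bb_self (v : Lam) : ∃ k, 2 * bb v v = bil v v + 4 * k :=
  ⟨v 0 * v 2 + v 1 * v 3 + v 2 * v 3 + v 3 * v 4 + v 4 * v 5 + v 5 * v 6 + v 6 * v 7, by
    unfold bb bil; ring⟩

lemma bil_self_even (v : Lam) : ∃ k, bil v v = 2 * k := by
  obtain ⟨k, hk⟩ := two_bb_self v
  exact ⟨bb v v - 2 * k, by linarith⟩

lemma sixty_bil (v : Lam) : 60 * bil v v = 30 * (2 * v 7 - v 6)^2 + 10 * (3 * v 6 - 2 * v 5)^2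
    + 5 * (4 * v 5 - 3 * v 4)^2 + 3 * (5 * v 4 - 4 * v 3)^2 + 30 * (2 * v 0 - v 2)^2
    + 10 * (3 * v 2 - 2 * v 3)^2 + 30 * (2 * v 1 - v 3)^2 + 2 * (v 3)^2 := by
  unfold bil; ring

lemma bil_self_nonneg (v : Lam) : 0 ≤ bil v v := by
  have := sixty_bil v
  have : 0 ≤ 60 * bil v v := by rw [this]; positivity
  linarith

lemma eq_zero_of_bil_self (v : Lam) (h : bil v v = 0) : v = 0 := by
  have e := sixty_bil v
  rw [h] at e
  have hs : ∀ x : ℤ, 0 ≤ x ^ 2 := fun x => sq_nonneg x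
  have h7 := hs (2 * v 7 - v 6)
  have h6 := hs (3 * v 6 - 2 * v 5)
  have h5 := hs (4 * v 5 - 3 * v 4)
  have h4 := hs (5 * v 4 - 4 * v 3)
  have h0 := hs (2 * v 0 - v 2)
  have h2 := hs (3 * v 2 - 2 * v 3)
  have h1 := hs (2 * v 1 - v 3)
  have h3 := hs (v 3)
  have e3 : v 3 = 0 := pow_eq_zero_iff (two_ne_zero) |>.1 (by linarith)
  have e1 : 2 * v 1 - v 3 = 0 := pow_eq_zero_iff (two_ne_zero) |>.1 (by linarith)
  have e2 : 3 * v 2 - 2 * v 3 = 0 := pow_eq_zero_iff (two_ne_zero) |>.1 (by linarith)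
  have e0 : 2 * v 0 - v 2 = 0 := pow_eq_zero_iff (two_ne_zero) |>.1 (by linarith)
  have e4 : 5 * v 4 - 4 * v 3 = 0 := pow_eq_zero_iff (two_ne_zero) |>.1 (by linarith)
  have e5 : 4 * v 5 - 3 * v 4 = 0 := pow_eq_zero_iff (two_ne_zero) |>.1 (by linarith)
  have e6 : 3 * v 6 - 2 * v 5 = 0 := pow_eq_zero_iff (two_ne_zero) |>.1 (by linarith)
  have e7 : 2 * v 7 - v 6 = 0 := pow_eq_zero_iff (two_ne_zero) |>.1 (by linarith)
  funext i
  fin_cases i <;> simp <;> omega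

lemma two_le_bil_self (v : Lam) (h : v ≠ 0) : 2 ≤ bil v v := by
  obtain ⟨k, hk⟩ := bil_self_even v
  have h1 := bil_self_nonneg v
  have h2 : bil v v ≠ 0 := fun h0 => h (eq_zero_of_bil_self v h0)
  omega

/-- `v` is a root. -/
def IsRt (v : Lam) : Prop := bil v v = 2

instance : DecidablePred IsRt := fun v => inferInstanceAs (Decidable (bil v v = 2))

lemma IsRt.ne_zero {v : Lam} (h : IsRt v) : v ≠ 0 := by
  rintro rfl; simp [IsRt] at h

lemma IsRt.neg {v : Lam} (h : IsRt v) : IsRt (-v) := by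
  unfold IsRt at *; rw [bil_neg_left, bil_neg_right, neg_neg, h]

lemma isRt_neg_iff {v : Lam} : IsRt (-v) ↔ IsRt v :=
  ⟨fun h => by simpa using h.neg, IsRt.neg⟩

lemma bil_add_self (u v : Lam) : bil (u + v) (u + v) = bil u u + 2 * bil u v + bil v v := by
  rw [bil_add_left, bil_add_right, bil_add_right, bil_comm v u]; ring

lemma bil_sub_self (u v : Lam) : bil (u - v) (u - v) = bil u u - 2 * bil u v + bil v v := by
  rw [bil_sub_left, bil_sub_right, bil_sub_right, bil_comm v u]; ring

lemma isRt_add_iff {u v : Lam} (hu : IsRt u) (hv : IsRt v) : IsRt (u + v) ↔ bil u v = -1 := by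
  unfold IsRt at *
  rw [bil_add_self, hu, hv]; omega

lemma add_eq_zero_iff_bil {u v : Lam} (hu : IsRt u) (hv : IsRt v) : u + v = 0 ↔ bil u v = -2 := by
  constructor
  · intro h
    have : v = -u := by rw [eq_neg_iff_add_eq_zero, add_comm]; exact h
    rw [this, bil_neg_right, show bil u u = 2 from hu]
  · intro h
    apply eq_zero_of_bil_self
    rw [bil_add_self, hu, hv, h]; rfl

lemma bil_le_two {u v : Lam} (hu : IsRt u) (hv : IsRt v) : bil u v ≤ 2 := by
  have := bil_self_nonneg (u - v)
  rw [bil_sub_self, hu, hv] at this; omega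

lemma neg_two_le_bil {u v : Lam} (hu : IsRt u) (hv : IsRt v) : -2 ≤ bil u v := by
  have := bil_self_nonneg (u + v)
  rw [bil_add_self, hu, hv] at this; omega

lemma eq_of_bil_eq_two {u v : Lam} (hu : IsRt u) (hv : IsRt v) (h : bil u v = 2) : u = v := by
  rw [← sub_eq_zero]
  apply eq_zero_of_bil_self
  rw [bil_sub_self, hu, hv, h]; rfl

/-- Simple roots. -/
def al (i : Fin 8) : Lam := Pi.single i 1

lemma isRt_al (i : Fin 8) : IsRt (al i) := by
  fin_cases i <;> decide

lemma bil_al_al (i j : Fin 8) : bil (al i) (al j) = CartanMatrix.E₈ i j := by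
  fin_cases i <;> fin_cases j <;> rfl

lemma eq_sum_al (v : Lam) : v = ∑ i, v i • al i := by
  funext j
  simp [al, Finset.sum_apply, Pi.single_apply]

lemma bil_eq_sum (u v : Lam) : bil u v = ∑ i, v i * bil u (al i) := by
  conv_lhs => rw [eq_sum_al v]
  have : ∀ s : Finset (Fin 8), bil u (∑ i ∈ s, v i • al i) = ∑ i ∈ s, v i * bil u (al i) := by
    intro s
    induction s using Finset.induction_on with
    | empty => simp
    | insert a s ha ih => rw [Finset.sum_insert ha, Finset.sum_insert ha, bil_add_right, ih,
        bil_smul_right]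
  exact this _

lemma bil_al_nonpos {i j : Fin 8} (h : i ≠ j) : bil (al i) (al j) ≤ 0 := by
  revert i j; decide

/-- A root has all coordinates of the same sign. -/
lemma IsRt.nonneg_or_nonpos {v : Lam} (h : IsRt v) : (∀ i, 0 ≤ v i) ∨ (∀ i, v i ≤ 0) := by
  set p : Lam := fun i => max (v i) 0 with hp
  set n : Lam := fun i => max (-(v i)) 0 with hn
  have hv : v = p - n := by
    funext i; simp only [hp, hn, Pi.sub_apply]; omega
  have hpn : bil p n ≤ 0 := by
    rw [bil_eq_sum]
    apply Finset.sum_nonpos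
    intro i _
    rw [bil_comm, bil_eq_sum, Finset.mul_sum]
    apply Finset.sum_nonpos
    intro j _
    by_cases hij : i = j
    · subst hij
      have : n i * p i = 0 := by
        simp only [hp, hn]
        rcases le_total (v i) 0 with h0 | h0
        · rw [max_eq_right h0, mul_zero]
        · rw [max_eq_right (by linarith : -v i ≤ 0), zero_mul]
      rw [← mul_assoc, this, zero_mul]
    · rw [← mul_assoc]
      have h1 : 0 ≤ n i := le_max_right _ _
      have h2 : 0 ≤ p j := le_max_right _ _
      exact mul_nonpos_of_nonneg_of_nonpos (mul_nonneg h1 h2) (bil_al_nonpos hij)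
  have hq : bil p p - 2 * bil p n + bil n n = 2 := by rw [← bil_sub_self, ← hv]; exact h
  by_cases hp0 : p = 0
  · right
    intro i
    have := congrFun hp0 i
    simp only [hp, Pi.zero_apply] at this
    omega
  by_cases hn0 : n = 0
  · left
    intro i
    have := congrFun hn0 i
    simp only [hn, Pi.zero_apply] at this
    omega
  have := two_le_bil_self p hp0
  have := two_le_bil_self n hn0
  omega

/-- Reflection. -/
def refl (a v : Lam) : Lam := v - bil v a • a

lemma bil_refl {a : Lam} (ha : IsRt a) (u v : Lam) : bil (refl a u) (refl a v) = bil u v := by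
  unfold refl
  simp only [bil_sub_left, bil_sub_right, bil_smul_left, bil_smul_right]
  rw [show bil a a = 2 from ha, bil_comm a v]; ring

lemma refl_refl {a : Lam} (ha : IsRt a) (v : Lam) : refl a (refl a v) = v := by
  unfold refl
  simp only [bil_sub_left, bil_smul_left]
  rw [show bil a a = 2 from ha]
  module

lemma IsRt.refl {a v : Lam} (ha : IsRt a) (hv : IsRt v) : IsRt (refl a v) := by
  unfold IsRt; rw [bil_refl ha]; exact hv

/-- codes of the 120 positive roots (base 8 digits) -/
def codes : List ℕ := [
  2097152, 262144, 32768, 4096, 512, 64, 8, 1, 2359296, 294912, 36864, 4608, 576, 520, 65,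
  2392064, 299008, 37376, 4672, 4616, 584, 577, 2396160, 299520, 37440, 37384, 4680, 4673, 585,
  2396672, 299584, 299528, 37448, 5192, 37441, 4681, 2396736, 2396680, 299592, 37960, 299585,
  37449, 5193, 2396744, 300104, 42056, 2396737, 299593, 37961, 5257, 2397256, 304200, 2396745,
  300105, 42057, 38025, 2401352, 336968, 2397257, 304201, 300169, 42121, 2434120, 2401353,
  336969, 2397321, 304265, 42633, 2696264, 2434121, 2401417, 337033, 304777, 42641, 2696265,
  2434185, 2401929, 337545, 304785, 2696329, 2434697, 341641, 2401937, 337553, 2696841, 2438793,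
  2434705, 341649, 2700937, 2696849, 2438801, 342161, 2733705, 2700945, 2439313, 342225, 2733713,
  2701457, 2439377, 342226, 2734225, 2701521, 2439378, 2738321, 2734289, 2701522, 2738385,
  2734290, 2738897, 2738386, 2738905, 2738898, 2738962, 2738906, 2738970, 2739482, 2743578,
  2776346, 3038490, 5135642]

/-- decode -/
def dec (c : ℕ) : Lam := fun i => ((c / 8 ^ (i : ℕ)) % 8 : ℕ)

end E8

namespace E8

/-- The set of roots. -/
abbrev R := {v : Lam // IsRt v}

/-- The cocycle sign. -/
def sg (F : Type) [Field F] (u v : Lam) : F := (((bb u v).negOnePow : ℤˣ) : ℤ)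

section sg
variable {F : Type} [Field F]
lemma sg_add_left (u v w : Lam) : sg F (u + v) w = sg F u w * sg F v w := by
  simp [sg, bb_add_left, Int.negOnePow_add]
lemma sg_add_right (u v w : Lam) : sg F u (v + w) = sg F u v * sg F u w := by
  simp [sg, bb_add_right, Int.negOnePow_add]
lemma sg_neg_left (u v : Lam) : sg F (-u) v = sg F u v := by
  simp [sg, bb_neg_left, Int.negOnePow_neg]
lemma sg_neg_right (u v : Lam) : sg F u (-v) = sg F u v := by
  simp [sg, bb_neg_right, Int.negOnePow_neg]
lemma sg_sq (u v : Lam) : sg F u v * sg F u v = 1 := by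
  simp only [sg]; rw [← Int.cast_mul, ← Units.val_mul, ← Int.negOnePow_add]
  rw [Int.negOnePow_even _ (Even.add_self _)]; simp
lemma sg_ne_zero (u v : Lam) : sg F u v ≠ 0 := fun h => by
  have := sg_sq (F := F) u v; rw [h] at this; simp at this
lemma sg_swap (u v : Lam) : sg F u v = ((bil u v).negOnePow : ℤ) * sg F v u := by
  obtain ⟨k, hk⟩ := bb_add_bb u v
  have : bb u v = bil u v + bb v u + 2 * (k - bb v u) := by linarith
  simp only [sg]
  rw [this, Int.negOnePow_add, Int.negOnePow_add, Int.negOnePow_even (2 * _) ⟨k - bb v u, by ring⟩]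
  push_cast; ring
lemma sg_self {u : Lam} (h : IsRt u) : sg F u u = -1 := by
  obtain ⟨k, hk⟩ := two_bb_self u
  rw [show bil u u = 2 from h] at hk
  simp only [sg]
  rw [Int.negOnePow_odd _ ⟨k, by linarith⟩]; simp
end sg

/-- Lattice model of the Lie algebra of type E8. -/
def M (F : Type) [Field F] : Type := (Fin 8 → F) × (R →₀ F)

variable {F : Type} [Field F]

noncomputable instance : AddCommGroup (M F) := inferInstanceAs (AddCommGroup ((Fin 8 → F) × (R →₀ F)))
noncomputable instance : Module F (M F) := inferInstanceAs (Module F ((Fin 8 → F) × (R →₀ F)))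

/-- Cartan part. -/
noncomputable def H : (Fin 8 → F) →ₗ[F] M F := LinearMap.inl F (Fin 8 → F) (R →₀ F)
/-- root part -/
noncomputable def X : (R →₀ F) →ₗ[F] M F := LinearMap.inr F (Fin 8 → F) (R →₀ F)
/-- projection -/
noncomputable def pH : M F →ₗ[F] (Fin 8 → F) := LinearMap.fst F (Fin 8 → F) (R →₀ F)
/-- projection -/
noncomputable def pX : M F →ₗ[F] (R →₀ F) := LinearMap.snd F (Fin 8 → F) (R →₀ F)

@[simp] lemma pH_H (h : Fin 8 → F) : pH (H h) = h := rfl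
@[simp] lemma pX_H (h : Fin 8 → F) : pX (H h) = 0 := rfl
@[simp] lemma pH_X (h : R →₀ F) : pH (X h) = 0 := rfl
@[simp] lemma pX_X (h : R →₀ F) : pX (X h) = h := rfl
lemma H_add_X (x : M F) : H (pH x) + X (pX x) = x := by
  exact Prod.ext (add_zero (pH x)) (zero_add (pX x))

/-- Root vectors, zero on non-roots. -/
noncomputable def E (F : Type) [Field F] (v : Lam) : M F := if h : IsRt v then X (Finsupp.single ⟨v, h⟩ 1) else 0

lemma E_of {v : Lam} (h : IsRt v) : E F v = X (Finsupp.single ⟨v, h⟩ 1) := by simp [E, h]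
lemma E_not {v : Lam} (h : ¬ IsRt v) : E F v = 0 := by simp [E, h]
@[simp] lemma pH_E (v : Lam) : pH (E F v) = 0 := by unfold E; split_ifs <;> simp
lemma pX_E {v : Lam} (h : IsRt v) : pX (E F v) = Finsupp.single ⟨v, h⟩ 1 := by simp [E_of h]
lemma E_ne_zero {v : Lam} (h : IsRt v) : E F v ≠ 0 := fun h0 => by
  have := pX_E (F := F) h; rw [h0, map_zero] at this
  exact one_ne_zero (Finsupp.single_eq_zero.1 this.symm)

/-- Pairing of coroot space with the root lattice -/
def pr (v : Lam) : (Fin 8 → F) →ₗ[F] F := ∑ i, ((bil (al i) v : ℤ) : F) • LinearMap.proj i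

lemma pr_apply (v : Lam) (h : Fin 8 → F) : pr v h = ∑ i, ((bil (al i) v : ℤ) : F) * h i := by
  simp [pr]
lemma pr_add (u v : Lam) (h : Fin 8 → F) : pr (u + v) h = pr u h + pr v h := by
  simp [pr_apply, bil_add_right, add_mul, Finset.sum_add_distrib]
lemma pr_neg (u : Lam) (h : Fin 8 → F) : pr (-u) h = - pr u h := by
  simp [pr_apply, bil_neg_right]

/-- coroot vector -/
def cor (F : Type) [Field F] (v : Lam) : Fin 8 → F := fun i => (v i : F)
lemma cor_add (u v : Lam) : cor F (u + v) = cor F u + cor F v := by funext i; simp [cor]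
lemma cor_neg (u : Lam) : cor F (-u) = - cor F u := by funext i; simp [cor]
@[simp] lemma cor_zero : cor F 0 = 0 := by funext i; simp [cor]
lemma pr_cor (u v : Lam) : pr v (cor F u) = (bil u v : ℤ) := by
  rw [pr_apply, bil_comm, bil_eq_sum]; push_cast
  apply Finset.sum_congr rfl; intro i _
  rw [bil_comm, cor, mul_comm]

/-- Structure constants. -/
noncomputable def T (F : Type) [Field F] (u v : Lam) : M F :=
  if u + v = 0 then sg F u v • H (cor F u) else sg F u v • E F (u + v)

/-- Bilinear part -/
noncomputable def TT : (R →₀ F) →ₗ[F] (R →₀ F) →ₗ[F] M F :=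
  Finsupp.linearCombination F (fun u : R => Finsupp.linearCombination F (fun v : R => T F u.1 v.1))

/-- Action of the Cartan part -/
noncomputable def act : (Fin 8 → F) →ₗ[F] (R →₀ F) →ₗ[F] M F :=
  (Finsupp.linearCombination F (fun v : R => (pr (F := F) v.1).smulRight (E F v.1))).flip

/-- The bracket. -/
noncomputable def br : M F →ₗ[F] M F →ₗ[F] M F :=
  act.compl₁₂ pH pX - (act.compl₁₂ pH pX).flip + TT.compl₁₂ pX pX

lemma br_HH (h k : Fin 8 → F) : br (H h) (H k) = 0 := by simp [br]
lemma br_HE (h : Fin 8 → F) (v : Lam) : br (H h) (E F v) = pr v h • E F v := by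
  by_cases hv : IsRt v
  · simp [br, act, pX_E hv]
  · simp [E_not hv]
lemma br_EH (h : Fin 8 → F) (v : Lam) : br (E F v) (H h) = -(pr v h • E F v) := by
  by_cases hv : IsRt v
  · simp [br, act, pX_E hv]
  · simp [E_not hv]
lemma br_EE {u v : Lam} (hu : IsRt u) (hv : IsRt v) : br (E F u) (E F v) = T F u v := by
  simp [br, TT, act, pX_E hu, pX_E hv]

lemma M.ind {p : M F → Prop} (hH : ∀ h, p (H h)) (hE : ∀ v, IsRt v → p (E F v))
    (hadd : ∀ x y, p x → p y → p (x + y)) (hsmul : ∀ (c : F) x, p x → p (c • x)) (x : M F) : p x := by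
  rw [← H_add_X x]
  refine hadd _ _ (hH _) ?_
  induction pX x using Finsupp.induction_linear with
  | zero => rw [map_zero, ← map_zero (H (F := F))]; exact hH 0
  | add f g hf hg => rw [map_add]; exact hadd _ _ hf hg
  | single a b =>
    have : X (Finsupp.single a b) = b • E F a.1 := by
      rw [E_of a.2, ← map_smul]; simp
    rw [this]; exact hsmul _ _ (hE _ a.2)

lemma br_skew (x y : M F) : br x y = - br y x := by
  induction x using M.ind with
  | hadd x x' h h' => simp only [map_add, LinearMap.add_apply, h, h']; abel
  | hsmul c x h => simp only [map_smul, LinearMap.smul_apply, h, smul_neg]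
  | hH h =>
    induction y using M.ind with
    | hadd x x' h h' => simp only [map_add, LinearMap.add_apply, h, h']; abel
    | hsmul c x h => simp only [map_smul, LinearMap.smul_apply, h, smul_neg]
    | hH k => simp [br_HH]
    | hE v hv => simp [br_HE, br_EH]
  | hE u hu =>
    induction y using M.ind with
    | hadd x x' h h' => simp only [map_add, LinearMap.add_apply, h, h']; abel
    | hsmul c x h => simp only [map_smul, LinearMap.smul_apply, h, smul_neg]
    | hH k => simp [br_HE, br_EH]
    | hE v hv =>
      rw [br_EE hu hv, br_EE hv hu]
      unfold T
      by_cases h0 : u + v = 0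
      · have hvu : v = -u := by rw [eq_neg_iff_add_eq_zero, add_comm]; exact h0
        rw [if_pos h0, if_pos (by rw [add_comm]; exact h0), hvu, sg_neg_left, sg_neg_right, cor_neg]
        simp
      · rw [if_neg h0, if_neg (by rw [add_comm]; exact h0), add_comm v u]
        by_cases h1 : IsRt (u + v)
        · rw [sg_swap u v, (isRt_add_iff hu hv).1 h1]
          simp [Int.negOnePow_odd (-1) (by decide)]
        · simp [E_not h1]

/-- cyclic sum -/
noncomputable def cyc (x y z : M F) : M F := br x (br y z) + br y (br z x) + br z (br x y)

lemma cyc_rot (x y z : M F) : cyc x y z = cyc y z x := by unfold cyc; abel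

lemma br_E_nb {u v : Lam} (hu : IsRt u) (hv : IsRt v) (h : u + v ≠ 0) :
    br (E F u) (E F v) = sg F u v • E F (u + v) := by
  rw [br_EE hu hv, T, if_neg h]

lemma br_E_opp {u : Lam} (hu : IsRt u) :
    br (E F u) (E F (-u)) = - H (cor F u) := by
  rw [br_EE hu hu.neg, T, if_pos (by simp), sg_neg_right, sg_self hu]; simp

lemma bil_ne {u v : Lam} (hu : IsRt u) (hv : IsRt v) : bil u v = -2 ∨ bil u v = -1 ∨ bil u v = 0 ∨ bil u v = 1 ∨ bil u v = 2 := by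
  have := bil_le_two hu hv
  have := neg_two_le_bil hu hv
  omega

lemma br_EE_zero {u v : Lam} (hu : IsRt u) (hv : IsRt v) (h : 0 ≤ bil u v) :
    br (E F u) (E F v) = 0 := by
  have h0 : u + v ≠ 0 := fun h0 => by
    rw [add_eq_zero_iff_bil hu hv] at h0; omega
  rw [br_E_nb hu hv h0, E_not, smul_zero]
  rw [isRt_add_iff hu hv]; omega

lemma br_EE_neg {u v : Lam} (hu : IsRt u) (hv : IsRt v) (h : bil u v = -1) :
    br (E F u) (E F v) = sg F u v • E F (u + v) := by
  apply br_E_nb hu hv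
  intro h0
  rw [add_eq_zero_iff_bil hu hv] at h0; omega

lemma cyc_opp {u w : Lam} (hu : IsRt u) (hw : IsRt w) : cyc (E F u) (E F (-u)) (E F w) = 0 := by
  have huu : bil u u = 2 := hu
  have hs := sg_self (F := F) hu
  have hq := sg_sq (F := F) u w
  unfold cyc
  rw [br_E_opp hu, map_neg, br_EH, neg_neg, pr_cor]
  rcases bil_ne hu hw with h | h | h | h | h
  · have : w = -u := by
      rw [eq_neg_iff_add_eq_zero, add_comm]; exact (add_eq_zero_iff_bil hu hw).2 h
    subst this
    rw [br_EE_zero hu.neg hu.neg (by simp [bil_neg_left, bil_neg_right, huu]), map_zero]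
    have := br_E_opp (F := F) hu.neg
    rw [neg_neg] at this
    rw [this, map_neg, br_EH, cor_neg, map_neg, pr_cor, h]
    module
  · have hwu : bil w u = -1 := by rw [bil_comm]; exact h
    have r := (isRt_add_iff hw hu).2 hwu
    have e := sg_swap (F := F) u w
    rw [h, Int.negOnePow_odd (-1) (by decide)] at e
    rw [br_EE_zero hu.neg hw (by rw [bil_neg_left, h]; decide), map_zero, br_EE_neg hw hu hwu,
      map_smul, br_EE_neg hu.neg r (by rw [bil_neg_left, bil_add_right, h, huu]; norm_num),
      sg_neg_left, sg_add_right, hs, h, show -u + (w + u) = w by abel]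
    have : sg F w u * sg F u w = -1 := by
      rw [e]; push_cast
      have := sg_sq (F := F) w u
      linear_combination -this
    rw [smul_smul, show sg F w u * (sg F u w * -1) = 1 by linear_combination -this]
    push_cast; module
  · rw [br_EE_zero hu.neg hw (by rw [bil_neg_left, h]; decide), br_EE_zero hw hu (by rw [bil_comm, h]), h]
    simp
  · have r := (isRt_add_iff hu.neg hw).2 (by rw [bil_neg_left, h])
    rw [br_EE_zero hw hu (by rw [bil_comm, h]; decide), map_zero, br_EE_neg hu.neg hw (by rw [bil_neg_left, h]),
      map_smul, br_EE_neg hu r (by rw [bil_add_right, bil_neg_right, h, huu]; norm_num),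
      sg_neg_left, sg_add_right, sg_neg_right, hs, h, show u + (-u + w) = w by abel, smul_smul,
      show sg F u w * (-1 * sg F u w) = -1 by linear_combination -hq]
    push_cast; module
  · have := eq_of_bil_eq_two hu hw h
    subst this
    rw [br_EE_zero hu hu (by rw [h]; decide), map_zero]
    have := br_E_opp (F := F) hu.neg
    rw [neg_neg] at this
    rw [this, map_neg, br_EH, cor_neg, map_neg, pr_cor, h]
    push_cast; module

lemma negOne_m1 : ((Int.negOnePow (-1) : ℤˣ) : ℤ) = -1 := by
  rw [Int.negOnePow_odd (-1) (by decide)]; rfl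

lemma cyc_aux {u v w : Lam} (hu : IsRt u) (hv : IsRt v) (hw : IsRt w)
    (a : bil v w = -1) (b : bil w u = -1) (c : bil u v = 0) : cyc (E F u) (E F v) (E F w) = 0 := by
  have e1 := sg_swap (F := F) w u
  have e2 := sg_swap (F := F) u v
  rw [b, negOne_m1] at e1
  rw [c] at e2
  unfold cyc
  rw [br_EE_zero hu hv (by omega), map_zero, br_EE_neg hv hw a, br_EE_neg hw hu b, map_smul, map_smul,
    br_EE_neg hu ((isRt_add_iff hv hw).2 a) (by rw [bil_add_right, c, bil_comm, b]; norm_num),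
    br_EE_neg hv ((isRt_add_iff hw hu).2 b) (by rw [bil_add_right, a, bil_comm, c]; norm_num),
    show u + (v + w) = v + (w + u) by abel, smul_smul, smul_smul, sg_add_right, sg_add_right, e1, e2]
  push_cast; simp only [Int.negOnePow_zero]
  push_cast
  module

lemma cyc_EEE {u v w : Lam} (hu : IsRt u) (hv : IsRt v) (hw : IsRt w) :
    cyc (E F u) (E F v) (E F w) = 0 := by
  have key : ∀ {x y : Lam}, IsRt x → IsRt y → bil x y = -2 → y = -x := fun hx hy h => by
    rw [eq_neg_iff_add_eq_zero, add_comm]; exact (add_eq_zero_iff_bil hx hy).2 h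
  by_cases c2 : bil u v = -2
  · rw [key hu hv c2]; exact cyc_opp hu hw
  by_cases a2 : bil v w = -2
  · rw [cyc_rot, key hv hw a2]; exact cyc_opp hv hu
  by_cases b2 : bil w u = -2
  · rw [cyc_rot, cyc_rot, key hw hu b2]; exact cyc_opp hw hv
  by_cases a : bil v w = -1 <;> by_cases b : bil w u = -1 <;> by_cases c : bil u v = -1
  · -- sum zero
    have hS : u + v + w = 0 := by
      apply eq_zero_of_bil_self
      rw [bil_add_self, bil_add_self, bil_add_left, show bil u u = 2 from hu, show bil v v = 2 from hv,
        show bil w w = 2 from hw, a, bil_comm u w, b, c]; norm_num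
    have hw' : w = -(u + v) := by rw [eq_neg_iff_add_eq_zero, add_comm]; exact hS
    have e2 := sg_swap (F := F) u v
    rw [c, negOne_m1] at e2
    have q1 := br_E_opp (F := F) hu
    have q2 := br_E_opp (F := F) hv
    have q3 := br_E_opp (F := F) hw
    unfold cyc
    rw [br_EE_neg hu hv c, br_EE_neg hv hw a, br_EE_neg hw hu b, map_smul, map_smul, map_smul,
      show v + w = -u by rw [hw']; abel, show w + u = -v by rw [hw']; abel,
      show u + v = -w by rw [hw']; abel, q1, q2, q3, hw']
    simp only [sg_neg_left, sg_neg_right, sg_add_left, sg_add_right, cor_neg, cor_add, map_neg, map_add,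
      sg_self hu, sg_self hv, e2]
    push_cast; module
  · have : 0 ≤ bil u v := by have := bil_ne hu hv; omega
    by_cases c0 : bil u v = 0
    · exact cyc_aux hu hv hw a b c0
    · unfold cyc
      rw [br_EE_zero hu hv this, map_zero, br_EE_neg hv hw a, br_EE_neg hw hu b, map_smul, map_smul,
        br_EE_zero hu ((isRt_add_iff hv hw).2 a) (by rw [bil_add_right, bil_comm u w, b]; omega),
        br_EE_zero hv ((isRt_add_iff hw hu).2 b) (by rw [bil_add_right, a, bil_comm v u]; omega)]
      simp
  · have : 0 ≤ bil w u := by have := bil_ne hw hu; omega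
    by_cases c0 : bil w u = 0
    · rw [cyc_rot, cyc_rot]; exact cyc_aux hw hu hv c a c0
    · unfold cyc
      rw [br_EE_zero hw hu this, map_zero, br_EE_neg hv hw a, br_EE_neg hu hv c, map_smul, map_smul,
        br_EE_zero hu ((isRt_add_iff hv hw).2 a) (by rw [bil_add_right, bil_comm u w, c]; omega),
        br_EE_zero hw ((isRt_add_iff hu hv).2 c) (by rw [bil_add_right, bil_comm w v, a]; omega)]
      simp
  · have h1 : 0 ≤ bil u v := by have := bil_ne hu hv; omega
    have h2 : 0 ≤ bil w u := by have := bil_ne hw hu; omega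
    unfold cyc
    rw [br_EE_zero hw hu h2, br_EE_zero hu hv h1, br_EE_neg hv hw a, map_smul,
        br_EE_zero hu ((isRt_add_iff hv hw).2 a) (by rw [bil_add_right, bil_comm u w]; omega)]
    simp
  · have : 0 ≤ bil v w := by have := bil_ne hv hw; omega
    by_cases c0 : bil v w = 0
    · rw [cyc_rot]; exact cyc_aux hv hw hu b c c0
    · unfold cyc
      rw [br_EE_zero hv hw this, map_zero, br_EE_neg hw hu b, br_EE_neg hu hv c, map_smul, map_smul,
        br_EE_zero hv ((isRt_add_iff hw hu).2 b) (by rw [bil_add_right, bil_comm v u, c]; omega),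
        br_EE_zero hw ((isRt_add_iff hu hv).2 c) (by rw [bil_add_right, bil_comm w v, b]; omega)]
      simp
  · have h1 : 0 ≤ bil u v := by have := bil_ne hu hv; omega
    have h2 : 0 ≤ bil v w := by have := bil_ne hv hw; omega
    unfold cyc
    rw [br_EE_zero hv hw h2, br_EE_zero hu hv h1, br_EE_neg hw hu b, map_smul,
        br_EE_zero hv ((isRt_add_iff hw hu).2 b) (by rw [bil_add_right, bil_comm v u]; omega)]
    simp
  · have h1 : 0 ≤ bil w u := by have := bil_ne hw hu; omega
    have h2 : 0 ≤ bil v w := by have := bil_ne hv hw; omega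
    unfold cyc
    rw [br_EE_zero hv hw h2, br_EE_zero hw hu h1, br_EE_neg hu hv c, map_smul,
        br_EE_zero hw ((isRt_add_iff hu hv).2 c) (by rw [bil_add_right, bil_comm w v]; omega)]
    simp
  · have h1 : 0 ≤ bil w u := by have := bil_ne hw hu; omega
    have h2 : 0 ≤ bil v w := by have := bil_ne hv hw; omega
    have h3 : 0 ≤ bil u v := by have := bil_ne hu hv; omega
    unfold cyc
    rw [br_EE_zero hv hw h2, br_EE_zero hw hu h1, br_EE_zero hu hv h3]
    simp

lemma cyc_HEE (h : Fin 8 → F) {v w : Lam} (hv : IsRt v) (hw : IsRt w) :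
    cyc (H h) (E F v) (E F w) = 0 := by
  unfold cyc
  rw [br_EH, br_HE, map_neg, map_smul, map_smul, br_skew (E F w) (E F v), br_EE hv hw]
  unfold T
  by_cases h0 : v + w = 0
  · have hvu : w = -v := by rw [eq_neg_iff_add_eq_zero, add_comm]; exact h0
    rw [if_pos h0, map_smul, br_HH, hvu, pr_neg]; module
  · rw [if_neg h0, map_smul, br_HE, pr_add]; module

lemma cyc_HHE (h k : Fin 8 → F) (v : Lam) : cyc (H h) (H k) (E F v) = 0 := by
  unfold cyc
  rw [br_HH, br_EH, br_HE, map_smul, map_neg, map_smul, br_HE, br_HE]; simp [smul_smul, mul_comm]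

lemma cyc_add (x x' y z : M F) : cyc (x + x') y z = cyc x y z + cyc x' y z := by
  simp only [cyc, map_add, LinearMap.add_apply]; abel
lemma cyc_smul (c : F) (x y z : M F) : cyc (c • x) y z = c • cyc x y z := by
  simp only [cyc, map_smul, LinearMap.smul_apply, smul_add]

lemma cyc_zero (x y z : M F) : cyc x y z = 0 := by
  induction x using M.ind generalizing y z with
  | hadd x x' h h' => rw [cyc_add, h, h', add_zero]
  | hsmul c x h => rw [cyc_smul, h, smul_zero]
  | hH h =>
    rw [cyc_rot]
    induction y using M.ind generalizing z with
    | hadd x x' h h' => rw [cyc_add, h, h', add_zero]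
    | hsmul c x h => rw [cyc_smul, h, smul_zero]
    | hH k =>
      rw [cyc_rot]
      induction z using M.ind with
      | hadd x x' h h' => rw [cyc_add, h, h', add_zero]
      | hsmul c x h => rw [cyc_smul, h, smul_zero]
      | hH l => simp [cyc, br_HH]
      | hE w hw => rw [cyc_rot]; exact cyc_HHE _ _ _
    | hE v hv =>
      rw [cyc_rot]
      induction z using M.ind with
      | hadd x x' h h' => rw [cyc_add, h, h', add_zero]
      | hsmul c x h => rw [cyc_smul, h, smul_zero]
      | hH l => exact cyc_HHE _ _ _
      | hE w hw => rw [cyc_rot]; exact cyc_HEE _ hv hw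
  | hE u hu =>
    rw [cyc_rot]
    induction y using M.ind generalizing z with
    | hadd x x' h h' => rw [cyc_add, h, h', add_zero]
    | hsmul c x h => rw [cyc_smul, h, smul_zero]
    | hH k =>
      rw [cyc_rot]
      induction z using M.ind with
      | hadd x x' h h' => rw [cyc_add, h, h', add_zero]
      | hsmul c x h => rw [cyc_smul, h, smul_zero]
      | hH l => rw [cyc_rot, cyc_rot]; exact cyc_HHE _ _ _
      | hE w hw => rw [cyc_rot, cyc_rot]; exact cyc_HEE _ hw hu
    | hE v hv =>
      rw [cyc_rot]
      induction z using M.ind with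
      | hadd x x' h h' => rw [cyc_add, h, h', add_zero]
      | hsmul c x h => rw [cyc_smul, h, smul_zero]
      | hH l => exact cyc_HEE _ hu hv
      | hE w hw => exact cyc_EEE hw hu hv

end E8

namespace E8

section lattice

/-- height -/
def ht (v : Lam) : ℤ := ∑ i, v i

lemma codes_step : ∀ c ∈ codes, ∀ i : Fin 8, bil (dec c) (al i) = -1 →
    (c + 8 ^ (i : ℕ) ∈ codes ∧ dec (c + 8 ^ (i : ℕ)) = dec c + al i) := by
  decide +kernel

lemma codes_simple : ∀ i : Fin 8, 8 ^ (i : ℕ) ∈ codes ∧ dec (8 ^ (i : ℕ)) = al i := by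
  decide +kernel

lemma codes_root : ∀ c ∈ codes, IsRt (dec c) ∧ ∀ i, 0 ≤ dec c i := by
  decide +kernel

lemma exists_bil_pos {v : Lam} (h : IsRt v) (hp : ∀ i, 0 ≤ v i) : ∃ i, 0 < v i ∧ 0 < bil v (al i) := by
  by_contra! hc
  have h1 : bil v v = 2 := h
  rw [bil_eq_sum] at h1
  have : ∑ i, v i * bil v (al i) ≤ 0 := Finset.sum_nonpos fun i _ => by
    rcases (hp i).lt_or_eq with h0 | h0
    · exact mul_nonpos_of_nonneg_of_nonpos h0.le (hc i h0)
    · rw [← h0, zero_mul]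
  omega

lemma IsRt.sub_al {v : Lam} (h : IsRt v) (hp : ∀ i, 0 ≤ v i) {i : Fin 8} (h1 : bil v (al i) = 1) :
    IsRt (v - al i) ∧ ∀ j, 0 ≤ (v - al i) j := by
  have hr : IsRt (v - al i) := by
    unfold IsRt; rw [bil_sub_self, h1, show bil v v = 2 from h, show bil (al i) (al i) = 2 from isRt_al i]; norm_num
  refine ⟨hr, ?_⟩
  rcases hr.nonneg_or_nonpos with h2 | h2
  · exact h2
  · exfalso
    have hv : v = v i • al i := by
      funext j
      by_cases hj : j = i
      · subst hj; simp [al]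
      · have := h2 j; have := hp j
        simp [al, Pi.single_apply, hj] at *
        omega
    have h3 := h1
    rw [hv, bil_smul_left, show bil (al i) (al i) = 2 from isRt_al i] at h3
    omega

lemma mem_codes {v : Lam} (h : IsRt v) (hp : ∀ i, 0 ≤ v i) : ∃ c ∈ codes, dec c = v := by
  have : ∀ n : ℕ, ∀ v : Lam, IsRt v → (∀ i, 0 ≤ v i) → ht v ≤ n → ∃ c ∈ codes, dec c = v := by
    intro n
    induction n with
    | zero =>
      intro v h hp hn
      exfalso
      obtain ⟨i, hi, -⟩ := exists_bil_pos h hp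
      have : v i ≤ ht v := Finset.single_le_sum (fun j _ => hp j) (Finset.mem_univ i)
      push_cast at hn; omega
    | succ n ih =>
      intro v h hp hn
      obtain ⟨i, hi, hb⟩ := exists_bil_pos h hp
      have h2 := bil_le_two h (isRt_al i)
      rcases (by omega : bil v (al i) = 1 ∨ bil v (al i) = 2) with h1 | h1
      · obtain ⟨hr, hp'⟩ := h.sub_al hp h1
        obtain ⟨c, hc, hcv⟩ := ih (v - al i) hr hp' (by
          have : ht (v - al i) = ht v - 1 := by simp [ht, al, Finset.sum_sub_distrib]
          push_cast at hn; omega)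
        have := codes_step c hc i (by
          rw [hcv, bil_sub_left, h1, show bil (al i) (al i) = 2 from isRt_al i]; norm_num)
        exact ⟨_, this.1, by rw [this.2, hcv]; abel⟩
      · have := eq_of_bil_eq_two h (isRt_al i) h1
        exact ⟨_, (codes_simple i).1, by rw [(codes_simple i).2, this]⟩
  obtain ⟨n, hn⟩ := Int.eq_ofNat_of_zero_le (Finset.sum_nonneg fun i _ => hp i : 0 ≤ ht v)
  exact this n v h hp hn.le

/-- positive root list -/
def posF : Finset Lam := (codes.map dec).toFinset

lemma mem_posF {v : Lam} : v ∈ posF ↔ IsRt v ∧ ∀ i, 0 ≤ v i := by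
  unfold posF
  simp only [List.mem_toFinset, List.mem_map]
  constructor
  · rintro ⟨c, hc, rfl⟩; exact codes_root c hc
  · rintro ⟨h, hp⟩; exact mem_codes h hp

/-- all roots -/
def rtF : Finset Lam := posF ∪ posF.image (fun v => -v)

lemma mem_rtF {v : Lam} : v ∈ rtF ↔ IsRt v := by
  simp only [rtF, Finset.mem_union, Finset.mem_image, mem_posF]
  constructor
  · rintro (h | ⟨w, h, rfl⟩)
    · exact h.1
    · exact h.1.neg
  · intro h
    rcases h.nonneg_or_nonpos with h1 | h1
    · exact Or.inl ⟨h, h1⟩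
    · exact Or.inr ⟨-v, ⟨h.neg, fun i => by simpa using h1 i⟩, by simp⟩

instance : Finite R := Finite.of_injective (fun v : R => (⟨v.1, mem_rtF.2 v.2⟩ : rtF))
  (fun u v h => Subtype.ext (congrArg (fun w : rtF => w.1) h))
noncomputable instance : Fintype R := Fintype.ofFinite R

end lattice

variable {F : Type} [Field F] [CharZero F]

noncomputable instance : Bracket (M F) (M F) := ⟨fun x y => br x y⟩

lemma lie_def (x y : M F) : ⁅x, y⁆ = br x y := rfl

noncomputable instance : LieRing (M F) where
  add_lie x y z := by simp [lie_def]
  lie_add x y z := by simp [lie_def]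
  lie_self x := by
    have := br_skew x x
    rw [lie_def]
    have h2 : (2 : F) • br x x = 0 := by rw [two_smul]; nth_rw 1 [this]; abel
    exact (smul_eq_zero.1 h2).resolve_left two_ne_zero
  leibniz_lie x y z := by
    have := cyc_zero x y z
    unfold cyc at this
    rw [br_skew z x, map_neg, br_skew z (br x y)] at this
    simp only [lie_def]
    rw [← sub_eq_zero, ← this]; abel

noncomputable instance : LieAlgebra F (M F) where
  lie_smul c x y := by simp [lie_def]

lemma lie_HH (h k : Fin 8 → F) : ⁅H h, H k⁆ = 0 := br_HH h k
lemma lie_HE (h : Fin 8 → F) (v : Lam) : ⁅H h, E F v⁆ = pr v h • E F v := br_HE h v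
lemma lie_EH (h : Fin 8 → F) (v : Lam) : ⁅E F v, H h⁆ = -(pr v h • E F v) := br_EH h v
lemma lie_opp {u : Lam} (hu : IsRt u) : ⁅E F u, E F (-u)⁆ = - H (cor F u) := br_E_opp hu
lemma lie_opp' {u : Lam} (hu : IsRt u) : ⁅E F (-u), E F u⁆ = H (cor F u) := by
  rw [← lie_skew, lie_opp hu, neg_neg]
lemma lie_zero_of {u v : Lam} (hu : IsRt u) (hv : IsRt v) (h : 0 ≤ bil u v) : ⁅E F u, E F v⁆ = 0 :=
  br_EE_zero hu hv h
lemma lie_neg_of {u v : Lam} (hu : IsRt u) (hv : IsRt v) (h : bil u v = -1) :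
    ⁅E F u, E F v⁆ = sg F u v • E F (u + v) := br_EE_neg hu hv h
lemma lie_nb {u v : Lam} (hu : IsRt u) (hv : IsRt v) (h : u + v ≠ 0) :
    ⁅E F u, E F v⁆ = sg F u v • E F (u + v) := br_E_nb hu hv h

/-- Basis of the model. -/
noncomputable def basM (F : Type) [Field F] : Module.Basis (Fin 8 ⊕ R) F (M F) :=
  ((Pi.basisFun F (Fin 8)).prod (Finsupp.basisSingleOne (R := F) (ι := R)) :
    Module.Basis (Fin 8 ⊕ R) F ((Fin 8 → F) × (R →₀ F)))

lemma basM_inl (i : Fin 8) : basM F (Sum.inl i) = H (Pi.single i 1) := by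
  refine Prod.ext ?_ ?_
  · refine (Module.Basis.prod_apply_inl_fst (Pi.basisFun F (Fin 8))
      (Finsupp.basisSingleOne (R := F) (ι := R)) i).trans ?_
    simp; rfl
  · exact (Module.Basis.prod_apply_inl_snd (Pi.basisFun F (Fin 8))
      (Finsupp.basisSingleOne (R := F) (ι := R)) i)
lemma basM_inr (v : R) : basM F (Sum.inr v) = E F v.1 := by
  rw [E_of v.2]
  refine Prod.ext ?_ ?_
  · exact (Module.Basis.prod_apply_inr_fst (Pi.basisFun F (Fin 8))
      (Finsupp.basisSingleOne (R := F) (ι := R)) v)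
  · refine (Module.Basis.prod_apply_inr_snd (Pi.basisFun F (Fin 8))
      (Finsupp.basisSingleOne (R := F) (ι := R)) v).trans ?_
    simp; rfl

instance : Module.Finite F (M F) := Module.Finite.of_basis (basM F)

/-- Coefficient of a root vector. -/
noncomputable def co (v : R) : M F →ₗ[F] F := Finsupp.lapply v ∘ₗ pX

@[simp] lemma co_H (v : R) (h : Fin 8 → F) : co v (H h) = 0 := by simp [co]
lemma co_E (v : R) (u : Lam) : co v (E F u) = if u = v.1 then 1 else 0 := by
  by_cases hu : IsRt u
  · simp only [co, LinearMap.comp_apply, pX_E hu, Finsupp.lapply_apply, Finsupp.single_apply]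
    congr 1; simp [Subtype.ext_iff]
  · have : u ≠ v.1 := fun h => hu (h ▸ v.2)
    simp [E_not hu, this]

lemma M_expand (x : M F) : x = H (pH x) + ∑ v : R, co v x • E F v.1 := by
  conv_lhs => rw [← H_add_X x]
  congr 1
  conv_lhs => rw [← Finsupp.sum_single (pX x)]
  rw [Finsupp.sum_fintype _ _ (by simp), map_sum]
  apply Finset.sum_congr rfl
  intro v _
  rw [E_of v.2, ← map_smul]; simp [co]

lemma M_ext {x y : M F} (h : pH x = pH y) (h2 : ∀ v : R, co v x = co v y) : x = y := by
  rw [M_expand x, M_expand y, h]; simp only [h2]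

/-- linear equality on generators -/
lemma M_hom_ext {V : Type*} [AddCommGroup V] [Module F V] {f g : M F →ₗ[F] V}
    (h : ∀ k, f (H k) = g (H k)) (h2 : ∀ v, IsRt v → f (E F v) = g (E F v)) : f = g := by
  ext x
  induction x using M.ind with
  | hadd x x' h h' => rw [map_add, map_add, h, h']
  | hsmul c x h => rw [map_smul, map_smul, h]
  | hH k => exact h k
  | hE v hv => exact h2 v hv

end E8

namespace E8

lemma sl2_comm {F V : Type*} [Field F] [AddCommGroup V] [Module F V]
    {e f h : Module.End F V} (hef : e * f - f * e = h) (hhf : h * f - f * h = (-2 : F) • f)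
    (k : F) (x : V) (hx : h x = k • x) (n : ℕ) :
    h ((f ^ n) x) = (k - 2 * n) • (f ^ n) x ∧
    e ((f ^ (n + 1)) x) = (f ^ (n + 1)) (e x) + ((n + 1) * (k - n)) • (f ^ n) x := by
  have hhf' : ∀ y, h (f y) = f (h y) + (-2 : F) • f y := fun y => by
    have := LinearMap.congr_fun hhf y
    simp only [LinearMap.sub_apply, Module.End.mul_apply, LinearMap.smul_apply] at this
    rw [← this]; abel
  have hef' : ∀ y, e (f y) = f (e y) + h y := fun y => by
    have := LinearMap.congr_fun hef y
    simp only [LinearMap.sub_apply, Module.End.mul_apply] at this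
    rw [← this]; abel
  induction n with
  | zero =>
    simp [hx, hef']
  | succ n ih =>
    have h1 : h ((f ^ (n + 1)) x) = (k - 2 * ((n + 1 : ℕ) : F)) • (f ^ (n + 1)) x := by
      rw [pow_succ', Module.End.mul_apply, hhf', ih.1, map_smul]; push_cast; module
    refine ⟨h1, ?_⟩
    rw [pow_succ' f (n + 1), Module.End.mul_apply, hef', h1, ih.2, map_add, map_smul,
      Module.End.mul_apply, ← Module.End.mul_apply f (f ^ n), ← pow_succ']
    push_cast; module

lemma sl2_inj {F V : Type*} [Field F] [CharZero F] [AddCommGroup V] [Module F V]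
    {e f h : Module.End F V} (hef : e * f - f * e = h) (hhf : h * f - f * h = (-2 : F) • f)
    (hhe : h * e - e * h = (2 : F) • e) (N : ℕ) :
    ∀ (k j : ℕ) (x : V), h x = (k : F) • x → j ≤ k → (f ^ j) x = 0 → (e ^ N) x = 0 → x = 0 := by
  induction N with
  | zero => intro k j x _ _ _ h; simpa using h
  | succ N ih =>
    intro k j x hx hj hf he
    have hex : e x = 0 := by
      apply ih (k + 2) (j + 1) (e x) _ (by omega) _ _
      · have := LinearMap.congr_fun hhe x
        simp only [LinearMap.sub_apply, Module.End.mul_apply, LinearMap.smul_apply, hx, map_smul] at this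
        rw [sub_eq_iff_eq_add] at this
        rw [this]; push_cast; module
      · have := (sl2_comm hef hhf k x hx j).2
        rw [hf, smul_zero, add_zero, pow_succ' f, Module.End.mul_apply, hf, map_zero, map_zero] at this
        rw [pow_succ']; exact this.symm
      · rw [← Module.End.mul_apply, ← pow_succ]; exact he
    clear ih he
    induction j with
    | zero => simpa using hf
    | succ m ihm =>
      apply ihm (by omega)
      have := (sl2_comm hef hhf k x hx m).2
      rw [hf, hex, map_zero, map_zero, zero_add] at this
      refine (smul_eq_zero.1 this.symm).resolve_left ?_
      have h1 : ((m : F) + 1) ≠ 0 := by exact_mod_cast Nat.succ_ne_zero m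
      have h2 : ((k : F) - m) ≠ 0 := by
        rw [sub_ne_zero]; exact_mod_cast (by omega : k ≠ m)
      exact mul_ne_zero h1 h2

lemma exists_bil_pos' {v : Lam} (h : v ≠ 0) (hp : ∀ i, 0 ≤ v i) : ∃ i, 0 < v i ∧ 0 < bil v (al i) := by
  by_contra! hc
  have h1 := two_le_bil_self v h
  rw [bil_eq_sum] at h1
  have : ∑ i, v i * bil v (al i) ≤ 0 := Finset.sum_nonpos fun i _ => by
    rcases (hp i).lt_or_eq with h0 | h0
    · exact mul_nonpos_of_nonneg_of_nonpos h0.le (hc i h0)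
    · rw [← h0, zero_mul]
  omega

/-- Abstract descent: the kernel meets every positive weight space trivially. -/
lemma descent {F V : Type*} [Field F] [CharZero F] [AddCommGroup V] [Module F V]
    (e f h : Fin 8 → Module.End F V) (W : Lam → Submodule F V) (K : Submodule F V)
    (hef : ∀ i, e i * f i - f i * e i = h i) (hhf : ∀ i, h i * f i - f i * h i = (-2 : F) • f i)
    (hhe : ∀ i, h i * e i - e i * h i = (2 : F) • e i)
    (hnil : ∀ i x, ∃ n, (e i ^ n) x = 0)
    (hW : ∀ i g x, x ∈ W g → h i x = ((bil g (al i) : ℤ) : F) • x)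
    (hfW : ∀ i g x, x ∈ W g → f i x ∈ W (g - al i)) (hfK : ∀ i x, x ∈ K → f i x ∈ K)
    (h0 : ∀ x ∈ K, x ∈ W 0 → x = 0)
    (hbad : ∀ g x, x ∈ W g → (∀ i, 0 ≤ g i) ∨ (∀ i, g i ≤ 0) ∨ x = 0) :
    ∀ g : Lam, (∀ i, 0 ≤ g i) → ∀ x ∈ K, x ∈ W g → x = 0 := by
  have hpow : ∀ i g x (n : ℕ), x ∈ W g → x ∈ K → (f i ^ n) x ∈ W (g - (n : ℤ) • al i) ∧ (f i ^ n) x ∈ K := by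
    intro i g x n hx hk
    induction n with
    | zero => simpa using ⟨hx, hk⟩
    | succ n ih =>
      rw [pow_succ', Module.End.mul_apply]
      refine ⟨?_, hfK _ _ ih.2⟩
      have := hfW i _ _ ih.1
      convert this using 2
      push_cast; module
  have main : ∀ n : ℕ, ∀ g : Lam, (∀ i, 0 ≤ g i) → ht g ≤ n → ∀ x ∈ K, x ∈ W g → x = 0 := by
    intro n
    induction n with
    | zero =>
      intro g hg hn x hx hxW
      by_cases hg0 : g = 0
      · subst hg0; exact h0 x hx hxW
      obtain ⟨i, hi, -⟩ := exists_bil_pos' hg0 hg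
      have : g i ≤ ht g := Finset.single_le_sum (fun j _ => hg j) (Finset.mem_univ i)
      push_cast at hn; omega
    | succ n ih =>
      intro g hg hn x hx hxW
      by_cases hg0 : g = 0
      · subst hg0; exact h0 x hx hxW
      obtain ⟨i, hi, hb⟩ := exists_bil_pos' hg0 hg
      obtain ⟨k, hk⟩ := Int.eq_ofNat_of_zero_le hb.le
      obtain ⟨N, hN⟩ := hnil i x
      have hxk : h i x = (k : F) • x := by rw [hW i g x hxW, hk]; push_cast; rfl
      have fin : ∀ j : ℕ, j ≤ k → (f i ^ j) x = 0 → x = 0 := fun j hj hz =>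
        sl2_inj (hef i) (hhf i) (hhe i) N k j x hxk hj hz hN
      obtain ⟨hw, hkk⟩ := hpow i g x k hxW hx
      rcases hbad _ _ hw with hc | hc | hc
      · apply fin k le_rfl
        apply ih _ hc _ _ hkk hw
        have : ht (g - (k : ℤ) • al i) = ht g - k := by
          simp [ht, al, Finset.sum_sub_distrib, ← Finset.mul_sum]
        push_cast at hn; omega
      · have hgi : g = g i • al i := by
          funext j
          by_cases hj : j = i
          · subst hj; simp [al]
          · have := hc j; have := hg j
            simp [al, Pi.single_apply, hj] at *
            omega
        obtain ⟨m, hm⟩ := Int.eq_ofNat_of_zero_le hi.le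
        have : bil g (al i) = 2 * g i := by
          conv_lhs => rw [hgi, bil_smul_left, show bil (al i) (al i) = 2 from isRt_al i]
          ring
        apply fin m (by omega)
        obtain ⟨hw', hk'⟩ := hpow i g x m hxW hx
        apply h0 _ hk'
        rw [← hm, ← hgi, sub_self] at hw'
        exact hw'
      · exact fin k le_rfl hc
  intro g hg
  obtain ⟨n, hn⟩ := Int.eq_ofNat_of_zero_le (Finset.sum_nonneg fun i _ => hg i : 0 ≤ ht g)
  exact main n g hg hn.le

end E8

namespace E8
open CartanMatrix LieAlgebra

variable {F : Type} [Field F] [CharZero F]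

section lift
variable {L : Type} [LieRing L] [LieAlgebra F L]

/-- Serre data in a Lie algebra. -/
structure IsSerre (h e f : Fin 8 → L) : Prop where
  hh : ∀ i j, ⁅h i, h j⁆ = 0
  ef : ∀ i, ⁅e i, f i⁆ = h i
  efn : ∀ i j, i ≠ j → ⁅e i, f j⁆ = 0
  he : ∀ i j, ⁅h i, e j⁆ = CartanMatrix.E₈ i j • e j
  hf : ∀ i j, ⁅h i, f j⁆ = -(CartanMatrix.E₈ i j • f j)
  ee : ∀ i j, ((LieAlgebra.ad F L (e i)) ^ (-CartanMatrix.E₈ i j).toNat) ⁅e i, e j⁆ = 0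
  ff : ∀ i j, ((LieAlgebra.ad F L (f i)) ^ (-CartanMatrix.E₈ i j).toNat) ⁅f i, f j⁆ = 0

/-- generators -/
def gen (h e f : Fin 8 → L) : Generators (Fin 8) → L
  | .H i => h i
  | .E i => e i
  | .F i => f i

lemma lift_ad {L' : Type} [LieRing L'] [LieAlgebra F L'] (φ : L' →ₗ⁅F⁆ L) (x y : L') (n : ℕ) :
    φ (((LieAlgebra.ad F L' x) ^ n) y) = ((LieAlgebra.ad F L (φ x)) ^ n) (φ y) := by
  induction n with
  | zero => simp
  | succ n ih => simp [pow_succ', ih]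

lemma IsSerre.le_ker {h e f : Fin 8 → L} (hs : IsSerre (F := F) h e f) :
    Relations.toIdeal F CartanMatrix.E₈ ≤ (FreeLieAlgebra.lift F (gen h e f)).ker := by
  unfold Relations.toIdeal
  rw [LieSubmodule.lieSpan_le]
  rintro x hx
  simp only [SetLike.mem_coe, LieHom.mem_ker]
  rcases hx with ((((⟨⟨i, j⟩, rfl⟩ | ⟨⟨i, j⟩, rfl⟩) | ⟨⟨i, j⟩, rfl⟩) | ⟨⟨i, j⟩, rfl⟩) | ⟨⟨i, j⟩, rfl⟩) | ⟨⟨i, j⟩, rfl⟩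
  · simp [Relations.HH, gen, hs.hh]
  · simp only [Relations.EF, Function.uncurry]
    split_ifs with hij
    · subst hij; simp [gen, hs.ef]
    · simp [gen, hs.efn i j hij]
  · simp [Relations.HE, gen, hs.he]
  · simp [Relations.HF, gen, hs.hf]
  · simp only [Relations.adE, Function.uncurry]
    rw [lift_ad]; simpa [gen] using hs.ee i j
  · simp only [Relations.adF, Function.uncurry]
    rw [lift_ad]; simpa [gen] using hs.ff i j

/-- projection from the free Lie algebra -/
noncomputable def pj (F : Type) [Field F] (x : FreeLieAlgebra F (Generators (Fin 8))) : e₈ F :=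
  LieSubmodule.Quotient.mk (N := Relations.toIdeal F CartanMatrix.E₈) x

lemma pj_surj (y : e₈ F) : ∃ x, pj F x = y := Quot.mk_surjective y
lemma pj_lie (x y) : pj F ⁅x, y⁆ = ⁅pj F x, pj F y⁆ :=
  LieSubmodule.Quotient.mk_bracket (I := Relations.toIdeal F CartanMatrix.E₈) x y

/-- projection as a hom -/
noncomputable def pjH (F : Type) [Field F] [CharZero F] : FreeLieAlgebra F (Generators (Fin 8)) →ₗ⁅F⁆ e₈ F where
  toFun := pj F
  map_add' _ _ := rfl
  map_smul' _ _ := rfl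
  map_lie' {x y} := pj_lie x y

lemma pjH_zero {x} (hx : x ∈ Relations.toIdeal F CartanMatrix.E₈) : pjH F x = 0 :=
  (LieSubmodule.Quotient.mk_eq_zero (N := Relations.toIdeal F CartanMatrix.E₈)).2 hx

lemma pjH_rel {x} (hx : x ∈ Relations.toSet F CartanMatrix.E₈) : pjH F x = 0 :=
  pjH_zero (LieSubmodule.subset_lieSpan hx)

/-- The induced homomorphism -/
noncomputable def IsSerre.hom {h e f : Fin 8 → L} (hs : IsSerre (F := F) h e f) : e₈ F →ₗ⁅F⁆ L where
  toLinearMap := Submodule.liftQ (Relations.toIdeal F CartanMatrix.E₈).toSubmodule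
    ((FreeLieAlgebra.lift F (gen h e f)) : FreeLieAlgebra F (Generators (Fin 8)) →ₗ[F] L)
      (fun x hx => hs.le_ker hx)
  map_lie' {x y} := by
    obtain ⟨x, rfl⟩ := pj_surj x
    obtain ⟨y, rfl⟩ := pj_surj y
    rw [← pj_lie]
    exact LieHom.map_lie (FreeLieAlgebra.lift F (gen h e f)) x y

lemma IsSerre.hom_pj {h e f : Fin 8 → L} (hs : IsSerre (F := F) h e f) (x) :
    hs.hom (pjH F x) = FreeLieAlgebra.lift F (gen h e f) x := rfl

end lift

/-- generators of the Serre algebra -/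
noncomputable def sh (F : Type) [Field F] [CharZero F] (i : Fin 8) : e₈ F := pjH F (FreeLieAlgebra.of F (.H i))
/-- generators of the Serre algebra -/
noncomputable def se (F : Type) [Field F] [CharZero F] (i : Fin 8) : e₈ F := pjH F (FreeLieAlgebra.of F (.E i))
/-- generators of the Serre algebra -/
noncomputable def sf (F : Type) [Field F] [CharZero F] (i : Fin 8) : e₈ F := pjH F (FreeLieAlgebra.of F (.F i))

lemma serre_e8 : IsSerre (F := F) (sh F) (se F) (sf F) where
  hh i j := by
    have : pjH F (Relations.HH F (i, j)) = 0 := pjH_rel (by simp [Relations.toSet])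
    simp only [Relations.HH, Function.uncurry, Function.comp, LieHom.map_lie] at this
    exact this
  ef i := by
    have : pjH F (Relations.EF F (i, i)) = 0 := pjH_rel (by
      left; left; left; left; right; exact ⟨_, rfl⟩)
    simp only [Relations.EF, Function.uncurry, if_true, Function.comp, map_sub, LieHom.map_lie] at this
    exact sub_eq_zero.1 this
  efn i j hij := by
    have : pjH F (Relations.EF F (i, j)) = 0 := pjH_rel (by
      left; left; left; left; right; exact ⟨_, rfl⟩)
    simp only [Relations.EF, Function.uncurry, if_neg hij, Function.comp, LieHom.map_lie] at this
    exact this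
  he i j := by
    have : pjH F (Relations.HE F CartanMatrix.E₈ (i, j)) = 0 := pjH_rel (by
      left; left; left; right; exact ⟨_, rfl⟩)
    simp only [Relations.HE, Function.uncurry, Function.comp, map_sub, LieHom.map_lie, map_zsmul] at this
    exact sub_eq_zero.1 this
  hf i j := by
    have : pjH F (Relations.HF F CartanMatrix.E₈ (i, j)) = 0 := pjH_rel (by
      left; left; right; exact ⟨_, rfl⟩)
    simp only [Relations.HF, Function.uncurry, Function.comp, map_add, LieHom.map_lie, map_zsmul] at this
    exact eq_neg_of_add_eq_zero_left this
  ee i j := by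
    have : pjH F (Relations.adE F CartanMatrix.E₈ (i, j)) = 0 := pjH_rel (by
      left; right; exact ⟨_, rfl⟩)
    simp only [Relations.adE, Function.uncurry, Function.comp, lift_ad, LieHom.map_lie] at this
    exact this
  ff i j := by
    have : pjH F (Relations.adF F CartanMatrix.E₈ (i, j)) = 0 := pjH_rel (by
      right; exact ⟨_, rfl⟩)
    simp only [Relations.adF, Function.uncurry, Function.comp, lift_ad, LieHom.map_lie] at this
    exact this

lemma E8_pair (i j : Fin 8) : CartanMatrix.E₈ i j = bil (al i) (al j) := (bil_al_al i j).symm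

lemma serre_M : IsSerre (F := F) (L := M F) (fun i => H (cor F (al i))) (fun i => E F (al i))
    (fun i => - E F (-al i)) where
  hh i j := lie_HH _ _
  ef i := by rw [lie_neg, lie_opp (isRt_al i), neg_neg]
  efn i j hij := by
    rw [lie_neg, lie_zero_of (isRt_al i) (isRt_al j).neg, neg_zero]
    rw [bil_neg_right]; have := bil_al_nonpos hij; omega
  he i j := by rw [lie_HE, pr_cor, E8_pair, Int.cast_smul_eq_zsmul]
  hf i j := by rw [lie_neg, lie_HE, pr_neg, pr_cor, E8_pair, smul_neg, neg_smul, Int.cast_smul_eq_zsmul]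
  ee i j := by
    rw [E8_pair]
    rcases bil_ne (isRt_al i) (isRt_al j) with h | h | h | h | h
    · exfalso; revert h; revert i j; decide
    · rw [lie_neg_of (isRt_al i) (isRt_al j) h, h]
      simp only [neg_neg, Int.toNat_one, pow_one, map_smul, LieAlgebra.ad_apply]
      rw [lie_zero_of (isRt_al i) ((isRt_add_iff (isRt_al i) (isRt_al j)).2 h), smul_zero]
      rw [bil_add_right, h, show bil (al i) (al i) = 2 from isRt_al i]; norm_num
    · rw [lie_zero_of (isRt_al i) (isRt_al j) (by omega), map_zero]
    · rw [lie_zero_of (isRt_al i) (isRt_al j) (by omega), map_zero]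
    · rw [lie_zero_of (isRt_al i) (isRt_al j) (by omega), map_zero]
  ff i j := by
    rw [E8_pair]
    have hb : bil (-al i) (-al j) = bil (al i) (al j) := by rw [bil_neg_left, bil_neg_right, neg_neg]
    rw [lie_neg, neg_lie, neg_neg]
    rcases bil_ne (isRt_al i) (isRt_al j) with h | h | h | h | h
    · exfalso; revert h; revert i j; decide
    · rw [lie_neg_of (isRt_al i).neg (isRt_al j).neg (by omega), h]
      simp only [neg_neg, Int.toNat_one, pow_one, map_smul, LieAlgebra.ad_apply, neg_lie]
      rw [lie_zero_of (isRt_al i).neg ((isRt_add_iff (isRt_al i).neg (isRt_al j).neg).2 (by omega)), neg_zero, smul_zero]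
      rw [bil_add_right, bil_neg_left, bil_neg_left, bil_neg_right, bil_neg_right, h, show bil (al i) (al i) = 2 from isRt_al i]; norm_num
    · rw [lie_zero_of (isRt_al i).neg (isRt_al j).neg (by omega), map_zero]
    · rw [lie_zero_of (isRt_al i).neg (isRt_al j).neg (by omega), map_zero]
    · rw [lie_zero_of (isRt_al i).neg (isRt_al j).neg (by omega), map_zero]

/-- The homomorphism from the Serre algebra to the model. -/
noncomputable def pi8 (F : Type) [Field F] [CharZero F] : e₈ F →ₗ⁅F⁆ M F := (serre_M (F := F)).hom

lemma pi8_h (i : Fin 8) : pi8 F (sh F i) = H (cor F (al i)) := by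
  unfold pi8 sh; rw [IsSerre.hom_pj, FreeLieAlgebra.lift_of_apply]; rfl
lemma pi8_e (i : Fin 8) : pi8 F (se F i) = E F (al i) := by
  unfold pi8 se; rw [IsSerre.hom_pj, FreeLieAlgebra.lift_of_apply]; rfl
lemma pi8_f (i : Fin 8) : pi8 F (sf F i) = - E F (-al i) := by
  unfold pi8 sf; rw [IsSerre.hom_pj, FreeLieAlgebra.lift_of_apply]; rfl

lemma H_span (h : Fin 8 → F) : H h = ∑ i, h i • H (cor F (al i)) := by
  simp only [← map_smul, ← map_sum]
  congr 1
  funext j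
  simp [cor, al, Finset.sum_apply, Pi.single_apply]

lemma pi8_surj : Function.Surjective (pi8 F) := by
  have hpos : ∀ n : ℕ, ∀ v : Lam, IsRt v → (∀ i, 0 ≤ v i) → ht v ≤ n →
      E F v ∈ (pi8 F).range ∧ E F (-v) ∈ (pi8 F).range := by
    intro n
    induction n with
    | zero =>
      intro v h hp hn
      exfalso
      obtain ⟨i, hi, -⟩ := exists_bil_pos h hp
      have : v i ≤ ht v := Finset.single_le_sum (fun j _ => hp j) (Finset.mem_univ i)
      push_cast at hn; omega
    | succ n ih =>
      intro v h hp hn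
      obtain ⟨i, hi, hb⟩ := exists_bil_pos h hp
      have h2 := bil_le_two h (isRt_al i)
      have hi1 : E F (al i) ∈ (pi8 F).range := by rw [← pi8_e]; exact ⟨_, rfl⟩
      have hi2 : E F (-al i) ∈ (pi8 F).range := by
        rw [← neg_neg (E F (-al i)), ← pi8_f]; exact neg_mem ⟨_, rfl⟩
      rcases (by omega : bil v (al i) = 1 ∨ bil v (al i) = 2) with h1 | h1
      · obtain ⟨hr, hp'⟩ := h.sub_al hp h1
        obtain ⟨m1, m2⟩ := ih (v - al i) hr hp' (by
          have : ht (v - al i) = ht v - 1 := by simp [ht, al, Finset.sum_sub_distrib]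
          push_cast at hn; omega)
        have hb : bil (al i) (v - al i) = -1 := by
          rw [bil_comm, bil_sub_left, h1, show bil (al i) (al i) = 2 from isRt_al i]; norm_num
        constructor
        · have := LieSubalgebra.lie_mem _ hi1 m1
          rw [lie_neg_of (isRt_al i) hr hb, show al i + (v - al i) = v by abel] at this
          have h3 := LieSubalgebra.smul_mem _ (sg F (al i) (v - al i)) this
          rwa [smul_smul, sg_sq, one_smul] at h3
        · have := LieSubalgebra.lie_mem _ hi2 m2
          rw [lie_neg_of (isRt_al i).neg hr.neg (by rw [bil_neg_left, bil_neg_right, hb, neg_neg]),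
            show -al i + -(v - al i) = -v by abel] at this
          have h3 := LieSubalgebra.smul_mem _ (sg F (-al i) (-(v - al i))) this
          rwa [smul_smul, sg_sq, one_smul] at h3
      · have := eq_of_bil_eq_two h (isRt_al i) h1
        subst this
        exact ⟨hi1, hi2⟩
  have hall : ∀ v, IsRt v → E F v ∈ (pi8 F).range := by
    intro v hv
    rcases hv.nonneg_or_nonpos with hp | hp
    · obtain ⟨n, hn⟩ := Int.eq_ofNat_of_zero_le (Finset.sum_nonneg fun i _ => hp i : 0 ≤ ht v)
      exact (hpos n v hv hp hn.le).1
    · have hp' : ∀ i, 0 ≤ (-v) i := fun i => by simpa using hp i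
      obtain ⟨n, hn⟩ := Int.eq_ofNat_of_zero_le (Finset.sum_nonneg fun i _ => hp' i : 0 ≤ ht (-v))
      simpa using (hpos n (-v) hv.neg hp' hn.le).2
  intro x
  show x ∈ (pi8 F).range
  induction x using M.ind with
  | hadd x y hx hy => exact add_mem hx hy
  | hsmul c x hx => exact LieSubalgebra.smul_mem _ _ hx
  | hE v hv => exact hall v hv
  | hH h =>
    rw [H_span]
    refine sum_mem fun i _ => LieSubalgebra.smul_mem _ _ ?_
    rw [← pi8_h]; exact ⟨_, rfl⟩

end E8

namespace E8
open CartanMatrix LieAlgebra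

variable {F : Type} [Field F] [CharZero F]

lemma gen_top : LieSubalgebra.lieSpan F (e₈ F) (Set.range (se F) ∪ Set.range (sf F)) = ⊤ := by
  set K := LieSubalgebra.lieSpan F (e₈ F) (Set.range (se F) ∪ Set.range (sf F)) with hK
  have he : ∀ i, se F i ∈ K := fun i => LieSubalgebra.subset_lieSpan (Or.inl ⟨i, rfl⟩)
  have hf : ∀ i, sf F i ∈ K := fun i => LieSubalgebra.subset_lieSpan (Or.inr ⟨i, rfl⟩)
  have hh : ∀ i, sh F i ∈ K := fun i => by
    rw [← serre_e8.ef]; exact K.lie_mem (he i) (hf i)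
  let φ : FreeLieAlgebra F (Generators (Fin 8)) →ₗ⁅F⁆ K :=
    FreeLieAlgebra.lift F (fun g => match g with
      | .H i => ⟨sh F i, hh i⟩ | .E i => ⟨se F i, he i⟩ | .F i => ⟨sf F i, hf i⟩)
  have : K.incl.comp φ = pjH F := by
    ext g
    cases g <;> simp [φ, sh, se, sf]
  rw [eq_top_iff]
  intro y _
  obtain ⟨x, rfl⟩ := pj_surj y
  have h2 : pj F x = K.incl (φ x) := (LieHom.congr_fun this x).symm
  rw [h2]
  exact (φ x).2

lemma sh_indep : LinearIndependent F (sh F) := by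
  apply LinearIndependent.of_comp (pi8 F : e₈ F →ₗ[F] M F)
  rw [Fintype.linearIndependent_iff]
  intro g hg i
  simp only [Function.comp, LieHom.coe_toLinearMap, pi8_h] at hg
  rw [← H_span] at hg
  have := congrArg pH hg
  simpa using congrFun this i

/-- The basis of the Serre algebra -/
noncomputable def sb : LieAlgebra.Basis (Fin 8) (LieSubalgebra.lieSpan F (e₈ F) (Set.range (sh F))) where
  A := CartanMatrix.E₈
  h := sh F
  e := se F
  f := sf F
  cartan_eq_lieSpan := rfl
  span_ef := gen_top
  linInd := sh_indep
  nondegen := Matrix.nondegenerate_of_det_ne_zero (by rw [E₈_det]; norm_num)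
  sl2 i := ⟨sh_indep.ne_zero i, serre_e8.ef i, by rw [serre_e8.he, E₈_diag]; norm_cast, by
    rw [serre_e8.hf, E₈_diag]; norm_cast⟩
  lie_h_h := serre_e8.hh
  lie_h_e i j := by rw [serre_e8.he]; congr 1; exact congrFun (congrFun E₈_transpose i) j
  lie_h_f i j := by rw [serre_e8.hf, neg_smul]; congr 2; exact congrFun (congrFun E₈_transpose i) j
  lie_e_f_ne := serre_e8.efn

/-- weight spaces -/
noncomputable def Wt (g : Lam) : Submodule F (e₈ F) where
  carrier := {x | ∀ i, ⁅sh F i, x⁆ = ((bil g (al i) : ℤ) : F) • x}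
  add_mem' hx hy i := by rw [lie_add, hx, hy, smul_add]
  zero_mem' i := by simp
  smul_mem' c x hx i := by rw [lie_smul, hx, smul_comm]

lemma Wt_lie {g k : Lam} {x y : e₈ F} (hx : x ∈ Wt g) (hy : y ∈ Wt k) : ⁅x, y⁆ ∈ Wt (g + k) := by
  intro i
  rw [leibniz_lie, hx i, hy i, bil_add_left]
  simp [smul_lie, lie_smul]; module

lemma se_mem (i : Fin 8) : se F i ∈ Wt (al i) := fun j => by
  rw [serre_e8.he, E8_pair, bil_comm, Int.cast_smul_eq_zsmul]
lemma sf_mem (i : Fin 8) : sf F i ∈ Wt (-al i) := fun j => by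
  rw [serre_e8.hf, E8_pair, bil_comm, bil_neg_left, Int.cast_smul_eq_zsmul, neg_smul]
lemma sh_mem (i : Fin 8) : sh F i ∈ Wt 0 := fun j => by
  rw [serre_e8.hh]; simp

lemma bil_inj {u v : Lam} (h : ∀ i, bil u (al i) = bil v (al i)) : u = v := by
  have h1 : bil (u - v) (u - v) = 0 := by
    rw [bil_eq_sum]; apply Finset.sum_eq_zero; intro i _; rw [bil_sub_left, h i]; ring
  by_contra hne
  have := two_le_bil_self (u - v) (sub_ne_zero.2 hne)
  omega

/-- weight spaces in general -/
noncomputable def Wg {L : Type} [LieRing L] [LieAlgebra F L] (h : Fin 8 → L) (g : Lam) : Submodule F L where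
  carrier := {x | ∀ i, ⁅h i, x⁆ = ((bil g (al i) : ℤ) : F) • x}
  add_mem' hx hy i := by rw [lie_add, hx, hy, smul_add]
  zero_mem' i := by simp
  smul_mem' c x hx i := by rw [lie_smul, hx, smul_comm]

lemma Wg_indep {L : Type} [LieRing L] [LieAlgebra F L] (h : Fin 8 → L) (hh : ∀ i j, ⁅h i, h j⁆ = 0) :
    iSupIndep (Wg (F := F) h) := by
  have h1 := Module.End.independent_iInf_maxGenEigenspace_of_forall_mapsTo
    (fun i => LieAlgebra.ad F L (h i)) (fun i j φ => by
      apply Module.End.mapsTo_maxGenEigenspace_of_comm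
      show _ * _ = _ * _
      ext x
      simp only [Module.End.mul_apply, LieAlgebra.ad_apply]
      rw [leibniz_lie (h j) (h i), hh, zero_lie, zero_add])
  have hinj : Function.Injective (fun (g : Lam) (i : Fin 8) => ((bil g (al i) : ℤ) : F)) := by
    intro u v h
    apply bil_inj
    intro i
    have := congrFun h i
    exact Int.cast_injective this
  refine (h1.comp hinj).mono fun g x hx => ?_
  simp only [Function.comp, Submodule.mem_iInf]
  intro i
  rw [Module.End.mem_maxGenEigenspace]
  refine ⟨1, ?_⟩
  have := hx i
  simp [this]

lemma Wt_indep : iSupIndep (Wt (F := F)) := Wg_indep (sh F) serre_e8.hh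

/-- positive part -/
noncomputable def Pp (F : Type) [Field F] [CharZero F] : Submodule F (e₈ F) :=
  ⨆ g : {g : Lam // g ≠ 0 ∧ ((∀ i, 0 ≤ g i))}, Wt g.1
/-- negative part -/
noncomputable def Pn (F : Type) [Field F] [CharZero F] : Submodule F (e₈ F) :=
  ⨆ g : {g : Lam // g ≠ 0 ∧ ((∀ i, g i ≤ 0))}, Wt g.1

lemma iSup_lie {S : Lam → Prop} (hS : ∀ u v, S u → S v → S (u + v)) {x y : e₈ F}
    (hx : x ∈ ⨆ g : {g : Lam // S g}, Wt g.1) (hy : y ∈ ⨆ g : {g : Lam // S g}, Wt g.1) :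
    ⁅x, y⁆ ∈ ⨆ g : {g : Lam // S g}, Wt (F := F) g.1 := by
  induction hx using Submodule.iSup_induction' with
  | zero => simp
  | add a b _ _ ha hb => rw [add_lie]; exact add_mem ha hb
  | mem g x hx =>
    induction hy using Submodule.iSup_induction' with
    | zero => simp
    | add a b _ _ ha hb => rw [lie_add]; exact add_mem ha hb
    | mem k y hy =>
      exact Submodule.mem_iSup_of_mem (p := fun g : {g : Lam // S g} => Wt (F := F) g.1)
        ⟨g.1 + k.1, hS _ _ g.2 k.2⟩ (Wt_lie hx hy)

lemma lieSpan_Pp : (LieSubalgebra.lieSpan F (e₈ F) (Set.range (se F))).toSubmodule ≤ Pp F := by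
  intro x hx
  have hx : x ∈ LieSubalgebra.lieSpan F (e₈ F) (Set.range (se F)) := hx
  induction hx using LieSubalgebra.lieSpan_induction with
  | mem u hu =>
    obtain ⟨i, rfl⟩ := hu
    refine Submodule.mem_iSup_of_mem ⟨al i, (isRt_al i).ne_zero, fun j => ?_⟩ (se_mem i)
    simp only [al, Pi.single_apply]; split_ifs <;> norm_num
  | zero => simp
  | add u v _ _ hu hv => exact add_mem (hu ‹_›) (hv ‹_›)
  | smul t u _ hu => exact Submodule.smul_mem _ _ (hu ‹_›)
  | lie u v _ _ hu hv =>
    refine iSup_lie ?_ (hu ‹_›) (hv ‹_›)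
    rintro a b ⟨ha, ha'⟩ ⟨hb, hb'⟩
    refine ⟨fun h => ha ?_, fun i => add_nonneg (ha' i) (hb' i)⟩
    funext i
    have := congrFun h i; have := ha' i; have := hb' i
    simp only [Pi.add_apply, Pi.zero_apply] at *
    omega

lemma lieSpan_Pn : (LieSubalgebra.lieSpan F (e₈ F) (Set.range (sf F))).toSubmodule ≤ Pn F := by
  intro x hx
  have hx : x ∈ LieSubalgebra.lieSpan F (e₈ F) (Set.range (sf F)) := hx
  induction hx using LieSubalgebra.lieSpan_induction with
  | mem u hu =>
    obtain ⟨i, rfl⟩ := hu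
    refine Submodule.mem_iSup_of_mem ⟨-al i, (isRt_al i).neg.ne_zero, fun j => ?_⟩ (sf_mem i)
    simp only [al, Pi.neg_apply, Pi.single_apply]; split_ifs <;> norm_num
  | zero => simp
  | add u v _ _ hu hv => exact add_mem (hu ‹_›) (hv ‹_›)
  | smul t u _ hu => exact Submodule.smul_mem _ _ (hu ‹_›)
  | lie u v _ _ hu hv =>
    refine iSup_lie ?_ (hu ‹_›) (hv ‹_›)
    rintro a b ⟨ha, ha'⟩ ⟨hb, hb'⟩
    refine ⟨fun h => ha ?_, fun i => add_nonpos (ha' i) (hb' i)⟩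
    funext i
    have := congrFun h i; have := ha' i; have := hb' i
    simp only [Pi.add_apply, Pi.zero_apply] at *
    omega

lemma decomp (x : e₈ F) : ∃ h ∈ Submodule.span F (Set.range (sh F)), ∃ p ∈ Pp F, ∃ n ∈ Pn F, x = h + n + p := by
  have h1 := (sb (F := F)).iSup_cartan_borelLower_borelUpper_eq_top
  have h2 : (LieSubalgebra.lieSpan F (e₈ F) (Set.range (sh F))).toLieSubmodule ⊔ (sb (F := F)).borelLower ⊔ (sb (F := F)).borelUpper = ⊤ := by
    simpa using h1
  have h3 : x ∈ (LieSubalgebra.lieSpan F (e₈ F) (Set.range (sh F))).toLieSubmodule ⊔ (sb (F := F)).borelLower ⊔ (sb (F := F)).borelUpper := by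
    rw [h2]; trivial
  obtain ⟨y, hy, p, hp, rfl⟩ := (LieSubmodule.mem_sup _ _ _).1 h3
  obtain ⟨h, hh, n, hn, rfl⟩ := (LieSubmodule.mem_sup _ _ _).1 hy
  refine ⟨h, ?_, p, lieSpan_Pp hp, n, lieSpan_Pn hn, rfl⟩
  have := (sb (F := F)).coe_cartan_eq_span
  have h5 : h ∈ (LieSubalgebra.lieSpan F (e₈ F) (Set.range (sh F))).toSubmodule := hh
  rw [this] at h5
  exact h5

lemma span_h_le : Submodule.span F (Set.range (sh F)) ≤ Wt 0 := by
  rw [Submodule.span_le]; rintro _ ⟨i, rfl⟩; exact sh_mem i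

lemma Wt_zero {x : e₈ F} (hx : x ∈ Wt 0) : x ∈ Submodule.span F (Set.range (sh F)) := by
  obtain ⟨h, hh, p, hp, n, hn, rfl⟩ := decomp x
  have h1 : n + p ∈ Wt 0 := by
    have := sub_mem hx (span_h_le hh)
    convert this using 1; abel
  have h2 : n + p ∈ ⨆ j : Lam, ⨆ _ : j ≠ 0, Wt (F := F) j := by
    refine add_mem ((iSup_le ?_ : Pn F ≤ _) hn) ((iSup_le ?_ : Pp F ≤ _) hp) <;>
    · rintro ⟨g, hg, -⟩
      exact le_iSup₂_of_le g hg le_rfl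
  have := (Submodule.disjoint_def.1 (Wt_indep (F := F) 0)) _ h1 h2
  rw [add_assoc, this, add_zero]; exact hh

lemma Wt_bad {g : Lam} {x : e₈ F} (hx : x ∈ Wt g) : (∀ i, 0 ≤ g i) ∨ (∀ i, g i ≤ 0) ∨ x = 0 := by
  by_contra! hc
  obtain ⟨⟨i, hi⟩, ⟨j, hj⟩, h0⟩ := hc
  apply h0
  refine (Submodule.disjoint_def.1 (Wt_indep (F := F) g)) _ hx ?_
  obtain ⟨h, hh, p, hp, n, hn, rfl⟩ := decomp x
  refine add_mem (add_mem ((le_iSup₂_of_le 0 (fun h => ?_) le_rfl : Wt 0 ≤ _) (span_h_le hh)) ((iSup_le ?_ : Pn F ≤ _) hn)) ((iSup_le ?_ : Pp F ≤ _) hp)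
  · rw [← h] at hi; simp at hi
  · rintro ⟨k, hk, hk'⟩
    refine le_iSup₂_of_le k (fun h => ?_) le_rfl
    have := hk' j; rw [h] at this; omega
  · rintro ⟨k, hk, hk'⟩
    refine le_iSup₂_of_le k (fun h => ?_) le_rfl
    have := hk' i; rw [h] at this; omega

lemma iSup_Wt : (⨆ g, Wt (F := F) g) = ⊤ := by
  rw [eq_top_iff]
  intro x _
  obtain ⟨h, hh, p, hp, n, hn, rfl⟩ := decomp x
  refine add_mem (add_mem ((le_iSup Wt 0) (span_h_le hh)) ((iSup_le fun k => le_iSup Wt k.1 : Pn F ≤ _) hn))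
    ((iSup_le fun k => le_iSup Wt k.1 : Pp F ≤ _) hp)

lemma ad_pow_zero {x y : e₈ F} (n : ℕ) (h : ((LieAlgebra.ad F (e₈ F) x) ^ n) ⁅x, y⁆ = 0) :
    y ∈ LieSubalgebra.engel F x := by
  rw [LieSubalgebra.mem_engel_iff]
  exact ⟨n + 1, by rw [pow_succ, Module.End.mul_apply, LieAlgebra.ad_apply, h]⟩

lemma engel_e (i : Fin 8) : LieSubalgebra.engel F (se F i) = ⊤ := by
  rw [eq_top_iff, ← gen_top, LieSubalgebra.lieSpan_le]
  rintro _ (⟨j, rfl⟩ | ⟨j, rfl⟩)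
  · exact ad_pow_zero _ (serre_e8.ee i j)
  · by_cases h : i = j
    · subst h
      apply ad_pow_zero 2
      rw [serre_e8.ef, pow_two, Module.End.mul_apply, LieAlgebra.ad_apply, LieAlgebra.ad_apply,
        ← lie_skew (se F i) (sh F i), serre_e8.he]
      simp
    · exact ad_pow_zero 0 (by rw [serre_e8.efn _ _ h, map_zero])

lemma engel_f (i : Fin 8) : LieSubalgebra.engel F (sf F i) = ⊤ := by
  rw [eq_top_iff, ← gen_top, LieSubalgebra.lieSpan_le]
  rintro _ (⟨j, rfl⟩ | ⟨j, rfl⟩)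
  · by_cases h : i = j
    · subst h
      apply ad_pow_zero 2
      rw [← lie_skew, serre_e8.ef, pow_two, Module.End.mul_apply, LieAlgebra.ad_apply, LieAlgebra.ad_apply,
        lie_neg, ← lie_skew (sf F i) (sh F i), serre_e8.hf]
      simp
    · exact ad_pow_zero 0 (by rw [← lie_skew, serre_e8.efn _ _ (Ne.symm h), neg_zero, map_zero])
  · exact ad_pow_zero _ (serre_e8.ff i j)

lemma ker_Wt_zero {x : e₈ F} (hx : pi8 F x = 0) (h : x ∈ Wt 0) : x = 0 := by
  obtain ⟨c, rfl⟩ := (Submodule.mem_span_range_iff_exists_fun F).1 (Wt_zero h)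
  have h2 : ∑ i, c i • H (cor F (al i)) = 0 := by
    rw [← hx, map_sum]; simp [pi8_h]
  rw [← H_span] at h2
  have h3 := congrArg pH h2
  simp only [pH_H, map_zero] at h3
  simp [h3]

lemma ker_Wt {g : Lam} {x : e₈ F} (hx : pi8 F x = 0) (h : x ∈ Wt g) : x = 0 := by
  have had : ∀ a b : e₈ F, ad F (e₈ F) a * ad F (e₈ F) b - ad F (e₈ F) b * ad F (e₈ F) a = ad F (e₈ F) ⁅a, b⁆ :=
    fun a b => by ext x; simp
  rcases Wt_bad h with hg | hg | hg
  · refine descent (F := F) (fun i => ad F _ (se F i)) (fun i => ad F _ (sf F i)) (fun i => ad F _ (sh F i))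
      Wt ((pi8 F).ker.toSubmodule) ?_ ?_ ?_ ?_ ?_ ?_ ?_ ?_ ?_ g hg x (by simpa using hx) h
    · intro i; rw [had, serre_e8.ef]
    · intro i; rw [had, serre_e8.hf, E₈_diag, ← Int.cast_smul_eq_zsmul F]; simp
    · intro i; rw [had, serre_e8.he, E₈_diag, ← Int.cast_smul_eq_zsmul F]; simp
    · intro i x
      exact (LieSubalgebra.mem_engel_iff F _ _).1 (by rw [engel_e i]; trivial)
    · intro i g x hx; exact hx i
    · intro i g x hx
      rw [sub_eq_neg_add]; exact Wt_lie (sf_mem i) hx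
    · intro i x hx; 
      simp only [LieSubmodule.mem_toSubmodule, LieHom.mem_ker] at hx ⊢
      simp [hx]
    · intro x hx h; exact ker_Wt_zero (by simpa using hx) h
    · intro g x hx; exact Wt_bad hx
  · refine descent (F := F) (fun i => ad F _ (sf F i)) (fun i => ad F _ (se F i)) (fun i => - ad F _ (sh F i))
      (fun g => Wt (-g)) ((pi8 F).ker.toSubmodule) ?_ ?_ ?_ ?_ ?_ ?_ ?_ ?_ ?_ (-g) (fun i => by simpa using hg i) x (by simpa using hx) (by simpa using h)
    · intro i; rw [had, ← lie_skew, serre_e8.ef, map_neg]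
    · intro i; rw [neg_mul, mul_neg, sub_neg_eq_add, neg_add_eq_sub, ← neg_sub, had, serre_e8.he, E₈_diag, ← Int.cast_smul_eq_zsmul F]; simp
    · intro i; rw [neg_mul, mul_neg, sub_neg_eq_add, neg_add_eq_sub, ← neg_sub, had, serre_e8.hf, E₈_diag, ← Int.cast_smul_eq_zsmul F]; simp
    · intro i x
      exact (LieSubalgebra.mem_engel_iff F _ _).1 (by rw [engel_f i]; trivial)
    · intro i g x hx
      have := hx i
      rw [LinearMap.neg_apply, LieAlgebra.ad_apply, this, bil_neg_left]; simp
    · intro i g x hx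
      show _ ∈ Wt (-(g - al i))
      rw [neg_sub, sub_eq_add_neg]; exact Wt_lie (se_mem i) hx
    · intro i x hx; 
      simp only [LieSubmodule.mem_toSubmodule, LieHom.mem_ker] at hx ⊢
      simp [hx]
    · intro x hx h; exact ker_Wt_zero (by simpa using hx) (by simpa using h)
    · intro g x hx
      rcases Wt_bad hx with h | h | h
      · right; left; intro i; simpa using h i
      · left; intro i; simpa using h i
      · right; right; exact h
  · exact hg

lemma pi8_inj : Function.Injective (pi8 F) := by
  rw [injective_iff_map_eq_zero]
  intro x hx
  have hmem : x ∈ ⨆ g, Wt (F := F) g := by rw [iSup_Wt]; trivial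
  obtain ⟨f, hf, rfl⟩ := (Submodule.mem_iSup_iff_exists_finsupp _ _).1 hmem
  have hind := Wg_indep (F := F) (fun i => H (cor F (al i))) (fun i j => lie_HH _ _)
  rw [iSupIndep_iff_finsetSum_eq_zero_imp_eq_zero] at hind
  have h1 := hind f.support (fun g => pi8 F (f g)) (fun g _ i => by
    show ⁅H (cor F (al i)), _⁆ = _
    rw [← pi8_h, ← LieHom.map_lie, hf g i, map_smul]) (by
    rw [← hx, Finsupp.sum, map_sum])
  apply Finset.sum_eq_zero
  intro g hg
  exact ker_Wt (h1 g hg) (hf g)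

/-- The isomorphism of the Serre algebra with the model. -/
noncomputable def iso8 (F : Type) [Field F] [CharZero F] : e₈ F ≃ₗ⁅F⁆ M F :=
  LieEquiv.ofBijective (pi8 F) ⟨pi8_inj, pi8_surj⟩

end E8

namespace E8
open LieAlgebra LieModule

variable {F : Type} [Field F] [CharZero F]

lemma kil_inv (x y z : M F) : killingForm F (M F) ⁅x, y⁆ z = killingForm F (M F) x ⁅y, z⁆ :=
  LieModule.traceForm_apply_lie_apply F (M F) (M F) x y z

lemma kil_comm (x y : M F) : killingForm F (M F) x y = killingForm F (M F) y x :=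
  LieModule.traceForm_comm F (M F) (M F) x y

lemma kil_HH_ne {v : Lam} (hv : IsRt v) : killingForm F (M F) (H (cor F v)) (H (cor F v)) ≠ 0 := by
  have h1 : killingForm F (M F) (H (cor F v)) (H (cor F v)) = ((∑ w : R, (bil v w.1) ^ 2 : ℤ) : F) := by
    show LinearMap.trace F _ _ = _
    rw [LinearMap.trace_eq_matrix_trace F (basM F), Matrix.trace, Fintype.sum_sum_type]
    have h0 : ∀ i, (LinearMap.toMatrix (basM F) (basM F) ((LieModule.toEnd F (M F) (M F)) (H (cor F v)) ∘ₗ (LieModule.toEnd F (M F) (M F)) (H (cor F v)))).diag (Sum.inl i) = 0 := by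
      intro i
      rw [Matrix.diag_apply, LinearMap.toMatrix_apply, basM_inl]
      simp [lie_HH]
    have h2 : ∀ w : R, (LinearMap.toMatrix (basM F) (basM F) ((LieModule.toEnd F (M F) (M F)) (H (cor F v)) ∘ₗ (LieModule.toEnd F (M F) (M F)) (H (cor F v)))).diag (Sum.inr w) = ((bil v w.1 ^ 2 : ℤ) : F) := by
      intro w
      rw [Matrix.diag_apply, LinearMap.toMatrix_apply, LinearMap.comp_apply]
      have : (LieModule.toEnd F (M F) (M F)) (H (cor F v)) ((LieModule.toEnd F (M F) (M F)) (H (cor F v)) (basM F (Sum.inr w))) = (((bil v w.1)^2 : ℤ) : F) • basM F (Sum.inr w) := by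
        rw [basM_inr]
        simp only [LieModule.toEnd_apply_apply, lie_HE, lie_smul, pr_cor, smul_smul]
        push_cast; ring_nf
      rw [this]
      simp
    refine (congrArg₂ (· + ·) (Finset.sum_eq_zero fun i _ => h0 i) (Finset.sum_congr rfl fun w _ => h2 w)).trans ?_
    push_cast; simp
  rw [h1]
  have : (0 : ℤ) < ∑ w : R, (bil v w.1) ^ 2 := by
    refine Finset.sum_pos' (fun w _ => sq_nonneg _) ⟨⟨v, hv⟩, Finset.mem_univ _, ?_⟩
    rw [show bil v v = 2 from hv]; norm_num
  exact_mod_cast this.ne'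

lemma kil_opp_ne {v : Lam} (hv : IsRt v) : killingForm F (M F) (E F v) (E F (-v)) ≠ 0 := by
  intro h0
  apply kil_HH_ne (F := F) hv
  have := kil_inv (H (cor F v)) (E F v) (E F (-v))
  rw [lie_opp hv, lie_HE, map_smul, LinearMap.smul_apply, h0, smul_zero, map_neg] at this
  exact neg_eq_zero.1 this.symm

lemma exists_al_ne {v : Lam} (hv : v ≠ 0) : ∃ i, bil (al i) v ≠ 0 := by
  by_contra! hc
  apply hv
  apply bil_inj
  intro i
  rw [bil_comm, hc i]; simp

lemma kil_HE (h : Fin 8 → F) {v : Lam} (hv : IsRt v) : killingForm F (M F) (H h) (E F v) = 0 := by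
  have := kil_inv (H h) (H (cor F v)) (E F v)
  rw [lie_HH, lie_HE, pr_cor, show bil v v = 2 from hv] at this
  simpa using this

lemma kil_EE {u v : Lam} (h : u + v ≠ 0) : killingForm F (M F) (E F u) (E F v) = 0 := by
  obtain ⟨i, hi⟩ := exists_al_ne h
  have := kil_inv (E F u) (H (cor F (al i))) (E F v)
  rw [lie_EH, lie_HE, pr_cor, pr_cor] at this
  simp only [map_neg, map_smul, LinearMap.neg_apply, LinearMap.smul_apply, smul_eq_mul] at this
  have h2 : ((bil (al i) (u + v) : ℤ) : F) * killingForm F (M F) (E F u) (E F v) = 0 := by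
    rw [bil_add_right]; push_cast; linear_combination -this
  exact (mul_eq_zero.1 h2).resolve_left (by exact_mod_cast hi)

lemma kil_co (x : M F) (v : R) : killingForm F (M F) x (E F (-v.1)) = co v x * killingForm F (M F) (E F v.1) (E F (-v.1)) := by
  conv_lhs => rw [M_expand x]
  rw [map_add, map_sum, LinearMap.add_apply, kil_HE _ v.2.neg, zero_add, LinearMap.sum_apply,
    Finset.sum_eq_single v]
  · simp
  · intro w _ hw
    rw [map_smul, LinearMap.smul_apply, kil_EE, smul_zero]
    intro h
    apply hw
    apply Subtype.ext
    exact add_neg_eq_zero.1 h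
  · simp

lemma pr_inj {h : Fin 8 → F} (hh : ∀ i, pr (al i) h = 0) : h = 0 := by
  have h1 : (CartanMatrix.E₈.map (Int.cast : ℤ → F)).mulVec h = 0 := by
    funext i
    have := hh i
    rw [pr_apply] at this
    simp only [Matrix.mulVec, dotProduct, Matrix.map_apply, Pi.zero_apply]
    rw [← this]
    refine Finset.sum_congr rfl fun j _ => ?_
    rw [bil_comm, bil_al_al]
  apply Matrix.eq_zero_of_mulVec_eq_zero _ h1
  have : (CartanMatrix.E₈.map (Int.cast : ℤ → F)).det = ((CartanMatrix.E₈.det : ℤ) : F) :=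
    (RingHom.map_det (Int.castRingHom F) CartanMatrix.E₈).symm
  rw [this, CartanMatrix.E₈_det]; simp

instance isKilling_M : IsKilling F (M F) where
  killingCompl_top_eq_bot := by
    rw [eq_bot_iff]
    intro x hx
    have hx' : ∀ y, killingForm F (M F) x y = 0 := fun y => by
      rw [kil_comm]
      exact (LieIdeal.mem_killingCompl F (M F) ⊤).1 hx y trivial
    have hco : ∀ y : M F, (∀ z, killingForm F (M F) y z = 0) → ∀ v, co v y = 0 := fun y hy v =>
      (mul_eq_zero.1 ((kil_co y v).symm.trans (hy _))).resolve_right (kil_opp_ne v.2)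
    have h1 := hco x hx'
    have hxH : x = H (pH x) := by
      conv_lhs => rw [M_expand x]
      simp [h1]
    have h2 : pH x = 0 := by
      apply pr_inj
      intro i
      have h3 := hco ⁅E F (al i), x⁆ (fun z => by rw [← lie_skew, map_neg, LinearMap.neg_apply, kil_inv, hx', neg_zero]) ⟨al i, isRt_al i⟩
      rw [hxH, lie_EH, map_neg, map_smul, co_E] at h3
      simpa using h3
    rw [hxH, h2]; simp

end E8

namespace E8
open LieAlgebra LieModule

variable {F : Type} [Field F] [CharZero F]

/-- The automorphism group of the model -/
abbrev Au (F : Type) [Field F] [CharZero F] := ↥(lieAut F (M F))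

lemma au_lie (g : Au F) (x y : M F) : g • ⁅x, y⁆ = ⁅g • x, g • y⁆ := g.2 x y
lemma au_smul (g : Au F) (c : F) (x : M F) : g • (c • x) = c • (g • x) :=
  map_smul (g : M F ≃ₗ[F] M F) c x
lemma au_ext {g h : Au F} (hx : ∀ x : M F, g • x = h • x) : g = h :=
  Subtype.ext (LinearEquiv.ext hx)

/-- the linear map of an automorphism -/
def Au.lin (g : Au F) : M F →ₗ[F] M F := ((g : M F ≃ₗ[F] M F) : M F →ₗ[F] M F)
lemma Au.lin_apply (g : Au F) (x : M F) : g.lin x = g • x := rfl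

lemma au_ext' {g h : Au F} (h1 : ∀ k, g • (H k : M F) = h • H k)
    (h2 : ∀ v, IsRt v → g • E F v = h • E F v) : g = h := by
  apply au_ext
  intro x
  exact LinearMap.congr_fun (M_hom_ext (f := g.lin) (g := h.lin) h1 h2) x

/-- automorphism from an injective Lie hom -/
noncomputable def mkAu (f : M F →ₗ[F] M F) (hl : ∀ x y, f ⁅x, y⁆ = ⁅f x, f y⁆)
    (hi : Function.Injective f) : Au F :=
  ⟨LinearEquiv.ofInjectiveEndo f hi, fun x y => hl x y⟩

@[simp] lemma mkAu_smul (f : M F →ₗ[F] M F) (hl) (hi) (x : M F) : mkAu f hl hi • x = f x := rfl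

/-- Weight spaces are lines. -/
lemma pH_lie_H (h : Fin 8 → F) (x : M F) : pH ⁅H h, x⁆ = 0 := by
  have : pH ∘ₗ (ad F (M F) (H h)) = 0 := M_hom_ext (by simp [lie_HH]) (by simp [lie_HE])
  exact LinearMap.congr_fun this x

lemma co_lie_H (h : Fin 8 → F) (x : M F) (v : R) : co v ⁅H h, x⁆ = pr v.1 h * co v x := by
  have : co v ∘ₗ (ad F (M F) (H h)) = pr v.1 h • co v := by
    apply M_hom_ext
    · simp [lie_HH]
    · intro u hu
      simp only [LinearMap.comp_apply, ad_apply, lie_HE, map_smul, LinearMap.smul_apply, co_E]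
      split_ifs with h
      · rw [h]
      · simp
  exact LinearMap.congr_fun this x

lemma pr_cor_al (v : Lam) (i : Fin 8) : pr v (cor F (al i)) = ((bil v (al i) : ℤ) : F) := by
  rw [pr_cor, bil_comm]

/-- a vector of weight u (a root) is a multiple of the root vector -/
lemma wt_line {u : Lam} (hu : IsRt u) {y : M F}
    (hy : ∀ i, ⁅H (cor F (al i)), y⁆ = ((bil u (al i) : ℤ) : F) • y) : y = co ⟨u, hu⟩ y • E F u := by
  apply M_ext
  · obtain ⟨i, hi⟩ := exists_al_ne hu.ne_zero
    have := pH_lie_H (cor F (al i)) y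
    rw [hy i, map_smul, smul_eq_zero] at this
    rw [map_smul, pH_E, smul_zero]
    exact this.resolve_left (by rw [bil_comm] at hi; exact_mod_cast hi)
  · intro v
    rw [map_smul, co_E]
    split_ifs with h
    · have : v = ⟨u, hu⟩ := Subtype.ext h.symm
      rw [this]; simp
    · by_contra hc
      rw [smul_zero] at hc
      apply h
      apply bil_inj
      intro i
      have h1 := co_lie_H (cor F (al i)) y v
      rw [hy i, map_smul, pr_cor_al, smul_eq_mul] at h1
      exact_mod_cast mul_right_cancel₀ hc h1

lemma wt_zero {y : M F} (hy : ∀ i, ⁅H (cor F (al i)), y⁆ = 0) : y = H (pH y) := by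
  apply M_ext
  · simp
  · intro v
    obtain ⟨i, hi⟩ := exists_al_ne v.2.ne_zero
    have h1 := co_lie_H (cor F (al i)) y v
    rw [hy i, map_zero, pr_cor] at h1
    rw [co_H]
    exact (mul_eq_zero.1 h1.symm).resolve_left (by exact_mod_cast hi)

/-! ### isometries -/

/-- isometry predicate -/
def IsIsom (w : Lam ≃+ Lam) : Prop := ∀ u v, bil (w u) (w v) = bil u v

lemma IsIsom.isRt {w : Lam ≃+ Lam} (hw : IsIsom w) {v : Lam} (hv : IsRt v) : IsRt (w v) := by
  unfold IsRt; rw [hw]; exact hv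
lemma IsIsom.symm {w : Lam ≃+ Lam} (hw : IsIsom w) : IsIsom w.symm := fun u v => by
  rw [← hw]; simp
lemma IsIsom.trans {w w' : Lam ≃+ Lam} (hw : IsIsom w) (hw' : IsIsom w') : IsIsom (w.trans w') :=
  fun u v => by simp [hw' _ _, hw _ _]

/-- reflection as an equivalence -/
def reflE {a : Lam} (ha : IsRt a) : Lam ≃+ Lam where
  toFun := refl a
  invFun := refl a
  left_inv := refl_refl ha
  right_inv := refl_refl ha
  map_add' u v := by unfold refl; rw [bil_add_left]; module

lemma reflE_isom {a : Lam} (ha : IsRt a) : IsIsom (reflE ha) := bil_refl ha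

lemma cart_ne (i j : Fin 8) : CartanMatrix.E₈ i j ≠ (-2 : ℤ) := by
  rw [← bil_al_al]; revert i j; decide

lemma serre_gen (b : Fin 8 → Lam) (hb : ∀ i j, bil (b i) (b j) = CartanMatrix.E₈ i j) :
    IsSerre (F := F) (L := M F) (fun i => H (cor F (b i))) (fun i => E F (b i))
    (fun i => - E F (-b i)) := by
  have hr : ∀ i, IsRt (b i) := fun i => (hb i i).trans (CartanMatrix.E₈_diag i)
  constructor
  case hh => exact fun i j => lie_HH _ _
  case ef => intro i; rw [lie_neg, lie_opp (hr i), neg_neg]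
  case efn =>
    intro i j hij
    rw [lie_neg, lie_zero_of (hr i) (hr j).neg, neg_zero]
    rw [bil_neg_right, hb]; have := CartanMatrix.E₈_off_diag_nonpos i j hij; omega
  case he => intro i j; rw [lie_HE, pr_cor, hb, Int.cast_smul_eq_zsmul]
  case hf => intro i j; rw [lie_neg, lie_HE, pr_neg, pr_cor, hb, smul_neg, neg_smul, Int.cast_smul_eq_zsmul]
  case ee =>
    intro i j
    rw [← hb]
    rcases bil_ne (hr i) (hr j) with h | h | h | h | h
    · exact absurd ((hb i j).symm.trans h) (cart_ne i j)
    · rw [lie_neg_of (hr i) (hr j) h, h]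
      simp only [neg_neg, Int.toNat_one, pow_one, map_smul, LieAlgebra.ad_apply]
      rw [lie_zero_of (hr i) ((isRt_add_iff (hr i) (hr j)).2 h), smul_zero]
      rw [bil_add_right, h, show bil (b i) (b i) = 2 from hr i]; norm_num
    · rw [lie_zero_of (hr i) (hr j) (by omega), map_zero]
    · rw [lie_zero_of (hr i) (hr j) (by omega), map_zero]
    · rw [lie_zero_of (hr i) (hr j) (by omega), map_zero]
  case ff =>
    intro i j
    rw [← hb]
    have hb' : bil (-b i) (-b j) = bil (b i) (b j) := by rw [bil_neg_left, bil_neg_right, neg_neg]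
    rw [lie_neg, neg_lie, neg_neg]
    rcases bil_ne (hr i) (hr j) with h | h | h | h | h
    · exact absurd ((hb i j).symm.trans h) (cart_ne i j)
    · rw [lie_neg_of (hr i).neg (hr j).neg (by omega), h]
      simp only [neg_neg, Int.toNat_one, pow_one, map_smul, LieAlgebra.ad_apply, neg_lie]
      rw [lie_zero_of (hr i).neg ((isRt_add_iff (hr i).neg (hr j).neg).2 (by omega)), neg_zero, smul_zero]
      rw [bil_add_right, bil_neg_left, bil_neg_left, bil_neg_right, bil_neg_right, h, show bil (b i) (b i) = 2 from hr i]; norm_num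
    · rw [lie_zero_of (hr i).neg (hr j).neg (by omega), map_zero]
    · rw [lie_zero_of (hr i).neg (hr j).neg (by omega), map_zero]
    · rw [lie_zero_of (hr i).neg (hr j).neg (by omega), map_zero]

lemma hom_sh (b : Fin 8 → Lam) (hb : ∀ i j, bil (b i) (b j) = CartanMatrix.E₈ i j) (i : Fin 8) :
    (serre_gen (F := F) b hb).hom (sh F i) = H (cor F (b i)) := by
  unfold sh; rw [IsSerre.hom_pj, FreeLieAlgebra.lift_of_apply]; rfl

lemma iso8_symm_H (i : Fin 8) : (iso8 F).symm (H (cor F (al i))) = sh F i := by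
  rw [← pi8_h]; exact (iso8 F).symm_apply_apply _

lemma isom_bil_al {w : Lam ≃+ Lam} (hw : IsIsom w) (i j : Fin 8) :
    bil (w (al i)) (w (al j)) = CartanMatrix.E₈ i j := by rw [hw, bil_al_al]

lemma isom_expand (w : Lam ≃+ Lam) (v : Lam) : w v = ∑ i, v i • w (al i) := by
  conv_lhs => rw [eq_sum_al v]
  rw [map_sum]; simp only [map_zsmul]

lemma cor_sum_al (w : Lam ≃+ Lam) (v : Lam) : cor F (w v) = ∑ i, (v i : F) • cor F (w (al i)) := by
  rw [isom_expand w v]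
  funext j
  simp [cor, Finset.sum_apply]

lemma H_cor_w (w : Lam ≃+ Lam) (v : Lam) : H (cor F (w v)) = ∑ i, (v i : F) • H (cor F (w (al i))) := by
  rw [cor_sum_al, map_sum]; simp only [map_smul]

/-- Every isometry of the lattice lifts to an automorphism. -/
lemma exists_lift {w : Lam ≃+ Lam} (hw : IsIsom w) : ∃ g : Au F,
    (∀ v, g • (H (cor F v) : M F) = H (cor F (w v))) ∧
    (∀ v, IsRt v → ∃ c : F, c ≠ 0 ∧ g • E F v = c • E F (w v)) := by
  let φ : M F →ₗ⁅F⁆ M F := ((serre_gen (F := F) (fun i => w (al i)) (isom_bil_al hw)).hom).comp ((iso8 F).symm : M F →ₗ⁅F⁆ e₈ F)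
  have hφH : ∀ i, φ (H (cor F (al i))) = H (cor F (w (al i))) := fun i => by
    show (serre_gen (F := F) (fun i => w (al i)) (isom_bil_al hw)).hom ((iso8 F).symm _) = _
    rw [iso8_symm_H]
    exact hom_sh _ (isom_bil_al hw) i
  have hφv : ∀ v, φ (H (cor F v)) = H (cor F (w v)) := fun v => by
    rw [H_cor_w w v, ← AddEquiv.refl_apply v, H_cor_w, map_sum]
    simp only [map_smul, AddEquiv.refl_apply, hφH]
  have hφE : ∀ v, IsRt v → ∃ c : F, c ≠ 0 ∧ φ (E F v) = c • E F (w v) := by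
    intro v hv
    have hline := wt_line (F := F) (hw.isRt hv) (y := φ (E F v)) (fun i => by
      have : H (cor F (al i)) = φ (H (cor F (w.symm (al i)))) := by rw [hφv]; simp
      rw [this, ← LieHom.map_lie, lie_HE, map_smul, pr_cor]
      congr 2
      rw [← hw]; simp [bil_comm])
    refine ⟨_, ?_, hline⟩
    intro h0
    rw [h0, zero_smul] at hline
    have h1 := congrArg φ (lie_opp (F := F) hv)
    rw [LieHom.map_lie, hline, zero_lie, map_neg, hφv] at h1
    have h2 := congrArg pH (neg_eq_zero.1 h1.symm)
    rw [pH_H, map_zero] at h2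
    have h3 := (hw.isRt hv).ne_zero
    apply h3
    funext i
    have := congrFun h2 i
    simpa [cor] using this
  have hinj : Function.Injective φ := by
    rw [injective_iff_map_eq_zero]
    intro x hx
    have hx0 := hx
    rw [M_expand x, H_span, map_add, map_sum, map_sum] at hx
    simp only [map_smul, hφH] at hx
    choose! c hc hcE using hφE
    have hs : ∀ v : R, φ (E F v.1) = c v.1 • E F (w v.1) := fun v => hcE _ v.2
    simp only [hs] at hx
    apply M_ext
    · have h1 := congrArg pH hx
      simp only [map_add, map_sum, map_smul, pH_E, smul_zero, Finset.sum_const_zero, add_zero, pH_H, map_zero] at h1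
      rw [map_zero]
      apply pr_inj
      intro i
      have h2 := congrArg (pr (w (al i))) h1
      rw [map_sum, map_zero] at h2
      rw [pr_apply, ← h2]
      refine Finset.sum_congr rfl fun j _ => ?_
      rw [map_smul, pr_cor, hw, smul_eq_mul, mul_comm]
    · intro v
      have h1 := congrArg (co ⟨w v.1, hw.isRt v.2⟩) hx
      simp only [map_add, map_sum, map_smul, co_H, smul_zero, Finset.sum_const_zero, zero_add, map_zero, co_E] at h1
      rw [Finset.sum_eq_single v] at h1
      · simpa [hc _ v.2] using h1
      · intro u _ hu
        rw [if_neg]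
        · simp
        · intro h; exact hu (Subtype.ext (w.injective h))
      · simp
  exact ⟨mkAu φ (fun x y => LieHom.map_lie φ x y) hinj, hφv, hφE⟩

/-! ### torus -/

/-- character of the lattice -/
noncomputable def chi (t : Fin 8 → Fˣ) (v : Lam) : Fˣ := ∏ i, t i ^ v i

lemma chi_add (t : Fin 8 → Fˣ) (u v : Lam) : chi t (u + v) = chi t u * chi t v := by
  simp [chi, zpow_add, Finset.prod_mul_distrib]
lemma chi_al (t : Fin 8 → Fˣ) (i : Fin 8) : chi t (al i) = t i := by
  unfold chi
  rw [Finset.prod_eq_single i] <;> simp [al]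
  intro j hj
  simp [Pi.single_apply, hj]
lemma chi_zero (t : Fin 8 → Fˣ) : chi t 0 = 1 := by simp [chi]
lemma chi_neg (t : Fin 8 → Fˣ) (v : Lam) : chi t (-v) = (chi t v)⁻¹ := by
  simp [chi]

/-- torus linear map -/
noncomputable def torL (t : Fin 8 → Fˣ) : M F →ₗ[F] M F :=
  H ∘ₗ pH + ∑ v : R, (chi t v.1 : F) • (LinearMap.toSpanSingleton F (M F) (E F v.1) ∘ₗ co v)

lemma torL_H (t : Fin 8 → Fˣ) (h : Fin 8 → F) : torL t (H h) = H h := by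
  simp [torL]
lemma torL_E (t : Fin 8 → Fˣ) {v : Lam} (hv : IsRt v) : torL t (E F v) = (chi t v : F) • E F v := by
  simp only [torL, LinearMap.add_apply, LinearMap.comp_apply, pH_E, map_zero, zero_add, LinearMap.sum_apply,
    LinearMap.smul_apply, co_E]
  rw [Finset.sum_eq_single ⟨v, hv⟩] <;> simp
  intro a ha hav h
  exact absurd h.symm hav

lemma torL_T (t : Fin 8 → Fˣ) {u v : Lam} (hu : IsRt u) (hv : IsRt v) :
    torL t ⁅E F u, E F v⁆ = ⁅torL t (E F u), torL t (E F v)⁆ := by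
  rw [torL_E t hu, torL_E t hv, smul_lie, lie_smul, smul_smul]
  by_cases h : u + v = 0
  · obtain rfl : v = -u := (neg_eq_of_add_eq_zero_right h).symm
    rw [lie_opp hu, map_neg, torL_H, chi_neg]; simp
  · rw [lie_nb hu hv h, map_smul]
    by_cases hr : IsRt (u + v)
    · rw [torL_E t hr, chi_add, smul_comm]; simp
    · rw [E_not hr]; simp

lemma torL_lie (t : Fin 8 → Fˣ) (x y : M F) : torL t ⁅x, y⁆ = ⁅torL t x, torL t y⁆ := by
  induction x using M.ind with
  | hadd x x' h h' => rw [add_lie, map_add, map_add, add_lie, h, h']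
  | hsmul c x h => rw [smul_lie, map_smul, map_smul, smul_lie, h]
  | hH k =>
    induction y using M.ind with
    | hadd x x' h h' => rw [lie_add, map_add, map_add, lie_add, h, h']
    | hsmul c x h => rw [lie_smul, map_smul, map_smul, lie_smul, h]
    | hH k => simp [lie_HH, torL_H]
    | hE v hv => rw [torL_H, torL_E t hv, lie_smul, lie_HE, map_smul, torL_E t hv, smul_comm]
  | hE u hu =>
    induction y using M.ind with
    | hadd x x' h h' => rw [lie_add, map_add, map_add, lie_add, h, h']
    | hsmul c x h => rw [lie_smul, map_smul, map_smul, lie_smul, h]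
    | hH k => rw [torL_H, torL_E t hu, smul_lie, lie_EH, map_neg, map_smul, torL_E t hu, smul_neg, smul_comm]
    | hE v hv => exact torL_T t hu hv

lemma torL_mul (t s : Fin 8 → Fˣ) (x : M F) : torL t (torL s x) = torL (t * s) x := by
  have : torL t ∘ₗ torL s = torL (F := F) (t * s) := by
    apply M_hom_ext
    · intro k; simp [torL_H]
    · intro v hv
      rw [LinearMap.comp_apply, torL_E s hv, map_smul, torL_E t hv, torL_E _ hv, smul_smul]
      congr 1
      rw [← Units.val_mul]; congr 1; simp [chi, mul_zpow, Finset.prod_mul_distrib, mul_comm]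
  exact LinearMap.congr_fun this x

lemma torL_one (x : M F) : torL 1 x = x := by
  have : torL (F := F) 1 = LinearMap.id := by
    apply M_hom_ext
    · intro k; simp [torL_H]
    · intro v hv
      rw [torL_E _ hv]; simp [chi]
  exact LinearMap.congr_fun this x

/-- torus element -/
noncomputable def tor (t : Fin 8 → Fˣ) : Au F := mkAu (torL t) (torL_lie t) (by
  intro x y h
  have := congrArg (torL t⁻¹) h
  simpa [torL_mul, torL_one] using this)

@[simp] lemma tor_H (t : Fin 8 → Fˣ) (h : Fin 8 → F) : tor t • (H h : M F) = H h := torL_H t h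
lemma tor_E (t : Fin 8 → Fˣ) {v : Lam} (hv : IsRt v) : tor t • E F v = (chi t v : F) • E F v := torL_E t hv

/-- An automorphism fixing the Cartan subalgebra pointwise is in the torus. -/
lemma eq_tor {g : Au F} (hg : ∀ h, g • (H h : M F) = H h) : ∃ t, g = tor t := by
  have hE : ∀ v, IsRt v → ∃ c : F, g • E F v = c • E F v := fun v hv => ⟨_, wt_line hv (fun i => by
    rw [← hg, ← au_lie, lie_HE, au_smul, pr_cor_al])⟩
  choose! c hc using hE
  have hne : ∀ v, IsRt v → c v ≠ 0 := fun v hv h0 => by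
    have := hc v hv
    rw [h0, zero_smul, smul_eq_zero_iff_eq] at this
    exact E_ne_zero hv this
  have hopp : ∀ v, IsRt v → c v * c (-v) = 1 := fun v hv => by
    have h1 : g • ⁅E F v, E F (-v)⁆ = g • (-H (cor F v)) := by rw [lie_opp hv]
    rw [au_lie, hc v hv, hc _ hv.neg, smul_lie, lie_smul, lie_opp hv, smul_neg g, hg, smul_neg, smul_neg, smul_smul] at h1
    have h2 := congrArg pH (neg_injective h1)
    simp only [map_smul, pH_H] at h2
    obtain ⟨i, hi⟩ := Function.ne_iff.1 hv.ne_zero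
    have h3 := congrFun h2 i
    simp only [cor, Pi.smul_apply, smul_eq_mul] at h3
    have hi' : (v i : F) ≠ 0 := by exact_mod_cast hi
    exact mul_right_cancel₀ hi' (by rw [one_mul]; exact h3)
  have hadd : ∀ u v, IsRt u → IsRt v → bil u v = -1 → c (u + v) = c u * c v := fun u v hu hv h => by
    have hr := (isRt_add_iff hu hv).2 h
    have h1 : g • ⁅E F u, E F v⁆ = g • (sg F u v • E F (u + v)) := by rw [lie_neg_of hu hv h]
    rw [au_lie, hc u hu, hc v hv, au_smul, hc _ hr, smul_lie, lie_smul, lie_neg_of hu hv h] at h1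
    have h2 := congrArg (co ⟨_, hr⟩) h1
    simp only [map_smul, co_E, if_true, smul_eq_mul, mul_one] at h2
    apply mul_left_cancel₀ (sg_ne_zero (F := F) u v)
    rw [← h2]; ring
  refine ⟨fun i => Units.mk0 (c (al i)) (hne _ (isRt_al i)), au_ext' (fun k => by rw [hg, tor_H]) ?_⟩
  set t : Fin 8 → Fˣ := fun i => Units.mk0 (c (al i)) (hne _ (isRt_al i)) with htd
  have hpos : ∀ n : ℕ, ∀ v : Lam, IsRt v → (∀ i, 0 ≤ v i) → ht v ≤ n → c v = chi t v := by
    intro n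
    induction n with
    | zero =>
      intro v h hp hn
      exfalso
      obtain ⟨i, hi, -⟩ := exists_bil_pos h hp
      have : v i ≤ E8.ht v := Finset.single_le_sum (fun j _ => hp j) (Finset.mem_univ i)
      push_cast at hn; omega
    | succ n ih =>
      intro v h hp hn
      obtain ⟨i, hi, hb⟩ := exists_bil_pos h hp
      have h2 := bil_le_two h (isRt_al i)
      rcases (by omega : bil v (al i) = 1 ∨ bil v (al i) = 2) with h1 | h1
      · obtain ⟨hr, hp'⟩ := h.sub_al hp h1
        have m1 := ih (v - al i) hr hp' (by
          have : E8.ht (v - al i) = E8.ht v - 1 := by simp [E8.ht, al, Finset.sum_sub_distrib]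
          push_cast at hn; omega)
        have hb : bil (v - al i) (al i) = -1 := by
          rw [bil_sub_left, h1, show bil (al i) (al i) = 2 from isRt_al i]; norm_num
        have := hadd _ _ hr (isRt_al i) hb
        rw [sub_add_cancel] at this
        rw [this, m1, ← sub_add_cancel v (al i), chi_add, chi_al]
        simp [htd]
      · have := eq_of_bil_eq_two h (isRt_al i) h1
        subst this
        rw [chi_al]; simp [htd]
  have hpos' : ∀ v : Lam, IsRt v → (∀ i, 0 ≤ v i) → c v = chi t v := fun v hv hp => by
    obtain ⟨n, hn⟩ := Int.eq_ofNat_of_zero_le (Finset.sum_nonneg fun i _ => hp i : 0 ≤ E8.ht v)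
    exact hpos n v hv hp hn.le
  intro v hv
  rw [hc v hv, tor_E _ hv]
  congr 1
  rcases hv.nonneg_or_nonpos with hp | hp
  · exact hpos' v hv hp
  · have h1 := hpos' (-v) hv.neg (fun i => by simpa using hp i)
    have h2 := hopp v hv
    rw [h1, chi_neg] at h2
    rw [Units.val_inv_eq_inv_val] at h2
    exact (mul_inv_eq_one₀ (Units.ne_zero _)).1 h2

/-! ### dominance -/

lemma refl_pos {v : Lam} (hv : IsRt v) (hp : ∀ i, 0 ≤ v i) {i : Fin 8} (h : v ≠ al i) : ∀ j, 0 ≤ refl (al i) v j := by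
  by_contra! hc
  obtain ⟨j, hj⟩ := hc
  have hr := (isRt_al i).refl hv
  have hn := hr.nonneg_or_nonpos.resolve_left (fun hq => by have := hq j; omega)
  have hz : ∀ k, k ≠ i → v k = 0 := fun k hk => by
    have h1 := hn k
    have h2 := hp k
    simp [refl, al, hk] at h1
    omega
  have hv' : v = v i • al i := by
    funext k
    by_cases hk : k = i
    · subst hk; simp [al]
    · simp [al, hk, hz k hk]
  have h2 : bil v v = 2 := hv
  rw [hv', bil_smul_left, bil_smul_right, show bil (al i) (al i) = 2 from isRt_al i] at h2
  have h3 : v i = 1 := by nlinarith [hp i]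
  apply h; rw [hv', h3, one_smul]

lemma dominance (l : Lam →+ ℚ) : ∃ w : Lam ≃+ Lam, IsIsom w ∧ ∀ i, 0 ≤ l (w (al i)) := by
  suffices ∀ n : ℕ, ∀ l : Lam →+ ℚ, (posF.filter (fun a => l a < 0)).card ≤ n →
      ∃ w : Lam ≃+ Lam, IsIsom w ∧ ∀ i, 0 ≤ l (w (al i)) from this _ l le_rfl
  intro n
  induction n with
  | zero =>
    intro l hl
    refine ⟨AddEquiv.refl _, fun _ _ => rfl, fun i => ?_⟩
    by_contra! hc
    have : al i ∈ posF.filter (fun a => l a < 0) := by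
      rw [Finset.mem_filter, mem_posF]
      exact ⟨⟨isRt_al i, fun j => by simp only [al, Pi.single_apply]; split_ifs <;> norm_num⟩, hc⟩
    have := Finset.card_pos.2 ⟨_, this⟩
    omega
  | succ n ih =>
    intro l hl
    by_cases hd : ∀ i, 0 ≤ l (al i)
    · exact ⟨AddEquiv.refl _, fun _ _ => rfl, hd⟩
    push Not at hd
    obtain ⟨i, hi⟩ := hd
    have hal : al i ∈ posF.filter (fun a => l a < 0) := by
      rw [Finset.mem_filter, mem_posF]
      exact ⟨⟨isRt_al i, fun j => by simp only [al, Pi.single_apply]; split_ifs <;> norm_num⟩, hi⟩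
    obtain ⟨w, hw, hw'⟩ := ih (l.comp (reflE (isRt_al i)).toAddMonoidHom) (by
      have : (posF.filter (fun a => (l.comp (reflE (isRt_al i)).toAddMonoidHom) a < 0)).card ≤
          ((posF.filter (fun a => l a < 0)).erase (al i)).card := by
        refine Finset.card_le_card_of_injOn (reflE (isRt_al i)) ?_ (reflE (isRt_al i)).injective.injOn
        intro a ha
        simp only [Finset.coe_filter, Set.mem_ofPred_eq, mem_posF] at ha
        have hne : a ≠ al i := by
          rintro rfl
          have h1 : reflE (isRt_al i) (al i) = -al i := by
            show refl _ _ = _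
            unfold refl; rw [show bil (al i) (al i) = 2 from isRt_al i]; module
          have h2 := ha.2
          simp only [AddMonoidHom.comp_apply] at h2
          have h3 : l (reflE (isRt_al i) (al i)) < 0 := h2
          rw [h1, map_neg] at h3
          linarith
        simp only [Finset.coe_erase, Finset.coe_filter, Set.mem_sdiff, Set.mem_ofPred_eq, mem_posF, Set.mem_singleton_iff]
        refine ⟨⟨⟨(isRt_al i).refl ha.1.1, refl_pos ha.1.1 ha.1.2 hne⟩, ha.2⟩, ?_⟩
        intro h
        have h4 : a = -al i := by
          apply (reflE (isRt_al i)).injective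
          rw [h]
          show _ = refl _ _
          unfold refl; rw [bil_neg_left, show bil (al i) (al i) = 2 from isRt_al i]; module
        have := ha.1.2 i
        rw [h4] at this
        simp [al] at this
      rw [Finset.card_erase_of_mem hal] at this
      omega)
    exact ⟨w.trans (reflE (isRt_al i)), hw.trans (reflE_isom _), hw'⟩

end E8

namespace E8
open LieAlgebra LieModule MvPolynomial

variable {F : Type} [Field F] [CharZero F]

/-! ### exponentials -/

lemma exists_exp (e : M F) (he : IsNilpotent (ad F (M F) e)) :
    ∃ g : Au F, ∀ K, (ad F (M F) e) ^ K = 0 →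
      ∀ x : M F, g • x = ∑ k ∈ Finset.range K, ((k.factorial : F)⁻¹) • ((ad F (M F) e) ^ k) x := by
  let i1 : Module ℚ (M F) := Module.compHom (M F) (algebraMap ℚ F)
  have hs : ∀ (q : ℚ) (x : M F), q • x = (q : F) • x := fun q x => rfl
  let i2 : LieAlgebra ℚ (M F) := { i1 with lie_smul := fun t x y => by rw [hs, hs, lie_smul] }
  let D : LieDerivation F (M F) (M F) := LieDerivation.inner F (M F) (M F) (-e)
  have hD : D.toLinearMap = ad F (M F) e := by
    ext x
    show ⁅x, -e⁆ = ⁅e, x⁆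
    rw [lie_neg, ← lie_skew, neg_neg]
  have hn : IsNilpotent D.toLinearMap := by rw [hD]; exact he
  refine ⟨⟨(LieDerivation.exp D hn).toLinearEquiv, fun x y => LieEquiv.map_lie _ x y⟩, fun K hK x => ?_⟩
  show IsNilpotent.exp D.toLinearMap x = _
  rw [hD, IsNilpotent.exp_eq_sum hK, LinearMap.sum_apply]
  refine Finset.sum_congr rfl fun k _ => ?_
  rw [LinearMap.smul_apply, hs]
  simp

/-- exponential of an ad-nilpotent element -/
noncomputable def expA (e : M F) (he : IsNilpotent (ad F (M F) e)) : Au F := (exists_exp e he).choose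

lemma expA_apply (e : M F) (he : IsNilpotent (ad F (M F) e)) {K : ℕ} (hK : (ad F (M F) e) ^ K = 0) (x : M F) :
    expA e he • x = ∑ k ∈ Finset.range K, ((k.factorial : F)⁻¹) • ((ad F (M F) e) ^ k) x :=
  (exists_exp e he).choose_spec K hK x

lemma nil_smul {e : M F} (he : IsNilpotent (ad F (M F) e)) (t : F) : IsNilpotent (ad F (M F) (t • e)) := by
  rw [map_smul]; exact he.smul t

lemma expA_smul (e : M F) (he : IsNilpotent (ad F (M F) e)) {K : ℕ} (hK : (ad F (M F) e) ^ K = 0) (t : F) (x : M F) :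
    expA (t • e) (nil_smul he t) • x = ∑ k ∈ Finset.range K, (t ^ k * (k.factorial : F)⁻¹) • ((ad F (M F) e) ^ k) x := by
  rw [expA_apply (K := K) _ _ (by rw [map_smul, smul_pow, hK, smul_zero])]
  refine Finset.sum_congr rfl fun k _ => ?_
  rw [map_smul, smul_pow, LinearMap.smul_apply, smul_smul, mul_comm]

/-! ### polynomial maps -/

/-- polynomial vector function with prescribed derivative at `b` -/
def HasD {σ : Type} (b : σ → F) (g : (σ → F) → M F) (D : σ → M F) : Prop :=
  ∀ l : M F →ₗ[F] F, ∃ p : MvPolynomial σ F, (∀ x, eval x p = l (g x)) ∧ ∀ i, eval b (pderiv i p) = l (D i)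

section HasD
variable {σ : Type} {b : σ → F}

lemma HasD.lin [Fintype σ] (w : σ → M F) : HasD b (fun x => ∑ i, x i • w i) w := by
  classical
  intro l
  refine ⟨∑ i, C (l (w i)) * MvPolynomial.X i, fun x => ?_, fun i => ?_⟩
  · simp [mul_comm]
  · simp only [map_sum, Derivation.leibniz, pderiv_X, pderiv_C, smul_zero, add_zero, smul_eq_mul, map_mul, eval_C]
    rw [Finset.sum_eq_single i]
    · simp
    · intro j _ hj; simp [Pi.single_apply, hj]
    · simp

lemma HasD.add {g g' : (σ → F) → M F} {D D' : σ → M F} (h : HasD b g D) (h' : HasD b g' D') :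
    HasD b (fun x => g x + g' x) (fun i => D i + D' i) := by
  intro l
  obtain ⟨p, hp, hp'⟩ := h l
  obtain ⟨q, hq, hq'⟩ := h' l
  exact ⟨p + q, fun x => by simp [hp, hq], fun i => by simp [hp', hq']⟩

lemma HasD.map {g : (σ → F) → M F} {D : σ → M F} (h : HasD b g D) (T : M F →ₗ[F] M F) :
    HasD b (fun x => T (g x)) (fun i => T (D i)) := fun l => h (l ∘ₗ T)

lemma HasD.zero : HasD b (fun _ => (0 : M F)) (fun _ => 0) := fun l => ⟨0, by simp, by simp⟩

lemma HasD.smulX {g : (σ → F) → M F} {D : σ → M F} (h : HasD b g D) [DecidableEq σ] (i : σ) (hi : b i = 0) :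
    HasD b (fun x => x i • g x) (fun j => if i = j then g b else 0) := by
  intro l
  obtain ⟨p, hp, hp'⟩ := h l
  refine ⟨MvPolynomial.X i * p, fun x => by simp [hp], fun j => ?_⟩
  simp only [Derivation.leibniz, smul_eq_mul, map_add, map_mul, eval_X, hi, zero_mul, zero_add, pderiv_X, hp]
  by_cases hij : i = j
  · subst hij; simp
  · simp [hij, Pi.single_apply, Ne.symm hij]

lemma HasD.congr {g g' : (σ → F) → M F} {D D' : σ → M F} (h : HasD b g D) (e : ∀ x, g x = g' x) (e' : ∀ i, D i = D' i) :
    HasD b g' D' := by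
  obtain rfl := funext e
  obtain rfl := funext e'
  exact h

lemma HasD.pow {g : (σ → F) → M F} {D : σ → M F} (h : HasD b g D) [DecidableEq σ] (i : σ) (hi : b i = 0) (k : ℕ) :
    HasD b (fun x => x i ^ k • g x) (fun j => if k = 0 then D j else if k = 1 then (if i = j then g b else 0) else 0) := by
  induction k with
  | zero => exact h.congr (by simp) (by simp)
  | succ k ih =>
    refine (ih.smulX i hi).congr (fun x => by rw [smul_smul, pow_succ']) (fun j => ?_)
    cases k with
    | zero => simp
    | succ k => simp [hi]

lemma HasD.sum {κ : Type} (s : Finset κ) {g : κ → (σ → F) → M F} {D : κ → σ → M F} (h : ∀ k ∈ s, HasD b (g k) (D k)) :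
    HasD b (fun x => ∑ k ∈ s, g k x) (fun i => ∑ k ∈ s, D k i) := by
  classical
  induction s using Finset.induction_on with
  | empty => simpa using HasD.zero
  | insert a s ha ih =>
    simp only [Finset.sum_insert ha]
    exact (h a (by simp)).add (ih fun k hk => h k (by simp [hk]))

lemma HasD.exp {g : (σ → F) → M F} {D : σ → M F} (h : HasD b g D) [DecidableEq σ] (i : σ) (hi : b i = 0)
    (e : M F) (he : IsNilpotent (ad F (M F) e)) :
    HasD b (fun x => expA (x i • e) (nil_smul he (x i)) • g x) (fun j => D j + if i = j then ⁅e, g b⁆ else 0) := by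
  have he' := he
  obtain ⟨K, hK⟩ := he'
  have hK2 : (ad F (M F) e) ^ (K + 2) = 0 := by rw [pow_add, hK, zero_mul]
  refine (HasD.sum (Finset.range (K + 2)) (fun k _ =>
    (h.pow i hi k).map ((k.factorial : F)⁻¹ • (ad F (M F) e) ^ k))).congr (fun x => ?_) (fun j => ?_)
  · rw [expA_smul e he hK2]
    refine Finset.sum_congr rfl fun k _ => ?_
    rw [map_smul, LinearMap.smul_apply, smul_smul]
  · rw [Finset.sum_range_succ', Finset.sum_range_succ', Finset.sum_eq_zero]
    · simp only [zero_add, Nat.factorial_one, Nat.cast_one, inv_one, one_smul, pow_one, one_ne_zero, if_false, if_true,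
        Nat.factorial_zero, pow_zero, Module.End.one_apply]
      rw [add_comm]
      congr 1
      split_ifs
      · simp
      · simp
    · intro k _; simp

end HasD

/-! ### frames -/

/-- A frame: toral subalgebra with nilpotent weight vectors, spanning S. -/
structure Frame (S : Submodule F (M F)) where
  H : Submodule F (M F)
  ι : Type
  fin : Fintype ι
  e : ι → M F
  a : ι → (M F →ₗ[F] F)
  nil : ∀ i, IsNilpotent (ad F (M F) (e i))
  lie : ∀ i, ∀ h ∈ H, ⁅h, e i⁆ = a i h • e i
  comm : ∀ h ∈ H, ∀ h' ∈ H, ⁅h, h'⁆ = 0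
  span : H ⊔ Submodule.span F (Set.range e) = S
  ne : ∀ i, ∃ h ∈ H, a i h ≠ 0

namespace Frame
variable {S : Submodule F (M F)} (A : Frame S)

lemma H_le : A.H ≤ S := le_sup_left.trans A.span.le
lemma e_mem (i : A.ι) : A.e i ∈ S := (le_sup_right.trans A.span.le) (Submodule.subset_span ⟨i, rfl⟩)

/-- the group generated by the exponentials -/
noncomputable def grp : Subgroup (Au F) := Subgroup.closure {g | ∃ i t, g = expA (t • A.e i) (nil_smul (A.nil i) t)}

lemma exp_mem (hS : ∀ x ∈ S, ∀ y ∈ S, ⁅x, y⁆ ∈ S) {e : M F} (he : e ∈ S) (hn : IsNilpotent (ad F (M F) e)) {x : M F} (hx : x ∈ S) :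
    expA e hn • x ∈ S := by
  have hn' := hn
  obtain ⟨K, hK⟩ := hn'
  rw [expA_apply _ hn hK]
  refine Submodule.sum_mem _ fun k hk0 => Submodule.smul_mem _ _ ?_
  clear hK hk0
  induction k with
  | zero => exact hx
  | succ k ih => rw [pow_succ']; exact hS _ he _ ih

lemma au_map_le {g : Au F} (h : ∀ x ∈ S, g • x ∈ S) (x : M F) : g • x ∈ S ↔ x ∈ S := by
  refine ⟨fun hx => ?_, h x⟩
  have h1 : Function.Injective (g.lin.restrict h) := by
    intro x y hxy
    have := congrArg Subtype.val hxy
    exact Subtype.ext (smul_left_cancel g this)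
  obtain ⟨y, hy⟩ := (LinearMap.injective_iff_surjective.1 h1) ⟨_, hx⟩
  have h2 : g • (y : M F) = g • x := congrArg Subtype.val hy
  rw [← smul_left_cancel g h2]; exact y.2

lemma grp_mem (hS : ∀ x ∈ S, ∀ y ∈ S, ⁅x, y⁆ ∈ S) {g : Au F} (hg : g ∈ A.grp) : ∀ x, g • x ∈ S ↔ x ∈ S := by
  induction hg using Subgroup.closure_induction with
  | mem g hg =>
    obtain ⟨i, t, rfl⟩ := hg
    exact au_map_le fun x hx => exp_mem hS (S.smul_mem t (A.e_mem i)) _ hx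
  | one => intro x; rw [one_smul]
  | mul g h _ _ hg hh => intro x; rw [mul_smul, hg, hh]
  | inv g _ hg => intro x; rw [← hg, smul_inv_smul]

/-- centraliser of a regular element -/
lemma cent {h : M F} (hh : h ∈ A.H) (hr : ∀ i, A.a i h ≠ 0) {z : M F} (hz : z ∈ S) (hc : ⁅h, z⁆ = 0) : z ∈ A.H := by
  rw [← A.span] at hz
  obtain ⟨y, hy, u, hu, rfl⟩ := Submodule.mem_sup.1 hz
  rw [lie_add, A.comm _ hh _ hy, zero_add] at hc
  set U := Submodule.span F (Set.range A.e)
  have hm : ∀ x ∈ U, (ad F (M F) h) x ∈ U := by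
    intro x hx
    induction hx using Submodule.span_induction with
    | mem x hx =>
      obtain ⟨i, rfl⟩ := hx
      rw [ad_apply, A.lie i h hh]
      exact U.smul_mem _ (Submodule.subset_span ⟨i, rfl⟩)
    | zero => simp
    | add x y _ _ hx hy => rw [map_add]; exact U.add_mem hx hy
    | smul c x _ hx => rw [map_smul]; exact U.smul_mem _ hx
  have hsur : Function.Surjective ((ad F (M F) h).restrict hm) := by
    rintro ⟨x, hx⟩
    have : ∃ y ∈ U, ⁅h, y⁆ = x := by
      induction hx using Submodule.span_induction with
      | mem x hx =>
        obtain ⟨i, rfl⟩ := hx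
        refine ⟨(A.a i h)⁻¹ • A.e i, U.smul_mem _ (Submodule.subset_span ⟨i, rfl⟩), ?_⟩
        rw [lie_smul, A.lie i h hh, smul_smul, inv_mul_cancel₀ (hr i), one_smul]
      | zero => exact ⟨0, U.zero_mem, lie_zero _⟩
      | add x y _ _ hx hy =>
        obtain ⟨a, ha, rfl⟩ := hx
        obtain ⟨b, hb, rfl⟩ := hy
        exact ⟨a + b, U.add_mem ha hb, lie_add _ _ _⟩
      | smul c x _ hx =>
        obtain ⟨a, ha, rfl⟩ := hx
        exact ⟨c • a, U.smul_mem _ ha, lie_smul _ _ _⟩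
    obtain ⟨y, hy, hyx⟩ := this
    exact ⟨⟨y, hy⟩, Subtype.ext hyx⟩
  have hinj := LinearMap.injective_iff_surjective.2 hsur
  have : (⟨u, hu⟩ : U) = 0 := hinj (by rw [map_zero]; exact Subtype.ext hc)
  have hu0 : u = 0 := congrArg Subtype.val this
  rw [hu0, add_zero]; exact hy

/-- index of parameters -/
abbrev par : Type := Fin (Module.finrank F A.H) ⊕ A.ι
noncomputable instance : Fintype A.par := by
  let := A.fin
  infer_instance
noncomputable instance : DecidableEq A.par := Classical.decEq _

/-- basis of the toral part -/
noncomputable def hb (i : Fin (Module.finrank F A.H)) : M F := (Module.finBasis F A.H i : M F)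
lemma hb_mem (i) : A.hb i ∈ A.H := (Module.finBasis F A.H i).2
lemma hb_span {h : M F} (hh : h ∈ A.H) : ∃ c : Fin (Module.finrank F A.H) → F, h = ∑ i, c i • A.hb i := by
  refine ⟨(Module.finBasis F A.H).repr ⟨h, hh⟩, ?_⟩
  have := congrArg Subtype.val ((Module.finBasis F A.H).sum_repr ⟨h, hh⟩)
  rw [Submodule.coe_sum] at this
  exact this.symm

/-- toral part of the parametrisation -/
noncomputable def th (x : A.par → F) : M F := ∑ i, x (Sum.inl i) • A.hb i
lemma th_mem (x : A.par → F) : A.th x ∈ A.H := Submodule.sum_mem _ fun i _ => A.H.smul_mem _ (A.hb_mem i)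

/-- the group element -/
noncomputable def gp (x : A.par → F) : List A.ι → Au F
  | [] => 1
  | i :: l => expA (x (Sum.inr i) • A.e i) (nil_smul (A.nil i) _) * gp x l

lemma gp_mem (x : A.par → F) (l : List A.ι) : A.gp x l ∈ A.grp := by
  induction l with
  | nil => exact A.grp.one_mem
  | cons i l ih => exact A.grp.mul_mem (Subgroup.subset_closure ⟨i, _, rfl⟩) ih

lemma expA_zero (e : M F) (he : IsNilpotent (ad F (M F) e)) (t : F) (ht : t = 0) (x : M F) :
    expA (t • e) (nil_smul he t) • x = x := by
  subst ht
  have he' := he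
  obtain ⟨K, hK⟩ := he'
  have hK1 : (ad F (M F) e) ^ (K + 1) = 0 := by rw [pow_succ, hK, zero_mul]
  rw [expA_smul e he hK1, Finset.sum_range_succ', Finset.sum_eq_zero]
  · simp
  · intro k _; simp

lemma hasD [DecidableEq A.ι] (b : A.par → F) (hb0 : ∀ i, b (Sum.inr i) = 0) (l : List A.ι) :
    A.gp b l • A.th b = A.th b ∧ HasD b (fun x => A.gp x l • A.th x)
      (Sum.elim A.hb (fun i => (l.count i : F) • ⁅A.e i, A.th b⁆)) := by
  induction l with
  | nil =>
    refine ⟨one_smul _ _, (HasD.lin (Sum.elim A.hb (fun _ => 0))).congr (fun x => ?_) (fun i => ?_)⟩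
    · let _ := A.fin
      have h1 := Fintype.sum_sum_type (fun i : A.par => x i • Sum.elim A.hb (fun _ => (0 : M F)) i)
      rw [gp, one_smul, th]
      convert h1 using 1
      simp
    · cases i <;> simp
  | cons i l ih =>
    constructor
    · rw [gp, mul_smul, ih.1, expA_zero _ (A.nil i) _ (hb0 i)]
    · refine (ih.2.exp (Sum.inr i) (hb0 i) (A.e i) (A.nil i)).congr (fun x => by rw [gp, mul_smul]) (fun j => ?_)
      cases j with
      | inl j => simp
      | inr j =>
        simp only [Sum.elim_inr, Sum.inr.injEq, List.count_cons, beq_iff_eq]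
        rw [ih.1]
        by_cases hij : i = j
        · subst hij; simp [add_smul]
        · simp [hij]

lemma exists_reg : ∃ h ∈ A.H, ∀ i, A.a i h ≠ 0 := by
  have := A.fin
  obtain ⟨h, hh⟩ := Module.Dual.exists_forall_ne_zero_of_forall_exists (fun i => (A.a i).domRestrict A.H)
    (fun i => by obtain ⟨h, hh, hne⟩ := A.ne i; exact ⟨⟨h, hh⟩, hne⟩)
  exact ⟨h, h.2, hh⟩

/-- polynomial data of a frame: generic surjectivity -/
lemma poly (hS : ∀ x ∈ S, ∀ y ∈ S, ⁅x, y⁆ ∈ S) {n : ℕ} (s : Module.Basis (Fin n) F S) (lc : Fin n → (M F →ₗ[F] F))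
    (hlc : ∀ j (x : S), lc j x = s.repr x j) :
    ∃ (g : (A.par → F) → Au F) (p : Fin n → MvPolynomial A.par F) (u : MvPolynomial A.par F),
      (∀ x, g x ∈ A.grp) ∧ (∀ j x, eval x (p j) = lc j (g x • A.th x)) ∧ Function.Injective (aeval (R := F) p) ∧ u ≠ 0 ∧
      ∀ x, eval x u ≠ 0 → ∀ i, A.a i (A.th x) ≠ 0 := by
  classical
  let _ := A.fin
  obtain ⟨h0, hh0, hreg⟩ := A.exists_reg
  obtain ⟨c, hc⟩ := A.hb_span hh0
  let b : A.par → F := Sum.elim c (fun _ => 0)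
  have hbt : A.th b = h0 := by rw [hc]; simp [th, b]
  let l : List A.ι := Finset.univ.toList
  obtain ⟨h1, h2⟩ := A.hasD b (fun _ => rfl) l
  set D : A.par → M F := Sum.elim A.hb (fun i => (l.count i : F) • ⁅A.e i, A.th b⁆) with hD
  choose p hp hp' using fun j => h2 (lc j)
  have hDS : ∀ i, D i ∈ S := by
    rintro (i | i)
    · exact A.H_le (A.hb_mem i)
    · exact S.smul_mem _ (hS _ (A.e_mem i) _ (A.H_le (A.th_mem b)))
  have hspan : ∀ y ∈ S, y ∈ Submodule.span F (Set.range D) := by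
    refine A.span.ge.trans ?_
    refine sup_le ?_ ?_
    · intro h hh
      obtain ⟨c, rfl⟩ := A.hb_span hh
      exact Submodule.sum_mem _ fun i _ => Submodule.smul_mem _ _ (Submodule.subset_span ⟨Sum.inl i, rfl⟩)
    · rw [Submodule.span_le]
      rintro _ ⟨i, rfl⟩
      have hi : D (Sum.inr i) = -((l.count i : F) * A.a i h0) • A.e i := by
        show (l.count i : F) • ⁅A.e i, A.th b⁆ = _
        rw [hbt, ← lie_skew, A.lie i h0 hh0]; module
      have hl : (l.count i : F) ≠ 0 := by
        have : 0 < l.count i := List.count_pos_iff.2 (by simp [l])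
        exact_mod_cast this.ne'
      have hx : -((l.count i : F) * A.a i h0) ≠ 0 := neg_ne_zero.2 (mul_ne_zero hl (hreg i))
      have : A.e i = (-((l.count i : F) * A.a i h0))⁻¹ • D (Sum.inr i) := by
        rw [hi, smul_smul, inv_mul_cancel₀ hx, one_smul]
      rw [this]
      exact Submodule.smul_mem _ _ (Submodule.subset_span ⟨_, rfl⟩)
  have hK : ∀ j, ∃ k : A.par → F, ∑ i, k i • D i = (s j : M F) := fun j =>
    (Submodule.mem_span_range_iff_exists_fun F).1 (hspan _ (s j).2)
  choose K hK using hK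
  refine ⟨fun x => A.gp x l, p, ∏ i : A.ι, ∑ k, C (A.a i (A.hb k)) * MvPolynomial.X (Sum.inl k), fun x => A.gp_mem x l, hp,
    aeval_inj p b (Matrix.of K) ?_, ?_, ?_⟩
  · ext j k
    simp only [Matrix.mul_apply, Matrix.of_apply, hp', Matrix.one_apply]
    have := congrArg (lc k) (hK j)
    rw [map_sum, hlc] at this
    simp only [map_smul, smul_eq_mul] at this
    rw [this, s.repr_self, Finsupp.single_apply]
  · intro h0'
    have h3 := congrArg (eval b) h0'
    rw [map_prod, map_zero, Finset.prod_eq_zero_iff] at h3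
    obtain ⟨i, -, hi⟩ := h3
    apply hreg i
    rw [← hbt, ← hi]
    simp [th, mul_comm]
  · intro x hx i
    rw [map_prod, Finset.prod_ne_zero_iff] at hx
    have := hx i (Finset.mem_univ i)
    simpa [th, mul_comm] using this

theorem conj [IsAlgClosed F] (hS : ∀ x ∈ S, ∀ y ∈ S, ⁅x, y⁆ ∈ S) (A B : Frame S) :
    ∃ g₁ ∈ A.grp, ∃ g₂ ∈ B.grp, ∀ z, g₁⁻¹ • z ∈ A.H ↔ g₂⁻¹ • z ∈ B.H := by
  classical
  let _ := A.fin
  let _ := B.fin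
  let s := Module.finBasis F S
  have hlc : ∀ j, ∃ l : M F →ₗ[F] F, ∀ x : S, l x = s.repr x j := fun j => by
    obtain ⟨l, hl⟩ := LinearMap.exists_extend (s.coord j)
    exact ⟨l, fun x => by rw [← s.coord_apply, ← hl]; rfl⟩
  choose lc hlc using hlc
  obtain ⟨g, p, u, hg, hp, hpi, hu, hu'⟩ := A.poly hS s lc hlc
  obtain ⟨g', q, v, hg', hq, hqi, hv, hv'⟩ := B.poly hS s lc hlc
  obtain ⟨x, y, hxy, hux, hvy⟩ := meet p q hpi hqi hu hv
  have hxS : g x • A.th x ∈ S := (A.grp_mem hS (hg x) _).2 (A.H_le (A.th_mem x))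
  have hyS : g' y • B.th y ∈ S := (B.grp_mem hS (hg' y) _).2 (B.H_le (B.th_mem y))
  have heq : g x • A.th x = g' y • B.th y := by
    have : (⟨_, hxS⟩ : S) = ⟨_, hyS⟩ := by
      apply s.repr.injective
      ext j
      rw [← hlc, ← hlc]
      show lc j (g x • A.th x) = lc j (g' y • B.th y)
      rw [← hp, ← hq, hxy]
    exact congrArg Subtype.val this
  have key : ∀ (A : Frame S) (g : Au F) (h : M F), g ∈ A.grp → h ∈ A.H → (∀ i, A.a i h ≠ 0) →
      ∀ z, g⁻¹ • z ∈ A.H ↔ z ∈ S ∧ ⁅g • h, z⁆ = 0 := by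
    intro A g h hg hh hr z
    have e1 : ⁅g • h, z⁆ = g • ⁅h, g⁻¹ • z⁆ := by rw [au_lie, smul_inv_smul]
    have e2 : z ∈ S ↔ g⁻¹ • z ∈ S := by rw [← A.grp_mem hS hg (g⁻¹ • z), smul_inv_smul]
    rw [e1, e2, smul_eq_zero_iff_eq]
    exact ⟨fun hz => ⟨A.H_le hz, A.comm _ hh _ hz⟩, fun hz => A.cent hh hr hz.1 hz.2⟩
  refine ⟨g x, hg x, g' y, hg' y, fun z => ?_⟩
  rw [key A _ _ (hg x) (A.th_mem x) (hu' x hux), key B _ _ (hg' y) (B.th_mem y) (hv' y hvy), heq]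

end Frame
end E8

namespace E8
open LieAlgebra LieModule

variable {F : Type} [Field F] [CharZero F]

lemma cor_inj {u v : Lam} (h : cor F u = cor F v) : u = v := by
  funext i
  have := congrFun h i
  simpa [cor] using this

lemma pr_eq {u v : Lam} (h : ∀ k : Fin 8 → F, pr u k = pr v k) : u = v := by
  by_contra hne
  obtain ⟨i, hi⟩ := exists_al_ne (sub_ne_zero.2 hne)
  apply hi
  have := h (cor F (al i))
  rw [pr_cor, pr_cor] at this
  rw [sub_eq_add_neg, bil_add_right, bil_neg_right]
  have := Int.cast_injective this
  omega

/-- evaluation at h as a homomorphism on the lattice -/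
def evH (k : Fin 8 → F) : Lam →+ F where
  toFun u := pr u k
  map_zero' := by simp [pr_apply, bil_zero_right]
  map_add' u v := pr_add u v k
lemma evH_apply (k : Fin 8 → F) (u : Lam) : evH k u = pr u k := rfl

lemma pr_sum (v : Lam) (b : Fin 8 → Lam) (k : Fin 8 → F) :
    pr (∑ i, v i • b i) k = ∑ i, (v i : F) * pr (b i) k := by
  rw [← evH_apply, map_sum]
  refine Finset.sum_congr rfl fun i _ => ?_
  rw [map_zsmul, zsmul_eq_mul, evH_apply]

/-- An automorphism preserving the Cartan subalgebra acts by a lattice isometry. -/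
lemma norm_isom {g : Au F} (hg : ∀ h, ∃ k, g • (H h : M F) = H k) : ∃ w : Lam ≃+ Lam, IsIsom w ∧
    (∀ v, g • (H (cor F v) : M F) = H (cor F (w v))) ∧
    (∀ v, IsRt v → ∃ c : F, c ≠ 0 ∧ g • E F v = c • E F (w v)) := by
  let K : (Fin 8 → F) →ₗ[F] (Fin 8 → F) := pH ∘ₗ g.lin ∘ₗ H
  have hK : ∀ h, g • (H h : M F) = H (K h) := fun h => by
    obtain ⟨k, hk⟩ := hg h
    have : K h = k := by
      change pH (g • (H h : M F)) = k
      rw [hk, pH_H]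
    rw [this, hk]
  have hKi : Function.Injective K := fun a b hab => by
    have : g • (H a : M F) = g • H b := by rw [hK, hK, hab]
    have := smul_left_cancel g this
    simpa using congrArg pH this
  have hKs : Function.Surjective K := LinearMap.surjective_of_injective hKi
  have key : ∀ v, IsRt v → ∃ u, IsRt u ∧ (∀ h, pr u (K h) = pr v h) ∧
      ∃ c : F, c ≠ 0 ∧ g • E F v = c • E F u := by
    intro v hv
    set y := g • E F v with hy
    have hy0 : y ≠ 0 := fun h0 => E_ne_zero (F := F) hv (by
      have := congrArg (fun z => g⁻¹ • z) h0
      simpa [hy] using this)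
    have hw : ∀ h, ⁅(H (K h) : M F), y⁆ = pr v h • y := fun h => by
      rw [hy, ← hK, ← au_lie, lie_HE, au_smul]
    have : ∃ u : R, co u y ≠ 0 := by
      by_contra! hc
      have h1 : y = H (pH y) := M_ext (by simp) (by intro v; rw [hc]; simp)
      have h2 := hw (cor F v)
      rw [h1, lie_HH, pr_cor, ← h1] at h2
      have : bil v v = 2 := hv
      rw [this] at h2
      have := smul_eq_zero.1 h2.symm
      rcases this with h | h
      · norm_num at h
      · exact hy0 h
    obtain ⟨u, hu⟩ := this
    have hpr : ∀ h, pr u.1 (K h) = pr v h := fun h => by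
      have := congrArg (co u) (hw h)
      rw [co_lie_H, (co u).map_smul (pr v h) y, smul_eq_mul] at this
      exact mul_right_cancel₀ hu this
    refine ⟨u.1, u.2, hpr, co u y, hu, wt_line u.2 fun i => ?_⟩
    obtain ⟨h, hh⟩ := hKs (cor F (al i))
    rw [← hh, hw, ← hpr, hh, pr_cor_al]
  choose! s hs1 hs2 hs3 using key
  have hneg : ∀ v, IsRt v → s (-v) = - s v := fun v hv => by
    apply pr_eq (F := F)
    intro k
    obtain ⟨h, rfl⟩ := hKs k
    rw [hs2 _ hv.neg, pr_neg, pr_neg, hs2 _ hv]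
  have hcor : ∀ v, IsRt v → K (cor F v) = cor F (s v) := fun v hv => by
    obtain ⟨c, hc, h1⟩ := hs3 v hv
    obtain ⟨d, hd, h2⟩ := hs3 (-v) hv.neg
    have h3 := congrArg (fun z => g • z) (lie_opp (F := F) hv)
    simp only [au_lie, smul_neg] at h3
    rw [h1, h2, hneg v hv, smul_lie, lie_smul, lie_opp (hs1 v hv), hK] at h3
    have h4 := congrArg pH h3
    simp only [map_smul, map_neg, pH_H] at h4
    have h5 : K (cor F v) = (c * d) • cor F (s v) := by
      rw [← neg_inj, ← h4, smul_neg, smul_neg, smul_smul]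
    have h6 := hs2 v hv (cor F v)
    rw [h5, map_smul, pr_cor, pr_cor] at h6
    have e1 : bil v v = 2 := hv
    have e2 : bil (s v) (s v) = 2 := hs1 v hv
    rw [e1, e2, smul_eq_mul] at h6
    have h7 : c * d = 1 := by
      apply mul_right_cancel₀ (b := ((2 : ℤ) : F)) (by norm_num)
      rw [h6, one_mul]
    rw [h5, h7, one_smul]
  let w0 : Lam →+ Lam :=
    { toFun := fun v => ∑ i, v i • s (al i)
      map_zero' := by simp
      map_add' := fun u v => by simp [add_smul, Finset.sum_add_distrib] }
  have hw0 : ∀ v, w0 v = ∑ i, v i • s (al i) := fun v => rfl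
  have hwc : ∀ v, K (cor F v) = cor F (w0 v) := fun v => by
    have h1 : cor F v = ∑ i, (v i : F) • cor F (al i) := cor_sum_al (AddEquiv.refl _) v
    have h2 : cor F (w0 v) = ∑ i, (v i : F) • cor F (s (al i)) := by
      rw [hw0]; funext j; simp [cor, Finset.sum_apply]
    rw [h1, h2, map_sum]
    refine Finset.sum_congr rfl fun i _ => ?_
    rw [map_smul, hcor _ (isRt_al i)]
  have hws : ∀ v, IsRt v → w0 v = s v := fun v hv => cor_inj (F := F) (by rw [← hwc, hcor v hv])
  have hpw : ∀ v h, pr (w0 v) (K h) = pr v h := fun v h => by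
    rw [hw0, pr_sum]
    conv_rhs => rw [eq_sum_al v, pr_sum]
    exact Finset.sum_congr rfl fun i _ => by rw [hs2 _ (isRt_al i)]
  have hiso : ∀ u v, bil (w0 u) (w0 v) = bil u v := fun u v => by
    have := hpw v (cor F u)
    rw [hwc, pr_cor, pr_cor] at this
    exact_mod_cast this
  have hinj : Function.Injective w0 := by
    rw [injective_iff_map_eq_zero]
    intro a ha
    apply eq_zero_of_bil_self
    rw [← hiso, ha, bil_zero_left]
  have hsurj : Function.Surjective w0 := by
    have h1 : Function.Surjective (fun v : R => (⟨w0 v.1, by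
        have := hs1 v.1 v.2; rwa [← hws v.1 v.2] at this⟩ : R)) := by
      apply Finite.surjective_of_injective
      intro a b hab
      exact Subtype.ext (hinj (congrArg Subtype.val hab))
    intro v
    rw [eq_sum_al v]
    have : ∀ i, ∃ u, w0 u = al i := fun i => by
      obtain ⟨u, hu⟩ := h1 ⟨al i, isRt_al i⟩
      exact ⟨u.1, congrArg Subtype.val hu⟩
    choose u hu using this
    exact ⟨∑ i, v i • u i, by rw [map_sum]; simp only [map_zsmul, hu]⟩
  refine ⟨AddEquiv.ofBijective w0 ⟨hinj, hsurj⟩, hiso, fun v => by rw [hK, hwc]; rfl, fun v hv => ?_⟩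
  obtain ⟨c, hc, h⟩ := hs3 v hv
  exact ⟨c, hc, by rw [h, ← hws v hv]; rfl⟩

lemma twoRho (v : Lam) : bil (∑ a ∈ posF, a) v = 2 * ht v := by
  have h : ∀ i, bil (∑ a ∈ posF, a) (al i) = 2 := by decide +kernel
  rw [bil_eq_sum, ht, Finset.mul_sum]
  exact Finset.sum_congr rfl fun i _ => by rw [h]; ring

set_option synthInstance.maxSize 4000 in
set_option synthInstance.maxHeartbeats 400000 in
lemma diag_dec : ∀ a0 a2, bil (al a0) (al a2) = -1 → ∀ a3, bil (al a2) (al a3) = -1 → bil (al a0) (al a3) = 0 →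
   ∀ a1, bil (al a1) (al a3) = -1 → bil (al a1) (al a2) = 0 → ∀ a4, bil (al a4) (al a3) = -1 → bil (al a4) (al a2) = 0 →
   bil (al a4) (al a1) = 0 → ∀ a5, bil (al a4) (al a5) = -1 → bil (al a5) (al a3) = 0 →
   ∀ a6, bil (al a6) (al a5) = -1 → bil (al a6) (al a4) = 0 → ∀ a7, bil (al a7) (al a6) = -1 → bil (al a7) (al a5) = 0 →
   a0 = 0 ∧ a1 = 1 ∧ a2 = 2 ∧ a3 = 3 ∧ a4 = 4 ∧ a5 = 5 ∧ a6 = 6 ∧ a7 = 7 := by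
  decide +kernel


lemma al_mem_posF : ∀ i, al i ∈ posF := by decide +kernel

/-- an isometry preserving positive roots is the identity -/
lemma isom_pos {w : Lam ≃+ Lam} (hw : IsIsom w) (hp : ∀ v ∈ posF, w v ∈ posF) : w = AddEquiv.refl _ := by
  have hrho : w (∑ a ∈ posF, a) = ∑ a ∈ posF, a := by
    rw [map_sum]
    refine Finset.sum_bij (fun a _ => w a) hp (fun a _ b _ h => w.injective h) ?_ (fun a _ => rfl)
    intro b hb
    obtain ⟨a, ha, h⟩ := Finset.surj_on_of_inj_on_of_card_le (s := posF) (t := posF) (fun a _ => w a) hp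
      (fun a b _ _ h => w.injective h) le_rfl b hb
    exact ⟨a, ha, h.symm⟩
  have hht : ∀ v, ht (w v) = ht v := fun v => by
    have h1 := twoRho (w v)
    rw [← hrho, hw, twoRho] at h1
    omega
  have hal : ∀ i, ∃ j, w (al i) = al j := by
    intro i
    have h1 : ht (w (al i)) = 1 := by rw [hht]; revert i; decide
    have hi : al i ∈ posF := al_mem_posF i
    have h2 := (mem_posF.1 (hp _ hi)).2
    set u := w (al i)
    have : ∃ j, u j ≠ 0 := by
      by_contra! hc
      rw [ht, Finset.sum_eq_zero (fun j _ => hc j)] at h1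
      omega
    obtain ⟨j, hj⟩ := this
    refine ⟨j, ?_⟩
    have h3 : ht u = u j + ∑ k ∈ Finset.univ.erase j, u k := (Finset.add_sum_erase _ _ (Finset.mem_univ j)).symm
    have h4 : 0 ≤ ∑ k ∈ Finset.univ.erase j, u k := Finset.sum_nonneg fun k _ => h2 k
    have h5 := h2 j
    have h6 : ∑ k ∈ Finset.univ.erase j, u k = 0 := by omega
    have h7 : u j = 1 := by omega
    rw [Finset.sum_eq_zero_iff_of_nonneg (fun k _ => h2 k)] at h6
    funext k
    by_cases hk : k = j
    · subst hk; simp [h7, al]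
    · rw [h6 k (by simp [hk])]; simp [al, hk]
  choose p hp using hal
  have hb : ∀ i j, bil (al (p i)) (al (p j)) = bil (al i) (al j) := fun i j => by rw [← hp, ← hp, hw]
  have hq := diag_dec (p 0) (p 2) ((hb _ _).trans (by decide)) (p 3) ((hb _ _).trans (by decide)) ((hb _ _).trans (by decide))
    (p 1) ((hb _ _).trans (by decide)) ((hb _ _).trans (by decide)) (p 4) ((hb _ _).trans (by decide)) ((hb _ _).trans (by decide))
    ((hb _ _).trans (by decide)) (p 5) ((hb _ _).trans (by decide)) ((hb _ _).trans (by decide))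
    (p 6) ((hb _ _).trans (by decide)) ((hb _ _).trans (by decide)) (p 7) ((hb _ _).trans (by decide)) ((hb _ _).trans (by decide))
  have hpi : ∀ i, p i = i := by
    intro i
    obtain ⟨h0, h1, h2, h3, h4, h5, h6, h7⟩ := hq
    fin_cases i <;> assumption
  ext1 v
  rw [isom_expand w v]
  simp only [hp, hpi]
  exact (eq_sum_al v).symm

/-- An automorphism fixing a regular element of the Cartan subalgebra is in the torus. -/
lemma reg_tor {g : Au F} {h : Fin 8 → F} (hreg : ∀ v, IsRt v → pr v h ≠ 0) (hfix : g • (H h : M F) = H h) :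
    ∃ t, g = tor t := by
  have hn : ∀ k, ∃ k', g • (H k : M F) = H k' := fun k => by
    refine ⟨pH (g • (H k : M F)), M_ext (by simp) fun v => ?_⟩
    have h1 : ⁅(H h : M F), g • (H k : M F)⁆ = 0 := by
      conv_lhs => rw [← hfix]
      rw [← au_lie, lie_HH, smul_zero]
    have h2 := congrArg (co v) h1
    rw [co_lie_H, map_zero] at h2
    rw [co_H]
    exact (mul_eq_zero.1 h2).resolve_left (hreg _ v.2)
  obtain ⟨s, hs, hH, hE⟩ := norm_isom hn
  have hsl : ∀ v, IsRt v → pr (s v) h = pr v h := fun v hv => by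
    obtain ⟨c, hc, h1⟩ := hE v hv
    have h2 := congrArg (fun z => g • z) (lie_HE (F := F) h v)
    simp only [au_lie, au_smul] at h2
    rw [hfix, h1, lie_smul, lie_HE, smul_comm] at h2
    have h3 := congrArg (co ⟨s v, hs.isRt hv⟩) h2
    simpa [hc, co_E, hs.isRt hv] using h3
  obtain ⟨φ, hφ⟩ := Module.exists_dual_forall_apply_ne_zero (K := ℚ) (fun v : R => pr v.1 h) (fun v => hreg _ v.2)
  let l : Lam →+ ℚ := φ.toAddMonoidHom.comp (evH h)
  have hl : ∀ v, l v = φ (pr v h) := fun v => rfl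
  obtain ⟨w, hw, hdom⟩ := dominance l
  have hpos : ∀ v, IsRt v → (v ∈ posF ↔ 0 < l (w v)) := by
    have h1 : ∀ v, l (w v) = ∑ i, (v i : ℚ) * l (w (al i)) := fun v => by
      conv_lhs => rw [isom_expand w v, map_sum]
      exact Finset.sum_congr rfl fun i _ => by rw [map_zsmul, zsmul_eq_mul]
    intro v hv
    have hne : l (w v) ≠ 0 := hφ ⟨w v, hw.isRt hv⟩
    constructor
    · intro hvp
      refine lt_of_le_of_ne ?_ hne.symm
      rw [h1]
      exact Finset.sum_nonneg fun i _ => mul_nonneg (by exact_mod_cast (mem_posF.1 hvp).2 i) (hdom i)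
    · intro hlt
      rcases hv.nonneg_or_nonpos with h2 | h2
      · exact mem_posF.2 ⟨hv, h2⟩
      · exfalso
        rw [h1] at hlt
        have : ∑ i, (v i : ℚ) * l (w (al i)) ≤ 0 := Finset.sum_nonpos fun i _ =>
          mul_nonpos_of_nonpos_of_nonneg (by exact_mod_cast h2 i) (hdom i)
        linarith
  have hid := isom_pos (w := (w.trans s).trans w.symm) ((hw.trans hs).trans hw.symm) (fun v hv => by
    have hv' := (mem_posF.1 hv).1
    rw [hpos _ (((hw.trans hs).trans hw.symm).isRt hv')]
    simp only [AddEquiv.coe_trans, Function.comp_apply, AddEquiv.apply_symm_apply]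
    rw [hl, hsl _ (hw.isRt hv'), ← hl]
    exact (hpos v hv').1 hv)
  have hsid : ∀ v, s v = v := fun v => by
    have := DFunLike.congr_fun hid (w.symm v)
    simp only [AddEquiv.coe_trans, Function.comp_apply, AddEquiv.apply_symm_apply, AddEquiv.refl_apply] at this
    exact w.symm.injective this
  apply eq_tor
  intro k
  have hk : (H k : M F) = ∑ i, k i • H (cor F (al i)) := by
    have h1 : k = ∑ i, k i • cor F (al i) := by
      funext j; simp [cor, al, Finset.sum_apply, Pi.single_apply]
    conv_lhs => rw [h1, map_sum]
    simp only [map_smul]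
  rw [hk, Finset.smul_sum]
  refine Finset.sum_congr rfl fun i _ => ?_
  rw [au_smul, hH, hsid]

end E8

namespace E8
open LieAlgebra LieModule

variable {F : Type} [Field F] [CharZero F]

lemma H_expand (k : Fin 8 → F) : (H k : M F) = ∑ i, k i • H (cor F (al i)) := by
  have h1 : k = ∑ i, k i • cor F (al i) := by
    funext j; simp [cor, al, Finset.sum_apply, Pi.single_apply]
  conv_lhs => rw [h1, map_sum]
  simp only [map_smul]

/-- fixed subspace of an automorphism -/
noncomputable def fixS (g : Au F) : Submodule F (M F) := LinearMap.eqLocus g.lin LinearMap.id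
lemma mem_fixS {g : Au F} {x : M F} : x ∈ fixS g ↔ g • x = x := by
  simp [fixS, LinearMap.mem_eqLocus, Au.lin_apply]

lemma fixS_conj (g s : Au F) : Module.finrank F (fixS (g * s * g⁻¹)) = Module.finrank F (fixS s) := by
  have : fixS (g * s * g⁻¹) = (fixS s).map ((g : M F ≃ₗ[F] M F) : M F →ₗ[F] M F) := by
    ext x
    rw [mem_fixS, Submodule.mem_map]
    constructor
    · intro h
      refine ⟨g⁻¹ • x, mem_fixS.2 ?_, smul_inv_smul g x⟩
      conv_rhs => rw [← h]
      simp [mul_smul]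
    · rintro ⟨y, hy, rfl⟩
      change (g * s * g⁻¹) • (g • y) = g • y
      rw [mul_smul, inv_smul_smul, mul_smul, mem_fixS.1 hy]
  rw [this]
  exact LinearEquiv.finrank_map_eq (g : M F ≃ₗ[F] M F) (fixS s)

open Classical in
lemma fixS_tor (t : Fin 8 → Fˣ) : Module.finrank F (fixS (tor t)) =
    8 + (rtF.filter (fun v => chi t v = 1)).card := by
  let S : Set (Fin 8 ⊕ R) := {s | ∀ v, s = Sum.inr v → chi t v.1 = 1}
  have h1 : fixS (tor t) = Submodule.span F (Set.range (fun s : S => (basM F s.1 : M F))) := by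
    apply le_antisymm
    · intro x hx
      rw [mem_fixS] at hx
      have h2 : ∀ v : R, chi t v.1 ≠ 1 → co v x = 0 := fun v hv => by
        have h3 : co v (tor t • x) = (chi t v.1 : F) * co v x := by
          have : co v ∘ₗ (tor t).lin = (chi t v.1 : F) • co v := by
            apply M_hom_ext
            · intro k; simp [Au.lin_apply, tor_H]
            · intro u hu
              simp only [LinearMap.comp_apply, Au.lin_apply, tor_E t hu, map_smul, LinearMap.smul_apply, co_E]
              split_ifs with h
              · rw [h]
              · simp
          exact LinearMap.congr_fun this x
        rw [hx] at h3
        by_contra hne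
        apply hv
        have : (chi t v.1 : F) = 1 := by
          apply mul_right_cancel₀ hne
          rw [← h3, one_mul]
        exact Units.ext this
      rw [M_expand x, H_expand]
      apply Submodule.add_mem
      · refine Submodule.sum_mem _ fun i _ => Submodule.smul_mem _ _ (Submodule.subset_span ⟨⟨Sum.inl i, by
          intro v hv; cases hv⟩, ?_⟩)
        change basM F (Sum.inl i) = _
        rw [basM_inl]; congr 1; funext j; simp [cor, al, Pi.single_apply]
      · refine Submodule.sum_mem _ fun v _ => ?_
        by_cases hv : chi t v.1 = 1
        · refine Submodule.smul_mem _ _ (Submodule.subset_span ⟨⟨Sum.inr v, by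
            rintro u hu; cases hu; exact hv⟩, ?_⟩)
          simp [basM_inr]
        · rw [h2 v hv, zero_smul]; exact Submodule.zero_mem _
    · rw [Submodule.span_le]
      rintro _ ⟨⟨s, hs⟩, rfl⟩
      rw [SetLike.mem_coe, mem_fixS]
      rcases s with i | v
      · simp [basM_inl, tor_H]
      · have := hs v rfl
        simp [basM_inr, tor_E t v.2, this]
  rw [h1, show (fun s : S => (basM F s.1 : M F)) = basM F ∘ Subtype.val from rfl,
    finrank_span_eq_card ((basM F).linearIndependent.comp _ Subtype.val_injective)]
  have e : S ≃ Fin 8 ⊕ {v // v ∈ rtF.filter (fun v => chi t v = 1)} :=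
    { toFun := fun s => match s with
        | ⟨Sum.inl i, _⟩ => Sum.inl i
        | ⟨Sum.inr v, h⟩ => Sum.inr ⟨v.1, by rw [Finset.mem_filter, mem_rtF]; exact ⟨v.2, h v rfl⟩⟩
      invFun := fun s => match s with
        | Sum.inl i => ⟨Sum.inl i, by intro v hv; cases hv⟩
        | Sum.inr v => ⟨Sum.inr ⟨v.1, mem_rtF.1 (Finset.mem_filter.1 v.2).1⟩, by
            rintro u hu; cases hu; exact (Finset.mem_filter.1 v.2).2⟩
      left_inv := by rintro ⟨i | v, h⟩ <;> rfl
      right_inv := by rintro (i | v) <;> rfl }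
  rw [Fintype.card_congr e, Fintype.card_sum, Fintype.card_fin, Fintype.card_coe]

lemma count_neg (P : Lam → Prop) [DecidablePred P] (hP : ∀ v, P (-v) ↔ P v) :
    (rtF.filter P).card = 2 * (posF.filter P).card := by
  unfold rtF
  rw [Finset.filter_union, Finset.card_union_of_disjoint, Finset.filter_image, Finset.card_image_of_injective _ neg_injective]
  · simp only [hP]; ring
  · rw [Finset.disjoint_left]
    intro v hv hv'
    simp only [Finset.mem_filter, Finset.mem_image, mem_posF] at hv hv'
    obtain ⟨⟨u, ⟨hu, hu'⟩, rfl⟩, _⟩ := hv'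
    apply hu.ne_zero
    funext i
    have h1 := hv.1.2 i
    have h2 := hu' i
    simp only [Pi.neg_apply] at h1
    simp; omega

/-- fundamental weights -/
def om : Fin 8 → Lam := ![![4, 5, 7, 10, 8, 6, 4, 2], ![5, 8, 10, 15, 12, 9, 6, 3], ![7, 10, 14, 20, 16, 12, 8, 4],
  ![10, 15, 20, 30, 24, 18, 12, 6], ![8, 12, 16, 24, 20, 15, 10, 5], ![6, 9, 12, 18, 15, 12, 8, 4],
  ![4, 6, 8, 12, 10, 8, 6, 3], ![2, 3, 4, 6, 5, 4, 3, 2]]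

lemma bil_om : ∀ i j, bil (om i) (al j) = if i = j then 1 else 0 := by decide +kernel

/-- highest root -/
def hr : Lam := ![2, 3, 4, 6, 5, 4, 3, 2]
lemma isRt_hr : IsRt hr := by unfold IsRt; decide

lemma count_dec : ∀ n0 ∈ Finset.range 3, ∀ n1 ∈ Finset.range 2, ∀ n2 ∈ Finset.range 2, ∀ n5 ∈ Finset.range 2,
   ∀ n6 ∈ Finset.range 2, ∀ n7 ∈ Finset.range 3, 2 * n0 + 3 * n1 + 4 * n2 + 4 * n5 + 3 * n6 + 2 * n7 ≤ 4 →
   (posF.filter (fun v => (4 : ℤ) ∣ n0 * v 0 + n1 * v 1 + n2 * v 2 + n5 * v 5 + n6 * v 6 + n7 * v 7)).card = 29 →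
   n0 = 0 ∧ n1 = 0 ∧ n2 = 1 ∧ n5 = 0 ∧ n6 = 0 ∧ n7 = 0 := by decide +kernel


/-- torus element attached to a lattice vector -/
noncomputable def torB (u : Fˣ) (m : Lam) : Au F := tor (fun i => u ^ (bil m (al i)))

lemma chi_torB (u : Fˣ) (m v : Lam) : chi (fun i => u ^ (bil m (al i))) v = u ^ (bil m v) := by
  have h : ∀ s : Finset (Fin 8), ∏ i ∈ s, (u ^ bil m (al i)) ^ v i = u ^ ∑ i ∈ s, v i * bil m (al i) := by
    intro s
    induction s using Finset.induction_on with
    | empty => simp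
    | insert a s ha ih => rw [Finset.prod_insert ha, Finset.sum_insert ha, ih, zpow_add, ← zpow_mul, mul_comm (v a)]
  rw [chi, bil_eq_sum m v, h]

lemma torB_H (u : Fˣ) (m : Lam) (h : Fin 8 → F) : torB u m • (H h : M F) = H h := tor_H _ _
lemma torB_E (u : Fˣ) (m : Lam) {v : Lam} (hv : IsRt v) :
    torB u m • E F v = ((u ^ (bil m v) : Fˣ) : F) • E F v := by
  rw [torB, tor_E _ hv, chi_torB]

lemma torB_add4 {u : Fˣ} (hu : u ^ 4 = 1) (m a : Lam) : torB u (m - (4 : ℤ) • a) = torB u m := by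
  apply au_ext'
  · intro k; rw [torB_H, torB_H]
  · intro v hv
    rw [torB_E _ _ hv, torB_E _ _ hv, sub_eq_add_neg, bil_add_left, bil_neg_left, bil_smul_left, zpow_add, zpow_neg,
      zpow_mul]
    have : u ^ (4 : ℤ) = 1 := by exact_mod_cast hu
    rw [this]; simp

lemma torB_conj (u : Fˣ) (m : Lam) {w : Lam ≃+ Lam} (hw : IsIsom w) : ∃ g : Au F,
    g * torB u m * g⁻¹ = torB u (w m) := by
  obtain ⟨g, h1, h2⟩ := exists_lift (F := F) hw
  refine ⟨g, ?_⟩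
  rw [mul_inv_eq_iff_eq_mul]
  apply au_ext'
  · intro k
    rw [mul_smul, mul_smul, torB_H, H_expand k, Finset.smul_sum, Finset.smul_sum]
    refine Finset.sum_congr rfl fun i _ => ?_
    rw [au_smul, au_smul, h1, torB_H]
  · intro v hv
    obtain ⟨c, hc, h⟩ := h2 v hv
    rw [mul_smul, mul_smul, torB_E _ _ hv, au_smul, h, au_smul, torB_E _ _ (hw.isRt hv), hw, smul_comm]

/-- classification of order four torus elements with 66-dimensional fixed algebra -/
lemma tor_kac {u : Fˣ} (hu : u ^ 2 = -1) {t : Fin 8 → Fˣ} (h4 : tor t ^ 4 = (1 : Au F))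
    (hd : Module.finrank F (fixS (tor t)) = 66) : ∃ g : Au F, g * tor t * g⁻¹ = torB u (om 2) := by
  have hu4 : u ^ 4 = 1 := by
    have : u ^ 4 = (u ^ 2) ^ 2 := by rw [← pow_mul]
    rw [this, hu]; simp
  have huF : (u : F) ^ 2 = -1 := by
    have := congrArg (fun z : Fˣ => (z : F)) hu
    simpa using this
  have hz : ∀ n : ℤ, u ^ n = 1 ↔ (4 : ℤ) ∣ n := by
    intro n
    constructor
    · intro h
      have h1 : orderOf u = 4 := by
        have := orderOf_eq_prime_pow (x := u) (p := 2) (n := 1) (by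
          norm_num; rw [hu]; intro h
          have := congrArg (fun z : Fˣ => (z : F)) h
          simp at this
          norm_num [neg_eq_iff_add_eq_zero] at this) (by norm_num; exact hu4)
        simpa using this
      have := orderOf_dvd_iff_zpow_eq_one.2 h
      rw [h1] at this; exact_mod_cast this
    · rintro ⟨k, rfl⟩
      rw [zpow_mul]
      have : u ^ (4 : ℤ) = 1 := by exact_mod_cast hu4
      rw [this, one_zpow]
  have ht4 : ∀ i, t i ^ 4 = 1 := by
    intro i
    have h1 : (tor t ^ 4) • E F (al i) = E F (al i) := by rw [h4, one_smul]
    have h2 : (tor t ^ 4) • E F (al i) = ((t i : F) ^ 4) • E F (al i) := by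
      have : tor t ^ 4 = tor t * (tor t * (tor t * tor t)) := by
        rw [pow_succ', pow_succ', pow_succ', pow_one]
      rw [this]
      simp only [mul_smul, tor_E t (isRt_al i), au_smul, chi_al]
      simp only [smul_smul]
      congr 1; ring
    rw [h1] at h2
    have h3 := congrArg (co ⟨al i, isRt_al i⟩) h2
    rw [map_smul, co_E, if_pos rfl] at h3
    apply Units.ext
    push_cast
    simpa using h3.symm
  have hm : ∀ i, ∃ m : ℤ, t i = u ^ m := by
    intro i
    have h1 : ((t i : F) - 1) * ((t i : F) + 1) * (((t i : F) - u) * ((t i : F) + u)) = 0 := by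
      have h2 : (t i : F) ^ 4 = 1 := by
        have := congrArg (fun z : Fˣ => (z : F)) (ht4 i)
        simpa using this
      linear_combination h2 + (-(t i : F) ^ 2 + 1) * huF
    rcases mul_eq_zero.1 h1 with h | h <;> rcases mul_eq_zero.1 h with h | h
    · exact ⟨0, Units.ext (by simpa using sub_eq_zero.1 h)⟩
    · exact ⟨2, Units.ext (by push_cast; rw [show ((u : F) ^ (2 : ℤ)) = (u : F) ^ 2 by norm_cast, huF]; exact eq_neg_of_add_eq_zero_left h)⟩
    · exact ⟨1, Units.ext (by simpa using sub_eq_zero.1 h)⟩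
    · exact ⟨3, Units.ext (by
        push_cast; rw [show ((u : F) ^ (3 : ℤ)) = (u : F) ^ 3 by norm_cast, pow_succ, huF]
        rw [eq_neg_of_add_eq_zero_left h]; ring)⟩
  choose m hm using hm
  have hB : tor t = torB u (∑ i, m i • om i) := by
    unfold torB
    congr 1
    funext j
    rw [hm]
    congr 1
    rw [bil_comm]
    have : ∀ s : Finset (Fin 8), bil (al j) (∑ i ∈ s, m i • om i) = ∑ i ∈ s, m i * bil (al j) (om i) := by
      intro s
      induction s using Finset.induction_on with
      | empty => simp [bil_zero_right]
      | insert a s ha ih => rw [Finset.sum_insert ha, Finset.sum_insert ha, bil_add_right, ih, bil_smul_right]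
    rw [this, Finset.sum_eq_single j]
    · rw [bil_comm, bil_om, if_pos rfl, mul_one]
    · intro i _ hij; rw [bil_comm, bil_om, if_neg hij, mul_zero]
    · simp
  -- minimal norm
  let S : Set Lam := {m | ∃ g : Au F, g * tor t * g⁻¹ = torB u m}
  obtain ⟨m0, hm0, hmin⟩ : ∃ m0 ∈ S, ∀ m1 ∈ S, bil m0 m0 ≤ bil m1 m1 := by
    have hne : S.Nonempty := ⟨_, 1, by rw [← hB]; simp⟩
    refine ⟨Function.argminOn (fun m => (bil m m).toNat) S hne, Function.argminOn_mem _ _ _, fun m1 h1 => ?_⟩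
    have := Function.argminOn_le (fun m => (bil m m).toNat) S h1
    have h2 := bil_self_nonneg m1
    have h3 := bil_self_nonneg (Function.argminOn (fun m => (bil m m).toNat) S hne)
    omega
  have hmin4 : ∀ m1 ∈ S, bil m1 m1 = bil m0 m0 → ∀ a, IsRt a → bil m1 a ≤ 4 := by
    intro m1 h1 h2 a ha
    have h3 : m1 - (4 : ℤ) • a ∈ S := by
      obtain ⟨g, hg⟩ := h1
      exact ⟨g, by rw [hg, torB_add4 hu4]⟩
    have h4 := hmin _ h3
    have h5 : bil (m1 - (4 : ℤ) • a) (m1 - (4 : ℤ) • a) = bil m1 m1 - 8 * bil m1 a + 16 * bil a a := by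
      simp only [sub_eq_add_neg, bil_add_left, bil_add_right, bil_neg_left, bil_neg_right, bil_smul_left, bil_smul_right]
      rw [bil_comm a m1]; ring
    have h6 : bil a a = 2 := ha
    rw [h5, h6, h2] at h4
    omega
  obtain ⟨w, hw, hdom⟩ := dominance
    { toFun := fun v => (bil m0 v : ℚ), map_zero' := by simp [bil_zero_right], map_add' := fun a b => by
        simp [bil_add_right] }
  set n := w.symm m0 with hn
  have hnS : n ∈ S := by
    obtain ⟨g, hg⟩ := hm0
    obtain ⟨k, hk⟩ := torB_conj u m0 hw.symm
    refine ⟨k * g, ?_⟩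
    rw [← hk, ← hg]; group
  have hn0 : ∀ i, 0 ≤ bil n (al i) := by
    intro i
    have := hdom i
    simp only [AddMonoidHom.coe_mk, ZeroHom.coe_mk] at this
    rw [hn, ← hw]
    simpa using this
  have hn4 := hmin4 n hnS (hw.symm _ _) hr isRt_hr
  rw [bil_eq_sum] at hn4
  obtain ⟨g, hg⟩ := hnS
  refine ⟨g, hg.trans ?_⟩
  have hcnt : (posF.filter (fun v => (4 : ℤ) ∣ bil n v)).card = 29 := by
    have h1 := fixS_conj g (tor t)
    rw [hg, hd, torB, fixS_tor] at h1
    simp only [chi_torB, hz] at h1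
    rw [count_neg _ (by intro v; rw [bil_neg_right, dvd_neg])] at h1
    omega
  have hk : ∀ i, ∃ k : ℕ, bil n (al i) = k := fun i => ⟨_, (Int.toNat_of_nonneg (hn0 i)).symm⟩
  choose k hk using hk
  simp only [hk, bil_eq_sum n] at hcnt hn4
  simp only [Fin.sum_univ_eight, hr] at hcnt hn4
  simp at hn4
  have h3 : k 3 = 0 := by omega
  have h4 : k 4 = 0 := by omega
  have := count_dec (k 0) (by rw [Finset.mem_range]; omega) (k 1) (by rw [Finset.mem_range]; omega)
    (k 2) (by rw [Finset.mem_range]; omega) (k 5) (by rw [Finset.mem_range]; omega)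
    (k 6) (by rw [Finset.mem_range]; omega) (k 7) (by rw [Finset.mem_range]; omega) (by omega) (by
      rw [← hcnt]
      refine congrArg Finset.card (Finset.filter_congr fun v _ => ?_)
      rw [h3, h4]
      have e : (k 0 : ℤ) * v 0 + k 1 * v 1 + k 2 * v 2 + k 5 * v 5 + k 6 * v 6 + k 7 * v 7 =
        v 0 * k 0 + v 1 * k 1 + v 2 * k 2 + v 3 * (0 : ℕ) + v 4 * (0 : ℕ) + v 5 * k 5 + v 6 * k 6 + v 7 * k 7 := by
        push_cast; ring
      rw [e])
  obtain ⟨a0, a1, a2, a5, a6, a7⟩ := this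
  have hfin : ∀ i, bil n (al i) = bil (om 2) (al i) := by
    intro i
    rw [bil_om, hk]
    fin_cases i <;> simp [a0, a1, a2, h3, h4, a5, a6, a7]
  unfold torB
  simp only [hfin]

end E8

namespace E8
open LieAlgebra LieModule

variable {F : Type} [Field F] [CharZero F]

/-- the Killing form -/

lemma ad_inj {x y : M F} (h : ad F (M F) x = ad F (M F) y) : x = y := by
  have h0 : ad F (M F) (x - y) = 0 := by rw [map_sub, h, sub_self]
  have h1 : LieDerivation.ad F (M F) (x - y) = 0 := by
    ext z
    have := LinearMap.congr_fun h0 z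
    simpa using this
  exact sub_eq_zero.1 ((LieDerivation.IsKilling.ad_apply_eq_zero_iff (R := F) (L := M F) (x - y)).1 h1)

/-- Jordan decomposition in the Lie algebra -/
lemma jordan [IsAlgClosed F] (y : M F) : ∃ s n : M F, y = s + n ∧ IsNilpotent (ad F (M F) n) ∧
    (∀ T : M F →ₗ[F] M F, Commute (ad F (M F) y) T → Commute (ad F (M F) s) T) ∧
    (∀ (z : M F) (k : ℕ), ((ad F (M F) y) ^ k) z = 0 → ⁅s, z⁆ = 0) := by
  obtain ⟨N, -, S, hS1, hN, hS, hSN⟩ := (ad F (M F) y).exists_isNilpotent_isSemisimple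
  have hS0 : Commute (ad F (M F) y) S := Algebra.commute_of_mem_adjoin_self hS1
  have hN' : IsNilpotent (ad F (M F) y - S) := by rwa [hSN, add_sub_cancel_right]
  have aux {μ : F} {z : M F} (hz : z ∈ (ad F (M F) y).maxGenEigenspace μ) : S z = μ • z := 
    Module.End.apply_eq_of_mem_of_comm_of_isFinitelySemisimple_of_isNil hz hS0 hS.isFinitelySemisimple hN'
  have h_der (a b : M F) : S ⁅a, b⁆ = ⁅S a, b⁆ + ⁅a, S b⁆ := by
    have ha : a ∈ ⨆ μ : F, (ad F (M F) y).maxGenEigenspace μ := by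
      rw [Module.End.iSup_maxGenEigenspace_eq_top]; trivial
    have hb : b ∈ ⨆ μ : F, (ad F (M F) y).maxGenEigenspace μ := by
      rw [Module.End.iSup_maxGenEigenspace_eq_top]; trivial
    induction ha using Submodule.iSup_induction' with
    | mem μ a ha =>
      induction hb using Submodule.iSup_induction' with
      | mem ν b hb =>
        rw [aux ha, aux hb, aux (lie_mem_maxGenEigenspace_toEnd ha hb), smul_lie, lie_smul, ← add_smul]
      | zero => simp
      | add _ _ _ _ h h' => simp only [lie_add, map_add, h, h']; abel
    | zero => simp
    | add _ _ _ _ h h' => simp only [add_lie, map_add, h, h']; abel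
  let S' : LieDerivation F (M F) (M F) := ⟨S, fun a b => by rw [h_der, ← lie_skew (S a) b]; abel⟩
  obtain ⟨s, hs⟩ := LieDerivation.IsKilling.exists_eq_ad S'
  have hs' : ad F (M F) s = S := by rw [← LieDerivation.coe_ad_apply_eq_ad_apply s, hs]
  refine ⟨s, y - s, by abel, by rw [map_sub, hs']; exact hN', fun T hT => ?_, fun z k hz => ?_⟩
  · rw [hs']
    exact (Algebra.commute_of_mem_adjoin_singleton_of_commute hS1 hT.symm).symm
  · have : z ∈ (ad F (M F) y).maxGenEigenspace 0 := by
      rw [Module.End.mem_maxGenEigenspace]; exact ⟨k, by simpa using hz⟩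
    have h1 := aux this
    rw [← hs', zero_smul] at h1
    exact h1

lemma kil_nil {n d : M F} (hn : IsNilpotent (ad F (M F) n)) (h : ⁅n, d⁆ = 0) : (killingForm F (M F)) n d = 0 := by
  have comm : Commute (toEnd F (M F) (M F) n) (toEnd F (M F) (M F) d) := by
    have : ∀ w : M F, ⁅n, ⁅d, w⁆⁆ = ⁅d, ⁅n, w⁆⁆ := fun w => by rw [leibniz_lie, h, zero_lie, zero_add]
    exact LinearMap.ext this
  change traceForm F (M F) (M F) n d = 0
  rw [traceForm_apply_apply, ← Module.End.mul_eq_comp]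
  exact (LinearMap.isNilpotent_trace_of_isNilpotent (comm.isNilpotent_mul_right hn)).eq_zero

lemma kil_au (g : Au F) (x y : M F) : (killingForm F (M F)) (g • x) (g • y) = (killingForm F (M F)) x y := by
  have h : ∀ z : M F, toEnd F (M F) (M F) (g • z) = (g : M F ≃ₗ[F] M F).conj (toEnd F (M F) (M F) z) := by
    intro z
    ext1 w
    rw [LinearEquiv.conj_apply_apply]
    change ⁅g • z, w⁆ = g • ⁅z, g⁻¹ • w⁆
    rw [au_lie, smul_inv_smul]
  change traceForm F (M F) (M F) _ _ = traceForm F (M F) (M F) _ _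
  rw [traceForm_apply_apply, traceForm_apply_apply, h, h, ← LinearEquiv.conj_comp, LinearMap.trace_conj']

lemma kil_nondeg {w : M F} (h : ∀ z, (killingForm F (M F)) w z = 0) : w = 0 := by
  have := LieAlgebra.IsKilling.ker_killingForm_eq_bot F (M F)
  have h1 : w ∈ LinearMap.ker (killingForm F (M F)) := by
    rw [LinearMap.mem_ker]; exact LinearMap.ext h
  rw [this] at h1
  exact h1

lemma au_engel (g : Au F) (x z : M F) (h : g • x = x) (hz : z ∈ LieSubalgebra.engel F x) :
    g • z ∈ LieSubalgebra.engel F x := by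
  rw [LieSubalgebra.mem_engel_iff] at hz ⊢
  obtain ⟨n, hn⟩ := hz
  refine ⟨n, ?_⟩
  have : ∀ n z, ((ad F (M F) x) ^ n) (g • z) = g • ((ad F (M F) x) ^ n) z := by
    intro n
    induction n with
    | zero => intro z; simp
    | succ n ih =>
      intro z
      rw [pow_succ', Module.End.mul_apply, Module.End.mul_apply, ih, ad_apply, ad_apply, au_lie, h]
  rw [this, hn, smul_zero]

/-- nondegeneracy on Engel subalgebras -/
lemma engel_nondeg {x w : M F} (hw : w ∈ LieSubalgebra.engel F x)
    (h : ∀ z ∈ LieSubalgebra.engel F x, (killingForm F (M F)) w z = 0) : w = 0 := by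
  apply kil_nondeg
  rw [LieSubalgebra.mem_engel_iff] at hw
  obtain ⟨k, hk⟩ := hw
  obtain ⟨n, hn, hkn⟩ := ((ad F (M F) x).eventually_isCompl_ker_pow_range_pow.and (Filter.eventually_ge_atTop k)).exists
  have hadj : ∀ n a b, (killingForm F (M F)) a (((ad F (M F) x) ^ n) b) = (-1) ^ n * (killingForm F (M F)) (((ad F (M F) x) ^ n) a) b := by
    intro n
    induction n with
    | zero => intro a b; simp
    | succ n ih =>
      intro a b
      rw [pow_succ, Module.End.mul_apply, ih, ad_apply, ← kil_inv, ← lie_skew, map_neg, LinearMap.neg_apply, ← pow_succ,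
        pow_succ' (ad F (M F) x), Module.End.mul_apply, ad_apply]
      ring
  intro z
  have hz : z ∈ LinearMap.ker ((ad F (M F) x) ^ n) ⊔ LinearMap.range ((ad F (M F) x) ^ n) := by
    rw [hn.sup_eq_top]; trivial
  obtain ⟨a, ha, b, ⟨c, rfl⟩, rfl⟩ := Submodule.mem_sup.1 hz
  rw [map_add, h a (by rw [LieSubalgebra.mem_engel_iff]; exact ⟨n, ha⟩), hadj]
  have : ((ad F (M F) x) ^ n) w = 0 := Module.End.pow_map_zero_of_le hkn hk
  rw [this]; simp

/-- eigenprojection -/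
noncomputable def prj (θ : Au F) (u : F) (z : M F) : M F :=
  (4 : F)⁻¹ • (z + u ^ 3 • (θ • z) + u ^ 2 • (θ • θ • z) + u • (θ • θ • θ • z))

lemma smul4 {θ : Au F} (h4 : θ ^ 4 = 1) (z : M F) : θ • θ • θ • θ • z = z := by
  have := congrArg (· • z) h4
  simpa [pow_succ, mul_smul] using this

lemma prj_eig {θ : Au F} (h4 : θ ^ 4 = 1) {u : F} (hu : u ^ 4 = 1) (z : M F) : θ • prj θ u z = u • prj θ u z := by
  unfold prj
  simp only [au_smul, smul_add, smul4 h4]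
  generalize θ • θ • θ • z = z3
  generalize θ • θ • z = z2
  generalize θ • z = z1
  match_scalars
  all_goals first | ring1 | linear_combination -(4 : F)⁻¹ * hu | linear_combination (4 : F)⁻¹ * hu

lemma prj_sum {θ : Au F} {i : F} (hi : i ^ 2 = -1) (z : M F) :
    z = prj θ 1 z + prj θ i z + prj θ (-1) z + prj θ (-i) z := by
  unfold prj
  generalize θ • θ • θ • z = z3
  generalize θ • θ • z = z2
  generalize θ • z = z1
  match_scalars
  · norm_num
  · ring
  · linear_combination -(2 : F)⁻¹ * hi
  · ring

lemma prj_engel {θ : Au F} {x : M F} (hx : θ • x = x) (u : F) {z : M F} (hz : z ∈ LieSubalgebra.engel F x) :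
    prj θ u z ∈ LieSubalgebra.engel F x := by
  have h1 := au_engel θ x z hx hz
  have h2 := au_engel θ x _ hx h1
  have h3 := au_engel θ x _ hx h2
  unfold prj
  let N := (LieSubalgebra.engel F x).toSubmodule
  exact N.smul_mem _ (N.add_mem (N.add_mem (N.add_mem hz (N.smul_mem _ h1)) (N.smul_mem _ h2)) (N.smul_mem _ h3))

/-- graded pieces of an Engel subalgebra -/
def cg (θ : Au F) (x : M F) (u : F) : Submodule F (M F) where
  carrier := {z | z ∈ LieSubalgebra.engel F x ∧ θ • z = u • z}
  add_mem' := fun {a b} ha hb => ⟨(LieSubalgebra.engel F x).add_mem ha.1 hb.1, by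
    rw [smul_add, ha.2, hb.2, smul_add]⟩
  zero_mem' := ⟨(LieSubalgebra.engel F x).zero_mem, by simp⟩
  smul_mem' := fun c a ha => ⟨(LieSubalgebra.engel F x).smul_mem c ha.1, by
    rw [au_smul, ha.2, smul_comm]⟩

lemma cg_lie {θ : Au F} {x : M F} {u v : F} {a b : M F} (ha : a ∈ cg θ x u) (hb : b ∈ cg θ x v) :
    ⁅a, b⁆ ∈ cg θ x (u * v) :=
  ⟨(LieSubalgebra.engel F x).lie_mem ha.1 hb.1, by
    rw [au_lie, ha.2, hb.2, smul_lie, lie_smul, smul_smul]⟩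

lemma prj_cg {θ : Au F} (h4 : θ ^ 4 = 1) {x : M F} (hx : θ • x = x) {u : F} (hu : u ^ 4 = 1) {z : M F}
    (hz : z ∈ LieSubalgebra.engel F x) : prj θ u z ∈ cg θ x u :=
  ⟨prj_engel hx u hz, prj_eig h4 hu z⟩

lemma kil_cg {θ : Au F} {x : M F} {u v : F} {a b : M F} (ha : a ∈ cg θ x u) (hb : b ∈ cg θ x v)
    (h : u * v ≠ 1) : (killingForm F (M F)) a b = 0 := by
  have := kil_au θ a b
  rw [ha.2, hb.2, map_smul, map_smul, LinearMap.smul_apply, smul_smul, smul_eq_mul] at this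
  have h2 : (u * v - 1) * (killingForm F (M F)) a b = 0 := by linear_combination this
  exact (mul_eq_zero.1 h2).resolve_left (sub_ne_zero.2 h)

lemma cg_nondeg {θ : Au F} (h4 : θ ^ 4 = 1) {x : M F} (hx : θ • x = x) {i : F} (hi : i ^ 2 = -1) {u v : F}
    (hu : u = 1 ∨ u = i ∨ u = -1 ∨ u = -i) (huv : u * v = 1) {w : M F} (hw : w ∈ cg θ x u)
    (h : ∀ z ∈ cg θ x v, (killingForm F (M F)) w z = 0) : w = 0 := by
  have hi4 : i ^ 4 = 1 := by linear_combination (i ^ 2 - 1) * hi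
  refine engel_nondeg hw.1 fun z hz => ?_
  have key : ∀ v', v' ^ 4 = 1 → (killingForm F (M F)) w (prj θ v' z) = 0 := fun v' hv' => by
    have hm := prj_cg h4 hx hv' hz
    by_cases e : u * v' = 1
    · have hu0 : u ≠ 0 := by rintro rfl; simp at e
      have : v' = v := mul_left_cancel₀ hu0 (e.trans huv.symm)
      exact h _ (this ▸ hm)
    · exact kil_cg hw hm e
  rw [prj_sum (θ := θ) hi z, map_add, map_add, map_add, key 1 (by ring), key i hi4, key (-1) (by ring),
    key (-i) (by linear_combination hi4)]
  simp
end E8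

namespace E8
open LieAlgebra LieModule

variable {F : Type} [Field F] [CharZero F]


lemma exists_min (θ : Au F) : ∃ x : M F, θ • x = x ∧ ∀ y : M F, θ • y = y →
    Module.finrank F (LieSubalgebra.engel F x) ≤ Module.finrank F (LieSubalgebra.engel F y) := by
  classical
  have hne : ∃ n, ∃ x : M F, θ • x = x ∧ Module.finrank F (LieSubalgebra.engel F x) = n :=
    ⟨_, 0, smul_zero θ, rfl⟩
  obtain ⟨x, hx, hn⟩ := Nat.find_spec hne
  refine ⟨x, hx, fun y hy => ?_⟩
  rw [hn]
  exact Nat.find_min' hne ⟨y, hy, rfl⟩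

/-- degree-zero part as a Lie subalgebra -/
def cg1 (θ : Au F) (x : M F) : LieSubalgebra F (M F) :=
  { cg θ x 1 with lie_mem' := fun {a b} ha hb => by simpa using cg_lie ha hb }

lemma mem_cg1 {θ : Au F} {x z : M F} : z ∈ cg1 θ x ↔ z ∈ cg θ x 1 := Iff.rfl

lemma cg1_le_engel {θ : Au F} {x : M F} (hx : θ • x = x)
    (hmin : ∀ y : M F, θ • y = y →
      Module.finrank F (LieSubalgebra.engel F x) ≤ Module.finrank F (LieSubalgebra.engel F y))
    {y : M F} (hy : y ∈ cg1 θ x) : LieSubalgebra.engel F x ≤ LieSubalgebra.engel F y := by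
  have hxm : x ∈ cg1 θ x := ⟨LieSubalgebra.self_mem_engel F x, by rw [hx, one_smul]⟩
  let E : {LieSubalgebra.engel F z | z ∈ cg1 θ x} := ⟨LieSubalgebra.engel F x, x, hxm, rfl⟩
  have hcard : (Module.finrank F (M F) : Cardinal) ≤ Cardinal.mk F :=
    (Cardinal.natCast_lt_aleph0).le.trans (Cardinal.aleph0_le_mk F)
  have hE : IsMin E := by
    rintro ⟨_, z, hz, rfl⟩ hle
    have hle' : LieSubalgebra.engel F z ≤ LieSubalgebra.engel F x := hle
    change LieSubalgebra.engel F x ≤ LieSubalgebra.engel F z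
    have h1 : (LieSubalgebra.engel F z).toSubmodule ≤ (LieSubalgebra.engel F x).toSubmodule := hle'
    have := Submodule.eq_of_le_of_finrank_le h1 (hmin z (by have := hz.2; rwa [one_smul] at this))
    intro w hw
    have hw' : w ∈ (LieSubalgebra.engel F x).toSubmodule := hw
    rw [← this] at hw'
    exact hw'
  exact engel_isBot_of_isMin hcard (cg1 θ x) E (fun z hz => hz.1) hE ⟨LieSubalgebra.engel F y, y, hy, rfl⟩

section
lemma cg1_abel [IsAlgClosed F] {θ : Au F} (h4 : θ ^ 4 = 1) {x : M F} (hx : θ • x = x) {i : F} (hi : i ^ 2 = -1)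
    (hmin : ∀ y : M F, θ • y = y →
      Module.finrank F (LieSubalgebra.engel F x) ≤ Module.finrank F (LieSubalgebra.engel F y))
    {a b : M F} (ha : a ∈ cg θ x 1) (hb : b ∈ cg θ x 1) : ⁅a, b⁆ = 0 := by
  have hn : LieRing.IsNilpotent (cg1 θ x) :=
    LieSubalgebra.isNilpotent_of_forall_le_engel _ fun y hy z hz => cg1_le_engel hx hmin hy hz.1
  have h0 : LinearMap.ker (traceForm F (cg1 θ x) (M F)) = ⊥ := by
    rw [eq_bot_iff]
    intro w hw
    rw [LinearMap.mem_ker] at hw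
    have : (w : M F) = 0 := cg_nondeg h4 hx hi (Or.inl rfl) (mul_one 1) w.2 fun z hz => by
      have := LinearMap.congr_fun hw ⟨z, hz⟩
      exact this
    exact Subtype.ext this
  have := isLieAbelian_of_ker_traceForm_eq_bot F (cg1 θ x) (M F) h0
  have h1 := LieModule.IsTrivial.trivial (⟨a, ha⟩ : cg1 θ x) (⟨b, hb⟩ : cg1 θ x)
  exact congrArg Subtype.val h1

/-- the degree zero part is central -/
lemma cg1_cent [IsAlgClosed F] {θ : Au F} (h4 : θ ^ 4 = 1) {x : M F} (hx : θ • x = x) {i : F} (hi : i ^ 2 = -1)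
    (hmin : ∀ y : M F, θ • y = y →
      Module.finrank F (LieSubalgebra.engel F x) ≤ Module.finrank F (LieSubalgebra.engel F y))
    {y z : M F} (hy : y ∈ cg θ x 1) (hz : z ∈ LieSubalgebra.engel F x) : ⁅y, z⁆ = 0 := by
  obtain ⟨s, n, hysn, hn, hcomm, hker⟩ := jordan y
  have hs : ∀ z ∈ LieSubalgebra.engel F x, ⁅s, z⁆ = 0 := by
    intro z hz
    have := cg1_le_engel hx hmin hy hz
    rw [LieSubalgebra.mem_engel_iff] at this
    obtain ⟨k, hk⟩ := this
    exact hker z k hk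
  have hyy : θ • y = y := by have := hy.2; rwa [one_smul] at this
  have hθs : θ • s = s := by
    apply ad_inj
    have hc : Commute (ad F (M F) y) (Au.lin θ) := by
      apply LinearMap.ext
      intro w
      simp only [Module.End.mul_apply, Au.lin_apply, ad_apply]
      rw [au_lie, hyy]
    have h2 := hcomm _ hc
    apply LinearMap.ext
    intro w
    have h3 := LinearMap.congr_fun h2 (θ⁻¹ • w)
    simp only [Module.End.mul_apply, Au.lin_apply, ad_apply] at h3
    rw [au_lie, smul_inv_smul] at h3
    rw [ad_apply, ad_apply, ← h3]
  have hxm : x ∈ LieSubalgebra.engel F x := LieSubalgebra.self_mem_engel F x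
  have hsm : s ∈ cg θ x 1 := by
    refine ⟨?_, by rw [hθs, one_smul]⟩
    rw [LieSubalgebra.mem_engel_iff]
    exact ⟨1, by rw [pow_one, ad_apply, ← lie_skew, hs x hxm, neg_zero]⟩
  have hnm : n ∈ cg θ x 1 := by
    have : n = y - s := by rw [hysn]; abel
    rw [this]; exact (cg θ x 1).sub_mem hy hsm
  have hn0 : n = 0 := cg_nondeg h4 hx hi (Or.inl rfl) (mul_one 1) hnm fun w hw =>
    kil_nil hn (cg1_abel h4 hx hi hmin hnm hw)
  rw [hysn, hn0, add_zero, hs z hz]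

lemma cg_opp [IsAlgClosed F] {θ : Au F} (h4 : θ ^ 4 = 1) {x : M F} (hx : θ • x = x) {i : F} (hi : i ^ 2 = -1)
    (hmin : ∀ y : M F, θ • y = y →
      Module.finrank F (LieSubalgebra.engel F x) ≤ Module.finrank F (LieSubalgebra.engel F y))
    {u v : F} (huv : u * v = 1) {a b : M F} (ha : a ∈ cg θ x u) (hb : b ∈ cg θ x v) : ⁅a, b⁆ = 0 := by
  have hm : ⁅a, b⁆ ∈ cg θ x 1 := huv ▸ cg_lie ha hb
  refine cg_nondeg h4 hx hi (Or.inl rfl) (mul_one 1) hm fun w hw => ?_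
  rw [kil_inv, ← lie_skew, cg1_cent h4 hx hi hmin hw hb.1, neg_zero, map_zero]

lemma cg_self [IsAlgClosed F] {θ : Au F} (h4 : θ ^ 4 = 1) {x : M F} (hx : θ • x = x) {i : F} (hi : i ^ 2 = -1)
    (hmin : ∀ y : M F, θ • y = y →
      Module.finrank F (LieSubalgebra.engel F x) ≤ Module.finrank F (LieSubalgebra.engel F y))
    {u : F} (hu : u ^ 2 = -1) {a a' : M F} (ha : a ∈ cg θ x u) (ha' : a' ∈ cg θ x u) : ⁅a, a'⁆ = 0 := by
  have huv : u * (-u) = 1 := by linear_combination -hu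
  have hu4 : u ^ 4 = 1 := by linear_combination (u ^ 2 - 1) * hu
  have hu0 : u ≠ 0 := by rintro rfl; norm_num at hu
  have hm : ⁅a, a'⁆ ∈ cg θ x (-1) := by
    have := cg_lie ha ha'
    rwa [show u * u = -1 by linear_combination hu] at this
  obtain ⟨s, n, hsn, hn, hcomm, hker⟩ := jordan a
  -- every element of the Engel subalgebra is killed by (ad a)^3
  have hk : ∀ z ∈ LieSubalgebra.engel F x, ⁅a, ⁅a, ⁅a, z⁆⁆⁆ = 0 := by
    intro z hz
    have e1 : ⁅a, prj θ 1 z⁆ = 0 := by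
      rw [← lie_skew, cg1_cent h4 hx hi hmin (prj_cg h4 hx (by ring) hz) ha.1, neg_zero]
    have e2 : ⁅a, prj θ (-u) z⁆ = 0 :=
      cg_opp h4 hx hi hmin huv ha (prj_cg h4 hx (by linear_combination hu4) hz)
    have e3 : ⁅a, ⁅a, prj θ (-1) z⁆⁆ = 0 := by
      have h3 := cg_lie ha (prj_cg h4 hx (u := -1) (by ring) hz)
      exact cg_opp h4 hx hi hmin (v := u * -1) (by linear_combination -hu) ha h3
    have e4 : ⁅a, ⁅a, ⁅a, prj θ u z⁆⁆⁆ = 0 := by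
      have h3 := cg_lie ha (cg_lie ha (prj_cg h4 hx hu4 hz))
      exact cg_opp h4 hx hi hmin (v := u * (u * u)) (by linear_combination hu4) ha h3
    rw [prj_sum (θ := θ) hu z]
    simp only [lie_add, e1, e2, e3, e4, lie_zero, add_zero]
  have hs : ∀ z ∈ LieSubalgebra.engel F x, ⁅s, z⁆ = 0 := fun z hz =>
    hker z 3 (by simpa [pow_succ] using hk z hz)
  refine cg_nondeg h4 hx hi (v := -1) (by tauto) (by ring) hm fun w hw => ?_
  have hb : ⁅a', w⁆ ∈ LieSubalgebra.engel F x := LieSubalgebra.lie_mem _ ha'.1 hw.1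
  have hb' : ⁅a', w⁆ ∈ cg θ x (-u) := by
    have := cg_lie ha' hw
    rwa [show u * -1 = -u by ring] at this
  have hab := cg_opp h4 hx hi hmin huv ha hb'
  rw [kil_inv, hsn, map_add, LinearMap.add_apply]
  have e1 : (killingForm F (M F)) n ⁅a', w⁆ = 0 := by
    apply kil_nil hn
    have : n = a - s := by rw [hsn]; abel
    rw [this, sub_lie, hab, hs _ hb, sub_zero]
  have e2 : (killingForm F (M F)) s ⁅a', w⁆ = 0 := by
    rw [← kil_inv, hs _ ha'.1]; simp
  rw [e1, e2, add_zero]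

theorem engel_abel [IsAlgClosed F] {θ : Au F} (h4 : θ ^ 4 = 1) {x : M F} (hx : θ • x = x) {i : F} (hi : i ^ 2 = -1)
    (hmin : ∀ y : M F, θ • y = y →
      Module.finrank F (LieSubalgebra.engel F x) ≤ Module.finrank F (LieSubalgebra.engel F y))
    {a b : M F} (ha : a ∈ LieSubalgebra.engel F x) (hb : b ∈ LieSubalgebra.engel F x) :
    ⁅a, b⁆ = 0 := by
  have hi4 : i ^ 4 = 1 := by linear_combination (i ^ 2 - 1) * hi
  have hni : (-i) ^ 2 = -1 := by linear_combination hi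
  have hni4 : (-i) ^ 4 = 1 := by linear_combination hi4
  have E2 : ∀ u : F, u ^ 2 = -1 → (u = i ∨ u = -i) → ∀ a ∈ cg θ x u, ∀ b ∈ cg θ x (-1), ⁅a, b⁆ = 0 := by
    intro u hu hui a ha b hb
    have hm : ⁅a, b⁆ ∈ cg θ x (-u) := by
      have := cg_lie ha hb
      rwa [show u * -1 = -u by ring] at this
    refine cg_nondeg h4 hx hi (v := u) (by rcases hui with rfl | rfl <;> simp) (by linear_combination -hu) hm
      fun w hw => ?_
    rw [← lie_skew, map_neg, LinearMap.neg_apply, kil_inv, cg_self h4 hx hi hmin hu ha hw, map_zero, neg_zero]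
  have main : ∀ u, (u = 1 ∨ u = i ∨ u = -1 ∨ u = -i) → ∀ v, (v = 1 ∨ v = i ∨ v = -1 ∨ v = -i) →
      ∀ a ∈ cg θ x u, ∀ b ∈ cg θ x v, ⁅a, b⁆ = 0 := by
    have sw : ∀ {a b : M F}, ⁅b, a⁆ = 0 → ⁅a, b⁆ = 0 := fun h => by rw [← lie_skew, h, neg_zero]
    rintro u (rfl | rfl | rfl | rfl) v (rfl | rfl | rfl | rfl) a ha b hb
    · exact cg1_cent h4 hx hi hmin ha hb.1
    · exact cg1_cent h4 hx hi hmin ha hb.1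
    · exact cg1_cent h4 hx hi hmin ha hb.1
    · exact cg1_cent h4 hx hi hmin ha hb.1
    · exact sw (cg1_cent h4 hx hi hmin hb ha.1)
    · exact cg_self h4 hx hi hmin hi ha hb
    · exact E2 _ hi (by simp) a ha b hb
    · exact cg_opp h4 hx hi hmin (by linear_combination -hi) ha hb
    · exact sw (cg1_cent h4 hx hi hmin hb ha.1)
    · exact sw (E2 _ hi (by simp) b hb a ha)
    · exact cg_opp h4 hx hi hmin (by ring) ha hb
    · exact sw (E2 _ hni (by simp) b hb a ha)
    · exact sw (cg1_cent h4 hx hi hmin hb ha.1)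
    · exact cg_opp h4 hx hi hmin (by linear_combination -hi) ha hb
    · exact E2 _ hni (by simp) a ha b hb
    · exact cg_self h4 hx hi hmin hni ha hb
  have p : ∀ z ∈ LieSubalgebra.engel F x, ∀ u, (u = 1 ∨ u = i ∨ u = -1 ∨ u = -i) → prj θ u z ∈ cg θ x u := by
    rintro z hz u (rfl | rfl | rfl | rfl)
    · exact prj_cg h4 hx (by ring) hz
    · exact prj_cg h4 hx hi4 hz
    · exact prj_cg h4 hx (by ring) hz
    · exact prj_cg h4 hx hni4 hz
  rw [prj_sum (θ := θ) hi a, prj_sum (θ := θ) hi b]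
  simp only [lie_add, add_lie]
  rw [main 1 (by simp) 1 (by simp) _ (p a ha _ (by simp)) _ (p b hb _ (by simp)),
    main 1 (by simp) i (by simp) _ (p a ha _ (by simp)) _ (p b hb _ (by simp)),
    main 1 (by simp) (-1) (by simp) _ (p a ha _ (by simp)) _ (p b hb _ (by simp)),
    main 1 (by simp) (-i) (by simp) _ (p a ha _ (by simp)) _ (p b hb _ (by simp)),
    main i (by simp) 1 (by simp) _ (p a ha _ (by simp)) _ (p b hb _ (by simp)),
    main i (by simp) i (by simp) _ (p a ha _ (by simp)) _ (p b hb _ (by simp)),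
    main i (by simp) (-1) (by simp) _ (p a ha _ (by simp)) _ (p b hb _ (by simp)),
    main i (by simp) (-i) (by simp) _ (p a ha _ (by simp)) _ (p b hb _ (by simp)),
    main (-1) (by simp) 1 (by simp) _ (p a ha _ (by simp)) _ (p b hb _ (by simp)),
    main (-1) (by simp) i (by simp) _ (p a ha _ (by simp)) _ (p b hb _ (by simp)),
    main (-1) (by simp) (-1) (by simp) _ (p a ha _ (by simp)) _ (p b hb _ (by simp)),
    main (-1) (by simp) (-i) (by simp) _ (p a ha _ (by simp)) _ (p b hb _ (by simp)),
    main (-i) (by simp) 1 (by simp) _ (p a ha _ (by simp)) _ (p b hb _ (by simp)),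
    main (-i) (by simp) i (by simp) _ (p a ha _ (by simp)) _ (p b hb _ (by simp)),
    main (-i) (by simp) (-1) (by simp) _ (p a ha _ (by simp)) _ (p b hb _ (by simp)),
    main (-i) (by simp) (-i) (by simp) _ (p a ha _ (by simp)) _ (p b hb _ (by simp))]
  simp
end
end E8

namespace E8
open LieAlgebra LieModule

variable {F : Type} [Field F] [CharZero F]

lemma adE_cube {v : Lam} (hv : IsRt v) : (ad F (M F) (E F v)) ^ 3 = 0 := by
  have hvv : bil v v = 2 := hv
  apply M_hom_ext
  · intro k
    simp only [pow_succ, pow_zero, one_mul, Module.End.mul_apply, ad_apply, LinearMap.zero_apply]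
    rw [lie_EH, lie_neg, lie_smul, lie_self]; simp
  · intro u hu
    simp only [pow_succ, pow_zero, one_mul, Module.End.mul_apply, ad_apply, LinearMap.zero_apply]
    by_cases h0 : 0 ≤ bil v u
    · rw [lie_zero_of hv hu h0]; simp
    by_cases h1 : bil v u = -1
    · have hr := (isRt_add_iff hv hu).2 h1
      rw [lie_neg_of hv hu h1, lie_smul, lie_zero_of hv hr (by rw [bil_add_right]; omega)]; simp
    · have h2 : bil v u = -2 := by have := neg_two_le_bil hv hu; omega
      have h3 : u = -v := by
        have := eq_of_bil_eq_two hv hu.neg (by rw [bil_neg_right]; omega)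
        rw [this, neg_neg]
      rw [h3, lie_opp hv, lie_neg, lie_EH, neg_neg, lie_smul, lie_self, smul_zero]

lemma adE_nil {v : Lam} (hv : IsRt v) : IsNilpotent (ad F (M F) (E F v)) := ⟨3, adE_cube hv⟩

/-- subspace spanned by the Cartan part and root vectors with property p -/
noncomputable def rsp (F : Type) [Field F] [CharZero F] (p : Lam → Prop) : Submodule F (M F) :=
  LinearMap.range (H : (Fin 8 → F) →ₗ[F] M F) ⊔
    Submodule.span F (Set.range (fun v : {v : R // p v.1} => E F v.1.1))

/-- standard frame -/
noncomputable def stdF (F : Type) [Field F] [CharZero F] (p : Lam → Prop) : Frame (rsp F p) where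
  H := LinearMap.range (H : (Fin 8 → F) →ₗ[F] M F)
  ι := {v : R // p v.1}
  fin := Fintype.ofFinite _
  e := fun v => E F v.1.1
  a := fun v => pr v.1.1 ∘ₗ pH
  nil := fun v => adE_nil v.1.2
  lie := by
    rintro v _ ⟨h, rfl⟩
    rw [lie_HE]; simp
  comm := by
    rintro _ ⟨h, rfl⟩ _ ⟨k, rfl⟩
    exact lie_HH h k
  span := rfl
  ne := by
    rintro v
    refine ⟨_, ⟨cor F v.1.1, rfl⟩, ?_⟩
    have : bil v.1.1 v.1.1 = 2 := v.1.2
    simp [pr_cor, this]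

lemma rsp_top : rsp F (fun _ => True) = ⊤ := by
  rw [eq_top_iff]
  intro x _
  rw [M_expand x]
  refine Submodule.add_mem _ (Submodule.mem_sup_left ⟨_, rfl⟩) (Submodule.mem_sup_right ?_)
  exact Submodule.sum_mem _ fun v _ => Submodule.smul_mem _ _ (Submodule.subset_span ⟨⟨v, trivial⟩, rfl⟩)

lemma csa_frame [IsAlgClosed F] (c : LieSubalgebra F (M F)) [c.IsCartanSubalgebra]
    (hab : ∀ a ∈ c, ∀ b ∈ c, ⁅a, b⁆ = 0) : ∃ A : Frame (⊤ : Submodule F (M F)), A.H = c.toSubmodule := by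
  have h1 : ∀ α : {α : Weight F c (M F) // α.IsNonZero}, ∃ e : M F, e ∈ rootSpace c α.1 ∧
      ∀ z ∈ rootSpace c α.1, ∃ t : F, t • e = z := by
    intro α
    obtain ⟨e, he⟩ := finrank_eq_one_iff'.1 (IsKilling.finrank_rootSpace_eq_one α.1 α.2)
    refine ⟨e.1, e.2, fun z hz => ?_⟩
    obtain ⟨t, ht⟩ := he.2 ⟨z, hz⟩
    exact ⟨t, congrArg Subtype.val ht⟩
  choose e he1 he2 using h1
  have h2 : ∀ α : {α : Weight F c (M F) // α.IsNonZero}, ∃ a : M F →ₗ[F] F, ∀ h : c, a h = α.1 h := by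
    intro α
    obtain ⟨a, ha⟩ := LinearMap.exists_extend (p := c.toSubmodule) (Weight.toLinear F c (M F) α.1)
    exact ⟨a, fun h => LinearMap.congr_fun ha h⟩
  choose a ha using h2
  refine ⟨⟨c.toSubmodule, {α : Weight F c (M F) // α.IsNonZero}, Fintype.ofFinite _, e, a,
    fun α => LieAlgebra.isNilpotent_ad_of_mem_rootSpace c (χ := α.1) (fun h => α.2 h) (he1 α),
    fun α h hh => ?_, hab, ?_, fun α => ?_⟩, rfl⟩
  · have := IsKilling.lie_eq_smul_of_mem_rootSpace (he1 α) (⟨h, hh⟩ : c)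
    rw [← ha α ⟨h, hh⟩] at this
    exact this
  · have h3 := LieAlgebra.cartan_sup_iSup_rootSpace_eq_top (H := c)
    rw [eq_top_iff]
    have h4 := congrArg LieSubmodule.toSubmodule h3
    rw [LieSubmodule.top_toSubmodule] at h4
    rw [← h4, LieSubmodule.sup_toSubmodule]
    refine sup_le_sup le_rfl ?_
    rw [LieSubmodule.iSup_toSubmodule]
    refine iSup_le fun α => ?_
    rw [LieSubmodule.iSup_toSubmodule]
    refine iSup_le fun hα z hz => ?_
    obtain ⟨t, rfl⟩ := he2 ⟨α, hα⟩ z hz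
    exact Submodule.smul_mem _ _ (Submodule.subset_span ⟨_, rfl⟩)
  · by_contra hcon
    push Not at hcon
    apply α.2
    funext h
    rw [← ha α h]
    exact hcon h.1 h.2

/-- an automorphism of order four with 66-dim fixed space is conjugate to the standard one -/
theorem order4_conj [IsAlgClosed F] {θ : Au F} (h4 : θ ^ 4 = 1) (hd : Module.finrank F (fixS θ) = 66)
    {u : Fˣ} (hu : u ^ 2 = -1) : ∃ g : Au F, g * θ * g⁻¹ = torB u (om 2) := by
  have hi : (u : F) ^ 2 = -1 := by rw [← Units.val_pow_eq_pow_val, hu]; simp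
  obtain ⟨x, hx, hmin⟩ := exists_min θ
  let c := LieSubalgebra.engel F x
  have hab : ∀ a ∈ c, ∀ b ∈ c, ⁅a, b⁆ = 0 := fun a ha b hb => engel_abel h4 hx hi hmin ha hb
  have hLA : IsLieAbelian c := ⟨fun a b => Subtype.ext (hab a a.2 b b.2)⟩
  have : c.IsCartanSubalgebra := ⟨inferInstance, LieSubalgebra.normalizer_engel F x⟩
  obtain ⟨A, hA⟩ := csa_frame c hab
  obtain ⟨g₁, -, g₂, -, hg⟩ := Frame.conj (S := ⊤) (fun _ _ _ _ => trivial) A (rsp_top (F := F) ▸ stdF F (fun _ => True))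
  have hBH : (rsp_top (F := F) ▸ stdF F (fun _ => True) : Frame ⊤).H = LinearMap.range (H : (Fin 8 → F) →ₗ[F] M F) := by
    have : ∀ (S : Submodule F (M F)) (h : rsp F (fun _ => True) = S), (h ▸ stdF F (fun _ => True) : Frame S).H =
      LinearMap.range (H : (Fin 8 → F) →ₗ[F] M F) := by rintro S rfl; rfl
    exact this _ _
  rw [hBH, hA] at hg
  set g := g₂⁻¹ * g₁ with hgd
  have hg' : ∀ z, z ∈ c ↔ g • z ∈ LinearMap.range (H : (Fin 8 → F) →ₗ[F] M F) := fun z => by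
    have := hg (g₁ • z)
    rw [inv_smul_smul] at this
    rw [hgd, mul_smul]
    exact this
  obtain ⟨h, hh⟩ := (hg' x).1 (LieSubalgebra.self_mem_engel F x)
  have hreg : ∀ v, IsRt v → pr v h ≠ 0 := by
    intro v hv h0
    have h1 : g⁻¹ • E F v ∈ c := by
      refine (LieSubalgebra.mem_engel_iff _ _ _).2 ⟨1, ?_⟩
      rw [pow_one, ad_apply]
      have : ⁅g • x, E F v⁆ = 0 := by rw [← hh, lie_HE, h0, zero_smul]
      have h2 := congrArg (g⁻¹ • ·) this
      simp only [au_lie, inv_smul_smul, smul_zero] at h2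
      exact h2
    rw [hg', smul_inv_smul] at h1
    obtain ⟨k, hk⟩ := h1
    have := congrArg (co ⟨v, hv⟩) hk
    rw [co_H, co_E] at this
    simp at this
  have hfix : (g * θ * g⁻¹) • (H h : M F) = H h := by
    rw [hh, mul_smul, mul_smul, inv_smul_smul, hx]
  obtain ⟨t, ht⟩ := reg_tor hreg hfix
  have h4' : tor t ^ 4 = (1 : Au F) := by
    rw [← ht, conj_pow, h4, mul_one, mul_inv_cancel]
  obtain ⟨g', hg'⟩ := tor_kac hu h4' (by rw [← ht, fixS_conj, hd])
  refine ⟨g' * g, ?_⟩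
  rw [← hg', ← ht]; group

end E8

namespace E8
open LieAlgebra LieModule

variable {F : Type} [Field F] [CharZero F]

/-- weights of the eight-dimensional factor (shifted) -/
def rho : Fin 8 → Lam := ![![0, 0, 0, 0, 0, 0, 0, 0], ![2, 3, 4, 6, 5, 4, 3, 2], ![2, 3, 4, 6, 5, 4, 3, 1],
  ![2, 3, 4, 6, 5, 4, 2, 1], ![2, 3, 4, 6, 5, 3, 2, 1], ![2, 3, 4, 6, 4, 3, 2, 1], ![2, 3, 4, 5, 4, 3, 2, 1],
  ![2, 2, 4, 5, 4, 3, 2, 1]]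
/-- weights of the two-dimensional factor (shifted) -/
def beta : Fin 2 → Lam := ![![-3, -5, -7, -10, -8, -6, -4, -2], ![-4, -5, -7, -10, -8, -6, -4, -2]]
/-- weights of the tensor product -/
def wt (i j : Fin 8) (k : Fin 2) : Lam := beta k + rho i + rho j

lemma wt_comm (i j : Fin 8) (k : Fin 2) : wt i j k = wt j i k := by unfold wt; abel

lemma bil_rho : ∀ i j, bil (rho i) (rho j) = if i = 0 ∨ j = 0 then 0 else if i = j then 2 else 1 := by decide +kernel
lemma bil_rho_beta : ∀ i k, bil (rho i) (beta k) = if i = 0 then 0 else -2 := by decide +kernel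
lemma bil_beta : ∀ k l, bil (beta k) (beta l) = if k = l then 4 else 3 := by decide +kernel
lemma wt_two : ∀ i j k, wt i j k 2 % 4 = 1 := by decide +kernel
lemma rho_two : ∀ i, rho i 2 % 4 = 0 := by decide +kernel
lemma beta_diff : beta 0 - beta 1 = al 0 := by decide +kernel

lemma isRt_wt : ∀ i j k, IsRt (wt i j k) ↔ i ≠ j := by decide +kernel
lemma isRt_rho : ∀ i j, IsRt (rho i - rho j) ↔ i ≠ j := by decide +kernel
/-- Kronecker delta with integer values -/
def dl (i j : Fin 8) : ℤ := if i = j then 1 else 0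

lemma bil_rho' : ∀ i j, bil (rho i) (rho j) = dl i j + 1 - dl i 0 - dl j 0 := by
  intro i j
  rw [bil_rho]; revert i j; decide
lemma bil_rho_beta' : ∀ i k, bil (rho i) (beta k) = 2 * dl i 0 - 2 := by
  intro i k
  rw [bil_rho_beta]; revert i; decide

lemma bil_rw (a b i j : Fin 8) (k : Fin 2) :
    bil (rho a - rho b) (wt i j k) = dl a i + dl a j - dl b i - dl b j := by
  simp only [sub_eq_add_neg, wt, bil_add_left, bil_add_right, bil_neg_left, bil_rho', bil_rho_beta']
  ring

lemma bil_bw : ∀ k i j l, bil (beta k - beta (1 - k)) (wt i j l) = if k = l then 1 else -1 := by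
  intro k i j l
  simp only [sub_eq_add_neg, wt, bil_add_left, bil_add_right, bil_neg_left, bil_neg_right, bil_comm _ (rho _), bil_rho_beta', bil_beta]
  revert k l
  have : ∀ x y : ℤ, ∀ k l : Fin 2, (if k = l then (4:ℤ) else 3) + x + y + (-(if 1 + -k = l then 4 else 3) + -x + -y) = if k = l then 1 else -1 := by
    intro x y k l
    fin_cases k <;> fin_cases l <;> simp <;> ring
  intro k l
  rw [← this (2 * dl i 0 - 2) (2 * dl j 0 - 2) k l]
  ring

lemma isRt_bb : ∀ k, IsRt (beta k - beta (1 - k)) := by decide +kernel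

lemma rho_wt_not {a b i j : Fin 8} {k : Fin 2} (h : a ≠ b) (hi : i ≠ b) (hj : j ≠ b) (hij : i ≠ j) :
    ¬ IsRt (rho a - rho b + wt i j k) := by
  rw [isRt_add_iff ((isRt_rho a b).2 h) ((isRt_wt i j k).2 hij), bil_rw]
  unfold dl
  rw [if_neg hi.symm, if_neg hj.symm]
  split_ifs <;> omega
lemma beta_wt_not {i j : Fin 8} (k : Fin 2) (hij : i ≠ j) : ¬ IsRt (beta k - beta (1 - k) + wt i j k) := by
  rw [isRt_add_iff (isRt_bb k) ((isRt_wt i j k).2 hij), bil_bw]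
  simp

lemma dl_pair {i j a b : Fin 8} (h : i ≠ j) (H : ∀ x, dl x i + dl x j = dl x a + dl x b) :
    (a = i ∧ b = j) ∨ (a = j ∧ b = i) := by
  have h1 := H i
  have h2 := H j
  unfold dl at h1 h2
  rw [if_pos rfl, if_neg h] at h1
  rw [if_pos rfl, if_neg h.symm] at h2
  split_ifs at h1 h2 <;> simp_all
lemma wt_inj {i j : Fin 8} {k : Fin 2} {i' j' : Fin 8} {k' : Fin 2} (h : i ≠ j) :
    wt i' j' k' = wt i j k ↔ ((i' = i ∧ j' = j) ∨ (i' = j ∧ j' = i)) ∧ k' = k := by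
  constructor
  · intro e
    have h1 : ∀ a b, dl a i + dl a j - dl b i - dl b j = dl a i' + dl a j' - dl b i' - dl b j' := by
      intro a b
      rw [← bil_rw a b i j k, ← e, bil_rw]
    have h2 : ∃ b, dl b i + dl b j = 0 ∧ dl b i' + dl b j' = 0 := by
      have : ∀ i j i' j', ∃ b, dl b i + dl b j = 0 ∧ dl b i' + dl b j' = 0 := by decide +kernel
      exact this i j i' j'
    obtain ⟨b, hb, hb'⟩ := h2
    refine ⟨dl_pair h (fun x => by have := h1 x b; linarith), ?_⟩
    have h3 := bil_bw k i j k
    rw [← e, bil_bw] at h3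
    by_contra hk
    rw [if_neg (fun h => hk h.symm), if_pos rfl] at h3
    omega
  · rintro ⟨⟨rfl, rfl⟩ | ⟨rfl, rfl⟩, rfl⟩
    · rfl
    · exact wt_comm _ _ _

lemma rt_codes {v : Lam} (h : IsRt v) : (∃ c ∈ codes, dec c = v) ∨ (∃ c ∈ codes, dec c = -v) := by
  rcases h.nonneg_or_nonpos with h1 | h1
  · exact Or.inl (mem_codes h h1)
  · exact Or.inr (mem_codes h.neg (fun i => by simpa using h1 i))

/-- all pairs of distinct indices -/
lemma cls0_pos : ∀ c ∈ codes, dec c 2 % 4 = 0 → (∃ i j, i ≠ j ∧ dec c = rho i - rho j) ∨ dec c = al 0 := by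
  decide +kernel
lemma cls0 {v : Lam} (h : IsRt v) (h2 : v 2 % 4 = 0) : (∃ i j, i ≠ j ∧ v = rho i - rho j) ∨ v = al 0 ∨ v = - al 0 := by
  rcases rt_codes h with ⟨c, hc, e⟩ | ⟨c, hc, e⟩
  · rcases cls0_pos c hc (by rw [e]; exact h2) with ⟨i, j, hij, h⟩ | h
    · exact Or.inl ⟨i, j, hij, by rw [← e, h]⟩
    · exact Or.inr (Or.inl (by rw [← e, h]))
  · rcases cls0_pos c hc (by rw [e, Pi.neg_apply]; omega) with ⟨i, j, hij, h⟩ | h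
    · exact Or.inl ⟨j, i, hij.symm, by rw [← neg_neg v, ← e, h]; abel⟩
    · exact Or.inr (Or.inr (by rw [← neg_neg v, ← e, h]))
lemma cls1_pos : ∀ c ∈ codes, (dec c 2 % 4 = 1 → ∃ i j k, i ≠ j ∧ dec c = wt i j k) ∧
    (dec c 2 % 4 = 3 → ∃ i j k, i ≠ j ∧ dec c = - wt i j k) := by decide +kernel
lemma cls1 {v : Lam} (h : IsRt v) (h2 : v 2 % 4 = 1) : ∃ i j k, i ≠ j ∧ v = wt i j k := by
  rcases rt_codes h with ⟨c, hc, e⟩ | ⟨c, hc, e⟩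
  · obtain ⟨i, j, k, hij, h⟩ := (cls1_pos c hc).1 (by rw [e]; exact h2)
    exact ⟨i, j, k, hij, by rw [← e, h]⟩
  · obtain ⟨i, j, k, hij, h⟩ := (cls1_pos c hc).2 (by rw [e, Pi.neg_apply]; omega)
    exact ⟨i, j, k, hij, by rw [← neg_neg v, ← e, h, neg_neg]⟩

lemma cls_gen_pos : ∀ c ∈ codes, (dec c 2 % 4 ≠ 1 → ∃ i j k, i ≠ j ∧ bil (dec c) (wt i j k) = 1) ∧
    (dec c 2 % 4 ≠ 3 → ∃ i j k, i ≠ j ∧ bil (dec c) (wt i j k) = -1) := by decide +kernel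
lemma cls_gen {v : Lam} (h : IsRt v) (h2 : v 2 % 4 ≠ 1) : ∃ i j k, i ≠ j ∧ IsRt (v - wt i j k) := by
  have key : ∃ i j k, i ≠ j ∧ bil v (wt i j k) = 1 := by
    rcases rt_codes h with ⟨c, hc, e⟩ | ⟨c, hc, e⟩
    · obtain ⟨i, j, k, hij, h⟩ := (cls_gen_pos c hc).1 (by rw [e]; exact h2)
      exact ⟨i, j, k, hij, by rw [← e, h]⟩
    · obtain ⟨i, j, k, hij, h⟩ := (cls_gen_pos c hc).2 (by rw [e, Pi.neg_apply]; omega)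
      rw [e, bil_neg_left] at h
      exact ⟨i, j, k, hij, by omega⟩
  obtain ⟨i, j, k, hij, hb⟩ := key
  refine ⟨i, j, k, hij, ?_⟩
  rw [sub_eq_add_neg, isRt_add_iff h ((isRt_wt i j k).2 hij).neg, bil_neg_right, hb]

end E8

namespace E8
open LieAlgebra LieModule

variable {F : Type} [Field F] [CharZero F]

/-- sign attached to the first index being moved past the zeroth one -/
noncomputable def tz (F : Type) [Field F] (j : Fin 8) : F := if j = 0 then -1 else 1
/-- signs of the tensor model -/
noncomputable def ss (F : Type) [Field F] (i j : Fin 8) (k : Fin 2) : F :=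
  tz F j * sg F (rho i) (rho j) * sg F (rho i + rho j) (beta k)
/-- basis vectors of the tensor model -/
noncomputable def psi (F : Type) [Field F] [CharZero F] (i j : Fin 8) (k : Fin 2) : M F := ss F i j k • E F (wt i j k)

lemma tz_ne (j : Fin 8) : tz F j ≠ 0 := by unfold tz; split_ifs <;> simp
lemma ss_ne (i j : Fin 8) (k : Fin 2) : ss F i j k ≠ 0 :=
  mul_ne_zero (mul_ne_zero (tz_ne j) (sg_ne_zero _ _)) (sg_ne_zero _ _)

lemma psi_self (i : Fin 8) (k : Fin 2) : psi F i i k = 0 := by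
  rw [psi, E_not (by rw [isRt_wt]; simp), smul_zero]

lemma ss_skew {i j : Fin 8} (h : i ≠ j) (k : Fin 2) : ss F j i k = - ss F i j k := by
  unfold ss tz
  rw [sg_swap (rho j) (rho i), bil_rho, add_comm (rho j)]
  by_cases hi : i = 0
  · have hj : j ≠ 0 := fun h' => h (by rw [hi, h'])
    simp [hi, hj]
  · by_cases hj : j = 0
    · simp [hi, hj]
    · simp [hi, hj, h, h.symm]

lemma psi_skew (i j : Fin 8) (k : Fin 2) : psi F j i k = - psi F i j k := by
  by_cases h : i = j
  · subst h; rw [psi_self, neg_zero]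
  · rw [psi, psi, ss_skew h, wt_comm j i, neg_smul]

/-- normalised root vectors of the eight-dimensional factor -/
noncomputable def ee (F : Type) [Field F] [CharZero F] (a b : Fin 8) : M F :=
  sg F (rho a - rho b) (rho b) • E F (rho a - rho b)
/-- normalised root vectors of the two-dimensional factor -/
noncomputable def ff (F : Type) [Field F] [CharZero F] (k : Fin 2) : M F :=
  sg F (beta k - beta (1 - k)) (beta (1 - k)) • E F (beta k - beta (1 - k))

lemma ee_aux {a b j : Fin 8} (h : a ≠ b) (hj : j ≠ b) (k : Fin 2) : ⁅ee F a b, psi F b j k⁆ = psi F a j k := by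
  have hs : rho a - rho b + wt b j k = wt a j k := by unfold wt; abel
  rw [ee, psi, smul_lie, lie_smul, lie_nb ((isRt_rho a b).2 h) ((isRt_wt b j k).2 hj.symm), hs, psi, smul_smul, smul_smul]
  · congr 1
    have h1 := sg_sq (F := F) (rho a - rho b) (rho b)
    have h2 : sg F (rho a) (rho j) = sg F (rho a - rho b) (rho j) * sg F (rho b) (rho j) := by
      rw [← sg_add_left, sub_add_cancel]
    have h3 : sg F (rho a + rho j) (beta k) = sg F (rho a - rho b) (beta k) * sg F (rho b + rho j) (beta k) := by
      rw [← sg_add_left]; congr 1; abel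
    simp only [ss, wt, sg_add_right, h2, h3]
    linear_combination (tz F j * sg F (rho b) (rho j) * sg F (rho b + rho j) (beta k) * sg F (rho a - rho b) (beta k) * sg F (rho a - rho b) (rho j)) * h1
  · intro h0
    have := congrFun h0 2
    rw [hs] at this
    have h4 := wt_two a j k
    rw [this] at h4
    simp at h4

lemma ee_psi {a b : Fin 8} (h : a ≠ b) (i j : Fin 8) (k : Fin 2) :
    ⁅ee F a b, psi F i j k⁆ = (if i = b then psi F a j k else 0) + (if j = b then psi F i a k else 0) := by
  by_cases hij : i = j
  · subst hij
    rw [psi_self, lie_zero]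
    split_ifs
    · rw [psi_skew i a]; simp
    · simp
  by_cases hi : i = b
  · subst hi
    rw [if_pos rfl, if_neg (Ne.symm hij), add_zero, ee_aux h (Ne.symm hij)]
  by_cases hj : j = b
  · subst hj
    rw [if_pos rfl, if_neg hij, zero_add, psi_skew j i, lie_neg, ee_aux h hij, psi_skew i a]
    simp
  · rw [if_neg hi, if_neg hj, add_zero, ee, psi, smul_lie, lie_smul, lie_nb ((isRt_rho a b).2 h) ((isRt_wt i j k).2 hij),
      E_not (rho_wt_not h hi hj hij)]
    · simp
    · intro h0
      have := congrFun h0 2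
      have h4 := wt_two i j k
      have h5 := rho_two a
      have h6 := rho_two b
      simp only [Pi.add_apply, Pi.sub_apply, Pi.zero_apply] at this
      omega

lemma one_sub_ne (k : Fin 2) : 1 - k ≠ k := by revert k; decide
lemma one_sub_sub (k : Fin 2) : 1 - (1 - k) = k := by revert k; decide
lemma eq_or_sub (k l : Fin 2) : l = k ∨ l = 1 - k := by revert k l; decide
lemma beta_two (k : Fin 2) : beta k 2 = -7 := by revert k; decide

lemma ff_psi (c : Fin 2) (i j : Fin 8) (k : Fin 2) :
    ⁅ff F c, psi F i j k⁆ = if k = 1 - c then psi F i j c else 0 := by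
  by_cases hij : i = j
  · subst hij; rw [psi_self, psi_self]; simp
  have hne : beta c - beta (1 - c) + wt i j k ≠ 0 := by
    intro h0
    have := congrFun h0 2
    have h4 := wt_two i j k
    simp only [Pi.add_apply, Pi.sub_apply, Pi.zero_apply, beta_two] at this
    omega
  rw [ff, psi, smul_lie, lie_smul, lie_nb (isRt_bb c) ((isRt_wt i j k).2 hij) hne]
  rcases eq_or_sub c k with rfl | rfl
  · rw [E_not (beta_wt_not k hij), if_neg (one_sub_ne k).symm]; simp
  · rw [if_pos rfl, psi, smul_smul, smul_smul, show beta c - beta (1 - c) + wt i j (1 - c) = wt i j c by unfold wt; abel]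
    congr 1
    have h1 := sg_sq (F := F) (beta c - beta (1 - c)) (beta (1 - c))
    have h2 : ∀ i, sg F (beta c - beta (1 - c)) (rho i) = sg F (rho i) (beta c - beta (1 - c)) := by
      intro i
      rw [sg_swap, bil_comm, sub_eq_add_neg, bil_add_right, bil_neg_right, bil_rho_beta', bil_rho_beta', add_neg_cancel]
      simp
    have h3 : sg F (rho i + rho j) (beta c) = sg F (rho i + rho j) (beta c - beta (1 - c)) * sg F (rho i + rho j) (beta (1 - c)) := by
      rw [← sg_add_right, sub_add_cancel]
    rw [ss, ss, h3, wt, sg_add_right, sg_add_right, h2, h2, sg_add_left (rho i) (rho j) (beta c - beta (1 - c))]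
    linear_combination (tz F j * sg F (rho i) (rho j) * sg F (rho i + rho j) (beta (1 - c)) * sg F (rho i) (beta c - beta (1 - c)) * sg F (rho j) (beta c - beta (1 - c))) * h1

/-- the degree one roots generate -/
lemma gen_ind {P : ℕ → Lam → Prop} (h1 : ∀ i j k, i ≠ j → P 1 (wt i j k))
    (hs : ∀ n v i j k, i ≠ j → IsRt v → IsRt (v + wt i j k) → P n v → P (n + 1) (v + wt i j k)) :
    ∀ n : ℕ, n < 4 → ∀ v, IsRt v → v 2 % 4 = ((n + 1 : ℕ) : ℤ) % 4 → P (n + 1) v := by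
  intro n
  induction n with
  | zero =>
    intro _ v hv h
    obtain ⟨i, j, k, hij, rfl⟩ := cls1 hv (by simpa using h)
    exact h1 i j k hij
  | succ n ih =>
    intro hn v hv h
    obtain ⟨i, j, k, hij, hr'⟩ := cls_gen hv (by push_cast at h; omega)
    have h4 := wt_two i j k
    have := hs (n + 1) _ i j k hij hr' (by rwa [sub_add_cancel]) (ih (by omega) _ hr' (by
      rw [Pi.sub_apply]; push_cast at h ⊢; omega))
    rwa [sub_add_cancel] at this

lemma exists_deg (v : Lam) : ∃ n : ℕ, n < 4 ∧ v 2 % 4 = ((n + 1 : ℕ) : ℤ) % 4 := by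
  have : (v 2 % 4 = 0 ∨ v 2 % 4 = 1) ∨ v 2 % 4 = 2 ∨ v 2 % 4 = 3 := by omega
  rcases this with (h | h) | h | h
  · exact ⟨3, by omega, by rw [h]; rfl⟩
  · exact ⟨0, by omega, by rw [h]; rfl⟩
  · exact ⟨1, by omega, by rw [h]; rfl⟩
  · exact ⟨2, by omega, by rw [h]; rfl⟩

lemma E_sum {u v : Lam} (hu : IsRt u) (hv : IsRt v) (h : IsRt (u + v)) :
    E F (u + v) = sg F u v • ⁅E F u, E F v⁆ := by
  rw [lie_nb hu hv h.ne_zero, smul_smul, sg_sq, one_smul]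

lemma gen_scal {q : Au F} {κ : F} (h : ∀ i j k, i ≠ j → q • E F (wt i j k) = κ • E F (wt i j k)) :
    ∀ n : ℕ, n < 4 → ∀ v, IsRt v → v 2 % 4 = ((n + 1 : ℕ) : ℤ) % 4 → q • E F v = κ ^ (n + 1) • E F v := by
  refine gen_ind (P := fun n v => q • E F v = κ ^ n • E F v) (fun i j k hij => by rw [pow_one, h i j k hij]) ?_
  intro n v i j k hij hv hv' hP
  rw [E_sum hv ((isRt_wt i j k).2 hij) hv', au_smul, au_lie, hP, h i j k hij, smul_lie, lie_smul]
  module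

lemma gen_line {q : Au F} (h : ∀ i j k, i ≠ j → ∃ c : F, q • E F (wt i j k) = c • E F (wt i j k)) {v : Lam}
    (hv : IsRt v) : ∃ c : F, q • E F v = c • E F v := by
  obtain ⟨n, hn, hd⟩ := exists_deg v
  refine gen_ind (P := fun n v => ∃ c : F, q • E F v = c • E F v) h ?_ n hn v hv hd
  rintro n v i j k hij hv hv' ⟨c, hP⟩
  obtain ⟨d, hd⟩ := h i j k hij
  refine ⟨c * d, ?_⟩
  rw [E_sum hv ((isRt_wt i j k).2 hij) hv', au_smul, au_lie, hP, hd, smul_lie, lie_smul]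
  module

lemma line_tor {q : Au F} (h : ∀ v, IsRt v → ∃ c : F, q • E F v = c • E F v) : ∃ t, q = tor t := by
  apply eq_tor
  have key : ∀ v, IsRt v → q • (H (cor F v) : M F) = H (cor F v) := by
    intro v hv
    obtain ⟨c, hc⟩ := h v hv
    obtain ⟨d, hd⟩ := h (-v) hv.neg
    have hc0 : c ≠ 0 := by
      rintro rfl
      rw [zero_smul, smul_eq_zero_iff_eq] at hc
      exact E_ne_zero hv hc
    have h1 : q • (H (cor F v) : M F) = (d * c) • H (cor F v) := by
      rw [← lie_opp' hv, au_lie, hc, hd, smul_lie, lie_smul, smul_smul]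
    have h2 : q • ⁅(H (cor F v) : M F), E F v⁆ = ⁅q • (H (cor F v) : M F), q • E F v⁆ := au_lie _ _ _
    rw [h1, hc, lie_HE, au_smul, hc, smul_lie, lie_smul, lie_HE, pr_cor, show bil v v = 2 from hv] at h2
    have h3 := congrArg (co (F := F) ⟨v, hv⟩) h2
    simp only [map_smul, co_E, if_pos, smul_eq_mul, mul_one] at h3
    have h4 : d * c = 1 := by
      have : ((2:ℤ):F) * c ≠ 0 := mul_ne_zero (by norm_num) hc0
      apply mul_right_cancel₀ this
      linear_combination -h3
    rw [h1, h4, one_smul]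
  intro k
  rw [H_expand]
  have : ∀ x : M F, q • x = q.lin x := fun x => (Au.lin_apply q x).symm
  rw [this, map_sum]
  refine Finset.sum_congr rfl fun i _ => ?_
  rw [map_smul, ← this, key _ (isRt_al i)]

lemma gen_one {q : Au F} (h : ∀ i j k, i ≠ j → q • E F (wt i j k) = E F (wt i j k)) : q = 1 := by
  have h1 : ∀ v, IsRt v → q • E F v = E F v := by
    intro v hv
    obtain ⟨n, hn, hd⟩ := exists_deg v
    have := gen_scal (q := q) (κ := 1) (fun i j k hij => by rw [h i j k hij, one_smul]) n hn v hv hd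
    rwa [one_pow, one_smul] at this
  obtain ⟨t, rfl⟩ := line_tor (q := q) (fun v hv => ⟨1, by rw [h1 v hv, one_smul]⟩)
  apply au_ext
  intro x
  rw [one_smul]
  have : (tor t : Au F).lin = LinearMap.id := by
    apply M_hom_ext
    · intro k; rw [Au.lin_apply, tor_H]; rfl
    · intro v hv; rw [Au.lin_apply, h1 v hv]; rfl
  rw [← Au.lin_apply, this]; rfl

lemma gen_theta {q : Au F} {κ : F} (h : ∀ i j k, i ≠ j → q • E F (wt i j k) = κ • E F (wt i j k)) : κ ^ 4 = 1 := by
  have h0 := gen_scal h 3 (by norm_num)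
  have hd : ∀ i j, (rho i - rho j) 2 % 4 = ((3 + 1 : ℕ) : ℤ) % 4 := by
    intro i j
    have h5 := rho_two i
    have h6 := rho_two j
    rw [Pi.sub_apply]; push_cast; omega
  have r01 := (isRt_rho 0 1).2 (by decide)
  have r12 := (isRt_rho 1 2).2 (by decide)
  have r02 := (isRt_rho 0 2).2 (by decide)
  have e : rho 0 - rho 2 = (rho 0 - rho 1) + (rho 1 - rho 2) := by abel
  have h1 := h0 _ r02 (hd 0 2)
  rw [e] at r02 h1
  rw [E_sum r01 r12 r02, au_smul, au_lie, h0 _ r01 (hd 0 1), h0 _ r12 (hd 1 2), smul_lie, lie_smul] at h1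
  have h2 : (κ ^ 4 * κ ^ 4) • E F (rho 0 - rho 1 + (rho 1 - rho 2)) = κ ^ 4 • E F (rho 0 - rho 1 + (rho 1 - rho 2)) := by
    rw [E_sum r01 r12 r02, ← h1]; module
  have h3 := congrArg (co (F := F) ⟨_, r02⟩) h2
  simp only [map_smul, co_E, if_pos, smul_eq_mul, mul_one] at h3
  have h4 : κ ^ 4 ≠ 0 := by
    intro h4
    have := h0 _ r01 (hd 0 1)
    rw [h4, zero_smul, smul_eq_zero_iff_eq] at this
    exact E_ne_zero r01 this
  exact mul_right_cancel₀ h4 (by rw [h3, one_mul])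

end E8

namespace E8
open LieAlgebra LieModule

variable {F : Type} [Field F] [CharZero F]

/-- the trilinear parametrisation of the degree one part -/
noncomputable def Psi : (Fin 8 → F) →ₗ[F] (Fin 8 → F) →ₗ[F] (Fin 2 → F) →ₗ[F] M F :=
  ∑ i, ∑ j, ∑ k, (LinearMap.proj i : (Fin 8 → F) →ₗ[F] F).smulRight
    ((LinearMap.proj j : (Fin 8 → F) →ₗ[F] F).smulRight
      ((LinearMap.proj k : (Fin 2 → F) →ₗ[F] F).smulRight (psi F i j k)))

lemma Psi_apply (x y : Fin 8 → F) (z : Fin 2 → F) :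
    Psi x y z = ∑ i, ∑ j, ∑ k, (x i * (y j * z k)) • psi F i j k := by
  simp only [Psi, LinearMap.sum_apply, LinearMap.smulRight_apply, LinearMap.smul_apply, LinearMap.proj_apply, smul_smul, mul_assoc]

/-- coordinate vectors -/
def e8 (F : Type) [Field F] (i : Fin 8) : Fin 8 → F := Pi.single i 1
/-- coordinate vectors -/
def e2 (F : Type) [Field F] (i : Fin 2) : Fin 2 → F := Pi.single i 1

lemma Psi_e (i j : Fin 8) (k : Fin 2) : Psi (e8 F i) (e8 F j) (e2 F k) = psi F i j k := by
  rw [Psi_apply, Finset.sum_eq_single i, Finset.sum_eq_single j, Finset.sum_eq_single k]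
  · simp [e8, e2]
  all_goals first
    | (intro b _ hb; simp [e8, e2, hb])
    | simp

lemma co_psi {i j : Fin 8} (h : i ≠ j) (k : Fin 2) (i' j' : Fin 8) (k' : Fin 2) :
    co (F := F) ⟨wt i j k, (isRt_wt i j k).2 h⟩ (psi F i' j' k') =
      ss F i j k * (if k' = k then ((if i' = i ∧ j' = j then 1 else 0) - (if i' = j ∧ j' = i then 1 else 0)) else 0) := by
  rw [psi, map_smul, co_E, smul_eq_mul]
  simp only [wt_inj h]
  by_cases hk : k' = k
  · subst hk
    by_cases h1 : i' = i ∧ j' = j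
    · obtain ⟨rfl, rfl⟩ := h1
      simp [h]
    · by_cases h2 : i' = j ∧ j' = i
      · obtain ⟨rfl, rfl⟩ := h2
        rw [ss_skew h]
        simp [h]
      · simp [h1, h2]
  · simp [hk]

lemma co_Psi {i j : Fin 8} (h : i ≠ j) (k : Fin 2) (x y : Fin 8 → F) (z : Fin 2 → F) :
    co (F := F) ⟨wt i j k, (isRt_wt i j k).2 h⟩ (Psi x y z) = ss F i j k * ((x i * y j - x j * y i) * z k) := by
  rw [Psi_apply]
  simp only [map_sum, map_smul, co_psi h k, smul_eq_mul]
  have e1 : ∀ a b c, x a * (y b * z c) * (ss F i j k * (if c = k then ((if a = i ∧ b = j then (1:F) else 0) - (if a = j ∧ b = i then 1 else 0)) else 0))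
      = ss F i j k * (if a = i then (if b = j then (if c = k then x a * (y b * z c) else 0) else 0) else 0) -
       ss F i j k * (if a = j then (if b = i then (if c = k then x a * (y b * z c) else 0) else 0) else 0) := by
    intro a b c
    split_ifs <;> first | ring1 | (exfalso; tauto)
  simp only [e1, Finset.sum_sub_distrib, ← Finset.mul_sum]
  simp only [Finset.sum_ite_irrel, Finset.sum_const_zero, Finset.sum_ite_eq', Finset.mem_univ, if_true]
  ring

lemma Psi_ext {x y x' y' : Fin 8 → F} {z z' : Fin 2 → F} (h : Psi x y z = Psi x' y' z') (i j : Fin 8) (k : Fin 2) :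
    (x i * y j - x j * y i) * z k = (x' i * y' j - x' j * y' i) * z' k := by
  by_cases hij : i = j
  · subst hij; ring
  · have := congrArg (co (F := F) ⟨wt i j k, (isRt_wt i j k).2 hij⟩) h
    rw [co_Psi hij, co_Psi hij] at this
    exact mul_left_cancel₀ (ss_ne i j k) this

/-- the automorphism q acts on the degree one part through the pair (A, B) -/
def RR (q : Au F) (A : Module.End F (Fin 8 → F)) (B : Module.End F (Fin 2 → F)) : Prop :=
  ∀ x y z, q • Psi x y z = Psi (A x) (A y) (B z)

lemma RR_of {q : Au F} {A : Module.End F (Fin 8 → F)} {B : Module.End F (Fin 2 → F)}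
    (h : ∀ i j k, q • psi F i j k = Psi (A (e8 F i)) (A (e8 F j)) (B (e2 F k))) : RR q A B := by
  have h1 : ∀ x y z, q • Psi x y z = q.lin (Psi x y z) := fun x y z => (Au.lin_apply q _).symm
  have e1 : ∀ x : Fin 8 → F, x = ∑ i, x i • e8 F i := fun x => by
    simpa [e8] using (pi_eq_sum_univ' x)
  have e3 : ∀ x : Fin 2 → F, x = ∑ i, x i • e2 F i := fun x => by
    simpa [e2] using (pi_eq_sum_univ' x)
  intro x y z
  rw [h1, e1 x, e1 y, e3 z]
  simp only [map_sum, map_smul, LinearMap.sum_apply, LinearMap.smul_apply]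
  simp only [Psi_e, ← h]
  simp only [← Au.lin_apply]

lemma RR_one : RR (1 : Au F) 1 1 := fun x y z => by rw [one_smul]; rfl
lemma RR.mul {q q' : Au F} {A A' : Module.End F (Fin 8 → F)} {B B' : Module.End F (Fin 2 → F)}
    (h : RR q A B) (h' : RR q' A' B') : RR (q * q') (A * A') (B * B') := fun x y z => by
  rw [mul_smul, h', h]; rfl
lemma RR.inv {q : Au F} {A A' : Module.End F (Fin 8 → F)} {B B' : Module.End F (Fin 2 → F)}
    (h : RR q A B) (hA : A * A' = 1) (hB : B * B' = 1) : RR q⁻¹ A' B' := fun x y z => by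
  rw [inv_smul_eq_iff, h]
  have h1 : ∀ x, A (A' x) = x := fun x => by rw [← Module.End.mul_apply, hA]; rfl
  have h2 : ∀ x, B (B' x) = x := fun x => by rw [← Module.End.mul_apply, hB]; rfl
  rw [h1, h1, h2]

lemma RR.rescale {q : Au F} {A : Module.End F (Fin 8 → F)} {B : Module.End F (Fin 2 → F)}
    (h : RR q A B) {s : F} (hs : s ≠ 0) : RR q (s • A) ((s⁻¹ * s⁻¹) • B) := fun x y z => by
  rw [h]
  simp only [LinearMap.smul_apply, map_smul, smul_smul]
  rw [show s⁻¹ * s⁻¹ * (s * s) = 1 by field_simp, one_smul]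

lemma RR_self {A : Module.End F (Fin 8 → F)} {B : Module.End F (Fin 2 → F)} (h : RR (1 : Au F) A B) :
    ∃ s : F, s ≠ 0 ∧ A = s • 1 ∧ B = (s⁻¹ * s⁻¹) • 1 := by
  have hp : ∀ i j k a b c, (e8 F i a * e8 F j b - e8 F i b * e8 F j a) * e2 F k c =
      (A (e8 F i) a * A (e8 F j) b - A (e8 F i) b * A (e8 F j) a) * B (e2 F k) c := by
    intro i j k a b c
    have := h (e8 F i) (e8 F j) (e2 F k)
    rw [one_smul] at this
    exact Psi_ext this a b c
  have hA : ∀ i a, a ≠ i → A (e8 F i) a = 0 := by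
    intro i a hai
    obtain ⟨j, hji, hja⟩ : ∃ j : Fin 8, j ≠ i ∧ j ≠ a := by
      have : ∀ i a : Fin 8, ∃ j : Fin 8, j ≠ i ∧ j ≠ a := by decide
      exact this i a
    have h1 := hp i j 0 i j 0
    have h2 := hp i j 0 a i 0
    have h3 := hp i j 0 a j 0
    simp [e8, e2, hji, hji.symm, hja, hja.symm, hai, hai.symm] at h1 h2 h3
    have hB : B (Pi.single 0 1) 0 ≠ 0 := by
      intro h0; rw [h0] at h1; simp at h1
    have h2' := h2.resolve_right hB
    have h3' := h3.resolve_right hB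
    simp only [e8]
    linear_combination (A (Pi.single i 1) a) * h1 + (B (Pi.single 0 1) 0) * ((A (Pi.single i 1) i) * h3' - A (Pi.single i 1) j * h2')
  have hd : ∀ i j k, i ≠ j → A (e8 F i) i * A (e8 F j) j * B (e2 F k) k = 1 := by
    intro i j k hij
    have h1 := hp i j k i j k
    rw [hA i j hij.symm, hA j i hij] at h1
    simp [e8, e2, hij, hij.symm] at h1
    simp only [e8, e2]
    exact h1.symm
  have hB : ∀ k c, c ≠ k → B (e2 F k) c = 0 := by
    intro k c hck
    have h1 := hp 0 1 k 0 1 c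
    have h2 := hd 0 1 k (by decide)
    rw [hA 0 1 (by decide), hA 1 0 (by decide)] at h1
    simp only [mul_zero, zero_mul, sub_zero] at h1
    have h3 : A (e8 F 0) 0 * A (e8 F 1) 1 ≠ 0 := fun h0 => by rw [h0] at h2; simp at h2
    have h4 : e2 F k c = 0 := by simp [e2, hck]
    rw [h4, mul_zero] at h1
    exact (mul_eq_zero.1 h1.symm).resolve_left h3
  have hs : A (e8 F 0) 0 ≠ 0 := fun h0 => by have h2 := hd 0 1 0 (by decide); rw [h0] at h2; simp at h2
  have hall : ∀ i, A (e8 F i) i = A (e8 F 0) 0 := by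
    intro i
    by_cases hi : i = 0
    · rw [hi]
    obtain ⟨j, hji, hja⟩ : ∃ j : Fin 8, i ≠ j ∧ 0 ≠ j := by
      have : ∀ i a : Fin 8, ∃ j : Fin 8, i ≠ j ∧ a ≠ j := by decide
      exact this i 0
    have h1 := hd i j 0 hji
    have h2 := hd 0 j 0 hja
    have h3 : A (e8 F j) j * B (e2 F 0) 0 ≠ 0 := fun h0 => by rw [mul_assoc, h0] at h1; simp at h1
    apply mul_right_cancel₀ h3
    rw [← mul_assoc, ← mul_assoc, h1, h2]
  refine ⟨A (e8 F 0) 0, hs, ?_, ?_⟩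
  · apply (Pi.basisFun F (Fin 8)).ext
    intro i
    funext a
    rw [Pi.basisFun_apply]
    by_cases hai : a = i
    · subst hai; simp; exact hall a
    · have := hA i a hai
      simp [hai]; exact this
  · apply (Pi.basisFun F (Fin 2)).ext
    intro k
    funext a
    rw [Pi.basisFun_apply]
    by_cases hai : a = k
    · subst hai; simp
      have := hd 0 1 a (by decide)
      rw [hall 1] at this
      simp only [e2] at this
      field_simp
      linear_combination this
    · have := hB k a hai
      simp [hai]; exact this

lemma RR.eq_one {q : Au F} (h : RR q 1 1) : q = 1 := by
  apply gen_one
  intro i j k hij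
  have h1 := h (e8 F i) (e8 F j) (e2 F k)
  simp only [Module.End.one_apply, Psi_e] at h1
  rw [psi, au_smul] at h1
  exact smul_right_injective _ (ss_ne i j k) h1

lemma RR.scal {q : Au F} {κ : F} (h : RR q 1 (κ • 1)) :
    ∀ i j k, i ≠ j → q • E F (wt i j k) = κ • E F (wt i j k) := by
  intro i j k hij
  have h1 := h (e8 F i) (e8 F j) (e2 F k)
  simp only [Module.End.one_apply, LinearMap.smul_apply, map_smul, Psi_e] at h1
  rw [psi, au_smul, smul_comm κ] at h1
  exact smul_right_injective _ (ss_ne i j k) h1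

end E8

namespace E8
open LieAlgebra LieModule

variable {F : Type} [Field F] [CharZero F]

lemma exp_two {v : Lam} (hv : IsRt v) {s : F} (hs : s * s = 1) (t : F) {x y : M F}
    (h1 : ⁅s • E F v, x⁆ = y) (h2 : ⁅s • E F v, y⁆ = 0) :
    expA ((t * s) • E F v) (nil_smul (adE_nil hv) _) • x = x + t • y := by
  have hs0 : s ≠ 0 := by rintro rfl; simp at hs
  have h3 : ⁅E F v, x⁆ = s • y := by
    rw [← h1, smul_lie, smul_smul, hs, one_smul]
  have h4 : ⁅E F v, y⁆ = 0 := by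
    rw [smul_lie] at h2
    exact (smul_eq_zero.1 h2).resolve_left hs0
  rw [expA_smul (E F v) (adE_nil hv) (adE_cube hv)]
  simp only [Finset.sum_range_succ, Finset.sum_range_zero, pow_zero, pow_one, pow_two, Module.End.mul_apply, ad_apply,
    Module.End.one_apply, h3, lie_smul, h4, smul_zero, add_zero, zero_add]
  simp only [smul_smul]
  congr 1
  · simp
  · congr 1
    simp only [Nat.factorial_one, Nat.cast_one, inv_one, mul_one]
    linear_combination t * hs

lemma tv8 {a b : Fin 8} (i : Fin 8) (t : F) :
    Matrix.toLin' (Matrix.transvection a b t) (e8 F i) = e8 F i + (if i = b then t else 0) • e8 F a := by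
  rw [Matrix.transvection, map_add, Matrix.toLin'_one, LinearMap.add_apply, LinearMap.id_apply]
  congr 1
  rw [Matrix.toLin'_apply, e8, Matrix.mulVec_single_one]
  funext j
  simp only [Matrix.col_apply, Matrix.single_apply, Pi.smul_apply, e8, Pi.single_apply, smul_eq_mul]
  split_ifs <;> simp_all

lemma tv2 {a b : Fin 2} (i : Fin 2) (t : F) :
    Matrix.toLin' (Matrix.transvection a b t) (e2 F i) = e2 F i + (if i = b then t else 0) • e2 F a := by
  rw [Matrix.transvection, map_add, Matrix.toLin'_one, LinearMap.add_apply, LinearMap.id_apply]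
  congr 1
  rw [Matrix.toLin'_apply, e2, Matrix.mulVec_single_one]
  funext j
  simp only [Matrix.col_apply, Matrix.single_apply, Pi.smul_apply, e2, Pi.single_apply, smul_eq_mul]
  split_ifs <;> simp_all

lemma RR_tv8 {a b : Fin 8} (h : a ≠ b) (t : F) :
    RR (expA ((t * sg F (rho a - rho b) (rho b)) • E F (rho a - rho b)) (nil_smul (adE_nil ((isRt_rho a b).2 h)) _))
      (Matrix.toLin' (Matrix.transvection a b t)) 1 := by
  have hv := (isRt_rho a b).2 h
  · apply RR_of
    intro i j k
    have h0 := ee_psi (F := F) h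
    rw [exp_two hv (sg_sq _ _) t (h0 i j k)]
    · simp only [tv8, map_add, map_smul, LinearMap.add_apply, LinearMap.smul_apply, Module.End.one_apply, Psi_e]
      by_cases hi : i = b <;> by_cases hj : j = b
      · subst hi; subst hj
        simp only [if_pos, psi_self, psi_skew j a]
        module
      all_goals (simp only [hi, hj, if_true, if_false]; module)
    · change ⁅ee F a b, _⁆ = 0
      rw [lie_add]
      by_cases hi : i = b <;> by_cases hj : j = b
      · subst hi; subst hj
        simp [h0, psi_self, h]
      all_goals simp [hi, hj, h0, h]

lemma RR_tv2 (a : Fin 2) (t : F) :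
    RR (expA ((t * sg F (beta a - beta (1 - a)) (beta (1 - a))) • E F (beta a - beta (1 - a))) (nil_smul (adE_nil (isRt_bb a)) _)) 1
      (Matrix.toLin' (Matrix.transvection a (1 - a) t)) := by
  apply RR_of
  intro i j k
  have h0 := ff_psi (F := F)
  rw [exp_two (isRt_bb a) (sg_sq _ _) t (h0 a i j k)]
  · simp only [tv2, map_add, map_smul, LinearMap.add_apply, LinearMap.smul_apply, Module.End.one_apply, Psi_e]
    by_cases hk : k = 1 - a
    · simp only [hk, if_true]
    · simp only [hk, if_false, smul_zero, zero_smul]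
  · change ⁅ff F a, _⁆ = 0
    split_ifs
    · rw [h0, if_neg (one_sub_ne a).symm]
    · exact lie_zero _

lemma RR_tor (t : Fin 8 → Fˣ) : RR (tor t) (Matrix.toLin' (Matrix.diagonal fun i => (chi t (rho i) : F)))
    (Matrix.toLin' (Matrix.diagonal fun i => (chi t (beta i) : F))) := by
  apply RR_of
  intro i j k
  have h1 : ∀ i : Fin 8, Matrix.toLin' (Matrix.diagonal fun i => (chi t (rho i) : F)) (e8 F i) = (chi t (rho i) : F) • e8 F i := by
    intro i
    rw [Matrix.toLin'_apply]; funext a; rw [Matrix.mulVec_diagonal]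
    simp only [e8, Pi.smul_apply, Pi.single_apply, smul_eq_mul]
    split_ifs with h <;> simp [h]
  have h2 : ∀ i : Fin 2, Matrix.toLin' (Matrix.diagonal fun i => (chi t (beta i) : F)) (e2 F i) = (chi t (beta i) : F) • e2 F i := by
    intro i
    rw [Matrix.toLin'_apply]; funext a; rw [Matrix.mulVec_diagonal]
    simp only [e2, Pi.smul_apply, Pi.single_apply, smul_eq_mul]
    split_ifs with h <;> simp [h]
  rw [h1, h1, h2]
  simp only [map_smul, LinearMap.smul_apply, Psi_e]
  by_cases hij : i = j
  · subst hij; simp [psi_self]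
  · rw [psi, au_smul, tor_E t ((isRt_wt i j k).2 hij), wt, chi_add, chi_add, Units.val_mul, Units.val_mul]
    module

lemma exists_tor [IsAlgClosed F] (a : Fin 8 → Fˣ) (b : Fˣ) (h0 : a 0 = 1) :
    ∃ t : Fin 8 → Fˣ, (∀ i, chi t (rho i) = a i) ∧ t 0 = b := by
  obtain ⟨r, hr4⟩ : ∃ r : Fˣ, r ^ 4 = a 1 * (b ^ 2 * (a 6 / a 7) ^ 3 * (a 5 / a 6) ^ 6 * (a 4 / a 5) ^ 5 * (a 3 / a 4) ^ 4 * (a 2 / a 3) ^ 3 * (a 1 / a 2) ^ 2)⁻¹ := by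
    generalize a 1 * _ = c
    obtain ⟨r, hr4⟩ := IsAlgClosed.exists_pow_nat_eq (c : F) (show 0 < 4 by norm_num)
    have : r ≠ 0 := by rintro rfl; exact c.ne_zero (by rw [← hr4]; simp)
    exact ⟨Units.mk0 r this, by ext; simpa using hr4⟩
  refine ⟨![b, a 6 / a 7, r, a 5 / a 6, a 4 / a 5, a 3 / a 4, a 2 / a 3, a 1 / a 2], ?_, rfl⟩
  generalize ht' : ![b, a 6 / a 7, r, a 5 / a 6, a 4 / a 5, a 3 / a 4, a 2 / a 3, a 1 / a 2] = t
  have e1 : chi t (rho 1) = a 1 := by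
    rw [← ht', show rho 1 = fun i => ((![2, 3, 4, 6, 5, 4, 3, 2] i : ℕ) : ℤ) by decide +kernel]
    simp only [chi, zpow_natCast, Fin.prod_univ_eight]
    simp only [Matrix.cons_val]
    rw [hr4]
    generalize (a 6 / a 7) ^ 3 = x1
    generalize (a 5 / a 6) ^ 6 = x2
    generalize (a 4 / a 5) ^ 5 = x3
    generalize (a 3 / a 4) ^ 4 = x4
    generalize (a 2 / a 3) ^ 3 = x5
    generalize (a 1 / a 2) ^ 2 = x6
    generalize b ^ 2 = x7
    generalize a 1 = x8
    apply Units.ext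
    push_cast
    have := x1.ne_zero
    have := x2.ne_zero
    have := x3.ne_zero
    have := x4.ne_zero
    have := x5.ne_zero
    have := x6.ne_zero
    have := x7.ne_zero
    field_simp
  have st : ∀ v w : Lam, ∀ i, w = v + -al i → chi t w = chi t v * (t i)⁻¹ := by
    intro v w i h; rw [h, chi_add, chi_neg, chi_al]
  have e2 : chi t (rho 2) = a 2 := by
    rw [st (rho 1) (rho 2) 7 (by decide +kernel), e1, ← ht']; simp
  have e3 : chi t (rho 3) = a 3 := by
    rw [st (rho 2) (rho 3) 6 (by decide +kernel), e2, ← ht']; simp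
  have e4 : chi t (rho 4) = a 4 := by
    rw [st (rho 3) (rho 4) 5 (by decide +kernel), e3, ← ht']; simp
  have e5 : chi t (rho 5) = a 5 := by
    rw [st (rho 4) (rho 5) 4 (by decide +kernel), e4, ← ht']; simp
  have e6 : chi t (rho 6) = a 6 := by
    rw [st (rho 5) (rho 6) 3 (by decide +kernel), e5, ← ht']; simp
  have e7 : chi t (rho 7) = a 7 := by
    rw [st (rho 6) (rho 7) 1 (by decide +kernel), e6, ← ht']; simp
  have e0 : chi t (rho 0) = a 0 := by
    rw [h0, show rho 0 = 0 by decide +kernel, chi_zero]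
  intro i
  fin_cases i
  · exact e0
  · exact e1
  · exact e2
  · exact e3
  · exact e4
  · exact e5
  · exact e6
  · exact e7


lemma RR_diag [IsAlgClosed F] {d : Fin 8 → F} {e : Fin 2 → F} (hd : ∀ i, d i ≠ 0) (he : ∀ i, e i ≠ 0) :
    ∃ q : Au F, ∃ c : F, c ≠ 0 ∧ RR q (Matrix.toLin' (Matrix.diagonal d)) (c • Matrix.toLin' (Matrix.diagonal e)) := by
  obtain ⟨t, h1, h2⟩ := exists_tor (fun i => Units.mk0 (d i) (hd i) / Units.mk0 (d 0) (hd 0))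
    (Units.mk0 (e 0) (he 0) / Units.mk0 (e 1) (he 1)) (by simp)
  have hb : (chi t (beta 0) : F) = e 0 / e 1 * chi t (beta 1) := by
    rw [show beta 0 = al 0 + beta 1 by decide +kernel, chi_add, chi_al, h2]; simp
  have hc1 : (chi t (beta 1) : F) ≠ 0 := Units.ne_zero _
  have := (RR_tor t).rescale (hd 0)
  refine ⟨tor t, (d 0)⁻¹ * (d 0)⁻¹ * (chi t (beta 1) / e 1), ?_, ?_⟩
  · have := hd 0
    have := he 1
    positivity
  · convert this using 1
    · rw [← map_smul]
      congr 1
      ext i j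
      simp only [Matrix.smul_apply, Matrix.diagonal_apply, h1, smul_eq_mul]
      split_ifs
      · simp; field_simp [hd 0]
      · simp
    · rw [← map_smul, ← map_smul]
      congr 1
      ext i j
      have := he 1
      simp only [Matrix.smul_apply, Matrix.diagonal_apply, smul_eq_mul]
      split_ifs
      · fin_cases i
        · simp [hb]; ring
        · simp; field_simp
      · simp

lemma RR_real8 [IsAlgClosed F] (A : Matrix (Fin 8) (Fin 8) F) (hA : A.det ≠ 0) :
    ∃ q : Au F, ∃ c : F, c ≠ 0 ∧ RR q (Matrix.toLin' A) (c • 1) := by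
  refine Matrix.diagonal_transvection_induction_of_det_ne_zero
    (fun A => ∃ q : Au F, ∃ c : F, c ≠ 0 ∧ RR q (Matrix.toLin' A) (c • 1)) A hA ?_ ?_ ?_
  · intro D hD
    rw [Matrix.det_diagonal, Finset.prod_ne_zero_iff] at hD
    obtain ⟨q, c, hc, h⟩ := RR_diag (d := D) (e := fun _ => 1) (fun i => hD i (Finset.mem_univ _)) (by simp)
    refine ⟨q, c, hc, ?_⟩
    simpa [Module.End.one_eq_id] using h
  · rintro ⟨a, b, hab, t⟩
    have h := RR_tv8 hab t
    exact ⟨_, 1, one_ne_zero, by rw [one_smul]; exact h⟩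
  · rintro A B - - ⟨q, c, hc, h⟩ ⟨q', c', hc', h'⟩
    refine ⟨q * q', c * c', mul_ne_zero hc hc', ?_⟩
    have := h.mul h'
    rwa [show Matrix.toLin' A * Matrix.toLin' B = Matrix.toLin' (A * B) from (Matrix.toLin'_mul A B).symm, smul_mul_smul_comm, one_mul] at this

lemma RR_real2 [IsAlgClosed F] (A : Matrix (Fin 2) (Fin 2) F) (hA : A.det ≠ 0) :
    ∃ q : Au F, ∃ c : F, c ≠ 0 ∧ RR q 1 (c • Matrix.toLin' A) := by
  refine Matrix.diagonal_transvection_induction_of_det_ne_zero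
    (fun A => ∃ q : Au F, ∃ c : F, c ≠ 0 ∧ RR q 1 (c • Matrix.toLin' A)) A hA ?_ ?_ ?_
  · intro D hD
    rw [Matrix.det_diagonal, Finset.prod_ne_zero_iff] at hD
    obtain ⟨q, c, hc, h⟩ := RR_diag (d := fun _ => 1) (e := D) (by simp) (fun i => hD i (Finset.mem_univ _))
    refine ⟨q, c, hc, ?_⟩
    simpa [Module.End.one_eq_id] using h
  · rintro ⟨a, b, hab, t⟩
    have hb : b = 1 - a := by revert a b; decide
    subst hb
    have h := RR_tv2 a t
    exact ⟨_, 1, one_ne_zero, by rw [one_smul]; exact h⟩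
  · rintro A B - - ⟨q, c, hc, h⟩ ⟨q', c', hc', h'⟩
    refine ⟨q * q', c * c', mul_ne_zero hc hc', ?_⟩
    have := h.mul h'
    rwa [smul_mul_smul_comm, show Matrix.toLin' A * Matrix.toLin' B = Matrix.toLin' (A * B) from (Matrix.toLin'_mul A B).symm, one_mul] at this

/-- every pair of invertible operators is realised up to a scalar -/
lemma RR_real [IsAlgClosed F] {A : Module.End F (Fin 8 → F)} {B : Module.End F (Fin 2 → F)} (hA : IsUnit A) (hB : IsUnit B) :
    ∃ q : Au F, ∃ c : F, c ≠ 0 ∧ RR q A (c • B) := by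
  obtain ⟨q, c, hc, h⟩ := RR_real8 (LinearMap.toMatrix' A) (by
    rw [LinearMap.det_toMatrix']; exact (LinearMap.isUnit_iff_isUnit_det A).1 hA |>.ne_zero)
  obtain ⟨q', c', hc', h'⟩ := RR_real2 (LinearMap.toMatrix' B) (by
    rw [LinearMap.det_toMatrix']; exact (LinearMap.isUnit_iff_isUnit_det B).1 hB |>.ne_zero)
  rw [Matrix.toLin'_toMatrix'] at h h'
  refine ⟨q * q', c * c', mul_ne_zero hc hc', ?_⟩
  have := h.mul h'
  rwa [smul_mul_smul_comm, one_mul, mul_one] at this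

end E8

namespace E8
open LieAlgebra LieModule

variable {F : Type} [Field F] [CharZero F]

lemma bil_rr (a b i j : Fin 8) : bil (rho a - rho b) (rho i - rho j) = dl a i - dl a j - dl b i + dl b j := by
  simp only [sub_eq_add_neg, bil_add_left, bil_add_right, bil_neg_left, bil_neg_right, bil_rho']
  ring
lemma bil_ra (a b : Fin 8) : bil (rho a - rho b) (al 0) = 0 := by
  rw [← beta_diff]
  simp only [sub_eq_add_neg, bil_add_left, bil_add_right, bil_neg_left, bil_neg_right, bil_rho_beta']
  ring
lemma rr_two (a b : Fin 8) : (rho a - rho b) 2 % 4 = 0 := by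
  have h5 := rho_two a
  have h6 := rho_two b
  rw [Pi.sub_apply]; omega
lemma dl_self (a : Fin 8) : dl a a = 1 := if_pos rfl
lemma dl_ne {a b : Fin 8} (h : a ≠ b) : dl a b = 0 := if_neg h
lemma dl_nonneg (a b : Fin 8) : 0 ≤ dl a b := by unfold dl; split_ifs <;> norm_num
lemma al_bw (i j : Fin 8) (k : Fin 2) : bil (al 0) (wt i j k) = if k = 0 then 1 else -1 := by
  rw [← beta_diff, show (1 : Fin 2) = 1 - 0 by decide, bil_bw]
  simp only [eq_comm]

lemma rr_one {a b a' b' : Fin 8} (h : a ≠ b) (h' : a' ≠ b')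
    (H : dl a a' - dl a b' - dl b a' + dl b b' = 1) : (a = a' ∧ b ≠ b') ∨ (a ≠ a' ∧ b = b') := by
  by_cases h1 : a = a'
  · subst h1
    by_cases h2 : b = b'
    · subst h2
      rw [dl_self, dl_self, dl_ne h, dl_ne h.symm] at H; omega
    · exact Or.inl ⟨rfl, h2⟩
  · by_cases h2 : b = b'
    · exact Or.inr ⟨h1, h2⟩
    · rw [dl_ne h1, dl_ne h2] at H
      have := dl_nonneg a b'
      have := dl_nonneg b a'
      omega

lemma avoid (σ : Fin 8 → Fin 8) (hσ : Function.Injective σ) (i j a b : Fin 8) :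
    ∃ y, dl y i = 0 ∧ dl y j = 0 ∧ dl (σ y) a = 0 ∧ dl (σ y) b = 0 := by
  have : ∃ y, y ∉ ({i, j} ∪ (Finset.univ.filter fun x => σ x ∈ ({a, b} : Finset (Fin 8))) : Finset (Fin 8)) := by
    by_contra hcon
    push Not at hcon
    have h1 : (Finset.univ : Finset (Fin 8)).card ≤ 4 := by
      rw [← Finset.eq_univ_iff_forall.2 hcon]
      refine (Finset.card_union_le _ _).trans ?_
      have h2 : (Finset.univ.filter fun x => σ x ∈ ({a, b} : Finset (Fin 8))).card ≤ 2 := by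
        refine (Finset.card_le_card_of_injOn σ (t := {a, b}) ?_ hσ.injOn).trans Finset.card_le_two
        intro x hx
        simpa using hx
      have h3 : ({i, j} : Finset (Fin 8)).card ≤ 2 := Finset.card_le_two
      omega
    simp at h1
  obtain ⟨y, hy⟩ := this
  simp only [Finset.mem_union, Finset.mem_insert, Finset.mem_singleton, Finset.mem_filter, Finset.mem_univ, true_and, not_or] at hy
  exact ⟨y, dl_ne hy.1.1, dl_ne hy.1.2, dl_ne hy.2.1, dl_ne hy.2.2⟩

lemma latt_rho {w : Lam ≃+ Lam} (hw : IsIsom w) (h0 : ∀ i j, i ≠ j → ∃ a b, a ≠ b ∧ w (rho i - rho j) = rho a - rho b) :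
    ∃ σ : Fin 8 → Fin 8, Function.Injective σ ∧ ((∀ i j, w (rho i - rho j) = rho (σ i) - rho (σ j)) ∨
      (∀ i j, w (rho i - rho j) = -(rho (σ i) - rho (σ j)))) := by
  have h1 : ∀ j : Fin 8, ∃ a b, j ≠ 0 → a ≠ b ∧ w (rho 0 - rho j) = rho a - rho b := by
    intro j
    by_cases hj : j = 0
    · exact ⟨0, 0, fun h => absurd hj h⟩
    · obtain ⟨a, b, h, h'⟩ := h0 0 j (Ne.symm hj)
      exact ⟨a, b, fun _ => ⟨h, h'⟩⟩
  choose a b hab using h1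
  have h2 : ∀ j l, j ≠ 0 → l ≠ 0 → j ≠ l → (a j = a l ∧ b j ≠ b l) ∨ (a j ≠ a l ∧ b j = b l) := by
    intro j l hj hl hjl
    apply rr_one (hab j hj).1 (hab l hl).1
    rw [← bil_rr, ← (hab j hj).2, ← (hab l hl).2, hw, bil_rr, dl_self, dl_ne (Ne.symm hl), dl_ne hj, dl_ne hjl]
    norm_num
  have hd : ∀ (c : Fin 8 → Lam) (ε : ℤ), (∀ j, w (rho 0 - rho j) = ε • (c 0 - c j)) →
      ∀ i j, w (rho i - rho j) = ε • (c i - c j) := by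
    intro c ε h i j
    rw [show rho i - rho j = (rho 0 - rho j) - (rho 0 - rho i) by abel, map_sub, h, h, ← smul_sub]
    congr 1; abel
  have n1 : (1 : Fin 8) ≠ 0 := by decide
  have n2 : (2 : Fin 8) ≠ 0 := by decide
  have n3 : (1 : Fin 8) ≠ 2 := by decide
  rcases h2 1 2 n1 n2 n3 with h12 | h12
  · have ha : ∀ m, m ≠ 0 → a m = a 1 := by
      intro m hm
      by_cases hm1 : m = 1
      · rw [hm1]
      by_cases hm2 : m = 2
      · rw [hm2, h12.1]
      rcases h2 m 2 hm n2 hm2 with h | h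
      · rw [h.1, h12.1]
      · rcases h2 m 1 hm n1 hm1 with h' | h'
        · exact h'.1
        · exact absurd (h'.2.symm.trans h.2) h12.2
    refine ⟨fun j => if j = 0 then a 1 else b j, ?_, Or.inl ?_⟩
    · intro i j hij
      by_contra hne
      by_cases hi : i = 0
      · have hj : j ≠ 0 := fun h => hne (by rw [hi, h])
        simp only [hi, hj, if_true, if_false] at hij
        exact (hab j hj).1 (by rw [ha j hj, hij])
      · by_cases hj : j = 0
        · simp only [hi, hj, if_true, if_false] at hij
          exact (hab i hi).1 (by rw [ha i hi, hij])
        · simp only [hi, hj, if_false] at hij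
          rcases h2 i j hi hj hne with h | h
          · exact h.2 hij
          · exact h.1 (by rw [ha i hi, ha j hj])
    · have := hd (fun j => rho (if j = 0 then a 1 else b j)) 1 (fun j => by
        by_cases hj : j = 0
        · subst hj; simp
        · rw [(hab j hj).2, ha j hj]; simp [hj])
      intro i j
      rw [this i j, one_smul]
  · have ha : ∀ m, m ≠ 0 → b m = b 1 := by
      intro m hm
      by_cases hm1 : m = 1
      · rw [hm1]
      by_cases hm2 : m = 2
      · rw [hm2, h12.2]
      rcases h2 m 2 hm n2 hm2 with h | h
      · rcases h2 m 1 hm n1 hm1 with h' | h'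
        · exact absurd (h'.1.symm.trans h.1) h12.1
        · exact h'.2
      · rw [h.2, h12.2]
    refine ⟨fun j => if j = 0 then b 1 else a j, ?_, Or.inr ?_⟩
    · intro i j hij
      by_contra hne
      by_cases hi : i = 0
      · have hj : j ≠ 0 := fun h => hne (by rw [hi, h])
        simp only [hi, hj, if_true, if_false] at hij
        exact (hab j hj).1 (by rw [ha j hj, hij])
      · by_cases hj : j = 0
        · simp only [hi, hj, if_true, if_false] at hij
          exact (hab i hi).1 (by rw [ha i hi, hij])
        · simp only [hi, hj, if_false] at hij
          rcases h2 i j hi hj hne with h | h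
          · exact h.2 (by rw [ha i hi, ha j hj])
          · exact h.1 hij
    · have := hd (fun j => rho (if j = 0 then b 1 else a j)) (-1) (fun j => by
        by_cases hj : j = 0
        · subst hj; simp
        · rw [(hab j hj).2, ha j hj]; simp [hj])
      intro i j
      rw [this i j, neg_smul, one_smul]

/-- isometries preserving the grading come from permutations -/
lemma latt {w : Lam ≃+ Lam} (hw : IsIsom w) (hm : ∀ v, IsRt v → (w v) 2 % 4 = v 2 % 4) :
    ∃ (σ : Fin 8 → Fin 8) (τ : Fin 2 → Fin 2), Function.Injective σ ∧ Function.Injective τ ∧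
      ∀ i j k, i ≠ j → w (wt i j k) = wt (σ i) (σ j) (τ k) := by
  have hal : w (al 0) = al 0 ∨ w (al 0) = - al 0 := by
    rcases cls0 (hw.isRt (isRt_al 0)) (by rw [hm _ (isRt_al 0)]; decide) with ⟨i, j, hij, h⟩ | h
    · exfalso
      obtain ⟨l, hl, hl', -⟩ := avoid id Function.injective_id i j i j
      have hil : i ≠ l := by rintro rfl; rw [dl_self] at hl; omega
      have hr' := (isRt_rho i l).2 hil
      have hb : bil (w.symm (rho i - rho l)) (al 0) = 1 := by
        rw [← hw, h, AddEquiv.apply_symm_apply, bil_rr, dl_self, dl_ne hij, hl, hl']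
        norm_num
      have hr2 := hw.symm.isRt hr'
      have hdeg := hm _ hr2
      rw [AddEquiv.apply_symm_apply, rr_two] at hdeg
      have h00 : bil (al 0) (al 0) = 2 := isRt_al 0
      rcases cls0 hr2 hdeg.symm with ⟨a, b, -, h'⟩ | h' | h'
      · rw [h', bil_ra] at hb; omega
      · rw [h', h00] at hb; omega
      · rw [h', bil_neg_left, h00] at hb; omega
    · exact h
  have h0 : ∀ i j, i ≠ j → ∃ a b, a ≠ b ∧ w (rho i - rho j) = rho a - rho b := by
    intro i j hij
    have hr' := (isRt_rho i j).2 hij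
    have h00 : bil (al 0) (al 0) = 2 := isRt_al 0
    have h1 : bil (w (rho i - rho j)) (w (al 0)) = 0 := by rw [hw, bil_ra]
    rcases cls0 (hw.isRt hr') (by rw [hm _ hr', rr_two]) with h | h
    · exact h
    · exfalso
      rcases h with h | h <;> rcases hal with h' | h' <;> rw [h, h'] at h1 <;>
        simp only [bil_neg_left, bil_neg_right, h00] at h1 <;> omega
  obtain ⟨σ, hσ, hcase⟩ := latt_rho hw h0
  have hwt : ∀ i j k, i ≠ j → ∃ l, w (wt i j k) = wt (σ i) (σ j) l := by
    intro i j k hij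
    have hr' := (isRt_wt i j k).2 hij
    obtain ⟨a, b, l, hab, h⟩ := cls1 (hw.isRt hr') (by rw [hm _ hr', wt_two])
    obtain ⟨y, hy1, hy2, hy3, hy4⟩ := avoid σ hσ i j a b
    have h1 : ∀ x, bil (w (rho x - rho y)) (w (wt i j k)) = dl x i + dl x j := by
      intro x; rw [hw, bil_rw, hy1, hy2]; ring
    rcases hcase with h2 | h2
    · simp only [h2, h, bil_rw, hy3, hy4] at h1
      have hi := h1 i
      have hj := h1 j
      rw [dl_self, dl_ne hij] at hi
      rw [dl_self, dl_ne hij.symm] at hj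
      have hsij : σ i ≠ σ j := fun h => hij (hσ h)
      refine ⟨l, ?_⟩
      rw [h, wt_inj hsij]
      refine ⟨?_, rfl⟩
      unfold dl at hi hj
      split_ifs at hi hj <;> simp_all
    · exfalso
      simp only [h2, h, bil_neg_left, bil_rw, hy3, hy4] at h1
      have hi := h1 i
      rw [dl_self, dl_ne hij] at hi
      have := dl_nonneg (σ i) a
      have := dl_nonneg (σ i) b
      omega
  rcases hal with h | h
  · refine ⟨σ, id, hσ, Function.injective_id, fun i j k hij => ?_⟩
    obtain ⟨l, hl⟩ := hwt i j k hij
    have h1 := hw (al 0) (wt i j k)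
    rw [h, hl, al_bw, al_bw] at h1
    rw [hl]
    congr 1
    revert h1; clear hl; revert k l; decide
  · refine ⟨σ, fun k => 1 - k, hσ, by decide, fun i j k hij => ?_⟩
    obtain ⟨l, hl⟩ := hwt i j k hij
    have h1 := hw (al 0) (wt i j k)
    rw [h, hl, bil_neg_left, al_bw, al_bw] at h1
    rw [hl]
    congr 1
    revert h1; clear hl; revert k l; decide

end E8

namespace E8
open LieAlgebra LieModule

variable {F : Type} [Field F] [CharZero F]

/-- automorphisms induced by a pair of invertible operators -/
def RT (q : Au F) : Prop := ∃ A B, IsUnit A ∧ IsUnit B ∧ RR q A B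

lemma RT.mul {q q' : Au F} (h : RT q) (h' : RT q') : RT (q * q') := by
  obtain ⟨A, B, hA, hB, h⟩ := h
  obtain ⟨A', B', hA', hB', h'⟩ := h'
  exact ⟨_, _, hA.mul hA', hB.mul hB', h.mul h'⟩
lemma RT.inv {q : Au F} (h : RT q) : RT q⁻¹ := by
  obtain ⟨A, B, ⟨A, rfl⟩, ⟨B, rfl⟩, h⟩ := h
  exact ⟨_, _, (A⁻¹).isUnit, (B⁻¹).isUnit, h.inv (A.mul_inv) (B.mul_inv)⟩
lemma RT_one : RT (1 : Au F) := ⟨1, 1, isUnit_one, isUnit_one, RR_one⟩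

lemma unit_mat {n : Type} [Fintype n] [DecidableEq n] {A : Matrix n n F} (h : A.det ≠ 0) : IsUnit (Matrix.toLin' A) := by
  rw [LinearMap.isUnit_iff_isUnit_det, LinearMap.det_toLin']
  exact h.isUnit

lemma RT_tor (t : Fin 8 → Fˣ) : RT (tor t) :=
  ⟨_, _, unit_mat (by rw [Matrix.det_diagonal, Finset.prod_ne_zero_iff]; exact fun i _ => Units.ne_zero _),
    unit_mat (by rw [Matrix.det_diagonal, Finset.prod_ne_zero_iff]; exact fun i _ => Units.ne_zero _), RR_tor t⟩

lemma RT_exp {v : Lam} (hv : IsRt v) (h4 : 4 ∣ v 2) (t : F) (hn : IsNilpotent (ad F (M F) (t • E F v))) :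
    RT (expA (t • E F v) hn) := by
  have h2 : ∀ (a : Fin 2), RT (expA (t • E F (beta a - beta (1 - a))) (nil_smul (adE_nil (isRt_bb a)) t)) := by
    intro a
    have h := RR_tv2 (F := F) a (t * sg F (beta a - beta (1 - a)) (beta (1 - a)))
    simp only [mul_assoc, sg_sq, mul_one] at h
    exact ⟨_, _, isUnit_one, unit_mat (by rw [Matrix.det_transvection_of_ne _ _ (one_sub_ne a).symm]; exact one_ne_zero), h⟩
  rcases cls0 hv (Int.emod_eq_zero_of_dvd h4) with ⟨a, b, hab, rfl⟩ | rfl | rfl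
  · have h := RR_tv8 (F := F) hab (t * sg F (rho a - rho b) (rho b))
    simp only [mul_assoc, sg_sq, mul_one] at h
    exact ⟨_, _, unit_mat (by rw [Matrix.det_transvection_of_ne _ _ hab]; exact one_ne_zero), isUnit_one, h⟩
  · have h := h2 0
    have e : beta 0 - beta (1 - 0) = al 0 := by decide +kernel
    revert hn
    rw [← e]
    intro hn
    exact h
  · have h := h2 1
    have e : beta 1 - beta (1 - 1) = - al 0 := by decide +kernel
    revert hn
    rw [← e]
    intro hn
    exact h

/-- the frame of the degree zero part -/
noncomputable abbrev F0 (F : Type) [Field F] [CharZero F] : Frame (rsp F (fun v => 4 ∣ v 2)) := stdF F (fun v => 4 ∣ v 2)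

lemma RT_grp {g : Au F} (hg : g ∈ (F0 F).grp) : RT g := by
  induction hg using Subgroup.closure_induction with
  | mem g hg =>
    obtain ⟨i, t, rfl⟩ := hg
    exact RT_exp i.1.2 i.2 t _
  | one => exact RT_one
  | mul x y _ _ hx hy => exact hx.mul hy
  | inv x _ hx => exact hx.inv

lemma expA_conj (q : Au F) {e : M F} (he : IsNilpotent (ad F (M F) e)) (he' : IsNilpotent (ad F (M F) (q • e))) :
    expA (q • e) he' = q * expA e he * q⁻¹ := by
  have he0 := he
  obtain ⟨K, hK⟩ := he0
  have h1 : ∀ n x, (ad F (M F) (q • e) ^ n) x = q • (ad F (M F) e ^ n) (q⁻¹ • x) := by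
    intro n
    induction n with
    | zero => intro x; simp
    | succ n ih =>
      intro x
      rw [pow_succ', Module.End.mul_apply, ih, ad_apply, pow_succ', Module.End.mul_apply, ad_apply, au_lie]
  have hK' : ad F (M F) (q • e) ^ K = 0 := by
    ext x; rw [h1, hK]; simp
  apply au_ext
  intro x
  have hl : ∀ f : ℕ → M F, q • ∑ k ∈ Finset.range K, f k = ∑ k ∈ Finset.range K, q • f k := fun f => by
    rw [← Au.lin_apply, map_sum]; rfl
  rw [expA_apply _ _ hK', mul_smul, mul_smul, expA_apply _ _ hK, hl]
  refine Finset.sum_congr rfl fun k _ => ?_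
  rw [au_smul, h1]

/-- transport of a frame -/
noncomputable def Frame.tr {S : Submodule F (M F)} (A : Frame S) (q : Au F) (hq : S.map q.lin = S) : Frame S where
  H := A.H.map q.lin
  ι := A.ι
  fin := A.fin
  e := fun i => q • A.e i
  a := fun i => A.a i ∘ₗ (q⁻¹).lin
  nil := fun i => by
    obtain ⟨K, hK⟩ := A.nil i
    refine ⟨K, ?_⟩
    have h1 : ∀ n x, (ad F (M F) (q • A.e i) ^ n) x = q • (ad F (M F) (A.e i) ^ n) (q⁻¹ • x) := by
      intro n
      induction n with
      | zero => intro x; simp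
      | succ n ih =>
        intro x
        rw [pow_succ', Module.End.mul_apply, ih, ad_apply, pow_succ', Module.End.mul_apply, ad_apply, au_lie]
    ext x; rw [h1, hK]; simp
  lie := by
    rintro i _ ⟨h, hh, rfl⟩
    rw [Au.lin_apply, ← au_lie, A.lie i h hh, au_smul, LinearMap.comp_apply, Au.lin_apply, inv_smul_smul]
  comm := by
    rintro _ ⟨h, hh, rfl⟩ _ ⟨h', hh', rfl⟩
    rw [Au.lin_apply, Au.lin_apply, ← au_lie, A.comm h hh h' hh', smul_zero]
  span := by
    conv_rhs => rw [← hq, ← A.span]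
    rw [Submodule.map_sup, Submodule.map_span]
    congr 2
    ext x
    simp [Au.lin_apply]
  ne := by
    intro i
    obtain ⟨h, hh, h0⟩ := A.ne i
    refine ⟨q.lin h, ⟨h, hh, rfl⟩, ?_⟩
    rw [LinearMap.comp_apply, Au.lin_apply, Au.lin_apply, inv_smul_smul]
    exact h0

lemma Frame.tr_grp {S : Submodule F (M F)} (A : Frame S) (q : Au F) (hq : S.map q.lin = S) {g : Au F}
    (hg : g ∈ (A.tr q hq).grp) : ∃ g' ∈ A.grp, g = q * g' * q⁻¹ := by
  induction hg using Subgroup.closure_induction with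
  | mem g hg =>
    obtain ⟨i, t, rfl⟩ := hg
    refine ⟨_, Subgroup.subset_closure ⟨i, t, rfl⟩, ?_⟩
    rw [← expA_conj q]
    · congr 1
      exact (au_smul _ _ _).symm
    · rw [au_smul]; exact nil_smul ((A.tr q hq).nil i) t
  | one => exact ⟨1, one_mem _, by group⟩
  | mul x y _ _ hx hy =>
    obtain ⟨x', hx, rfl⟩ := hx
    obtain ⟨y', hy, rfl⟩ := hy
    exact ⟨_, mul_mem hx hy, by group⟩
  | inv x _ hx =>
    obtain ⟨x', hx, rfl⟩ := hx
    exact ⟨_, inv_mem hx, by group⟩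

/-- the standard automorphism of order four -/
noncomputable abbrev th (u : Fˣ) : Au F := torB u (om 2)

lemma bil_om_two (v : Lam) : bil (om 2) v = v 2 := by
  rw [bil_eq_sum]
  simp [bil_om]

end E8

namespace E8
open LieAlgebra LieModule

variable {F : Type} [Field F] [CharZero F]

lemma u_four {u : Fˣ} (hu : u ^ 2 = -1) : u ^ 4 = 1 := by
  have : u ^ 4 = (u ^ 2) ^ 2 := by rw [← pow_mul]
  rw [this, hu]; simp

lemma u_ord {u : Fˣ} (hu : u ^ 2 = -1) : orderOf u = 4 := by
  refine orderOf_eq_prime_pow (p := 2) (n := 1) ?_ (u_four hu)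
  norm_num
  rw [hu]
  intro h
  have := congrArg Units.val h
  simp at this
  norm_num [neg_eq_iff_add_eq_zero] at this

lemma u_zpow {u : Fˣ} (hu : u ^ 2 = -1) (a b : ℤ) : u ^ a = u ^ b ↔ a % 4 = b % 4 := by
  rw [zpow_eq_zpow_iff_modEq, u_ord hu]; rfl

lemma th_E (u : Fˣ) {v : Lam} (hv : IsRt v) : th u • E F v = ((u ^ (v 2) : Fˣ) : F) • E F v := by
  rw [th, torB_E u _ hv, bil_om_two]

lemma th_wt {u : Fˣ} (hu : u ^ 2 = -1) {i j : Fin 8} (k : Fin 2) (h : i ≠ j) :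
    th u • E F (wt i j k) = (u : F) • E F (wt i j k) := by
  rw [th_E u ((isRt_wt i j k).2 h)]
  have := (u_zpow hu ((wt i j k) 2) 1).2 (by rw [wt_two]; rfl)
  rw [this, zpow_one]

lemma RR_th {u : Fˣ} (hu : u ^ 2 = -1) : RR (th u : Au F) 1 ((u : F) • 1) := by
  apply RR_of
  intro i j k
  simp only [Module.End.one_apply, LinearMap.smul_apply, map_smul, Psi_e]
  by_cases h : i = j
  · subst h; rw [psi_self]; simp
  · rw [psi, au_smul, th_wt hu k h, smul_comm]

lemma mem_rsp_th {u : Fˣ} (hu : u ^ 2 = -1) (x : M F) : x ∈ rsp F (fun v => 4 ∣ v 2) ↔ th u • x = x := by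
  constructor
  · have : rsp F (fun v => 4 ∣ v 2) ≤ fixS (th u) := by
      apply sup_le
      · rintro _ ⟨h, rfl⟩; rw [mem_fixS]; exact torB_H _ _ _
      · rw [Submodule.span_le]
        rintro _ ⟨⟨v, hv⟩, rfl⟩
        rw [SetLike.mem_coe, mem_fixS]
        have h1 : (u : Fˣ) ^ (v.1 2) = u ^ (0 : ℤ) := (u_zpow hu _ _).2 (Int.emod_eq_zero_of_dvd hv)
        simp only
        rw [th_E u v.2, h1]; simp
    exact fun h => mem_fixS.1 (this h)
  · intro hx
    have h2 : ∀ v : R, ¬ 4 ∣ v.1 2 → co v x = 0 := fun v hv => by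
      have h3 : co v (th u • x) = ((u ^ (v.1 2) : Fˣ) : F) * co v x := by
        have : co v ∘ₗ (th u).lin = ((u ^ (v.1 2) : Fˣ) : F) • co v := by
          apply M_hom_ext
          · intro k; simp only [LinearMap.comp_apply, Au.lin_apply, th, torB_H]; simp
          · intro w hw
            simp only [LinearMap.comp_apply, Au.lin_apply, th_E u hw, map_smul, LinearMap.smul_apply, co_E]
            split_ifs with h
            · rw [h]
            · simp
        exact LinearMap.congr_fun this x
      rw [hx] at h3
      by_contra hne
      apply hv
      have : ((u ^ (v.1 2) : Fˣ) : F) = 1 := by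
        apply mul_right_cancel₀ hne
        rw [← h3, one_mul]
      have h4 : u ^ (v.1 2) = u ^ (0 : ℤ) := Units.ext (by rw [this]; simp)
      exact Int.dvd_of_emod_eq_zero ((u_zpow hu _ _).1 h4)
    rw [M_expand x]
    apply Submodule.add_mem
    · exact Submodule.mem_sup_left ⟨_, rfl⟩
    · refine Submodule.sum_mem _ fun v _ => ?_
      by_cases hv : 4 ∣ v.1 2
      · exact Submodule.smul_mem _ _ (Submodule.mem_sup_right (Submodule.subset_span ⟨⟨v, hv⟩, rfl⟩))
      · rw [h2 v hv, zero_smul]; exact Submodule.zero_mem _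

/-- the permutation operator -/
lemma perm_op {n : Type} [Fintype n] [DecidableEq n] {σ : n → n} (hσ : Function.Injective σ) :
    ∃ A : Module.End F (n → F), IsUnit A ∧ ∀ i, A (Pi.single i 1) = Pi.single (σ i) 1 := by
  let e : n ≃ n := Equiv.ofBijective σ (Finite.injective_iff_bijective.1 hσ)
  let L : (n → F) ≃ₗ[F] (n → F) := LinearEquiv.funCongrLeft F F e.symm
  refine ⟨L.toLinearMap, ?_, fun i => ?_⟩
  · rw [Module.End.isUnit_iff]; exact L.bijective
  · funext j
    show (Pi.single i (1 : F) : n → F) (e.symm j) = _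
    rw [Pi.single_apply, Pi.single_apply]
    exact if_congr (Equiv.symm_apply_eq e) rfl rfl

lemma RT.comm {u : Fˣ} (hu : u ^ 2 = -1) {q : Au F} (h : RT q) : q * th u = th u * q := by
  obtain ⟨A, B, hA, hB, h⟩ := h
  have h0 := RR_th (F := F) hu
  have hd : ∀ (x y : Fin 8 → F) (z : Fin 2 → F), (q * th u) • Psi x y z = (th u * q) • Psi x y z := by
    intro x y z
    rw [(h.mul h0) x y z, (h0.mul h) x y z]
    simp
  have h1 : (q * th u) = (th u * q) * 1 := by
    rw [← inv_mul_eq_iff_eq_mul]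
    apply RR.eq_one
    intro x y z
    rw [mul_smul, hd, inv_smul_smul]; rfl
  rw [h1, mul_one]

theorem cent_RT [IsAlgClosed F] {u : Fˣ} (hu : u ^ 2 = -1) {q : Au F} (h : q * th u = th u * q) : RT q := by
  have hq' : ∀ x, x ∈ rsp F (fun v => 4 ∣ v 2) → q • x ∈ rsp F (fun v => 4 ∣ v 2) := by
    intro x hx
    rw [mem_rsp_th hu] at hx ⊢
    rw [← mul_smul, ← h, mul_smul, hx]
  have hqi : ∀ x, x ∈ rsp F (fun v => 4 ∣ v 2) → q⁻¹ • x ∈ rsp F (fun v => 4 ∣ v 2) := by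
    intro x hx
    rw [mem_rsp_th hu] at hx ⊢
    have : q⁻¹ * th u = th u * q⁻¹ := by rw [inv_mul_eq_iff_eq_mul, ← mul_assoc, h]; group
    rw [← mul_smul, ← this, mul_smul, hx]
  have hq : (rsp F (fun v => 4 ∣ v 2)).map q.lin = rsp F (fun v => 4 ∣ v 2) := by
    apply le_antisymm
    · rintro _ ⟨x, hx, rfl⟩; exact hq' x hx
    · intro x hx; exact ⟨q⁻¹ • x, hqi x hx, by rw [Au.lin_apply, smul_inv_smul]⟩
  have hS : ∀ x ∈ rsp F (fun v => 4 ∣ v 2), ∀ y ∈ rsp F (fun v => 4 ∣ v 2), ⁅x, y⁆ ∈ rsp F (fun v => 4 ∣ v 2) := by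
    intro x hx y hy
    rw [mem_rsp_th hu] at hx hy ⊢
    rw [au_lie, hx, hy]
  obtain ⟨g₁, hg₁, g₂, hg₂, hz⟩ := Frame.conj hS (F0 F) ((F0 F).tr q hq)
  obtain ⟨g₃, hg₃, rfl⟩ := (F0 F).tr_grp q hq hg₂
  have r1 := RT_grp hg₁
  have r3 := RT_grp hg₃
  set n := g₁⁻¹ * q * g₃ with hn
  have hnq : q = g₁ * n * g₃⁻¹ := by rw [hn]; group
  have hnth : n * th u = th u * n := by
    have c1 := r1.inv.comm hu
    have c3 := r3.comm hu
    rw [hn, mul_assoc, c3, mul_assoc, ← mul_assoc q, h, mul_assoc (th u), ← mul_assoc g₁⁻¹, c1]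
    simp only [mul_assoc]
  have hnH : ∀ k, ∃ k', n • (H k : M F) = H k' := by
    intro k
    have h1 := (hz (q • g₃ • (H k : M F))).2 (by
      refine ⟨H k, ⟨k, rfl⟩, ?_⟩
      rw [Au.lin_apply]
      simp only [mul_inv_rev, inv_inv, mul_smul, inv_smul_smul])
    obtain ⟨k', hk'⟩ := h1
    exact ⟨k', by rw [hk', hn, mul_smul, mul_smul]⟩
  obtain ⟨w, hw, -, hwE⟩ := norm_isom hnH
  have hm : ∀ v, IsRt v → (w v) 2 % 4 = v 2 % 4 := by
    intro v hv
    obtain ⟨c, hc, h1⟩ := hwE v hv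
    have h2 := congrArg (fun g : Au F => g • E F v) hnth
    simp only [mul_smul] at h2
    rw [th_E u hv, au_smul, h1, au_smul, th_E u (hw.isRt hv), smul_smul, smul_smul] at h2
    have h3 := congrArg (co (F := F) ⟨w v, hw.isRt hv⟩) h2
    rw [LinearMap.map_smul, LinearMap.map_smul, co_E, if_pos rfl] at h3
    simp only [smul_eq_mul, mul_one] at h3
    rw [mul_comm c] at h3
    have h4 := mul_right_cancel₀ hc h3
    exact ((u_zpow hu _ _).1 (Units.ext h4)).symm
  obtain ⟨σ, τ, hσ, hτ, hst⟩ := latt hw hm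
  obtain ⟨A, hA, hAe⟩ := perm_op (F := F) hσ
  obtain ⟨B, hB, hBe⟩ := perm_op (F := F) hτ
  obtain ⟨p, c, hc, hp⟩ := RR_real hA hB
  have hpR : RT p := ⟨_, _, hA, hB.smul (Units.mk0 c hc), hp⟩
  have h5 : ∀ i j k, i ≠ j → ∃ d : F, (p⁻¹ * n) • E F (wt i j k) = d • E F (wt i j k) := by
    intro i j k hij
    obtain ⟨d, hd, h1⟩ := hwE _ ((isRt_wt i j k).2 hij)
    rw [hst i j k hij] at h1
    have h2 := hp (e8 F i) (e8 F j) (e2 F k)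
    have e1 : ∀ i, A (e8 F i) = e8 F (σ i) := hAe
    have e2' : ∀ i, B (e2 F i) = e2 F (τ i) := hBe
    rw [Psi_e, e1, e1, LinearMap.smul_apply, e2', map_smul, Psi_e, psi, psi, au_smul, smul_smul] at h2
    have hs : c * ss F (σ i) (σ j) (τ k) ≠ 0 := mul_ne_zero hc (ss_ne _ _ _)
    have h3 : p⁻¹ • E F (wt (σ i) (σ j) (τ k)) = ((c * ss F (σ i) (σ j) (τ k))⁻¹ * ss F i j k) • E F (wt i j k) := by
      rw [inv_smul_eq_iff, au_smul, mul_smul, h2, smul_smul, inv_mul_cancel₀ hs, one_smul]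
    exact ⟨_, by rw [mul_smul, h1, au_smul, h3, smul_smul]⟩
  obtain ⟨t, ht'⟩ := line_tor fun v hv => gen_line h5 hv
  have : n = p * tor t := by rw [← ht']; group
  rw [hnq, this]
  exact (r1.mul (hpR.mul (RT_tor t))).mul r3.inv

end E8

namespace E8

section alg
variable {F : Type} [Field F] [CharZero F] {U : Type} [Ring U] [Algebra F U]

lemma sc_pow_left {x y : U} {s : F} (h : x * y = s • (y * x)) (m : ℕ) : x ^ m * y = s ^ m • (y * x ^ m) := by
  induction m with
  | zero => simp
  | succ m ih => rw [pow_succ', mul_assoc, ih, mul_smul_comm, ← mul_assoc, h, smul_mul_assoc, smul_smul, mul_assoc, ← pow_succ, ]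

lemma sc_pow_right {x y : U} {s : F} (h : x * y = s • (y * x)) (m : ℕ) : x * y ^ m = s ^ m • (y ^ m * x) := by
  induction m with
  | zero => simp
  | succ m ih => rw [pow_succ, ← mul_assoc, ih, smul_mul_assoc, mul_assoc, h, mul_smul_comm, smul_smul, ← mul_assoc, ← pow_succ]

lemma sc_mul_left {x y z : U} {s t : F} (h : x * z = s • (z * x)) (h' : y * z = t • (z * y)) :
    (x * y) * z = (s * t) • (z * (x * y)) := by
  rw [mul_assoc, h', mul_smul_comm, ← mul_assoc, h, smul_mul_assoc, smul_smul, mul_comm, mul_assoc]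

lemma sc_symm {x y : U} {s t : F} (h : x * y = s • (y * x)) (hst : t * s = 1) : y * x = t • (x * y) := by
  rw [h, smul_smul, hst, one_smul]

/-- correction by powers of a quasi-commuting pair -/
lemma sc_fix {x y A : U} {s : F} {N : ℕ} (hN : s ^ (N + 1) = 1) (hxy : x * y = s • (y * x)) {i j : ℕ}
    (hx : A * x = s ^ i • (x * A)) (hy : A * y = s ^ j • (y * A)) :
    ∃ m n, Commute (A * (x ^ m * y ^ n)) x ∧ Commute (A * (x ^ m * y ^ n)) y := by
  have hyx : y * x = s ^ N • (x * y) := sc_symm hxy (by rw [← pow_succ, hN])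
  refine ⟨N * j, i, ?_, ?_⟩
  · have h1 : x ^ (N * j) * x = (1 : F) • (x * x ^ (N * j)) := by rw [one_smul, ← pow_succ, ← pow_succ']
    have h2 := sc_mul_left hx (sc_mul_left h1 (sc_pow_left hyx i))
    have : s ^ i * (1 * (s ^ N) ^ i) = 1 := by
      rw [one_mul, ← mul_pow, ← pow_succ', hN, one_pow]
    rw [this, one_smul] at h2
    exact h2
  · have h1 : y ^ i * y = (1 : F) • (y * y ^ i) := by rw [one_smul, ← pow_succ, ← pow_succ']
    have h2 := sc_mul_left hy (sc_mul_left (sc_pow_left hxy (N * j)) h1)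
    have : s ^ j * (s ^ (N * j) * 1) = 1 := by
      rw [mul_one, pow_mul, ← mul_pow, ← pow_succ', hN, one_pow]
    rw [this, one_smul] at h2
    exact h2

lemma comm_cancel {X A V : U} (h : Commute X (A * V)) (hV : Commute X V) (hu : IsUnit V) : Commute X A := by
  have h1 : X * (A * V) = (A * V) * X := h
  have h2 : X * V = V * X := hV
  apply hu.mul_right_cancel
  rw [mul_assoc, h1, mul_assoc, mul_assoc, h2]

end alg

section lin
variable {F : Type} [Field F] [CharZero F] {V : Type} [AddCommGroup V] [Module F V]

lemma eig_one {u : Fˣ} (hu : u ^ 2 = -1) {a b : Module.End F V} (ha : a ^ 4 = 1) (hb : b ^ 4 = 1)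
    (hab : a * b = (u : F) • (b * a)) {v : V} (hv : v ≠ 0) :
    ∃ Z : Module.End F V, Z v ≠ 0 ∧ a * Z = Z ∧ ∀ c, Commute c a → Commute c b → Commute c Z := by
  have huF : (u : F) ^ 2 = -1 := by rw [← Units.val_pow_eq_pow_val, hu]; simp
  have hu4 : (u : F) ^ 4 = 1 := by rw [show 4 = 2 * 2 from rfl, pow_mul, huF]; norm_num
  let p : ℕ → Module.End F V := fun n => ∑ m ∈ Finset.range 4, ((u : F) ^ n) ^ m • a ^ m
  have hp : ∀ n, (u : F) ^ n • (a * p n) = p n := by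
    intro n
    have h4 : ((u : F) ^ n) ^ 4 = 1 := by rw [← pow_mul, mul_comm, pow_mul, hu4, one_pow]
    simp only [p]
    generalize (u : F) ^ n = s at h4 ⊢
    simp only [Finset.sum_range_succ, Finset.sum_range_zero, mul_add, smul_add, mul_smul_comm, smul_smul, ← pow_succ']
    rw [ha, h4]
    simp only [zero_add, pow_zero, mul_zero, smul_zero]
    abel
  obtain ⟨n, hn4, hn⟩ : ∃ n < 4, p n v ≠ 0 := by
    by_contra hcon
    push Not at hcon
    have h0 : p 0 + p 1 + p 2 + p 3 = (4 : F) • 1 := by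
      simp only [p, Finset.sum_range_succ, Finset.sum_range_zero]
      have e3 : (u : F) ^ 3 = - u := by rw [pow_succ, huF]; ring
      simp only [pow_zero, pow_one, huF, e3, one_pow, neg_sq]
      have e4 : (-(u : F)) ^ 3 = u := by rw [neg_pow, e3]; ring
      rw [e4]
      norm_num
      module
    have h1 := LinearMap.congr_fun h0 v
    simp only [LinearMap.add_apply] at h1
    rw [hcon 0 (by norm_num), hcon 1 (by norm_num), hcon 2 (by norm_num), hcon 3 (by norm_num)] at h1
    have h2 : (4 : F) • v = 0 := by rw [← Module.End.one_apply (R := F) v, ← LinearMap.smul_apply, ← h1]; simp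
    exact hv ((smul_eq_zero.1 h2).resolve_left (by norm_num))
  refine ⟨b ^ n * p n, ?_, ?_, ?_⟩
  · intro h
    apply hn
    have : (b ^ n) ^ 3 * (b ^ n * p n) = p n := by
      rw [← mul_assoc, ← pow_succ, ← pow_mul, mul_comm, pow_mul, hb, one_pow, one_mul]
    rw [← this, Module.End.mul_apply, h, map_zero]
  · rw [← mul_assoc, sc_pow_right hab, smul_mul_assoc, mul_assoc, ← mul_smul_comm, hp]
  · intro c hca hcb
    refine (hcb.pow_right n).mul_right ?_
    refine Commute.sum_right _ _ _ fun m _ => (hca.pow_right m).smul_right _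

/-- a pair of order four operators has non-scalar commutant unless the dimension is four -/
lemma pair_comm [FiniteDimensional F V] {u : Fˣ} (hu : u ^ 2 = -1) {a b : Module.End F V} (ha : a ^ 4 = 1) (hb : b ^ 4 = 1)
    (hab : a * b = (u : F) • (b * a)) (hd : Module.finrank F V = 8)
    (hs : ∀ X, Commute X a → Commute X b → ∃ x : F, X = x • 1) : False := by
  have huF : (u : F) ^ 2 = -1 := by rw [← Units.val_pow_eq_pow_val, hu]; simp
  have hu4 : (u : F) ^ 4 = 1 := by rw [show 4 = 2 * 2 from rfl, pow_mul, huF]; norm_num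
  have : Nontrivial V := Module.nontrivial_of_finrank_pos (R := F) (by omega)
  obtain ⟨v1, hv1⟩ := exists_ne (0 : V)
  obtain ⟨Z, hZ, haZ, -⟩ := eig_one hu ha hb hab hv1
  set v := Z v1 with hv
  have hav : a v = v := by rw [hv, ← Module.End.mul_apply, haZ]
  obtain ⟨y, hy⟩ : ∃ y : V →ₗ[F] F, y v = 1 := by
    obtain ⟨y, hy⟩ : ∃ y : Module.Dual F V, y v ≠ 0 := by
      by_contra hcon
      push Not at hcon
      exact hZ ((Module.forall_dual_apply_eq_zero_iff F v).1 hcon)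
    exact ⟨(y v)⁻¹ • y, by simp [hy]⟩
  let φ : V →ₗ[F] F := (4 : F)⁻¹ • (y ∘ₗ (1 + a + a ^ 2 + a ^ 3))
  have hφa : ∀ x, φ (a x) = φ x := by
    intro x
    have h1 : (1 + a + a ^ 2 + a ^ 3) * a = 1 + a + a ^ 2 + a ^ 3 := by
      have : (1 + a + a ^ 2 + a ^ 3) * a = a + a ^ 2 + a ^ 3 + a ^ 4 := by noncomm_ring
      rw [this, ha]; abel
    have h2 := LinearMap.congr_fun h1 x
    simp only [φ, LinearMap.smul_apply, LinearMap.comp_apply]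
    rw [← h2, Module.End.mul_apply]
  have hφv : φ v = 1 := by
    have e2 : (a ^ 2) v = v := by rw [pow_two, Module.End.mul_apply, hav, hav]
    have e3 : (a ^ 3) v = v := by rw [pow_succ, Module.End.mul_apply, hav, e2]
    simp only [φ, LinearMap.smul_apply, LinearMap.comp_apply, LinearMap.add_apply, Module.End.one_apply, hav, e2, e3, map_add, hy]
    norm_num
  let Y : Module.End F V := φ.smulRight v
  have hYa : Y * a = Y := by
    ext x; simp [Y, hφa]
  have haY : a * Y = Y := by
    ext x; simp [Y, hav]
  have hb' : ∀ n, b ^ (n + 4) = b ^ n := fun n => by rw [pow_add, hb, mul_one]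
  let X : Module.End F V := Y + b * Y * b ^ 3 + b ^ 2 * Y * b ^ 2 + b ^ 3 * Y * b
  have hba : b * a = ((u : F) ^ 3) • (a * b) := sc_symm hab (by rw [← pow_succ, hu4])
  have hXb : Commute X b := by
    show X * b = b * X
    have h1 : X * b = Y * b + b * Y * b ^ 4 + b ^ 2 * Y * b ^ 3 + b ^ 3 * Y * b ^ 2 := by
      simp only [X]; noncomm_ring
    have h2 : b * X = b * Y + b ^ 2 * Y * b ^ 3 + b ^ 3 * Y * b ^ 2 + b ^ 4 * Y * b := by
      simp only [X]; noncomm_ring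
    rw [h1, h2, hb, mul_one, one_mul]; abel
  have hXa : Commute X a := by
    show X * a = a * X
    have e1 : ∀ m n, b ^ m * Y * b ^ n * a = ((u : F) ^ 3) ^ n • (b ^ m * Y * b ^ n) := by
      intro m n
      rw [mul_assoc, sc_pow_left hba, mul_smul_comm, ← mul_assoc, mul_assoc _ Y a, hYa]
    have e2 : ∀ m n, a * (b ^ m * Y * b ^ n) = (u : F) ^ m • (b ^ m * Y * b ^ n) := by
      intro m n
      rw [← mul_assoc, ← mul_assoc, sc_pow_right hab, smul_mul_assoc, mul_assoc _ a Y, haY, smul_mul_assoc]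
    have hX : X = b ^ 0 * Y * b ^ 0 + b ^ 1 * Y * b ^ 3 + b ^ 2 * Y * b ^ 2 + b ^ 3 * Y * b ^ 1 := by
      simp [X]
    rw [hX, add_mul, add_mul, add_mul, mul_add, mul_add, mul_add, e1, e1, e1, e1, e2, e2, e2, e2]
    have f : ∀ n m k, n = m + 4 * k → (u : F) ^ n = (u : F) ^ m := by
      intro n m k h; rw [h, pow_add, pow_mul, hu4, one_pow, mul_one]
    simp only [← pow_mul]
    rw [f (3 * 3) 1 2 rfl, f (3 * 2) 2 1 rfl]
  obtain ⟨x, hx⟩ := hs X hXa hXb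
  have hφb : ∀ m, (u : F) ^ m ≠ 1 → φ ((b ^ m) v) = 0 := by
    intro m hm
    have h1 := hφa ((b ^ m) v)
    have e : a ((b ^ m) v) = (u : F) ^ m • (b ^ m) v := by
      rw [← Module.End.mul_apply, sc_pow_right hab, LinearMap.smul_apply, Module.End.mul_apply, hav]
    rw [e, LinearMap.map_smul, smul_eq_mul] at h1
    have : ((u : F) ^ m - 1) * φ ((b ^ m) v) = 0 := by rw [sub_mul, h1]; ring
    exact (mul_eq_zero.1 this).resolve_left (sub_ne_zero.2 hm)
  have n1 : (u : F) ≠ 1 := by intro h; rw [h] at huF; norm_num [eq_neg_iff_add_eq_zero] at huF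
  have n2 : (u : F) ^ 2 ≠ 1 := by rw [huF]; norm_num [neg_eq_iff_add_eq_zero]
  have n3 : (u : F) ^ 3 ≠ 1 := by
    intro h; rw [pow_succ, huF] at h
    apply n2; rw [show (u : F) = -1 by linear_combination -h]; norm_num
  have hXv : X v = v := by
    have z1 : φ (b v) = 0 := by have := hφb 1 (by rwa [pow_one]); rwa [pow_one] at this
    simp only [X, LinearMap.add_apply, Module.End.mul_apply, Y, LinearMap.smulRight_apply, hφb 2 n2, hφb 3 n3, z1, hφv]
    simp
  have hv0 : v ≠ 0 := hZ
  have hx1 : x = 1 := by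
    rw [hx] at hXv
    have : (x - 1) • v = 0 := by rw [sub_smul, one_smul, sub_eq_zero]; exact hXv
    exact sub_eq_zero.1 ((smul_eq_zero.1 this).resolve_right hv0)
  have ht : LinearMap.trace F V X = 4 := by
    have hY : LinearMap.trace F V Y = 1 := by
      rw [← hφv]; exact LinearMap.trace_smulRight _ _
    have e : ∀ m n, m + n = 4 → LinearMap.trace F V (b ^ m * Y * b ^ n) = 1 := by
      intro m n h
      rw [LinearMap.trace_mul_comm, ← mul_assoc, ← pow_add, add_comm n, h, hb, one_mul, hY]
    have hX : X = Y + b ^ 1 * Y * b ^ 3 + b ^ 2 * Y * b ^ 2 + b ^ 3 * Y * b ^ 1 := by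
      simp [X]
    rw [hX, map_add, map_add, map_add, hY, e 1 3 rfl, e 2 2 rfl, e 3 1 rfl]; norm_num
  rw [hx, hx1, one_smul, LinearMap.trace_one, hd] at ht
  norm_num at ht

/-- an operator commuting with a diagonal operator with simple spectrum is diagonal -/
lemma diag_comm {ι : Type} [Fintype ι] (v : Module.Basis ι F V) {e X : Module.End F V} {μ : ι → F} (hμ : Function.Injective μ)
    (he : ∀ i, e (v i) = μ i • v i) (hX : Commute X e) (i : ι) : ∃ x : F, X (v i) = x • v i := by
  classical
  have h1 : ∀ x j, v.repr (e x) j = μ j * v.repr x j := by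
    intro x j
    conv_lhs => rw [← v.sum_repr x]
    simp only [map_sum, map_smul, he, Finsupp.coe_finsetSum, Finset.sum_apply, Finsupp.coe_smul, Pi.smul_apply,
      Module.Basis.repr_self, smul_eq_mul, Finsupp.single_apply]
    rw [Finset.sum_eq_single j]
    · simp; ring
    · intro k _ hk; simp [hk]
    · simp
  have h2 : ∀ j, j ≠ i → v.repr (X (v i)) j = 0 := by
    intro j hj
    have h3 : e (X (v i)) = μ i • X (v i) := by
      rw [← map_smul, ← he, ← Module.End.mul_apply, ← Module.End.mul_apply]
      exact LinearMap.congr_fun hX.symm (v i)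
    have h4 := h1 (X (v i)) j
    rw [h3, map_smul, Finsupp.smul_apply, smul_eq_mul] at h4
    have : (μ i - μ j) * v.repr (X (v i)) j = 0 := by rw [sub_mul, h4, sub_self]
    exact (mul_eq_zero.1 this).resolve_left (sub_ne_zero.2 fun h => hj (hμ h).symm)
  refine ⟨v.repr (X (v i)) i, ?_⟩
  conv_lhs => rw [← v.sum_repr (X (v i))]
  rw [Finset.sum_eq_single i]
  · intro k _ hk; rw [h2 k hk, zero_smul]
  · simp

/-- relations of the four generators on the eight-dimensional space -/
structure RelV (u : Fˣ) (a b c d : Module.End F V) : Prop where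
  ha : a ^ 4 = 1
  hb : b ^ 4 = 1
  hc : c ^ 2 = 1
  hd : d ^ 2 = 1
  ab : a * b = (u : F) • (b * a)
  cd : c * d = (-1 : F) • (d * c)
  ac : Commute a c
  ad : Commute a d
  bc : Commute b c
  bd : Commute b d

/-- relations of the two generators on the plane -/
structure RelW (a b : Module.End F V) : Prop where
  ha : a ^ 2 = 1
  hb : b ^ 2 = 1
  ab : a * b = (-1 : F) • (b * a)

lemma sgn_inj : Function.Injective (fun l : Fin 2 => (-1 : F) ^ l.val) := by
  have h1 : (1 : F) ≠ -1 := by norm_num [eq_neg_iff_add_eq_zero]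
  have h2 : ∀ i j : Fin 2, (-1 : F) ^ i.val = (-1) ^ j.val → i = j := by
    simp [Fin.forall_fin_two, h1, h1.symm]
  exact fun i j h => h2 i j h

lemma RelW.ev {a b : Module.End F V} (h : RelW a b) [Nontrivial V] : ∃ v, v ≠ 0 ∧ a v = v := by
  by_contra hcon
  push Not at hcon
  have h1 : a + 1 = 0 := by
    ext x
    by_contra hx
    apply hcon _ hx
    rw [← Module.End.mul_apply, mul_add, ← pow_two, h.ha, mul_one, add_comm]
  have h2 : a = -1 := eq_neg_of_add_eq_zero_left h1
  have h3 := h.ab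
  rw [h2] at h3
  have h4 : b = -b := by simpa using h3.symm
  have h5 : (2 : F) • b = 0 := by
    have : b + b = 0 := by nth_rewrite 1 [h4]; simp
    rw [two_smul, this]
  have h6 := (smul_eq_zero.1 h5).resolve_left (by norm_num)
  have h7 := h.hb
  rw [h6] at h7
  simp at h7

lemma RelW.basis [FiniteDimensional F V] (hd : Module.finrank F V = 2) {a b : Module.End F V} (h : RelW a b) :
    ∃ v : Module.Basis (Fin 2) F V, (∀ l, a (v l) = (-1 : F) ^ l.val • v l) ∧ ∀ l, v l = (b ^ l.val) (v 0) := by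
  have : Nontrivial V := Module.nontrivial_of_finrank_pos (R := F) (by omega)
  obtain ⟨w, hw, haw⟩ := h.ev
  have hbi : ∀ n, (b ^ n) w ≠ 0 := fun n hn => hw (by
    have : (b ^ n) ((b ^ n) w) = w := by
      rw [← Module.End.mul_apply, ← pow_add, ← two_mul, pow_mul, h.hb, one_pow]; rfl
    rw [← this, hn, map_zero])
  have he : ∀ l : Fin 2, a ((b ^ l.val) w) = (-1 : F) ^ l.val • (b ^ l.val) w := by
    intro l
    rw [← Module.End.mul_apply, sc_pow_right h.ab, LinearMap.smul_apply, Module.End.mul_apply, haw]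
  have hli : LinearIndependent F (fun l : Fin 2 => (b ^ l.val) w) := by
    apply Module.End.eigenvectors_linearIndependent' a (fun l : Fin 2 => (-1 : F) ^ l.val)
    · exact sgn_inj
    · intro l
      exact ⟨Module.End.mem_eigenspace_iff.2 (he l), hbi _⟩
  refine ⟨basisOfLinearIndependentOfCardEqFinrank hli (by simp [hd]), ?_, ?_⟩
  · intro l; simpa using he l
  · intro l; simp

lemma RelW.comm [FiniteDimensional F V] (hd : Module.finrank F V = 2) {a b X : Module.End F V} (h : RelW a b)
    (hXa : Commute X a) (hXb : Commute X b) : ∃ x : F, X = x • 1 := by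
  obtain ⟨v, h1, h2⟩ := h.basis hd
  have hinj : Function.Injective (fun l : Fin 2 => (-1 : F) ^ l.val) := sgn_inj
  obtain ⟨x, hx⟩ := diag_comm v hinj h1 hXa 0
  refine ⟨x, v.ext fun l => ?_⟩
  have h3 : X * b ^ l.val = b ^ l.val * X := hXb.pow_right _
  rw [h2 l, ← Module.End.mul_apply, h3, Module.End.mul_apply, hx, map_smul]; rfl

lemma pow_val {N : ℕ} [NeZero N] {b : Module.End F V} (hb : b ^ N = 1) (k : Fin N) : b * b ^ k.val = b ^ (k + 1).val := by
  rw [← pow_succ', Fin.val_add, ← pow_mod_orderOf b (k.val + 1)]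
  have : ((k + 1) % N) % orderOf b = (k + 1) % orderOf b := Nat.mod_mod_of_dvd _ (orderOf_dvd_of_pow_eq_one hb)
  rw [← this, pow_mod_orderOf]
  congr 1
  rw [Nat.add_mod, Nat.add_mod k.val]
  simp

lemma RelW.conj [FiniteDimensional F V] (hd : Module.finrank F V = 2) {a b a' b' : Module.End F V} (h : RelW a b)
    (h' : RelW a' b') : ∃ T : Module.End F V, IsUnit T ∧ T * a = a' * T ∧ T * b = b' * T := by
  obtain ⟨v, h1, h2⟩ := h.basis hd
  obtain ⟨v', h1', h2'⟩ := h'.basis hd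
  let L := v.equiv v' (Equiv.refl _)
  have hL : ∀ l, L.toLinearMap (v l) = v' l := fun l => by simp [L]
  refine ⟨L.toLinearMap, ?_, ?_, ?_⟩
  · rw [Module.End.isUnit_iff]; exact L.bijective
  · refine v.ext fun l => ?_
    rw [Module.End.mul_apply, Module.End.mul_apply, h1, map_smul, hL, h1']
  · refine v.ext fun l => ?_
    rw [Module.End.mul_apply, Module.End.mul_apply, hL]
    have e : b (v l) = v (l + 1) := by rw [h2 l, h2 (l + 1), ← Module.End.mul_apply, pow_val h.hb]
    have e' : b' (v' l) = v' (l + 1) := by rw [h2' l, h2' (l + 1), ← Module.End.mul_apply, pow_val h'.hb]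
    rw [e, e', hL]

end lin
end E8

namespace E8

section lin
variable {F : Type} [Field F] [CharZero F] {V : Type} [AddCommGroup V] [Module F V]

lemma eig_inj {u : Fˣ} (hu : u ^ 2 = -1) :
    Function.Injective (fun i : Fin 4 × Fin 2 => (u : F) ^ i.1.val + 3 * (-1) ^ i.2.val) := by
  have huF : (u : F) ^ 2 = -1 := by rw [← Units.val_pow_eq_pow_val, hu]; simp
  have hsq : ∀ n : ℕ, ((u : F) ^ n) ^ 2 = 1 ∨ ((u : F) ^ n) ^ 2 = -1 := by
    intro n
    rw [← pow_mul, mul_comm, pow_mul, huF]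
    exact neg_one_pow_eq_or F n
  have no : ∀ x y : F, (x ^ 2 = 1 ∨ x ^ 2 = -1) → (y ^ 2 = 1 ∨ y ^ 2 = -1) → x ≠ y + 6 := by
    rintro x y hx hy rfl
    rcases hx with hx | hx <;> rcases hy with hy | hy
    · have : (-3 : F) = y := by linear_combination (-1 / 12) * (hx - hy)
      rw [← this] at hy; norm_num at hy
    · have : (-34 / 12 : F) = y := by linear_combination (-1 / 12) * (hx - hy)
      rw [← this] at hy; norm_num [eq_neg_iff_add_eq_zero] at hy
    · have : (-38 / 12 : F) = y := by linear_combination (-1 / 12) * (hx - hy)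
      rw [← this] at hy; norm_num at hy
    · have : (-3 : F) = y := by linear_combination (-1 / 12) * (hx - hy)
      rw [← this] at hy; norm_num [eq_neg_iff_add_eq_zero] at hy
  rintro ⟨k, l⟩ ⟨k', l'⟩ h
  simp only at h
  have hk : (u : F) ^ k.val = (u : F) ^ k'.val → k = k' := by
    intro h1
    have h2 : u ^ (k.val : ℤ) = u ^ (k'.val : ℤ) := by
      apply Units.ext
      simpa using h1
    have := (u_zpow hu _ _).1 h2
    ext
    omega
  have hl : l = l' := by
    by_contra hne
    rcases neg_one_pow_eq_or F l.val with e | e <;> rcases neg_one_pow_eq_or F l'.val with e' | e'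
    · exact hne (sgn_inj (F := F) (by simp only; rw [e, e']))
    · rw [e, e'] at h
      exact no _ _ (hsq k'.val) (hsq k.val) (by linear_combination -h)
    · rw [e, e'] at h
      exact no _ _ (hsq k.val) (hsq k'.val) (by linear_combination h)
    · exact hne (sgn_inj (F := F) (by simp only; rw [e, e']))
  subst hl
  rw [hk (by linear_combination h)]

lemma RelV.ev {u : Fˣ} (hu : u ^ 2 = -1) {a b c d : Module.End F V} (h : RelV u a b c d) [Nontrivial V] :
    ∃ v, v ≠ 0 ∧ a v = v ∧ c v = v := by
  have hW : RelW c d := ⟨h.hc, h.hd, h.cd⟩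
  obtain ⟨w, hw, hcw⟩ := hW.ev
  obtain ⟨Z, hZ, haZ, hcZ⟩ := eig_one hu h.ha h.hb h.ab hw
  refine ⟨Z w, hZ, ?_, ?_⟩
  · rw [← Module.End.mul_apply, haZ]
  · have : c * Z = Z * c := hcZ c h.ac.symm h.bc.symm
    rw [← Module.End.mul_apply, this, Module.End.mul_apply, hcw]

lemma RelV.basis [FiniteDimensional F V] (hd : Module.finrank F V = 8) {u : Fˣ} (hu : u ^ 2 = -1)
    {a b c d : Module.End F V} (h : RelV u a b c d) :
    ∃ v : Module.Basis (Fin 4 × Fin 2) F V, (∀ i, a (v i) = (u : F) ^ i.1.val • v i) ∧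
      (∀ i, c (v i) = (-1 : F) ^ i.2.val • v i) ∧ ∀ i, v i = (b ^ i.1.val * d ^ i.2.val) (v 0) := by
  have : Nontrivial V := Module.nontrivial_of_finrank_pos (R := F) (by omega)
  obtain ⟨w, hw, haw, hcw⟩ := h.ev hu
  have hu4 : ∀ n, (b ^ n) ^ 3 * b ^ n = 1 := fun n => by
    rw [← pow_succ, ← pow_mul, mul_comm, pow_mul, h.hb, one_pow]
  have hd2 : ∀ n, d ^ n * d ^ n = 1 := fun n => by rw [← pow_add, ← two_mul, pow_mul, h.hd, one_pow]
  have hbi : ∀ m n, (b ^ m * d ^ n) w ≠ 0 := fun m n hn => hw (by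
    have : (d ^ n * (b ^ m) ^ 3) ((b ^ m * d ^ n) w) = w := by
      rw [← Module.End.mul_apply, mul_assoc, ← mul_assoc _ (b ^ m), hu4, one_mul, hd2]; rfl
    rw [← this, hn, map_zero])
  have he : ∀ i : Fin 4 × Fin 2, a ((b ^ i.1.val * d ^ i.2.val) w) = (u : F) ^ i.1.val • (b ^ i.1.val * d ^ i.2.val) w := by
    intro i
    have h1 : a * d ^ i.2.val = d ^ i.2.val * a := h.ad.pow_right _
    rw [← Module.End.mul_apply, ← mul_assoc, sc_pow_right h.ab, smul_mul_assoc, mul_assoc, h1, ← mul_assoc,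
      LinearMap.smul_apply, Module.End.mul_apply, haw]
  have he' : ∀ i : Fin 4 × Fin 2, c ((b ^ i.1.val * d ^ i.2.val) w) = (-1 : F) ^ i.2.val • (b ^ i.1.val * d ^ i.2.val) w := by
    intro i
    have h1 : c * b ^ i.1.val = b ^ i.1.val * c := h.bc.symm.pow_right _
    rw [← Module.End.mul_apply, ← mul_assoc, h1, mul_assoc, sc_pow_right h.cd, mul_smul_comm, ← mul_assoc,
      LinearMap.smul_apply, Module.End.mul_apply, hcw]
  have hli : LinearIndependent F (fun i : Fin 4 × Fin 2 => (b ^ i.1.val * d ^ i.2.val) w) := by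
    apply Module.End.eigenvectors_linearIndependent' (a + (3 : F) • c) _ (eig_inj hu)
    intro i
    refine ⟨Module.End.mem_eigenspace_iff.2 ?_, hbi _ _⟩
    rw [LinearMap.add_apply, LinearMap.smul_apply, he, he', add_smul, smul_smul]
  refine ⟨basisOfLinearIndependentOfCardEqFinrank hli (by simp [hd]), ?_, ?_, ?_⟩
  · intro i; simpa using he i
  · intro i; simpa using he' i
  · intro i; simp

lemma RelV.comm [FiniteDimensional F V] (hd : Module.finrank F V = 8) {u : Fˣ} (hu : u ^ 2 = -1)
    {a b c d X : Module.End F V} (h : RelV u a b c d)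
    (hXa : Commute X a) (hXb : Commute X b) (hXc : Commute X c) (hXd : Commute X d) : ∃ x : F, X = x • 1 := by
  obtain ⟨v, h1, h1', h2⟩ := h.basis hd hu
  obtain ⟨x, hx⟩ := diag_comm v (e := a + (3 : F) • c) (eig_inj hu)
    (fun i => by rw [LinearMap.add_apply, LinearMap.smul_apply, h1, h1', add_smul, smul_smul])
    (hXa.add_right (hXc.smul_right _)) 0
  refine ⟨x, v.ext fun i => ?_⟩
  have h3 : X * (b ^ i.1.val * d ^ i.2.val) = b ^ i.1.val * d ^ i.2.val * X :=
    (hXb.pow_right _).mul_right (hXd.pow_right _)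
  rw [h2 i, ← Module.End.mul_apply, h3, Module.End.mul_apply, hx, map_smul]; rfl

lemma RelV.conj [FiniteDimensional F V] (hd : Module.finrank F V = 8) {u : Fˣ} (hu : u ^ 2 = -1)
    {a b c d a' b' c' d' : Module.End F V} (h : RelV u a b c d) (h' : RelV u a' b' c' d') :
    ∃ T : Module.End F V, IsUnit T ∧ T * a = a' * T ∧ T * b = b' * T ∧ T * c = c' * T ∧ T * d = d' * T := by
  obtain ⟨v, h1, h1', h2⟩ := h.basis hd hu
  obtain ⟨v', h3, h3', h4⟩ := h'.basis hd hu
  let L := v.equiv v' (Equiv.refl _)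
  have hL : ∀ l, L.toLinearMap (v l) = v' l := fun l => by simp [L]
  have eb : ∀ {a b c d : Module.End F V} (h : RelV u a b c d) (v : Module.Basis (Fin 4 × Fin 2) F V)
      (h2 : ∀ i, v i = (b ^ i.1.val * d ^ i.2.val) (v 0)) (i), b (v i) = v (i.1 + 1, i.2) ∧ d (v i) = v (i.1, i.2 + 1) := by
    intro a b c d h v h2 i
    constructor
    · rw [h2 i, h2 (i.1 + 1, i.2), ← Module.End.mul_apply, ← mul_assoc, pow_val h.hb]
    · have e : d * b ^ i.1.val = b ^ i.1.val * d := h.bd.symm.pow_right _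
      rw [h2 i, h2 (i.1, i.2 + 1), ← Module.End.mul_apply, ← mul_assoc, e, mul_assoc, pow_val h.hd]
  refine ⟨L.toLinearMap, ?_, ?_, ?_, ?_, ?_⟩
  · rw [Module.End.isUnit_iff]; exact L.bijective
  · refine v.ext fun l => ?_
    rw [Module.End.mul_apply, Module.End.mul_apply, h1, map_smul, hL, h3]
  · refine v.ext fun l => ?_
    rw [Module.End.mul_apply, Module.End.mul_apply, hL, (eb h v h2 l).1, (eb h' v' h4 l).1, hL]
  · refine v.ext fun l => ?_
    rw [Module.End.mul_apply, Module.End.mul_apply, h1', map_smul, hL, h3']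
  · refine v.ext fun l => ?_
    rw [Module.End.mul_apply, Module.End.mul_apply, hL, (eb h v h2 l).2, (eb h' v' h4 l).2, hL]

end lin
end E8

namespace E8

variable {F : Type} [Field F] [CharZero F]

/-- operators on the two factors -/
abbrev EV (F : Type) [Field F] := Module.End F (Fin 8 → F)
/-- operators on the plane -/
abbrev EW (F : Type) [Field F] := Module.End F (Fin 2 → F)

/-- a realisation of an automorphism by invertible operators -/
structure RP (q : Au F) (A : EV F) (B : EW F) : Prop where
  a : IsUnit A
  b : IsUnit B
  r : RR q A B

lemma RP.mul {q q' : Au F} {A A' : EV F} {B B' : EW F} (h : RP q A B) (h' : RP q' A' B') :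
    RP (q * q') (A * A') (B * B') := ⟨h.a.mul h'.a, h.b.mul h'.b, h.r.mul h'.r⟩
lemma RP.one : RP (1 : Au F) 1 1 := ⟨isUnit_one, isUnit_one, RR_one⟩
lemma RP.pow {q : Au F} {A : EV F} {B : EW F} (h : RP q A B) (n : ℕ) : RP (q ^ n) (A ^ n) (B ^ n) := by
  induction n with
  | zero => exact RP.one
  | succ n ih => rw [pow_succ, pow_succ, pow_succ]; exact ih.mul h
lemma smul_unit {U : Type} [Ring U] [Algebra F U] {A : U} (h : IsUnit A) {s : F} (hs : s ≠ 0) : IsUnit (s • A) :=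
  h.smul (Units.mk0 s hs)
lemma RP.rescale {q : Au F} {A : EV F} {B : EW F} (h : RP q A B) {s : F} (hs : s ≠ 0) :
    RP q (s • A) ((s⁻¹ * s⁻¹) • B) :=
  ⟨smul_unit h.a hs, smul_unit h.b (mul_ne_zero (inv_ne_zero hs) (inv_ne_zero hs)), h.r.rescale hs⟩

lemma RP.uniq {q : Au F} {A A' : EV F} {B B' : EW F} (h : RP q A B) (h' : RP q A' B') :
    ∃ s : F, s ≠ 0 ∧ A = s • A' ∧ B = (s⁻¹ * s⁻¹) • B' := by
  obtain ⟨⟨A', rfl⟩, ⟨B', rfl⟩, h'⟩ := h'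
  have h1 := h.r.mul (h'.inv A'.mul_inv B'.mul_inv)
  rw [mul_inv_cancel] at h1
  obtain ⟨s, hs, e1, e2⟩ := RR_self h1
  refine ⟨s, hs, ?_, ?_⟩
  · rw [Units.mul_inv_eq_iff_eq_mul] at e1; rw [e1, smul_mul_assoc, one_mul]
  · rw [Units.mul_inv_eq_iff_eq_mul] at e2; rw [e2, smul_mul_assoc, one_mul]

lemma RP.eq {q q' : Au F} {A : EV F} {B : EW F} (h : RP q A B) (h' : RP q' A B) : q = q' := by
  obtain ⟨⟨A', rfl⟩, ⟨B', rfl⟩, h⟩ := h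
  have h1 := h'.r.mul (h.inv A'.mul_inv B'.mul_inv)
  rw [A'.mul_inv, B'.mul_inv] at h1
  exact (mul_inv_eq_one.1 h1.eq_one).symm

lemma RP_th {u : Fˣ} (hu : u ^ 2 = -1) : RP (th u : Au F) 1 ((u : F) • 1) :=
  ⟨isUnit_one, smul_unit isUnit_one (Units.ne_zero u), RR_th hu⟩

lemma four_pow {u : Fˣ} (hu : u ^ 2 = -1) {z : F} (hz : z ^ 4 = 1) : ∃ n : ℕ, z = (u : F) ^ n := by
  have huF : (u : F) ^ 2 = -1 := by rw [← Units.val_pow_eq_pow_val, hu]; simp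
  have h1 : (z - 1) * (z + 1) * ((z - u) * (z + u)) = 0 := by linear_combination hz + (1 - z ^ 2) * huF
  rcases mul_eq_zero.1 h1 with h1 | h1 <;> rcases mul_eq_zero.1 h1 with h1 | h1
  · exact ⟨0, by rw [pow_zero]; linear_combination h1⟩
  · exact ⟨2, by rw [huF]; linear_combination h1⟩
  · exact ⟨1, by rw [pow_one]; linear_combination h1⟩
  · exact ⟨3, by rw [pow_succ, huF]; linear_combination h1⟩

lemma RP.same {u : Fˣ} (hu : u ^ 2 = -1) {q q' : Au F} {A : EV F} {B : EW F} {κ : F} (h : RP q A B) (h' : RP q' A (κ • B)) :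
    ∃ m : ℕ, q' = q * th u ^ m := by
  have hh := h
  obtain ⟨⟨A', rfl⟩, ⟨B', rfl⟩, h⟩ := h
  have h1 := (h.inv A'.mul_inv B'.mul_inv).mul h'.r
  rw [A'.inv_mul, mul_smul_comm, B'.inv_mul] at h1
  obtain ⟨m, rfl⟩ := four_pow hu (gen_theta h1.scal)
  refine ⟨m, RP.eq h' ?_⟩
  have h2 := hh.mul ((RP_th hu).pow m)
  rw [one_pow, mul_one, smul_pow, one_pow, mul_smul_comm, mul_one] at h2
  exact h2

lemma sc_det {n : ℕ} {A B : Module.End F (Fin n → F)} (hA : IsUnit A) (hB : IsUnit B) {z : F} (h : A * B = z • (B * A)) : z ^ n = 1 := by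
  have h1 := congrArg LinearMap.det h
  rw [map_mul, LinearMap.det_smul, map_mul, Module.finrank_fin_fun, mul_comm (LinearMap.det B)] at h1
  have h2 : LinearMap.det A * LinearMap.det B ≠ 0 :=
    mul_ne_zero ((LinearMap.isUnit_iff_isUnit_det A).1 hA).ne_zero ((LinearMap.isUnit_iff_isUnit_det B).1 hB).ne_zero
  exact mul_right_cancel₀ h2 (by rw [← h1, one_mul])

lemma RP.sc {q p : Au F} {A A' : EV F} {B B' : EW F} (h : RP q A B) (h' : RP p A' B') (hc : q * p = p * q) :
    ∃ z : F, z ^ 4 = 1 ∧ A * A' = z • (A' * A) ∧ B * B' = z ^ 2 • (B' * B) := by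
  obtain ⟨z, hz, e1, e2⟩ := (h.mul h').uniq (hc ▸ h'.mul h)
  have h2 := sc_det h.b h'.b e2
  have h4 : z ^ 4 = 1 := by
    have : (z⁻¹ * z⁻¹) ^ 2 = (z ^ 4)⁻¹ := by field_simp
    rw [this, inv_eq_one] at h2
    exact h2
  refine ⟨z, h4, e1, ?_⟩
  rw [e2]
  congr 1
  field_simp
  exact h4.symm

lemma sm_one {U : Type} [Ring U] [Algebra F U] {x : U} {z : F} (h : x = z • x) (hx : x ≠ 0) : z = 1 := by
  have : (1 - z) • x = 0 := by rw [sub_smul, one_smul, ← h, sub_self]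
  exact (sub_eq_zero.1 ((smul_eq_zero.1 this).resolve_right hx)).symm

lemma sm_scal {U : Type} [Ring U] [Algebra F U] [Nontrivial U] {X : U} {p r t s : F}
    (h : p • (t • 1 - X) = r • (s • 1 - X)) (hp : p ≠ 0) (hts : t ≠ s) : ∃ x : F, X = x • 1 := by
  have e3 : (p - r) • X = (p * t - r * s) • 1 := by
    rw [smul_sub, smul_sub, smul_smul, smul_smul] at h
    rw [sub_smul, sub_smul]
    rw [← sub_eq_zero] at h ⊢
    rw [← neg_eq_zero, ← h]; abel
  have hz2 : p - r ≠ 0 := by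
    intro h0
    rw [h0, zero_smul] at e3
    have h2 := (smul_eq_zero.1 e3.symm).resolve_right one_ne_zero
    rw [← sub_eq_zero.1 h0, ← mul_sub] at h2
    exact hts (sub_eq_zero.1 ((mul_eq_zero.1 h2).resolve_left hp))
  refine ⟨(p - r)⁻¹ * (p * t - r * s), ?_⟩
  rw [mul_smul, ← e3, smul_smul, inv_mul_cancel₀ hz2, one_smul]

lemma sc_one {n : ℕ} [NeZero n] {A B : Module.End F (Fin n → F)} (hA : IsUnit A) (hB : IsUnit B) {z : F}
    (h : A * B = z • (B * A)) (hc : Commute A B) : z = 1 := by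
  exact sm_one (by rw [← h]; exact hc.symm) (hB.mul hA).ne_zero

/-- if the first operators commute then so do the second ones -/
lemma RP.comm_b {q p : Au F} {A A' : EV F} {B B' : EW F} (h : RP q A B) (h' : RP p A' B') (hc : q * p = p * q)
    (hA : Commute A A') : Commute B B' := by
  obtain ⟨z, -, e1, e2⟩ := h.sc h' hc
  rw [sc_one h.a h'.a e1 hA, one_pow, one_smul] at e2
  exact e2

/-- if one of the second operators is scalar, the first ones commute up to sign -/
lemma RP.sc_b {q p : Au F} {A A' : EV F} {B B' : EW F} (h : RP q A B) (h' : RP p A' B') (hc : q * p = p * q)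
    (hB : Commute B B') : ∃ z : F, z ^ 2 = 1 ∧ A * A' = z • (A' * A) := by
  obtain ⟨z, -, e1, e2⟩ := h.sc h' hc
  exact ⟨z, sc_one h.b h'.b e2 hB, e1⟩

/-- the properties of our groups -/
structure Good (u : Fˣ) (Q : Subgroup (Au F)) : Prop where
  fin : (Q : Set (Au F)).Finite
  comm : ∀ q ∈ Q, ∀ p ∈ Q, q * p = p * q
  max : ∀ g, (∀ q ∈ Q, g * q = q * g) → g ∈ Q
  th : th u ∈ Q

variable [IsAlgClosed F] {u : Fˣ} {Q : Subgroup (Au F)}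

lemma Good.rp (h : Good u Q) (hu : u ^ 2 = -1) {q : Au F} (hq : q ∈ Q) : ∃ A B, RP q A B := by
  obtain ⟨A, B, hA, hB, hr⟩ := cent_RT hu (h.comm q hq _ h.th)
  exact ⟨A, B, hA, hB, hr⟩

lemma Good.mem (h : Good u Q) {g : Au F} {A : EV F} {B : EW F} (hg : RP g A B)
    (hX : ∀ q ∈ Q, ∃ A' B', RP q A' B' ∧ Commute A A' ∧ Commute B B') : g ∈ Q := by
  apply h.max
  intro q hq
  obtain ⟨A', B', hp, h1, h2⟩ := hX q hq
  refine RP.eq (hg.mul hp) ?_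
  have : RP (q * g) (A' * A) (B' * B) := hp.mul hg
  rw [h1.eq, h2.eq]
  exact this

lemma spec_inf {n : ℕ} (X : Module.End F (Fin n → F)) : {t : F | IsUnit (t • 1 - X)}.Infinite := by
  have h1 : (spectrum F X).Finite := Module.End.finite_spectrum X
  have h2 : {t : F | IsUnit (t • 1 - X)} = (spectrum F X)ᶜ := by
    ext t
    rw [Set.mem_compl_iff, spectrum.mem_iff, not_not, Algebra.algebraMap_eq_smul_one]
    rfl
  rw [h2]
  exact h1.infinite_compl

lemma Good.commV (h : Good u Q) {X : EV F} (hX : ∀ q ∈ Q, ∃ A B, RP q A B ∧ Commute X A) : ∃ x : F, X = x • 1 := by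
  have h1 : ∀ t : F, ∃ g : Au F, ∃ c : F, IsUnit (t • 1 - X) → RP g (t • 1 - X) (c • 1) := by
    intro t
    by_cases ht' : IsUnit (t • 1 - X)
    · obtain ⟨g, c, hc, hg⟩ := RR_real ht' (isUnit_one (M := EW F))
      exact ⟨g, c, fun _ => ⟨ht', smul_unit isUnit_one hc, hg⟩⟩
    · exact ⟨1, 1, fun h => absurd h ht'⟩
  choose g c hg using h1
  have hm : Set.MapsTo g {t : F | IsUnit (t • 1 - X)} Q := by
    intro t ht'
    refine h.mem (hg t ht') fun q hq => ?_
    obtain ⟨A, B, hp, hc⟩ := hX q hq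
    exact ⟨A, B, hp, ((Commute.one_left A).smul_left t).sub_left hc, (Commute.one_left B).smul_left _⟩
  obtain ⟨t, ht', s, hs, hts, he⟩ := (spec_inf X).exists_ne_map_eq_of_mapsTo hm h.fin
  obtain ⟨z, hz, e1, e2⟩ := (hg t ht').uniq (he ▸ hg s hs)
  exact sm_scal (p := 1) (by rw [one_smul]; exact e1) one_ne_zero hts

lemma Good.commW (h : Good u Q) {X : EW F} (hX : ∀ q ∈ Q, ∃ A B, RP q A B ∧ Commute X B) : ∃ x : F, X = x • 1 := by
  have h1 : ∀ t : F, ∃ g : Au F, ∃ c : F, IsUnit (t • 1 - X) → c ≠ 0 ∧ RP g 1 (c • (t • 1 - X)) := by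
    intro t
    by_cases ht' : IsUnit (t • 1 - X)
    · obtain ⟨g, c, hc, hg⟩ := RR_real (isUnit_one (M := EV F)) ht'
      exact ⟨g, c, fun _ => ⟨hc, isUnit_one, smul_unit ht' hc, hg⟩⟩
    · exact ⟨1, 1, fun h => absurd h ht'⟩
  choose g c hg using h1
  have hm : Set.MapsTo g {t : F | IsUnit (t • 1 - X)} Q := by
    intro t ht'
    refine h.mem (hg t ht').2 fun q hq => ?_
    obtain ⟨A, B, hp, hc⟩ := hX q hq
    exact ⟨A, B, hp, Commute.one_left A, (((Commute.one_left B).smul_left t).sub_left hc).smul_left _⟩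
  obtain ⟨t, ht', s, hs, hts, he⟩ := (spec_inf X).exists_ne_map_eq_of_mapsTo hm h.fin
  obtain ⟨z, hz, e1, e2⟩ := (hg t ht').2.uniq (he ▸ (hg s hs).2)
  have hz1 : z = 1 := sm_one (U := EV F) e1 one_ne_zero
  rw [hz1, inv_one, one_mul, one_smul] at e2
  exact sm_scal e2 (hg t ht').1 hts

end E8

namespace E8

variable {F : Type} [Field F] [CharZero F]

lemma comm_of_sc {U : Type} [Ring U] [Algebra F U] {A B : U} {z : F} (h : A * B = z • (B * A)) (hz : z = 1) : Commute A B := by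
  rw [hz, one_smul] at h; exact h

lemma scal_comm {U : Type} [Ring U] [Algebra F U] (X : U) {A : U} (h : ∃ x : F, A = x • 1) : Commute X A := by
  obtain ⟨x, rfl⟩ := h
  exact (Commute.one_right X).smul_right x

lemma pow_comm_sc {U : Type} [Ring U] [Algebra F U] {A B : U} {z : F} (h : A * B = z • (B * A)) {n : ℕ} (hz : z ^ n = 1) :
    Commute (A ^ n) B := comm_of_sc (sc_pow_left h n) hz

lemma sc_scale {U : Type} [Ring U] [Algebra F U] {A B : U} {z : F} (h : A * B = z • (B * A)) (r t : F) :
    (r • A) * (t • B) = z • ((t • B) * (r • A)) := by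
  rw [smul_mul_smul_comm, smul_mul_smul_comm, h, smul_comm, mul_comm r t]

lemma smul_cancel_inv {U : Type} [Ring U] [Algebra F U] (B : U) {r : F} (hr0 : r ≠ 0) (s : F) :
    s • B = (s * r⁻¹) • (r • B) := by
  rw [smul_smul, mul_assoc, inv_mul_cancel₀ hr0, mul_one]

variable [IsAlgClosed F] {u : Fˣ} {Q : Subgroup (Au F)}

lemma root_norm {U : Type} [Ring U] [Algebra F U] [Nontrivial U] {A : U} (hA : IsUnit A) {n : ℕ} (hn : 0 < n) (h : ∃ x : F, A ^ n = x • 1) :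
    ∃ s : F, s ≠ 0 ∧ (s • A) ^ n = 1 := by
  obtain ⟨x, hx⟩ := h
  have hx0 : x ≠ 0 := by
    rintro rfl
    rw [zero_smul] at hx
    exact (hA.pow n).ne_zero hx
  obtain ⟨s, hs⟩ := IsAlgClosed.exists_pow_nat_eq (x⁻¹) hn
  refine ⟨s, ?_, ?_⟩
  · rintro rfl
    rw [zero_pow hn.ne'] at hs
    exact inv_ne_zero hx0 hs.symm
  · rw [smul_pow, hx, hs, smul_smul, inv_mul_cancel₀ hx0, one_smul]

lemma Good.powV (h : Good u Q) (hu : u ^ 2 = -1) {q : Au F} (hq : q ∈ Q) {A : EV F} {B : EW F} (hr : RP q A B) : ∃ x : F, A ^ 4 = x • 1 := by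
  refine h.commV fun p hp => ?_
  obtain ⟨A', B', hr'⟩ := h.rp hu hp
  obtain ⟨z, hz, e1, e2⟩ := hr.sc hr' (h.comm q hq p hp)
  exact ⟨A', B', hr', pow_comm_sc e1 hz⟩

lemma Good.powW (h : Good u Q) (hu : u ^ 2 = -1) {q : Au F} (hq : q ∈ Q) {A : EV F} {B : EW F} (hr : RP q A B) : ∃ x : F, B ^ 2 = x • 1 := by
  refine h.commW fun p hp => ?_
  obtain ⟨A', B', hr'⟩ := h.rp hu hp
  obtain ⟨z, hz, e1, e2⟩ := hr.sc hr' (h.comm q hq p hp)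
  exact ⟨A', B', hr', pow_comm_sc e2 (by rw [← pow_mul]; exact hz)⟩

lemma plane_ne (h : ∀ X : EW F, ∃ x : F, X = x • 1) : False := by
  obtain ⟨x, hx⟩ := h (LinearMap.proj 0 |>.smulRight (Pi.single 1 1))
  have h1 := congrFun (congrArg (fun f : EW F => f (Pi.single 0 1)) hx) 1
  simp at h1

lemma Good.pair0 (h : Good u Q) (hu : u ^ 2 = -1) :
    ∃ qa ∈ Q, ∃ qb ∈ Q, ∃ a b Ba Bb, RP qa a Ba ∧ RP qb b Bb ∧ a * b = (u : F) • (b * a) ∧ Ba * Bb = (-1 : F) • (Bb * Ba) := by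
  have huF : (u : F) ^ 2 = -1 := by rw [← Units.val_pow_eq_pow_val, hu]; simp
  by_contra hcon
  have key : ∀ q ∈ Q, ∀ p ∈ Q, ∀ A B A' B', RP q A B → RP p A' B' → Commute B B' := by
    intro q hq p hp A B A' B' hr hr'
    obtain ⟨z, hz, e1, e2⟩ := hr.sc hr' (h.comm q hq p hp)
    have hz' : (z ^ 2 - 1) * ((z - u) * (z + u)) = 0 := by linear_combination hz + (1 - z ^ 2) * huF
    rcases mul_eq_zero.1 hz' with h1 | h1
    · exact comm_of_sc e2 (sub_eq_zero.1 h1)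
    · exfalso
      have hz2 : z ^ 2 = -1 := by linear_combination h1 + huF
      rw [hz2] at e2
      rcases mul_eq_zero.1 h1 with h1 | h1
      · rw [sub_eq_zero.1 h1] at e1
        exact hcon ⟨q, hq, p, hp, A, A', B, B', hr, hr', e1, e2⟩
      · rw [eq_neg_of_add_eq_zero_left h1] at e1
        exact hcon ⟨p, hp, q, hq, A', A, B', B, hr', hr,
          sc_symm e1 (by linear_combination - huF), sc_symm e2 (by norm_num)⟩
  refine plane_ne (F := F) fun X => h.commW fun q hq => ?_
  obtain ⟨A, B, hr⟩ := h.rp hu hq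
  refine ⟨A, B, hr, scal_comm X (h.commW fun p hp => ?_)⟩
  obtain ⟨A', B', hr'⟩ := h.rp hu hp
  exact ⟨A', B', hr', key q hq p hp _ _ _ _ hr hr'⟩

lemma Good.norm4 (h : Good u Q) (hu : u ^ 2 = -1) {q : Au F} (hq : q ∈ Q) {A : EV F} {B : EW F} (hr : RP q A B) :
    ∃ s t l : F, l ≠ 0 ∧ RP q (s • A) (l • (t • B)) ∧ (s • A) ^ 4 = 1 ∧ (t • B) ^ 2 = 1 := by
  obtain ⟨s, hs, hs4⟩ := root_norm hr.a (by norm_num : 0 < 4) (h.powV hu hq hr)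
  obtain ⟨t, ht0, ht2⟩ := root_norm hr.b (by norm_num : 0 < 2) (h.powW hu hq hr)
  refine ⟨s, t, (s⁻¹ * s⁻¹) * t⁻¹, ?_, ?_, hs4, ht2⟩
  · exact mul_ne_zero (mul_ne_zero (inv_ne_zero hs) (inv_ne_zero hs)) (inv_ne_zero ht0)
  · rw [← smul_cancel_inv (U := EW F) B ht0]
    exact hr.rescale hs

lemma Good.pair (h : Good u Q) (hu : u ^ 2 = -1) :
    ∃ qa ∈ Q, ∃ qb ∈ Q, ∃ (a b : EV F) (α β : EW F) (la lb : F), RP qa a (la • α) ∧ RP qb b (lb • β) ∧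
      la ≠ 0 ∧ lb ≠ 0 ∧ a ^ 4 = 1 ∧ b ^ 4 = 1 ∧ a * b = (u : F) • (b * a) ∧ RelW α β := by
  obtain ⟨qa, hqa, qb, hqb, a, b, Ba, Bb, ra, rb, e1, e2⟩ := h.pair0 hu
  obtain ⟨s, t, l, hl, r1, h1, h2⟩ := h.norm4 hu hqa ra
  obtain ⟨s', t', l', hl', r1', h1', h2'⟩ := h.norm4 hu hqb rb
  exact ⟨qa, hqa, qb, hqb, _, _, _, _, l, l', r1, r1', hl, hl', h1, h1', sc_scale (U := EV F) e1 _ _, h2, h2', sc_scale (U := EW F) e2 _ _⟩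

lemma fix4 (hu : u ^ 2 = -1) {qa qb q : Au F} {a b A : EV F} {Ba Bb B : EW F} (ra : RP qa a Ba) (rb : RP qb b Bb) (r : RP q A B)
    (hab : a * b = (u : F) • (b * a)) (ca : q * qa = qa * q) (cb : q * qb = qb * q) :
    ∃ m n, Commute (A * (a ^ m * b ^ n)) a ∧ Commute (A * (a ^ m * b ^ n)) b := by
  obtain ⟨z, hz, e1, -⟩ := r.sc ra ca
  obtain ⟨z', hz', e1', -⟩ := r.sc rb cb
  obtain ⟨i, rfl⟩ := four_pow hu hz
  obtain ⟨j, rfl⟩ := four_pow hu hz'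
  have huF : (u : F) ^ 2 = -1 := by rw [← Units.val_pow_eq_pow_val, hu]; simp
  exact sc_fix (U := EV F) (N := 3) (by linear_combination ((u : F) ^ 2 - 1) * huF) hab e1 e1'

lemma Good.pair2 (h : Good u Q) (hu : u ^ 2 = -1) {qa qb : Au F} (hqa : qa ∈ Q) (hqb : qb ∈ Q) {a b : EV F} {Ba Bb : EW F}
    (ra : RP qa a Ba) (rb : RP qb b Bb)
    (ha : a ^ 4 = 1) (hb : b ^ 4 = 1) (hab : a * b = (u : F) • (b * a)) :
    ∃ q ∈ Q, ∃ p ∈ Q, ∃ (C D : EV F) (B B' : EW F), RP q C B ∧ RP p D B' ∧ Commute C a ∧ Commute C b ∧ Commute D a ∧ Commute D b ∧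
      ¬ Commute C D := by
  by_contra hcon
  refine pair_comm hu ha hb hab (by simp) fun X hXa hXb => h.commV fun q hq => ?_
  obtain ⟨A, B, r⟩ := h.rp hu hq
  obtain ⟨m, n, c1, c2⟩ := fix4 hu ra rb r hab (h.comm q hq _ hqa) (h.comm q hq _ hqb)
  refine ⟨A, B, r, ?_⟩
  have hV : IsUnit (a ^ m * b ^ n) := (ra.a.pow m).mul (rb.a.pow n)
  refine comm_cancel (U := EV F) (scal_comm (U := EV F) X (h.commV fun p hp => ?_)) ((hXa.pow_right m).mul_right (hXb.pow_right n)) hV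
  obtain ⟨A', B', r'⟩ := h.rp hu hp
  obtain ⟨m', n', c1', c2'⟩ := fix4 hu ra rb r' hab (h.comm p hp _ hqa) (h.comm p hp _ hqb)
  refine ⟨A', B', r', ?_⟩
  refine comm_cancel (U := EV F) (V := a ^ m' * b ^ n') ?_ ((c1.pow_right m').mul_right (c2.pow_right n')) ((ra.a.pow m').mul (rb.a.pow n'))
  by_contra hn
  refine hcon ⟨_, Q.mul_mem hq (Q.mul_mem (Q.pow_mem hqa m) (Q.pow_mem hqb n)), _, Q.mul_mem hp (Q.mul_mem (Q.pow_mem hqa m') (Q.pow_mem hqb n')), _, _, _, _,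
    r.mul ((ra.pow m).mul (rb.pow n)), r'.mul ((ra.pow m').mul (rb.pow n')), c1, c2, c1', c2', hn⟩

structure Quad (u : Fˣ) (Q : Subgroup (Au F)) (qa qb qc qd : Au F) (a b c d : EV F) (α β : EW F) (la lb lc ld : F) : Prop where
  ma : qa ∈ Q
  mb : qb ∈ Q
  mc : qc ∈ Q
  md : qd ∈ Q
  na : la ≠ 0
  nb : lb ≠ 0
  ra : RP qa a (la • α)
  rb : RP qb b (lb • β)
  rc : RP qc c (lc • 1)
  rd : RP qd d (ld • 1)
  v : RelV u a b c d
  w : RelW α β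

lemma comm_unscale {U : Type} [Ring U] [Algebra F U] {X α : U} {l : F} (hl : l ≠ 0) (h : Commute X (l • α)) : Commute X α := by
  have h1 := h.smul_right l⁻¹
  rwa [smul_smul, inv_mul_cancel₀ hl, one_smul] at h1

lemma Good.norm2 (h : Good u Q) (hu : u ^ 2 = -1) {q : Au F} (hq : q ∈ Q) {A : EV F} {B : EW F} (hr : RP q A B) (hB : ∃ x : F, B = x • 1) :
    ∃ s l : F, RP q (s • A) (l • 1) ∧ (s • A) ^ 2 = 1 := by
  obtain ⟨x, rfl⟩ := hB
  obtain ⟨s, hs, hs2⟩ := root_norm hr.a (by norm_num : 0 < 2) (h.commV (X := A ^ 2) fun p hp => by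
    obtain ⟨A', B', hr'⟩ := h.rp hu hp
    obtain ⟨z, hz, e1⟩ := hr.sc_b hr' (h.comm q hq p hp) ((Commute.one_left B').smul_left x)
    exact ⟨A', B', hr', pow_comm_sc e1 hz⟩)
  refine ⟨s, (s⁻¹ * s⁻¹) * x, ?_, hs2⟩
  rw [mul_smul]
  exact hr.rescale hs

lemma Good.quad (h : Good u Q) (hu : u ^ 2 = -1) :
    ∃ qa qb qc qd a b c d α β la lb lc ld, Quad u Q qa qb qc qd a b c d α β la lb lc ld := by
  obtain ⟨qa, hqa, qb, hqb, a, b, α, β, la, lb, ra, rb, na, nb, ha, hb, hab, hw⟩ := h.pair hu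
  obtain ⟨q, hq, p, hp, C, D, B, B', r, r', c1, c2, c3, c4, hn⟩ := h.pair2 hu hqa hqb ra rb ha hb hab
  have sB : ∃ x : F, B = x • 1 := hw.comm (by simp)
    (comm_unscale (U := EW F) na (r.comm_b ra (h.comm q hq _ hqa) c1)) (comm_unscale (U := EW F) nb (r.comm_b rb (h.comm q hq _ hqb) c2))
  have sB' : ∃ x : F, B' = x • 1 := hw.comm (by simp)
    (comm_unscale (U := EW F) na (r'.comm_b ra (h.comm p hp _ hqa) c3)) (comm_unscale (U := EW F) nb (r'.comm_b rb (h.comm p hp _ hqb) c4))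
  obtain ⟨z, hz, e⟩ := r.sc_b r' (h.comm q hq p hp) (scal_comm (U := EW F) B sB')
  have hz1 : z = -1 := by
    rcases mul_self_eq_one_iff.1 ((sq z).symm.trans hz) with h1 | h1
    · exact absurd (comm_of_sc (U := EV F) e h1) hn
    · exact h1
  obtain ⟨s, l, r2, hs⟩ := h.norm2 hu hq r sB
  obtain ⟨s', l', r2', hs'⟩ := h.norm2 hu hp r' sB'
  exact ⟨qa, qb, q, p, a, b, s • C, s' • D, α, β, la, lb, l, l', hqa, hqb, hq, hp, na, nb, ra, rb, r2, r2',
    ⟨ha, hb, hs, hs', hab, hz1 ▸ sc_scale (U := EV F) e s s', c1.symm.smul_right s, c3.symm.smul_right s', c2.symm.smul_right s, c4.symm.smul_right s'⟩, hw⟩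

end E8

namespace E8

variable {F : Type} [Field F] [CharZero F]

lemma sign_pow {z : F} (hz : z ^ 2 = 1) : ∃ i : ℕ, z = (-1) ^ i := by
  rcases mul_self_eq_one_iff.1 ((sq z).symm.trans hz) with h1 | h1
  · exact ⟨0, by rw [h1, pow_zero]⟩
  · exact ⟨1, by rw [h1, pow_one]⟩

lemma unit_scal {U : Type} [Ring U] [Algebra F U] [Nontrivial U] {x : F} (h : IsUnit (x • (1 : U))) : x ≠ 0 := by
  rintro rfl
  rw [zero_smul] at h
  exact not_isUnit_zero h

lemma smul_inv_one {U : Type} [Ring U] [Algebra F U] {x : F} (h : x ≠ 0) : x⁻¹ • x • (1 : U) = 1 := by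
  rw [smul_smul, inv_mul_cancel₀ h, one_smul]

lemma mem_of_mul {G : Type} [Group G] {Q : Subgroup G} {g h : G} (hh : h ∈ Q) (hgh : g * h ∈ Q) : g ∈ Q :=
  (Q.mul_mem_cancel_right hh).1 hgh

lemma comm_mul_el {G : Type} [Group G] {g h q : G} (h1 : g * q = q * g) (h2 : h * q = q * h) : (g * h) * q = q * (g * h) :=
  (Commute.mul_left (show Commute g q from h1) (show Commute h q from h2)).eq

variable [IsAlgClosed F] {u : Fˣ} {Q : Subgroup (Au F)}

lemma Quad.cent {qa qb qc qd : Au F} {a b c d : EV F} {α β : EW F} {la lb lc ld : F}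
    (k : Quad u Q qa qb qc qd a b c d α β la lb lc ld) (h : Good u Q) (hu : u ^ 2 = -1) {g : Au F}
    (ht' : g * th u = th u * g) (ha : g * qa = qa * g) (hb : g * qb = qb * g) (hc : g * qc = qc * g) (hd : g * qd = qd * g) : g ∈ Q := by
  obtain ⟨A, B, hA, hB, hr'⟩ := cent_RT hu ht'
  have r : RP g A B := ⟨hA, hB, hr'⟩
  obtain ⟨m, n, c1, c2⟩ := fix4 hu k.ra k.rb r k.v.ab ha hb
  have r1 := r.mul ((k.ra.pow m).mul (k.rb.pow n))
  have m1 : qa ^ m * qb ^ n ∈ Q := Q.mul_mem (Q.pow_mem k.ma m) (Q.pow_mem k.mb n)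
  have q1 : ∀ q ∈ Q, g * q = q * g → (g * (qa ^ m * qb ^ n)) * q = q * (g * (qa ^ m * qb ^ n)) :=
    fun q hq e => comm_mul_el e (h.comm _ m1 q hq)
  refine mem_of_mul m1 ?_
  generalize g * (qa ^ m * qb ^ n) = g1 at r1 q1 ⊢
  generalize A * (a ^ m * b ^ n) = A1 at r1 c1 c2
  generalize B * _ = B1 at r1
  obtain ⟨z, hz, e1⟩ := r1.sc_b k.rc (q1 _ k.mc hc) ((Commute.one_right B1).smul_right _)
  obtain ⟨z', hz', e1'⟩ := r1.sc_b k.rd (q1 _ k.md hd) ((Commute.one_right B1).smul_right _)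
  obtain ⟨i, rfl⟩ := sign_pow hz
  obtain ⟨j, rfl⟩ := sign_pow hz'
  obtain ⟨m', n', c3, c4⟩ := sc_fix (U := EV F) (N := 1) (by norm_num) k.v.cd e1 e1'
  have r2 := r1.mul ((k.rc.pow m').mul (k.rd.pow n'))
  have m2 : qc ^ m' * qd ^ n' ∈ Q := Q.mul_mem (Q.pow_mem k.mc m') (Q.pow_mem k.md n')
  have c5 : Commute (A1 * (c ^ m' * d ^ n')) a := c1.mul_left ((k.v.ac.symm.pow_left m').mul_left (k.v.ad.symm.pow_left n'))
  have c6 : Commute (A1 * (c ^ m' * d ^ n')) b := c2.mul_left ((k.v.bc.symm.pow_left m').mul_left (k.v.bd.symm.pow_left n'))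
  have q2 : ∀ q ∈ Q, g * q = q * g → (g1 * (qc ^ m' * qd ^ n')) * q = q * (g1 * (qc ^ m' * qd ^ n')) :=
    fun q hq e => comm_mul_el (q1 q hq e) (h.comm _ m2 q hq)
  refine mem_of_mul m2 ?_
  generalize g1 * _ = g2 at r2 q2 ⊢
  generalize A1 * _ = A2 at r2 c3 c4 c5 c6
  generalize B1 * _ = B2 at r2
  obtain ⟨x, rfl⟩ := k.v.comm (by simp) hu c5 c6 c3 c4
  obtain ⟨y, rfl⟩ := k.w.comm (by simp) (comm_unscale (U := EW F) k.na (r2.comm_b k.ra (q2 _ k.ma ha) c5))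
    (comm_unscale (U := EW F) k.nb (r2.comm_b k.rb (q2 _ k.mb hb) c6))
  have hx : x ≠ 0 := unit_scal (U := EV F) r2.a
  have r3 := r2.rescale (inv_ne_zero hx)
  rw [smul_inv_one (U := EV F) hx, ← mul_smul] at r3
  obtain ⟨l, hl⟩ := RP.same hu RP.one r3
  rw [hl, one_mul]
  exact Q.pow_mem h.th l

lemma conj_sc {U : Type} [Ring U] [Algebra F U] {T T' a b : U} (h : T * a = b * T) (hT : T * T' = 1) {l l' s t : F} (hl : l' ≠ 0)
    (hst : s * t = 1) :
    (s • T) * (l • a) * (t • T') = (l * l'⁻¹) • (l' • b) := by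
  rw [smul_mul_smul_comm, smul_mul_smul_comm, h, mul_assoc b T T', hT, mul_one, ← smul_cancel_inv b hl]
  congr 1
  linear_combination l * hst

/-- conjugation carries a generator into the other group -/
lemma conj_gen (hu : u ^ 2 = -1) {g q q' : Au F} {S a a' : EV F} {T α α' : EW F} {k l l' : F} (hk : k ≠ 0) (hl : l' ≠ 0)
    (hg : RP g S (k • T)) (hT : IsUnit T) (r : RP q a (l • α)) (r' : RP q' a' (l' • α')) (e : S * a = a' * S) (e' : T * α = α' * T) :
    ∃ m : ℕ, g * q * g⁻¹ = q' * th u ^ m := by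
  obtain ⟨⟨S, rfl⟩, -, hg⟩ := hg
  obtain ⟨T, rfl⟩ := hT
  have hi : RP g⁻¹ (S⁻¹ : (EV F)ˣ) (k⁻¹ • ((T⁻¹ : (EW F)ˣ) : EW F)) := ⟨Units.isUnit _, smul_unit (Units.isUnit _) (inv_ne_zero hk),
    hg.inv S.mul_inv (by rw [smul_mul_smul_comm, T.mul_inv, mul_inv_cancel₀ hk, one_smul])⟩
  have r2 := (RP.mul ⟨S.isUnit, smul_unit T.isUnit hk, hg⟩ r).mul hi
  rw [e, S.mul_inv_cancel_right, conj_sc (U := EW F) e' T.mul_inv hl (mul_inv_cancel₀ hk)] at r2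
  exact RP.same hu r' r2

lemma comm_conj_el {G : Type} [Group G] {g q p t q' : G} (h : g * p * g⁻¹ = q' * t) (hc : q * p = p * q) (ht' : g * q * g⁻¹ * t = t * (g * q * g⁻¹)) :
    g * q * g⁻¹ * q' = q' * (g * q * g⁻¹) := by
  have h1 : Commute (g * q * g⁻¹) (q' * t) := by
    rw [← h]
    show _ = _
    simp only [mul_assoc, inv_mul_cancel_left]
    rw [← mul_assoc q, hc, mul_assoc]
  have h2 : q' = (q' * t) * t⁻¹ := by group
  rw [h2]
  exact (h1.mul_right (Commute.inv_right (show Commute _ t from ht'))).eq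

theorem main_conj {Q' : Subgroup (Au F)} (hu : u ^ 2 = -1) (h : Good u Q) (h' : Good u Q') : SubgroupIsConj Q Q' := by
  obtain ⟨qa, qb, qc, qd, a, b, c, d, α, β, la, lb, lc, ld, k⟩ := h.quad hu
  obtain ⟨qa', qb', qc', qd', a', b', c', d', α', β', la', lb', lc', ld', k'⟩ := h'.quad hu
  obtain ⟨S, hS, ea, eb, ec, ed⟩ := k.v.conj (by simp) hu k'.v
  obtain ⟨T, hT, ea', eb'⟩ := k.w.conj (by simp) k'.w
  obtain ⟨g, κ, hκ, hg⟩ := RR_real hS hT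
  have rg : RP g S (κ • T) := ⟨hS, smul_unit hT hκ, hg⟩
  have hlc : lc' ≠ 0 := unit_scal (U := EW F) k'.rc.b
  have hld : ld' ≠ 0 := unit_scal (U := EW F) k'.rd.b
  obtain ⟨ma, ka⟩ := conj_gen hu hκ k'.na rg hT k.ra k'.ra ea ea'
  obtain ⟨mb, kb⟩ := conj_gen hu hκ k'.nb rg hT k.rb k'.rb eb eb'
  obtain ⟨mc, kc⟩ := conj_gen hu hκ hlc rg hT k.rc k'.rc ec (by rw [mul_one, one_mul])
  obtain ⟨md, kd⟩ := conj_gen hu hκ hld rg hT k.rd k'.rd ed (by rw [mul_one, one_mul])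
  have kt : g * th u = th u * g := by
    refine RP.eq (rg.mul (RP_th hu)) ?_
    have := (RP_th hu).mul rg
    rw [one_mul, smul_mul_assoc, one_mul] at this
    rw [mul_one, mul_smul_comm, mul_one]
    exact this
  have key : ∀ q ∈ Q, g * q * g⁻¹ ∈ Q' := by
    intro q hq
    have ct : Commute (g * q * g⁻¹) (th u) :=
      ((show Commute g (th u) from kt).mul_left (show Commute q (th u) from h.comm q hq _ h.th)).mul_left (Commute.inv_left (show Commute g (th u) from kt))
    exact k'.cent h' hu ct (comm_conj_el ka (h.comm q hq _ k.ma) (ct.pow_right ma)) (comm_conj_el kb (h.comm q hq _ k.mb) (ct.pow_right mb))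
      (comm_conj_el kc (h.comm q hq _ k.mc) (ct.pow_right mc)) (comm_conj_el kd (h.comm q hq _ k.md) (ct.pow_right md))
  refine ⟨g, le_antisymm ?_ ?_⟩
  · intro p hp
    refine ⟨g⁻¹ * p * g, h.max _ fun q hq => ?_, by simp [MulAut.conj_apply, mul_assoc]⟩
    have h1 := h'.comm p hp _ (key q hq)
    have h2 := congrArg (fun x => g⁻¹ * x * g) h1
    simpa [mul_assoc] using h2
  · rintro _ ⟨q, hq, rfl⟩
    exact key q hq

end E8

namespace E8

section
variable {G G' : Type} [Group G] [Group G']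

lemma maxab_comm {Q : Subgroup G} (h : IsMaximalFiniteAbelian Q) {g : G} (hg : ∀ q ∈ Q, g * q = q * g) : g ∈ Q := by
  obtain ⟨-, h2, h3⟩ := h
  have h4 : ∀ x ∈ (Q : Set G) ∪ {g}, ∀ y ∈ (Q : Set G) ∪ {g}, x * y = y * x := by
    rintro x (hx | rfl) y (hy | rfl)
    · exact h2 _ _ hx hy
    · exact (hg x hx).symm
    · exact hg y hy
    · rfl
  have h5 := h3 (Subgroup.closure ((Q : Set G) ∪ {g})) (fun a b ha hb => by
    have hc := Subgroup.isMulCommutative_closure h4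
    exact congrArg Subtype.val (hc.is_comm.comm (⟨a, ha⟩ : Subgroup.closure ((Q : Set G) ∪ {g})) ⟨b, hb⟩))
    (fun x hx => Subgroup.subset_closure (Or.inl hx))
  rw [← h5]
  exact Subgroup.subset_closure (Or.inr rfl)

lemma conj_of_map (φ : G ≃* G') (g₁ g₂ : G') {Q₁ Q₂ : Subgroup G}
    (h : SubgroupIsConj (Q₁.map (φ.trans (MulAut.conj g₁)).toMonoidHom) (Q₂.map (φ.trans (MulAut.conj g₂)).toMonoidHom)) :
    SubgroupIsConj Q₁ Q₂ := by
  obtain ⟨g, hg⟩ := h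
  have key : ∀ p, p ∈ Q₂ ↔ ∃ q ∈ Q₁, g * (g₁ * φ q * g₁⁻¹) * g⁻¹ = g₂ * φ p * g₂⁻¹ := by
    intro p
    have h1 : p ∈ Q₂ ↔ (φ.trans (MulAut.conj g₂)) p ∈ Q₂.map (φ.trans (MulAut.conj g₂)).toMonoidHom :=
      ⟨fun hp => ⟨p, hp, rfl⟩, fun ⟨p', hp', e⟩ => (φ.trans (MulAut.conj g₂)).injective e ▸ hp'⟩
    rw [h1, hg]
    constructor
    · rintro ⟨_, ⟨q, hq, rfl⟩, e⟩
      exact ⟨q, hq, e⟩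
    · rintro ⟨q, hq, e⟩
      exact ⟨_, ⟨q, hq, rfl⟩, e⟩
  refine ⟨φ.symm (g₂⁻¹ * g * g₁), ?_⟩
  ext p
  rw [key, Subgroup.mem_map]
  refine exists_congr fun q => and_congr_right fun _ => ?_
  rw [← φ.injective.eq_iff]
  have e3 : φ ((MulAut.conj (φ.symm (g₂⁻¹ * g * g₁))).toMonoidHom q) = (g₂⁻¹ * g * g₁) * φ q * (g₂⁻¹ * g * g₁)⁻¹ := by
    show φ (φ.symm (g₂⁻¹ * g * g₁) * q * (φ.symm (g₂⁻¹ * g * g₁))⁻¹) = _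
    rw [map_mul, map_mul, map_inv, MulEquiv.apply_symm_apply]
  rw [e3]
  constructor
  · intro e
    have e2 : φ p = g₂⁻¹ * (g₂ * φ p * g₂⁻¹) * g₂ := by group
    rw [e2, ← e]; group
  · intro e
    rw [← e]; group

end

section
variable {F : Type} [Field F] {L L' : Type} [LieRing L] [LieAlgebra F L] [LieRing L'] [LieAlgebra F L']

def autHom (e : L ≃ₗ⁅F⁆ L') (g : lieAut F L) : lieAut F L' :=
  ⟨(e.symm.toLinearEquiv.trans (g : L ≃ₗ[F] L)).trans e.toLinearEquiv, fun x y => by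
    show e ((g : L ≃ₗ[F] L) (e.symm ⁅x, y⁆)) = ⁅e ((g : L ≃ₗ[F] L) (e.symm x)), e ((g : L ≃ₗ[F] L) (e.symm y))⁆
    rw [LieEquiv.map_lie, g.2, LieEquiv.map_lie]⟩

lemma autHom_apply (e : L ≃ₗ⁅F⁆ L') (g : lieAut F L) (x : L') :
    (autHom e g : L' ≃ₗ[F] L') x = e ((g : L ≃ₗ[F] L) (e.symm x)) := rfl

/-- transport of automorphisms as an isomorphism of groups -/
def autEq (e : L ≃ₗ⁅F⁆ L') : lieAut F L ≃* lieAut F L' where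
  toFun := autHom e
  invFun := autHom e.symm
  left_inv g := Subtype.ext (LinearEquiv.ext fun x => by
    rw [autHom_apply, autHom_apply]
    show e.symm (e _) = _
    rw [e.symm_apply_apply]
    show (g : L ≃ₗ[F] L) (e.symm (e x)) = _
    rw [e.symm_apply_apply])
  right_inv g := Subtype.ext (LinearEquiv.ext fun x => by
    rw [autHom_apply, autHom_apply]
    show e (e.symm _) = _
    rw [e.apply_symm_apply]
    show (g : L' ≃ₗ[F] L') (e (e.symm x)) = _
    rw [e.apply_symm_apply])
  map_mul' g h := Subtype.ext (LinearEquiv.ext fun x => by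
    show e ((g : L ≃ₗ[F] L) ((h : L ≃ₗ[F] L) (e.symm x))) = e ((g : L ≃ₗ[F] L) (e.symm (e ((h : L ≃ₗ[F] L) (e.symm x)))))
    rw [e.symm_apply_apply])

end

variable {F : Type} [Field F] [CharZero F] [IsAlgClosed F]

lemma fix_transport (θ : lieAut F (LieAlgebra.e₈ F)) :
    Module.finrank F (fixS (autEq (iso8 F) θ)) = Module.finrank F (fixedSubalgebra θ) := by
  have : fixS (autEq (iso8 F) θ) = (fixedSubalgebra θ).toSubmodule.map (iso8 F).toLinearEquiv.toLinearMap := by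
    ext x
    rw [mem_fixS, Submodule.mem_map]
    have hx : (iso8 F) ((iso8 F).symm x) = x := (iso8 F).apply_symm_apply x
    constructor
    · intro h
      refine ⟨(iso8 F).symm x, ?_, hx⟩
      show (θ : LieAlgebra.e₈ F ≃ₗ[F] LieAlgebra.e₈ F) ((iso8 F).symm x) = (iso8 F).symm x
      apply (iso8 F).injective
      exact Eq.trans h hx.symm
    · rintro ⟨y, hy, rfl⟩
      show (iso8 F) ((θ : LieAlgebra.e₈ F ≃ₗ[F] LieAlgebra.e₈ F) ((iso8 F).symm ((iso8 F) y))) = (iso8 F) y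
      rw [(iso8 F).symm_apply_apply]
      exact congrArg (iso8 F) hy
  rw [this]
  exact LinearEquiv.finrank_map_eq (iso8 F).toLinearEquiv _

lemma good_of {u : Fˣ} (hu : u ^ 2 = -1) {Q : Subgroup ↥(lieAut F (LieAlgebra.e₈ F))} (hQ : IsMaximalFiniteAbelian Q)
    (h : ∃ θ ∈ Q, orderOf θ = 4 ∧ LieAlgebra.IsSemisimple F ↥(fixedSubalgebra θ) ∧
      Module.finrank F ↥(fixedSubalgebra θ) = 66) :
    ∃ g : Au F, Good u (Q.map ((autEq (iso8 F)).trans (MulAut.conj g)).toMonoidHom) := by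
  obtain ⟨θ, hθ, ho, -, hd⟩ := h
  obtain ⟨g, hg⟩ := order4_conj (θ := autEq (iso8 F) θ) (by rw [← map_pow, ← ho, pow_orderOf_eq_one, map_one])
    ((fix_transport θ).trans hd) hu
  refine ⟨g, ?_, ?_, ?_, ?_⟩
  · rw [Subgroup.coe_map]
    have := hQ.1
    exact (Set.toFinite (Q : Set ↥(lieAut F (LieAlgebra.e₈ F)))).image _
  · rintro _ ⟨a, ha, rfl⟩ _ ⟨b, hb, rfl⟩
    rw [← map_mul, hQ.2.1 a b ha hb, map_mul]
  · intro x hx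
    obtain ⟨y, rfl⟩ := ((autEq (iso8 F)).trans (MulAut.conj g)).surjective x
    refine ⟨y, maxab_comm hQ fun q hq => ?_, rfl⟩
    have h1 := hx _ ⟨q, hq, rfl⟩
    apply ((autEq (iso8 F)).trans (MulAut.conj g)).injective
    rw [map_mul, map_mul]
    exact h1
  · exact ⟨θ, hθ, hg⟩

end E8

theorem stmt8 (F : Type) [Field F] [IsAlgClosed F] [CharZero F]
    (Q₁ Q₂ : Subgroup ↥(lieAut F (LieAlgebra.e₈ F)))
    (hQ₁ : IsMaximalFiniteAbelian Q₁) (hQ₂ : IsMaximalFiniteAbelian Q₂)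
    (h₁ : ∃ θ ∈ Q₁, orderOf θ = 4 ∧ LieAlgebra.IsSemisimple F ↥(fixedSubalgebra θ) ∧
      Module.finrank F ↥(fixedSubalgebra θ) = 66)
    (h₂ : ∃ θ ∈ Q₂, orderOf θ = 4 ∧ LieAlgebra.IsSemisimple F ↥(fixedSubalgebra θ) ∧
      Module.finrank F ↥(fixedSubalgebra θ) = 66) :
    SubgroupIsConj Q₁ Q₂ := by
  obtain ⟨i, hi⟩ := IsAlgClosed.exists_pow_nat_eq (-1 : F) (by norm_num : 0 < 2)
  have hi0 : i ≠ 0 := by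
    rintro rfl
    norm_num at hi
  have hu : (Units.mk0 i hi0) ^ 2 = -1 := Units.ext (by simpa using hi)
  obtain ⟨g₁, k₁⟩ := E8.good_of hu hQ₁ h₁
  obtain ⟨g₂, k₂⟩ := E8.good_of hu hQ₂ h₂
  exact E8.conj_of_map _ _ _ (E8.main_conj hu k₁ k₂)
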